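/- (Basic theorem on p-adic analytic integrals.) For any subanalytic constructible function f ∈ C(ℚ_p^{m+n}), the function I_m(f) is a subanalytic constructible function on ℚ_p^m, i.e., I_m(f) ∈ C(ℚ_p^m). -/

import Mathlib

open Filter MeasureTheory
open scoped ENNReal

namespace PadicSub

variable (p : ℕ) [Fact p.Prime]

/-- The coefficients (indexed by multi-indices) of a restricted power series:
they tend to `0` along the cofinite filter. -/
def IsRestrictedCoeffs {m : ℕ} (a : (Fin m → ℕ) → ℚ_[p]) : Prop :=
  Filter.Tendsto a Filter.cofinite (nhds 0)

/-- The restricted analytic function associated to a family of coefficients: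
the sum of the power series on `ℤ_p^m`, and `0` outside `ℤ_p^m`. -/
noncomputable def ranalFn {m : ℕ} (a : (Fin m → ℕ) → ℚ_[p]) (x : Fin m → ℚ_[p]) : ℚ_[p] :=
  if ∀ j, ‖x j‖ ≤ 1 then ∑' i : (Fin m → ℕ), a i * ∏ j, x j ^ i j else 0

/-- `D`-functions: the functions obtained from restricted analytic functions, polynomial
maps, and the inverse function (with the convention `0⁻¹ = 0`) by repeated composition. -/
inductive IsDFunction : {m : ℕ} → ((Fin m → ℚ_[p]) → ℚ_[p]) → Prop where
  | ranal {m : ℕ} (a : (Fin m → ℕ) → ℚ_[p]) (ha : IsRestrictedCoeffs p a) :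
      IsDFunction (ranalFn p a)
  | poly {m : ℕ} (q : MvPolynomial (Fin m) ℚ_[p]) :
      IsDFunction (fun x => MvPolynomial.eval x q)
  | inv : IsDFunction (fun x : Fin 1 → ℚ_[p] => (x 0)⁻¹)
  | comp {m n : ℕ} (f : (Fin n → ℚ_[p]) → ℚ_[p]) (g : Fin n → (Fin m → ℚ_[p]) → ℚ_[p]) :
      IsDFunction f → (∀ i, IsDFunction (g i)) →
      IsDFunction (fun x => f (fun i => g i x))

/-- `P_n`: the set of nonzero `n`-th powers in `ℚ_p`. -/
def Pset (n : ℕ) : Set ℚ_[p] := {x | ∃ y : ℚ_[p], y ≠ 0 ∧ y ^ n = x}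

/-- The coset `μ P_n`. -/
def cosetP (μ : ℚ_[p]) (n : ℕ) : Set ℚ_[p] := {x | ∃ y ∈ Pset p n, x = μ * y}

/-- A (globally) subanalytic subset of `ℚ_p^m`: a finite union of finite intersections of
sets of the form `{x | f x = 0}` and `{x | f x ∈ P_n}`, `f` a `D`-function, `n > 0`. -/
def IsSubanalytic {m : ℕ} (X : Set (Fin m → ℚ_[p])) : Prop :=
  ∃ (r s : ℕ) (F : Fin r → Fin s → Set (Fin m → ℚ_[p])),
    (∀ i j, (∃ f, IsDFunction p f ∧ F i j = {x | f x = 0}) ∨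
            (∃ f n, IsDFunction p f ∧ 0 < n ∧ F i j = {x | f x ∈ Pset p n})) ∧
    X = ⋃ i, ⋂ j, F i j

/-- A semialgebraic subset of `ℚ_p^m`: a finite union of finite intersections of
sets of the form `{x | f x = 0}` and `{x | f x ∈ P_n}`, `f` a polynomial, `n > 0`. -/
def IsSemialgebraic {m : ℕ} (X : Set (Fin m → ℚ_[p])) : Prop :=
  ∃ (r s : ℕ) (F : Fin r → Fin s → Set (Fin m → ℚ_[p])),
    (∀ i j, (∃ f : MvPolynomial (Fin m) ℚ_[p], F i j = {x | MvPolynomial.eval x f = 0}) ∨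
            (∃ (f : MvPolynomial (Fin m) ℚ_[p]) (n : ℕ), 0 < n ∧
              F i j = {x | MvPolynomial.eval x f ∈ Pset p n})) ∧
    X = ⋃ i, ⋂ j, F i j

/-- The graph of the restriction to `X` of a map `ℚ_p^m → ℚ_p^n`, inside `ℚ_p^(m+n)`. -/
def graphMap {m n : ℕ} (X : Set (Fin m → ℚ_[p])) (F : (Fin m → ℚ_[p]) → (Fin n → ℚ_[p])) :
    Set (Fin (m + n) → ℚ_[p]) :=
  {z | (fun i => z (Fin.castAdd n i)) ∈ X ∧
    F (fun i => z (Fin.castAdd n i)) = fun j => z (Fin.natAdd m j)}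

/-- The graph of the restriction to `X` of a function `ℚ_p^m → ℚ_p`, inside `ℚ_p^(m+1)`. -/
def graphFun {m : ℕ} (X : Set (Fin m → ℚ_[p])) (f : (Fin m → ℚ_[p]) → ℚ_[p]) :
    Set (Fin (m + 1) → ℚ_[p]) :=
  {z | (fun i : Fin m => z i.castSucc) ∈ X ∧ f (fun i : Fin m => z i.castSucc) = z (Fin.last m)}

/-- A function `ℚ_p^m → ℚ_p` is subanalytic on `X` if its graph over `X` is subanalytic. -/
def IsSubanalyticFnOn {m : ℕ} (X : Set (Fin m → ℚ_[p])) (f : (Fin m → ℚ_[p]) → ℚ_[p]) : Prop :=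
  IsSubanalytic p (graphFun p X f)

/-- A (totally defined) subanalytic function `ℚ_p^m → ℚ_p`. -/
def IsSubanalyticFn {m : ℕ} (f : (Fin m → ℚ_[p]) → ℚ_[p]) : Prop :=
  IsSubanalyticFnOn p Set.univ f

/-- A function `ℚ_p^m → ℚ_p` is semialgebraic on `X` if its graph over `X` is
semialgebraic. -/
def IsSemialgebraicFnOn {m : ℕ} (X : Set (Fin m → ℚ_[p])) (f : (Fin m → ℚ_[p]) → ℚ_[p]) :
    Prop :=
  IsSemialgebraic p (graphFun p X f)

/-- A subanalytic subset of `ℚ_p` (one-variable version). -/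
def IsSubanalytic1 (X : Set ℚ_[p]) : Prop :=
  IsSubanalytic p {z : Fin 1 → ℚ_[p] | z 0 ∈ X}

/-- A semialgebraic subset of `ℚ_p` (one-variable version). -/
def IsSemialgebraic1 (X : Set ℚ_[p]) : Prop :=
  IsSemialgebraic p {z : Fin 1 → ℚ_[p] | z 0 ∈ X}

/-- A function `ℚ_p → ℚ_p` subanalytic on `X ⊆ ℚ_p`: its graph over `X` is a subanalytic
subset of `ℚ_p²`. -/
def IsSubanalyticFnOn1 (X : Set ℚ_[p]) (f : ℚ_[p] → ℚ_[p]) : Prop :=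
  IsSubanalytic p {z : Fin 2 → ℚ_[p] | z 0 ∈ X ∧ f (z 0) = z 1}

/-- A function `ℚ_p → ℚ_p` semialgebraic on `X ⊆ ℚ_p`: its graph over `X` is a
semialgebraic subset of `ℚ_p²`. -/
def IsSemialgebraicFnOn1 (X : Set ℚ_[p]) (f : ℚ_[p] → ℚ_[p]) : Prop :=
  IsSemialgebraic p {z : Fin 2 → ℚ_[p] | z 0 ∈ X ∧ f (z 0) = z 1}

/-- Interpretation of the symbols `□ᵢ` in the definition of cells: `true` means `<` and
`false` means "no condition". -/
def sqRel (b : Bool) (x y : ℝ) : Prop := b = true → x < y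

/-- A cell in `ℚ_p`, presented with its center `γ` and coset data `μ`, `n`. -/
def IsCell1 (A : Set ℚ_[p]) (γ μ : ℚ_[p]) (n : ℕ) : Prop :=
  0 < n ∧ A.Nonempty ∧
  ∃ (α β : ℚ_[p]) (b₁ b₂ : Bool), α ≠ 0 ∧ β ≠ 0 ∧
    A = {t | sqRel b₁ ‖α‖ ‖t - γ‖ ∧ sqRel b₂ ‖t - γ‖ ‖β‖ ∧ t - γ ∈ cosetP p μ n}

/-- Subanalytic cells in `ℚ_p^(m+1)`, defined inductively, presented with their center
`γ : ℚ_p^m → ℚ_p` and coset data `μ`, `n`.  The projection of the cell onto the first `m`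
coordinates is required to be a cell. -/
inductive IsCell : {m : ℕ} → Set (Fin (m + 1) → ℚ_[p]) →
    ((Fin m → ℚ_[p]) → ℚ_[p]) → ℚ_[p] → ℕ → Prop where
  | base (n : ℕ) (hn : 0 < n) (μ γ0 α β : ℚ_[p]) (hα : α ≠ 0) (hβ : β ≠ 0)
      (b₁ b₂ : Bool) (A : Set (Fin 1 → ℚ_[p])) (hne : A.Nonempty)
      (hA : A = {z | sqRel b₁ ‖α‖ ‖z 0 - γ0‖ ∧ sqRel b₂ ‖z 0 - γ0‖ ‖β‖ ∧
        z 0 - γ0 ∈ cosetP p μ n}) :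
      IsCell A (fun _ => γ0) μ n
  | succ {m : ℕ} {D : Set (Fin (m + 1) → ℚ_[p])} {γD : (Fin m → ℚ_[p]) → ℚ_[p]}
      {μD : ℚ_[p]} {nD : ℕ} (hD : IsCell D γD μD nD)
      (n : ℕ) (hn : 0 < n) (μ : ℚ_[p]) (α β γ : (Fin (m + 1) → ℚ_[p]) → ℚ_[p])
      (hα : IsSubanalyticFn p α) (hβ : IsSubanalyticFn p β) (hγ : IsSubanalyticFn p γ)
      (hα0 : ∀ x, α x ≠ 0) (hβ0 : ∀ x, β x ≠ 0)
      (b₁ b₂ : Bool) (A : Set (Fin (m + 2) → ℚ_[p]))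
      (hA : A = {z | (fun i : Fin (m + 1) => z i.castSucc) ∈ D ∧
          sqRel b₁ ‖α (fun i : Fin (m + 1) => z i.castSucc)‖
            ‖z (Fin.last (m + 1)) - γ (fun i : Fin (m + 1) => z i.castSucc)‖ ∧
          sqRel b₂ ‖z (Fin.last (m + 1)) - γ (fun i : Fin (m + 1) => z i.castSucc)‖
            ‖β (fun i : Fin (m + 1) => z i.castSucc)‖ ∧
          z (Fin.last (m + 1)) - γ (fun i : Fin (m + 1) => z i.castSucc) ∈ cosetP p μ n})
      (hproj : (fun (z : Fin (m + 2) → ℚ_[p]) (i : Fin (m + 1)) => z i.castSucc) '' A = D) :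
      IsCell A γ μ n

/-- Analytic cells in `ℚ_p^(m+1)`: as subanalytic cells, but at each stage of the inductive
definition the functions `α`, `β`, `γ` are moreover analytic on the projection of the cell. -/
inductive IsAnalyticCell : {m : ℕ} → Set (Fin (m + 1) → ℚ_[p]) →
    ((Fin m → ℚ_[p]) → ℚ_[p]) → ℚ_[p] → ℕ → Prop where
  | base (n : ℕ) (hn : 0 < n) (μ γ0 α β : ℚ_[p]) (hα : α ≠ 0) (hβ : β ≠ 0)
      (b₁ b₂ : Bool) (A : Set (Fin 1 → ℚ_[p])) (hne : A.Nonempty)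
      (hA : A = {z | sqRel b₁ ‖α‖ ‖z 0 - γ0‖ ∧ sqRel b₂ ‖z 0 - γ0‖ ‖β‖ ∧
        z 0 - γ0 ∈ cosetP p μ n}) :
      IsAnalyticCell A (fun _ => γ0) μ n
  | succ {m : ℕ} {D : Set (Fin (m + 1) → ℚ_[p])} {γD : (Fin m → ℚ_[p]) → ℚ_[p]}
      {μD : ℚ_[p]} {nD : ℕ} (hD : IsAnalyticCell D γD μD nD)
      (n : ℕ) (hn : 0 < n) (μ : ℚ_[p]) (α β γ : (Fin (m + 1) → ℚ_[p]) → ℚ_[p])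
      (hα : IsSubanalyticFn p α) (hβ : IsSubanalyticFn p β) (hγ : IsSubanalyticFn p γ)
      (hαan : AnalyticOn ℚ_[p] α D) (hβan : AnalyticOn ℚ_[p] β D)
      (hγan : AnalyticOn ℚ_[p] γ D)
      (hα0 : ∀ x, α x ≠ 0) (hβ0 : ∀ x, β x ≠ 0)
      (b₁ b₂ : Bool) (A : Set (Fin (m + 2) → ℚ_[p]))
      (hA : A = {z | (fun i : Fin (m + 1) => z i.castSucc) ∈ D ∧
          sqRel b₁ ‖α (fun i : Fin (m + 1) => z i.castSucc)‖
            ‖z (Fin.last (m + 1)) - γ (fun i : Fin (m + 1) => z i.castSucc)‖ ∧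
          sqRel b₂ ‖z (Fin.last (m + 1)) - γ (fun i : Fin (m + 1) => z i.castSucc)‖
            ‖β (fun i : Fin (m + 1) => z i.castSucc)‖ ∧
          z (Fin.last (m + 1)) - γ (fun i : Fin (m + 1) => z i.castSucc) ∈ cosetP p μ n})
      (hproj : (fun (z : Fin (m + 2) → ℚ_[p]) (i : Fin (m + 1)) => z i.castSucc) '' A = D) :
      IsAnalyticCell A γ μ n

/-- Generators of the algebra of subanalytic constructible functions on `ℚ_p^m`:
`ℤ`-valued valuations of nonvanishing subanalytic functions, and (`ℚ`-valued) norms of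
subanalytic functions. -/
def constructibleGens (m : ℕ) : Set ((Fin m → ℚ_[p]) → ℚ) :=
  {g | ∃ h : (Fin m → ℚ_[p]) → ℚ_[p], IsSubanalyticFn p h ∧ (∀ x, h x ≠ 0) ∧
        g = fun x => ((h x).valuation : ℚ)} ∪
  {g | ∃ h : (Fin m → ℚ_[p]) → ℚ_[p], IsSubanalyticFn p h ∧
        g = fun x => (padicNormE (h x) : ℚ)}

/-- The `ℚ`-algebra `C(ℚ_p^m)` of subanalytic constructible functions on `ℚ_p^m`. -/
noncomputable def ConstructibleAlg (m : ℕ) : Subalgebra ℚ ((Fin m → ℚ_[p]) → ℚ) :=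
  Algebra.adjoin ℚ (constructibleGens p m)

/-- `ℤ_p^m` as a subset of `ℚ_p^m`. -/
def ZpSet (m : ℕ) : Set (Fin m → ℚ_[p]) := {x | ∀ j, ‖x j‖ ≤ 1}

/-- A simple subset of `ℤ^n × ℚ_p^m`. -/
def IsSimpleSet (n m : ℕ) (A : Set ((Fin n → ℤ) × (Fin m → ℚ_[p]))) : Prop :=
  IsSubanalytic p {z : Fin (n + m) → ℚ_[p] |
    (∀ i : Fin n, z (Fin.castAdd m i) ≠ 0) ∧
    ((fun i : Fin n => (z (Fin.castAdd m i)).valuation),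
      fun j : Fin m => z (Fin.natAdd n j)) ∈ A}

/-- A simple function `ℤ^n × ℚ_p^m → ℤ`: one whose graph is a simple set. -/
def IsSimpleFn (n m : ℕ) (h : (Fin n → ℤ) × (Fin m → ℚ_[p]) → ℤ) : Prop :=
  IsSimpleSet p (n + 1) m
    {w | w.1 (Fin.last n) = h (fun i : Fin n => w.1 i.castSucc, w.2)}

/-- Generators of `C_simple(ℤ^n × ℚ_p^m)`: simple functions, and `p^h` for `h` simple. -/
def simpleGens (n m : ℕ) : Set ((Fin n → ℤ) × (Fin m → ℚ_[p]) → ℚ) :=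
  {g | ∃ h, IsSimpleFn p n m h ∧ g = fun w => (h w : ℚ)} ∪
  {g | ∃ h, IsSimpleFn p n m h ∧ g = fun w => (p : ℚ) ^ (h w)}

/-- The `ℚ`-algebra `C_simple(ℤ^n × ℚ_p^m)`. -/
noncomputable def SimpleAlg (n m : ℕ) : Subalgebra ℚ ((Fin n → ℤ) × (Fin m → ℚ_[p]) → ℚ) :=
  Algebra.adjoin ℚ (simpleGens p n m)

noncomputable instance : MeasurableSpace ℚ_[p] := borel _
instance : BorelSpace ℚ_[p] := ⟨rfl⟩

end PadicSub

open Filter MeasureTheory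
open scoped ENNReal
namespace PadicSub
variable {p : ℕ} [Fact p.Prime]

/-- The field of `p`-adic numbers. -/
local notation "Qp" => ℚ_[p]
/-- The uniformizer of `Qp`. -/
local notation "ϖ" => (p : ℚ_[p])
/-- Affine space. -/
local notation:max "Aff" m:max => (Fin m → ℚ_[p])
/-- Functions on `S × Qp`. -/
local notation:max "Fn" S:max => (S × ℚ_[p] → ℚ_[p])
/-- Algebras of functions. -/
local notation:max "Alg" Z:max => Subalgebra ℤ_[p] (Z → ℚ_[p])
/-- Constructible functions. -/
local notation "CA" => ConstructibleAlg p
open Finset (range mem_image sum_range_succ mul_sum sum_congr mem_coe univ le_sup mem_univ sum_insert mem_range mem_insert mem_insert_of_mem mem_insert_self)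
open Algebra (adjoin adjoin_le subset_adjoin)
open Set (mem_ofPred_eq indicator indicator_of_notMem indicator_of_mem)
open Padic (norm_p_lt_one valuation_mul valuation_pow valuation_zpow valuation_p valuation_one)
open Polynomial (eval₂_add eval₂_mul eval₂_C eval₂_X eval₂_monomial)
open Metric (closedBall)
open Pi (mul_apply pow_apply)

/-- Genericity of an ultrafilter on `S × Qp`. -/
abbrev Gen {S : Type*} (R : Set (S → Qp)) (U : Ultrafilter (S × Qp)) : Prop :=
  ∀ c ∈ R, {z : S × Qp | z.2 ≠ c z.1} ∈ U

/-- All functions in `B` are bounded by `1`. -/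
abbrev Unif {S : Type*} (B : Alg S) : Prop := ∀ r ∈ B, ∀ s, ‖r s‖ ≤ 1

lemma compl_umem {α : Type*} {U : Ultrafilter α} {s : Set α} (h : s ∉ U) : sᶜ ∈ U :=
  Ultrafilter.compl_mem_iff_notMem.2 h

/-! ### Part 1 : basic facts on `p`-adic numbers -/

lemma pK_ne : ϖ ≠ 0 := by
  exact_mod_cast (Fact.out : p.Prime).ne_zero

lemma one_lt_pR : (1 : ℝ) < p := by exact_mod_cast (Fact.out : p.Prime).one_lt

lemma norm_pow_p_le_one (n : ℕ) : ‖ϖ ^ n‖ ≤ 1 := by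
  rw [norm_pow]; exact pow_le_one₀ (norm_nonneg _) norm_p_lt_one.le

lemma norm_add_le_one {x y : Qp} (hx : ‖x‖ ≤ 1) (hy : ‖y‖ ≤ 1) : ‖x + y‖ ≤ 1 :=
  (IsUltrametricDist.norm_add_le_max x y).trans (max_le hx hy)

lemma norm_mul_le_one {x y : Qp} (hx : ‖x‖ ≤ 1) (hy : ‖y‖ ≤ 1) : ‖x * y‖ ≤ 1 := by
  rw [norm_mul]; exact mul_le_one₀ hx (norm_nonneg _) hy

lemma exists_mul_of_norm_le {x y : Qp} (hy : y ≠ 0) (h : ‖x‖ ≤ ‖y‖) :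
    ∃ z, ‖z‖ ≤ 1 ∧ x = y * z :=
  ⟨x / y, by rw [norm_div]; exact div_le_one_of_le₀ h (norm_nonneg _), by field_simp⟩

lemma norm_one_add_p {N : ℕ} (hN : 0 < N) {y : Qp} (hy : ‖y‖ ≤ 1) :
    ‖1 + ϖ ^ N * y‖ = 1 := by
  have h : ‖ϖ ^ N * y‖ < 1 := by
    rw [norm_mul, norm_pow]
    exact (mul_le_of_le_one_right (by positivity) hy).trans_lt
      (pow_lt_one₀ (norm_nonneg _) norm_p_lt_one hN.ne')
  rw [IsUltrametricDist.norm_add_eq_max_of_norm_ne_norm (by rw [norm_one]; exact h.ne')]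
  rw [norm_one]; exact max_eq_left h.le

lemma exists_residue (N : ℕ) {x : Qp} (hx : ‖x‖ ≤ 1) :
    ∃ n : ℕ, n < p ^ N ∧ ∃ y : Qp, ‖y‖ ≤ 1 ∧ x = n + ϖ ^ N * y := by
  obtain ⟨c, rfl⟩ : ∃ c : ℤ_[p], (c : Qp) = x := ⟨⟨x, hx⟩, rfl⟩
  have h := PadicInt.appr_spec N c
  rw [Ideal.mem_span_singleton] at h
  obtain ⟨y, hy⟩ := h
  refine ⟨PadicInt.appr c N, PadicInt.appr_lt _ _, y, y.2, ?_⟩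
  have := congrArg (fun z : ℤ_[p] => (z : Qp)) hy
  simp only [PadicInt.coe_sub, PadicInt.coe_mul, PadicInt.coe_pow, PadicInt.coe_natCast] at this
  rw [← this]; ring

lemma exists_unit (x : Qp) (hx : x ≠ 0) :
    ∃ u : Qp, ‖u‖ = 1 ∧ x = ϖ ^ x.valuation * u := by
  refine ⟨x / ϖ ^ x.valuation, ?_, ?_⟩
  · rw [norm_div, Padic.norm_p_zpow, Padic.norm_eq_zpow_neg_valuation hx]
    exact div_self (zpow_ne_zero _ (by have := one_lt_pR (p := p); positivity))
  · rw [mul_div_cancel₀ _ (zpow_ne_zero _ pK_ne)]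

lemma near_one_pow (k : ℕ) (hk : 0 < k) :
    ∃ N : ℕ, 0 < N ∧ ∀ y : Qp, ‖y‖ ≤ 1 →
      ∃ z : Qp, ‖z‖ = 1 ∧ z ^ k = 1 + ϖ ^ N * y := by
  have hk0 : (k : Qp) ≠ 0 := by exact_mod_cast hk.ne'
  obtain ⟨N, hN⟩ : ∃ N : ℕ, ‖ϖ‖ ^ N < ‖(k : Qp)‖ ^ 2 :=
    exists_pow_lt_of_lt_one (by positivity) norm_p_lt_one
  refine ⟨N + 1, by omega, fun y hy => ?_⟩
  have hx1 : ‖1 + ϖ ^ (N + 1) * y‖ = 1 := norm_one_add_p (by omega) hy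
  obtain ⟨c, hc⟩ : ∃ c : ℤ_[p], (c : Qp) = 1 + ϖ ^ (N + 1) * y := ⟨⟨_, hx1.le⟩, rfl⟩
  have key : ‖(Polynomial.aeval (1 : ℤ_[p])) (Polynomial.X ^ k - Polynomial.C c)‖ <
      ‖(Polynomial.aeval (1 : ℤ_[p])) (Polynomial.derivative (Polynomial.X ^ k - Polynomial.C c))‖ ^ 2 := by
    simp only [map_sub, map_pow, Polynomial.aeval_X, Polynomial.aeval_C, one_pow,
      Polynomial.derivative_X_pow, Polynomial.derivative_C, sub_zero, map_mul, mul_one, map_natCast]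
    rw [PadicInt.norm_def, PadicInt.norm_def]
    simp only [Algebra.algebraMap_self, RingHom.id_apply, PadicInt.coe_sub, PadicInt.coe_one,
      PadicInt.coe_natCast, hc]
    refine lt_of_le_of_lt ?_ hN
    rw [show (1 : Qp) - (1 + ϖ ^ (N + 1) * y) = - (ϖ ^ (N + 1) * y) by ring,
      norm_neg, norm_mul, norm_pow, pow_succ]
    have h1 : ‖ϖ‖ ≤ 1 := norm_p_lt_one.le
    have h2 : 0 ≤ ‖ϖ‖ ^ N := by positivity
    calc _ ≤ ‖ϖ‖ ^ N * 1 * 1 := by gcongr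
      _ = _ := by ring
  obtain ⟨z, hz, -⟩ := hensels_lemma key
  simp only [map_sub, map_pow, Polynomial.aeval_X, Polynomial.aeval_C,
    Algebra.algebraMap_self, RingHom.id_apply, sub_eq_zero] at hz
  have hz' : (z : Qp) ^ k = 1 + ϖ ^ (N + 1) * y := by
    have := congrArg (fun z : ℤ_[p] => (z : Qp)) hz
    simpa [hc] using this
  refine ⟨z, ?_, hz'⟩
  have : ‖(z : Qp)‖ ^ k = 1 := by rw [← norm_pow, hz', hx1]
  exact (pow_eq_one_iff_of_nonneg (norm_nonneg _) hk.ne').1 this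

/-- the power threshold -/
lemma near_one_Pset (k : ℕ) (hk : 0 < k) :
    ∃ N : ℕ, 0 < N ∧ ∀ y : Qp, ‖y‖ ≤ 1 → 1 + ϖ ^ N * y ∈ Pset p k := by
  obtain ⟨N, hN, h⟩ := near_one_pow (p := p) k hk
  refine ⟨N, hN, fun y hy => ?_⟩
  obtain ⟨z, hz, hz'⟩ := h y hy
  exact ⟨z, by rintro rfl; simp at hz, hz'⟩

lemma Pset_mul {k : ℕ} {x y : Qp} (hx : x ∈ Pset p k) (hy : y ∈ Pset p k) :
    x * y ∈ Pset p k := by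
  obtain ⟨a, ha, rfl⟩ := hx; obtain ⟨b, hb, rfl⟩ := hy
  exact ⟨a * b, mul_ne_zero ha hb, by ring⟩

lemma Pset_inv {k : ℕ} {x : Qp} (hx : x ∈ Pset p k) : x⁻¹ ∈ Pset p k := by
  obtain ⟨a, ha, rfl⟩ := hx
  exact ⟨a⁻¹, inv_ne_zero ha, by simp⟩

lemma Pset_ne {k : ℕ} {x : Qp} (hx : x ∈ Pset p k) : x ≠ 0 := by
  obtain ⟨a, ha, rfl⟩ := hx
  exact pow_ne_zero _ ha

lemma Pset_mul_iff {k : ℕ} {x y : Qp} (hx : x ∈ Pset p k) :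
    x * y ∈ Pset p k ↔ y ∈ Pset p k := by
  refine ⟨fun h => ?_, Pset_mul hx⟩
  have := Pset_mul (Pset_inv hx) h
  rwa [inv_mul_cancel_left₀ (Pset_ne hx)] at this

lemma Pset_pow_self {k : ℕ} {x : Qp} (hx : x ≠ 0) : x ^ k ∈ Pset p k := ⟨x, hx, rfl⟩

lemma Pset_dvd {k l : ℕ} (h : k ∣ l) {x : Qp} (hx : x ∈ Pset p l) : x ∈ Pset p k := by
  obtain ⟨c, rfl⟩ := h
  obtain ⟨a, ha, rfl⟩ := hx
  exact ⟨a ^ c, pow_ne_zero _ ha, by rw [← pow_mul, mul_comm]⟩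

lemma Pset_pow {k : ℕ} {x : Qp} (hx : x ∈ Pset p k) (n : ℕ) : x ^ n ∈ Pset p k := by
  obtain ⟨a, ha, rfl⟩ := hx
  exact ⟨a ^ n, pow_ne_zero _ ha, by rw [← pow_mul, ← pow_mul, mul_comm]⟩

/-- finitely many cosets of `P_k` -/
lemma finite_cosets (k : ℕ) (hk : 0 < k) :
    ∃ T : Finset Qp, (∀ μ ∈ T, μ ≠ 0) ∧ ∀ x : Qp, x ≠ 0 → ∃ μ ∈ T, x / μ ∈ Pset p k := by
  classical
  obtain ⟨N, hN, h⟩ := near_one_Pset (p := p) k hk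
  refine ⟨((range k ×ˢ range (p ^ N)).image
    (fun q => ϖ ^ q.1 * (q.2 : Qp))).filter (· ≠ 0), fun μ hμ => (Finset.mem_filter.1 hμ).2,
    fun x hx => ?_⟩
  obtain ⟨u, hu, hxu⟩ := exists_unit x hx
  obtain ⟨n, hn, y, hy, huy⟩ := exists_residue N hu.le
  have hnu : ‖(n : Qp)‖ = 1 := by
    have h1 : (n : Qp) = u * (1 + ϖ ^ N * (-y / u)) := by
      have : u ≠ 0 := by rintro rfl; simp at hu
      field_simp
      rw [huy]; ring
    rw [h1, norm_mul, hu, norm_one_add_p hN, one_mul]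
    rw [norm_div, norm_neg, hu, div_one]; exact hy
  have hn0 : (n : Qp) ≠ 0 := by intro h0; rw [h0] at hnu; simp at hnu
  have hkz : (0 : ℤ) < k := by exact_mod_cast hk
  set j := (x.valuation % k).toNat with hj
  have hj' : (j : ℤ) = x.valuation % k := Int.toNat_of_nonneg (Int.emod_nonneg _ hkz.ne')
  have hjk : j < k := by have := Int.emod_lt_of_pos x.valuation hkz; omega
  refine ⟨ϖ ^ j * n, ?_, ?_⟩
  · refine Finset.mem_filter.2 ⟨mem_image.2 ⟨(j, n), ?_, rfl⟩, mul_ne_zero (pow_ne_zero _ pK_ne) hn0⟩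
    simp [hjk, hn]
  · have h1 : x / (ϖ ^ j * n) =
        (ϖ ^ (x.valuation / k)) ^ k * (1 + ϖ ^ N * (y / n)) := by
      have h2 : ϖ ^ x.valuation =
          (ϖ ^ (x.valuation / k)) ^ k * ϖ ^ j := by
        rw [← zpow_natCast, ← zpow_natCast, ← zpow_mul, ← zpow_add₀ pK_ne, hj', mul_comm,
          Int.mul_ediv_add_emod]
      have h3 : ϖ ^ j ≠ 0 := pow_ne_zero _ pK_ne
      have h4 : u = n * (1 + ϖ ^ N * (y / n)) := by rw [huy]; field_simp
      rw [div_eq_iff (mul_ne_zero h3 hn0)]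
      calc x = ϖ ^ x.valuation * u := hxu
        _ = (ϖ ^ (x.valuation / k)) ^ k * ϖ ^ j *
            (n * (1 + ϖ ^ N * (y / n))) := by rw [h2, ← h4]
        _ = _ := by ring
    rw [h1]
    refine Pset_mul (Pset_pow_self (zpow_ne_zero _ pK_ne)) (h _ ?_)
    rw [norm_div, hnu, div_one]; exact hy

lemma unit_pow_totient (N : ℕ) {x : Qp} (hx : ‖x‖ = 1) :
    ∃ y, ‖y‖ ≤ 1 ∧ x ^ (p ^ N).totient = 1 + ϖ ^ N * y := by
  obtain ⟨c, rfl⟩ : ∃ c : ℤ_[p], (c : Qp) = x := ⟨⟨x, hx.le⟩, rfl⟩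
  have hc : IsUnit c := PadicInt.isUnit_iff.2 hx
  have h1 : PadicInt.toZModPow N (c ^ (p ^ N).totient - 1) = 0 := by
    rw [map_sub, map_pow, map_one, sub_eq_zero]
    obtain ⟨u, hu⟩ := hc.map (PadicInt.toZModPow N)
    rw [← hu, ← Units.val_pow_eq_pow_val, ZMod.pow_totient, Units.val_one]
  rw [← RingHom.mem_ker, PadicInt.ker_toZModPow, Ideal.mem_span_singleton] at h1
  obtain ⟨y, hy⟩ := h1
  refine ⟨y, y.2, ?_⟩
  have := congrArg (fun z : ℤ_[p] => (z : Qp)) hy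
  simp only [PadicInt.coe_sub, PadicInt.coe_mul, PadicInt.coe_pow, PadicInt.coe_natCast,
    PadicInt.coe_one] at this
  rw [← this]; ring

lemma Pset_near (N : ℕ) {x : Qp} (hx : ‖x‖ = 1) (h : x ∈ Pset p (p ^ N).totient) :
    ∃ y, ‖y‖ ≤ 1 ∧ x = 1 + ϖ ^ N * y := by
  obtain ⟨z, hz, rfl⟩ := h
  have hk : 0 < (p ^ N).totient := Nat.totient_pos.2 (pow_pos (Fact.out : p.Prime).pos _)
  refine unit_pow_totient N ?_
  rw [norm_pow] at hx
  exact (pow_eq_one_iff_of_nonneg (norm_nonneg _) hk.ne').1 hx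

/-- exponent killing all roots of unity of `ℚ_p` -/
def rootM (p : ℕ) : ℕ := (p ^ 2).totient

lemma rootM_pos : 0 < rootM p := Nat.totient_pos.2 (pow_pos (Fact.out : p.Prime).pos _)

lemma norm_prime_ge {q : ℕ} (hq : q.Prime) {y : Qp} (hy : ‖y‖ ≤ 1)
    (h : (q : Qp) = ϖ ^ 2 * y) : False := by
  have h1 : ‖((q : ℤ) : Qp)‖ ≤ (p : ℝ) ^ (-(2 : ℕ) : ℤ) := by
    rw [Int.cast_natCast, h, norm_mul, ← Padic.norm_p_pow]
    exact mul_le_of_le_one_right (norm_nonneg _) hy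
  rw [Padic.norm_int_le_pow_iff_dvd] at h1
  have h2 : p ^ 2 ∣ q := by exact_mod_cast h1
  have h3 : p ∣ q := (Dvd.intro _ (by ring : p * p = p ^ 2)).trans h2
  have h4 : p = q := (Nat.prime_dvd_prime_iff_eq Fact.out hq).1 h3
  subst h4
  have := Nat.le_of_dvd hq.pos h2
  nlinarith [hq.two_le]

lemma geom_near {q : ℕ} {w : Qp} (hw : ‖w‖ ≤ 1) :
    ∃ y, ‖y‖ ≤ 1 ∧ ∑ i ∈ range q, (1 + ϖ ^ 2 * w) ^ i = q + ϖ ^ 2 * y := by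
  have hpow : ∀ i : ℕ, ∃ y, ‖y‖ ≤ 1 ∧ (1 + ϖ ^ 2 * w) ^ i = 1 + ϖ ^ 2 * y := by
    intro i
    induction i with
    | zero => exact ⟨0, by simp, by simp⟩
    | succ n ih =>
      obtain ⟨y, hy, e⟩ := ih
      refine ⟨y + w + ϖ ^ 2 * (y * w), ?_, by rw [pow_succ, e]; ring⟩
      exact norm_add_le_one (norm_add_le_one hy hw)
        (norm_mul_le_one (norm_pow_p_le_one _) (norm_mul_le_one hy hw))
  induction q with
  | zero => exact ⟨0, by simp, by simp⟩
  | succ n ih =>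
    obtain ⟨y, hy, e⟩ := ih
    obtain ⟨y', hy', e'⟩ := hpow n
    exact ⟨y + y', norm_add_le_one hy hy', by rw [sum_range_succ, e, e']; push_cast; ring⟩

lemma root_of_unity_pow {n : ℕ} (hn : 0 < n) {z : Qp} (hz : z ^ n = 1) : z ^ rootM p = 1 := by
  have hz1 : ‖z‖ = 1 := by
    have : ‖z‖ ^ n = 1 := by rw [← norm_pow, hz, norm_one]
    exact (pow_eq_one_iff_of_nonneg (norm_nonneg _) hn.ne').1 this
  by_contra hne
  set y := z ^ rootM p with hy
  have hyn : y ^ n = 1 := by rw [hy, ← pow_mul, mul_comm, pow_mul, hz, one_pow]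
  have ho : orderOf y ≠ 1 := by rwa [Ne, orderOf_eq_one_iff]
  have ho0 : 0 < orderOf y := orderOf_pos_iff.2 (isOfFinOrder_iff_pow_eq_one.2 ⟨n, hn, hyn⟩)
  obtain ⟨q, hq, c, hc⟩ := Nat.exists_prime_and_dvd ho
  have hc0 : 0 < c := by
    rcases Nat.eq_zero_or_pos c with h | h
    · rw [h, mul_zero] at hc; omega
    · exact h
  set x := y ^ c with hx
  have hx1 : x ≠ 1 := by
    intro h
    have := orderOf_dvd_of_pow_eq_one h
    rw [hc] at this
    have := Nat.le_of_dvd hc0 this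
    nlinarith [hq.two_le]
  have hxq : x ^ q = 1 := by rw [hx, ← pow_mul, mul_comm, ← hc, pow_orderOf_eq_one]
  have hzc : ‖z ^ c‖ = 1 := by rw [norm_pow, hz1, one_pow]
  obtain ⟨w, hw, e⟩ := unit_pow_totient 2 hzc
  have hxe : x = 1 + ϖ ^ 2 * w := by
    rw [← e, hx, hy, ← pow_mul, ← pow_mul, mul_comm]; rfl
  obtain ⟨v, hv, e2⟩ := geom_near (q := q) hw
  have h0 : ∑ i ∈ range q, x ^ i = 0 := by
    have := geom_sum_mul x q
    rw [hxq, sub_self, mul_eq_zero] at this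
    exact this.resolve_right (sub_ne_zero.2 hx1)
  rw [hxe, e2] at h0
  exact norm_prime_ge hq (y := -v) (by rwa [norm_neg]) (by linear_combination h0)

/-- uniqueness of roots in `P_M` -/
lemma root_unique {l : ℕ} (hl : 0 < l) {x y : Qp} (hx : x ∈ Pset p (rootM p))
    (hy : y ∈ Pset p (rootM p)) (h : x ^ l = y ^ l) : x = y := by
  have hy0 := Pset_ne hy
  obtain ⟨a, ha, rfl⟩ := hx
  obtain ⟨b, hb, rfl⟩ := hy
  have h1 : (a / b) ^ (rootM p * l) = 1 := by
    rw [pow_mul, div_pow, div_pow, h, div_self (pow_ne_zero _ hy0)]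
  have h2 := root_of_unity_pow (Nat.mul_pos rootM_pos hl) h1
  rw [div_pow, div_eq_one_iff_eq hy0] at h2
  exact h2

/-! ### Part 2 : Tate closures -/

section Tate
variable {Z : Type*}

def Bdd (C : Set Z) (D : Alg Z) : Prop := ∀ d ∈ D, ∀ z ∈ C, ‖d z‖ ≤ 1

def Tate (C : Set Z) (D : Alg Z) : Set (Z → Qp) :=
  {f | ∃ P : ℕ → Z → Qp, (∀ n, P n ∈ D) ∧
    ∀ z ∈ C, HasSum (fun n => ϖ ^ n * P n z) (f z)}

variable {C : Set Z} {D : Subalgebra ℤ_[p] (Z → ℚ_[p])}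

lemma zsmul_apply (c : ℤ_[p]) (f : Z → Qp) (z : Z) : (c • f) z = (c : Qp) * f z := by
  rw [Pi.smul_apply, Algebra.smul_def]; rfl

lemma exists_order {ι : Type*} [Countable ι] (c : ι → Qp) (hc : Tendsto c cofinite (nhds 0))
    (hc1 : ∀ i, ‖c i‖ ≤ 1) : ∃ (h : ι → ℕ) (b : ι → ℤ_[p]), Tendsto h cofinite atTop ∧
      ∀ i, c i = ϖ ^ h i * b i := by
  obtain ⟨e, he⟩ := exists_injective_nat ι
  classical
  have hex : ∀ i, ∃ (n : ℕ) (b : ℤ_[p]), c i = ϖ ^ n * b ∧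
      ((c i = 0 ∧ n = e i) ∨ ‖c i‖ = ‖ϖ‖ ^ n) := by
    intro i
    by_cases h0 : c i = 0
    · exact ⟨e i, 0, by simp [h0], .inl ⟨h0, rfl⟩⟩
    · obtain ⟨u, hu, hx⟩ := exists_unit (c i) h0
      have hv : 0 ≤ (c i).valuation := (Padic.norm_le_one_iff_val_nonneg _).1 (hc1 i)
      obtain ⟨n, hn⟩ := Int.eq_ofNat_of_zero_le hv
      refine ⟨n, ⟨u, hu.le⟩, ?_, .inr ?_⟩
      · rw [hx.trans (by rw [hn])]; simp
      · conv_lhs => rw [hx]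
        rw [hn, norm_mul, hu, mul_one, zpow_natCast, norm_pow]
  choose h b hb hor using hex
  refine ⟨h, b, ?_, hb⟩
  rw [tendsto_atTop]
  intro n
  have h1 : ∀ᶠ i in cofinite, ‖c i‖ < ‖ϖ‖ ^ n := by
    have := (tendsto_zero_iff_norm_tendsto_zero.1 hc)
    refine this.eventually_lt_const ?_
    exact pow_pos (norm_pos_iff.2 pK_ne) n
  have h2 : ∀ᶠ i in cofinite, n ≤ e i := by
    have := he.tendsto_cofinite
    rw [Nat.cofinite_eq_atTop] at this
    exact this.eventually_ge_atTop n
  filter_upwards [h1, h2] with i hi1 hi2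
  rcases hor i with ⟨-, h3⟩ | h3
  · rwa [h3]
  · rw [h3] at hi1
    exact ((pow_lt_pow_iff_right_of_lt_one₀ (norm_pos_iff.2 pK_ne) norm_p_lt_one).1 hi1).le

lemma summable_of_tendsto_zero {ι : Type*} {f : ι → Qp} (h : Tendsto f cofinite (nhds 0)) :
    Summable f :=
  NonarchimedeanAddGroup.summable_of_tendsto_cofinite_zero h

lemma tendsto_pow_order {ι : Type*} {h : ι → ℕ} (hh : Tendsto h cofinite atTop) {f : ι → Qp}
    (hf : ∀ i, ‖f i‖ ≤ 1) : Tendsto (fun i => ϖ ^ h i * f i) cofinite (nhds 0) := by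
  rw [tendsto_zero_iff_norm_tendsto_zero]
  have h1 : Tendsto (fun i => ‖ϖ‖ ^ h i) cofinite (nhds 0) :=
    (tendsto_pow_atTop_nhds_zero_of_lt_one (norm_nonneg _) norm_p_lt_one).comp hh
  refine squeeze_zero (fun i => norm_nonneg _) (fun i => ?_) h1
  rw [norm_mul, norm_pow]
  exact mul_le_of_le_one_right (by positivity) (hf i)

lemma summable_pow_mul {f : ℕ → Qp} (hf : ∀ i, ‖f i‖ ≤ 1) :
    Summable (fun n => ϖ ^ n * f n) := by
  refine summable_of_tendsto_zero (tendsto_pow_order (h := fun n => n) ?_ hf)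
  rw [Nat.cofinite_eq_atTop]; exact tendsto_id

lemma tate_sum {ι : Type*} [Countable ι] (hB : Bdd C D) (f : ι → Z → Qp)
    (hf : ∀ i, f i ∈ Tate C D) (c : ι → Qp) (hc : Tendsto c cofinite (nhds 0))
    (hc1 : ∀ i, ‖c i‖ ≤ 1) (g : Z → Qp)
    (hg : ∀ z ∈ C, HasSum (fun i => c i * f i z) (g z)) : g ∈ Tate C D := by
  classical
  obtain ⟨h, b, hh, hb⟩ := exists_order c hc hc1
  choose P hP hPs using hf
  let q : ι × ℕ → ℕ := fun x => h x.1 + x.2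
  have hfin1 : ∀ n, {i | h i ≤ n}.Finite := by
    intro n
    have := hh.eventually_gt_atTop n
    rw [eventually_cofinite] at this
    simpa using this
  have hfin : ∀ k, {x : ι × ℕ | q x ≤ k}.Finite := by
    intro k
    refine ((hfin1 k).prod (Set.finite_Iic k)).subset ?_
    rintro ⟨i, m⟩ hx
    simp only [mem_ofPred_eq, q] at hx
    simp only [Set.mem_prod, mem_ofPred_eq, Set.mem_Iic]; omega
  have hfib : ∀ k, (q ⁻¹' {k}).Finite := fun k => (hfin k).subset (fun x hx => by
    simp only [Set.mem_preimage, Set.mem_singleton_iff] at hx; simp [hx])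
  have hq : Tendsto q cofinite atTop := by
    rw [tendsto_atTop]
    intro n
    rw [eventually_cofinite]
    refine (hfin n).subset (fun x hx => ?_)
    simp only [mem_ofPred_eq, not_le] at hx ⊢; omega
  refine ⟨fun k => ∑ x ∈ (hfib k).toFinset, b x.1 • P x.1 x.2, fun k =>
    Subalgebra.sum_mem _ (fun x _ => Subalgebra.smul_mem _ (hP _ _) _), fun z hz => ?_⟩
  let F : ι × ℕ → Qp := fun x => ϖ ^ q x * ((b x.1 : Qp) * P x.1 x.2 z)
  have hFs : Summable F := summable_of_tendsto_zero
    (tendsto_pow_order hq (fun x => norm_mul_le_one (b x.1).2 (hB _ (hP _ _) z hz)))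
  have hF2 : HasSum (fun i => c i * f i z) (∑' x, F x) := by
    refine hFs.hasSum.prod_fiberwise (fun i => ?_)
    have := (hPs i z hz).mul_left (c i)
    refine this.congr_fun ?_
    intro m
    simp only [F, q, hb i, pow_add]; ring
  have hF3 : HasSum F (g z) := by rw [(hg z hz).unique hF2]; exact hFs.hasSum
  have := hF3.tsum_fiberwise q
  refine this.congr_fun (fun k => ?_)
  rw [← (hfib k).coe_toFinset, Finset.tsum_subtype']
  beta_reduce
  rw [Finset.sum_apply, mul_sum]
  refine sum_congr (by simp) (fun x hx => ?_)
  simp only [Set.Finite.mem_toFinset, Set.mem_preimage, Set.mem_singleton_iff] at hx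
  simp only [F, hx, zsmul_apply]

lemma norm_hasSum_le {ι : Type*} {f : ι → Qp} {a : Qp} {r : ℝ} (hr : 0 ≤ r) (h : HasSum f a)
    (hf : ∀ i, ‖f i‖ ≤ r) : ‖a‖ ≤ r := by
  refine le_of_tendsto (h.norm) (Eventually.of_forall (fun s => ?_))
  exact IsUltrametricDist.norm_sum_le_of_forall_le_of_nonneg hr (fun i _ => hf i)

lemma tate_of_mem {d : Z → Qp} (hd : d ∈ D) : d ∈ Tate C D := by
  refine ⟨fun n => if n = 0 then d else 0, fun n => ?_, fun z _ => ?_⟩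
  · dsimp only; split_ifs
    · exact hd
    · exact D.zero_mem
  · have := hasSum_ite_eq (0 : ℕ) (d z)
    refine this.congr_fun (fun n => ?_)
    split_ifs with h <;> simp [h]

lemma tate_congr {f g : Z → Qp} (hf : f ∈ Tate C D) (h : ∀ z ∈ C, g z = f z) :
    g ∈ Tate C D := by
  obtain ⟨P, hP, hs⟩ := hf
  exact ⟨P, hP, fun z hz => by rw [h z hz]; exact hs z hz⟩

lemma tate_mono {C' : Set Z} {D' : Alg Z} {f : Z → Qp}
    (hf : f ∈ Tate C D) (hC : C' ⊆ C) (hD : D ≤ D') : f ∈ Tate C' D' := by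
  obtain ⟨P, hP, hs⟩ := hf
  exact ⟨P, fun n => hD (hP n), fun z hz => hs z (hC hz)⟩

lemma tate_bdd (hB : Bdd C D) {f : Z → Qp} (hf : f ∈ Tate C D) {z : Z} (hz : z ∈ C) :
    ‖f z‖ ≤ 1 := by
  obtain ⟨P, hP, hs⟩ := hf
  exact norm_hasSum_le zero_le_one (hs z hz)
    (fun n => norm_mul_le_one (norm_pow_p_le_one n) (hB _ (hP n) z hz))

lemma tate_add {f g : Z → Qp} (hf : f ∈ Tate C D) (hg : g ∈ Tate C D) : f + g ∈ Tate C D := by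
  obtain ⟨P, hP, hs⟩ := hf
  obtain ⟨Q, hQ, ht⟩ := hg
  refine ⟨fun n => P n + Q n, fun n => D.add_mem (hP n) (hQ n), fun z hz => ?_⟩
  refine ((hs z hz).add (ht z hz)).congr_fun (fun n => ?_)
  simp [mul_add]

lemma tendsto_pow_p : Tendsto (fun n : ℕ => ϖ ^ n) cofinite (nhds 0) := by
  rw [Nat.cofinite_eq_atTop]
  exact tendsto_pow_atTop_nhds_zero_of_norm_lt_one norm_p_lt_one

lemma tate_powsum (hB : Bdd C D) (f : ℕ → Z → Qp) (hf : ∀ i, f i ∈ Tate C D) (g : Z → Qp)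
    (hg : ∀ z ∈ C, HasSum (fun n => ϖ ^ n * f n z) (g z)) : g ∈ Tate C D :=
  tate_sum hB f hf _ tendsto_pow_p norm_pow_p_le_one g hg

lemma tate_mul (hB : Bdd C D) {f g : Z → Qp} (hf : f ∈ Tate C D) (hg : g ∈ Tate C D) :
    f * g ∈ Tate C D := by
  obtain ⟨P, hP, hs⟩ := hf
  obtain ⟨Q, hQ, ht⟩ := hg
  refine tate_powsum hB (fun n => P n * g) (fun n => ?_) _ (fun z hz => ?_)
  · refine ⟨fun k => P n * Q k, fun k => D.mul_mem (hP n) (hQ k), fun z hz => ?_⟩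
    refine ((ht z hz).mul_left (P n z)).congr_fun (fun k => ?_)
    simp only [mul_apply]; ring
  · refine ((hs z hz).mul_right (g z)).congr_fun (fun k => ?_)
    simp only [mul_apply]; ring

/-- The Tate closure as a subalgebra. -/
def TateAlg (C : Set Z) (D : Alg Z) (hB : Bdd C D) :
    Alg Z where
  carrier := Tate C D
  add_mem' := tate_add
  mul_mem' := tate_mul hB
  algebraMap_mem' r := tate_of_mem (D.algebraMap_mem r)

lemma tate_trans (hB : Bdd C D) {D' : Alg Z}
    (h : ∀ d ∈ D', d ∈ Tate C D) {f : Z → Qp} (hf : f ∈ Tate C D') : f ∈ Tate C D := by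
  obtain ⟨P, hP, hs⟩ := hf
  exact tate_powsum hB P (fun n => h _ (hP n)) _ hs

/-- Successive approximation. -/
lemma tate_approx {D' : Alg Z} (hDD : D ≤ D') (hB : Bdd C D')
    (G : Set (Z → Qp)) (hG : D' = adjoin ℤ_[p] G)
    (h : ∀ g ∈ G, ∃ d ∈ D, ∃ e ∈ Tate C D', ∀ z ∈ C, g z = d z + p * e z)
    {f : Z → Qp} (hf : f ∈ Tate C D') : f ∈ Tate C D := by
  have hpT : ∀ e ∈ Tate C D', (fun z => ϖ * e z) ∈ Tate C D' := by
    intro e he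
    exact tate_congr ((TateAlg C D' hB).smul_mem he (p : ℤ_[p]))
      (fun z _ => by rw [zsmul_apply]; simp)
  have h1 : ∀ g ∈ D', ∃ d ∈ D, ∃ e ∈ Tate C D', ∀ z ∈ C, g z = d z + p * e z := by
    intro g hg
    rw [hG] at hg
    induction hg using Algebra.adjoin_induction with
    | mem x hx => exact h x hx
    | algebraMap r => exact ⟨_, D.algebraMap_mem r, 0, (TateAlg C D' hB).zero_mem, by simp⟩
    | add x y _ _ hx hy =>
      obtain ⟨d, hd, e, he, h1⟩ := hx
      obtain ⟨d', hd', e', he', h2⟩ := hy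
      refine ⟨d + d', D.add_mem hd hd', e + e', tate_add he he', fun z hz => ?_⟩
      simp only [Pi.add_apply, h1 z hz, h2 z hz]; ring
    | mul x y _ _ hx hy =>
      obtain ⟨d, hd, e, he, h1⟩ := hx
      obtain ⟨d', hd', e', he', h2⟩ := hy
      have q1 := tate_of_mem (C := C) (hDD hd)
      have q2 := tate_of_mem (C := C) (hDD hd')
      refine ⟨d * d', D.mul_mem hd hd', d * e' + d' * e + (fun z => ϖ * (e * e') z),
        tate_add (tate_add (tate_mul hB q1 he') (tate_mul hB q2 he)) (hpT _ (tate_mul hB he he')),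
        fun z hz => ?_⟩
      simp only [Pi.add_apply, mul_apply, h1 z hz, h2 z hz]; ring
  have h2 : ∀ g ∈ Tate C D', ∃ d ∈ D, ∃ e ∈ Tate C D', ∀ z ∈ C, g z = d z + p * e z := by
    rintro g ⟨P, hP, hs⟩
    obtain ⟨d, hd, e, he, h3⟩ := h1 _ (hP 0)
    refine ⟨d, hd, e + fun z => ∑' n, ϖ ^ n * P (n + 1) z, tate_add he ?_, ?_⟩
    · refine ⟨fun n => P (n + 1), fun n => hP _, fun z hz => ?_⟩
      exact (summable_pow_mul (fun i => hB _ (hP (i + 1)) z hz)).hasSum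
    · intro z hz
      have h4 := (hs z hz).summable.tsum_eq_zero_add
      rw [(hs z hz).tsum_eq] at h4
      rw [h4, Pi.add_apply, mul_add, ← tsum_mul_left, pow_zero, one_mul, h3 z hz, add_assoc]
      simp only [pow_succ', mul_assoc]
  choose! d hd e he hde using h2
  refine ⟨fun n => d (e^[n] f), fun n => ?_, fun z hz => ?_⟩
  · refine hd _ ?_
    induction n with
    | zero => exact hf
    | succ n ih => rw [Function.iterate_succ_apply']; exact he _ ih
  · have hE : ∀ n, e^[n] f ∈ Tate C D' := by
      intro n
      induction n with
      | zero => exact hf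
      | succ n ih => rw [Function.iterate_succ_apply']; exact he _ ih
    have hsum : ∀ n, ∑ i ∈ range n, ϖ ^ i * d (e^[i] f) z =
        f z - p ^ n * (e^[n] f) z := by
      intro n
      induction n with
      | zero => simp
      | succ n ih =>
        rw [sum_range_succ, ih, Function.iterate_succ_apply']
        have := hde _ (hE n) z hz
        rw [this]; ring
    have hsm : Summable (fun n => ϖ ^ n * d (e^[n] f) z) :=
      summable_pow_mul (fun i => hB _ (hDD (hd _ (hE i))) z hz)
    have ht := hsm.hasSum.tendsto_sum_nat
    have h0 : Tendsto (fun n => ϖ ^ n * (e^[n] f) z) atTop (nhds 0) := by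
      have := tendsto_pow_order (p := p) (h := fun n : ℕ => n) (f := fun n => (e^[n] f) z)
        (by rw [Nat.cofinite_eq_atTop]; exact tendsto_id) (fun i => tate_bdd hB (hE i) hz)
      rwa [Nat.cofinite_eq_atTop] at this
    have h1 : Tendsto (fun n => f z - ϖ ^ n * (e^[n] f) z) atTop (nhds (f z - 0)) :=
      tendsto_const_nhds.sub h0
    simp only [hsum] at ht
    rw [sub_zero] at h1
    rw [← tendsto_nhds_unique ht h1]
    exact hsm.hasSum

lemma hasSum_swap {ι κ : Type*} {F : ι → κ → Qp}
    (h : Tendsto (fun x : ι × κ => F x.1 x.2) cofinite (nhds 0)) :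
    HasSum (fun j => ∑' i, F i j) (∑' i, ∑' j, F i j) := by
  have hs : Summable (fun x : ι × κ => F x.1 x.2) := summable_of_tendsto_zero h
  have hs' : Summable (fun x : κ × ι => F x.2 x.1) := hs.prod_symm
  have h1 : ∑' i, ∑' j, F i j = ∑' x : κ × ι, F x.2 x.1 := by
    rw [← hs.tsum_prod]
    exact ((Equiv.prodComm κ ι).tsum_eq (fun x : ι × κ => F x.1 x.2)).symm
  rw [h1]
  refine hs'.hasSum.prod_fiberwise (fun j => ?_)
  exact (hs'.prod_factor j).hasSum

end Tate

/-! ### Part 3 : representation of Tate functions, finitely generated version -/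

section TateFG
variable {Z : Type*} {C : Set Z} {D : Subalgebra ℤ_[p] (Z → ℚ_[p])}

lemma tendsto_prod_of_fin {I : Type*} (G : ℕ → I → Qp) (hG : ∀ n i, ‖G n i‖ ≤ 1)
    (hf : ∀ n, {i | G n i ≠ 0}.Finite) :
    Tendsto (fun x : ℕ × I => ϖ ^ x.1 * G x.1 x.2) cofinite (nhds 0) := by
  rw [tendsto_zero_iff_norm_tendsto_zero, tendsto_order]
  refine ⟨fun a ha => Eventually.of_forall fun x => ha.trans_le (norm_nonneg _), fun ε hε => ?_⟩
  obtain ⟨N, hN⟩ := exists_pow_lt_of_lt_one hε (norm_p_lt_one (p := p))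
  rw [eventually_cofinite]
  refine (Set.Finite.biUnion (Set.finite_Iio N) (fun n _ => (hf n).image (fun i => (n, i)))).subset ?_
  rintro ⟨n, i⟩ hx
  simp only [mem_ofPred_eq, not_lt, norm_mul, norm_pow] at hx
  simp only [Set.mem_iUnion, Set.mem_Iio, Set.mem_image, mem_ofPred_eq]
  refine ⟨n, ?_, i, ?_, rfl⟩
  · by_contra hn
    push Not at hn
    have h1 : ‖ϖ‖ ^ n ≤ ‖ϖ‖ ^ N :=
      pow_le_pow_of_le_one (norm_nonneg _) norm_p_lt_one.le hn
    have h2 : ‖ϖ‖ ^ n * ‖G n i‖ ≤ ‖ϖ‖ ^ n :=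
      mul_le_of_le_one_right (by positivity) (hG n i)
    linarith
  · intro h0
    rw [h0] at hx
    simp at hx; linarith

lemma tendsto_tsum_of_prod {I J : Type*} {F : J → I → Qp}
    (h : Tendsto (fun x : J × I => F x.1 x.2) cofinite (nhds 0)) :
    Tendsto (fun i => ∑' n, F n i) cofinite (nhds 0) := by
  rw [tendsto_zero_iff_norm_tendsto_zero, tendsto_order]
  refine ⟨fun a ha => Eventually.of_forall fun x => ha.trans_le (norm_nonneg _), fun ε hε => ?_⟩
  rw [tendsto_zero_iff_norm_tendsto_zero] at h
  have h1 := h.eventually_lt_const (half_pos hε)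
  rw [eventually_cofinite] at h1 ⊢
  refine (h1.image Prod.snd).subset ?_
  intro i hi
  by_contra hcon
  apply hi
  have hs : Summable (fun n => F n i) := by
    have := (summable_of_tendsto_zero (tendsto_zero_iff_norm_tendsto_zero.2 h)).prod_symm
    exact this.prod_factor i
  refine lt_of_le_of_lt (norm_hasSum_le (half_pos hε).le hs.hasSum (fun n => ?_)) (half_lt_self hε)
  by_contra hn
  exact hcon ⟨(n, i), by simpa using (not_le.1 hn).le, rfl⟩

lemma aeval_fun_apply {k : ℕ} (η : Fin k → Z → Qp) (q : MvPolynomial (Fin k) ℤ_[p]) (z : Z) :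
    (MvPolynomial.aeval η q) z = MvPolynomial.aeval (fun j => η j z) q := by
  have := MvPolynomial.comp_aeval_apply (f := η) (Pi.evalAlgHom ℤ_[p] (fun _ : Z => Qp) z) q
  exact this

lemma tate_repr {k : ℕ} (η : Fin k → Z → Qp) (hη : ∀ j, ∀ z ∈ C, ‖η j z‖ ≤ 1)
    {f : Z → Qp} (hf : f ∈ Tate C (adjoin ℤ_[p] (Set.range η))) :
    ∃ a : (Fin k → ℕ) → Qp, IsRestrictedCoeffs p a ∧
      ∀ z ∈ C, f z = ranalFn p a (fun j => η j z) := by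
  obtain ⟨P, hP, hs⟩ := hf
  have h1 : ∀ n, ∃ q : MvPolynomial (Fin k) ℤ_[p], MvPolynomial.aeval η q = P n := by
    intro n
    have := hP n
    rw [Algebra.adjoin_range_eq_range_aeval] at this
    exact this
  choose q hq using h1
  let G : ℕ → (Fin k → ℕ) → Qp :=
    fun n i => (((q n).coeff (Finsupp.equivFunOnFinite.symm i) : ℤ_[p]) : Qp)
  have hG1 : ∀ n i, ‖G n i‖ ≤ 1 := fun n i => ((q n).coeff _).2
  have hGf : ∀ n, {i | G n i ≠ 0}.Finite := by
    intro n
    refine ((q n).support.finite_toSet.image Finsupp.equivFunOnFinite).subset ?_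
    intro i hi
    refine ⟨Finsupp.equivFunOnFinite.symm i, ?_, by simp⟩
    simp only [mem_coe, MvPolynomial.mem_support_iff]
    intro h0; apply hi; simp [G, h0]
  refine ⟨fun i => ∑' n, ϖ ^ n * G n i,
    tendsto_tsum_of_prod (F := fun n i => ϖ ^ n * G n i)
      (tendsto_prod_of_fin G hG1 hGf), fun z hz => ?_⟩
  unfold ranalFn
  rw [if_pos (fun j => hη j z hz), ← (hs z hz).tsum_eq]
  have hprod : ∀ i : Fin k → ℕ, ‖∏ j, η j z ^ i j‖ ≤ 1 := by
    intro i
    rw [norm_prod]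
    refine Finset.prod_le_one (fun j _ => norm_nonneg _) (fun j _ => ?_)
    rw [norm_pow]
    exact pow_le_one₀ (norm_nonneg _) (hη j z hz)
  have hsw := hasSum_swap (F := fun n i => ϖ ^ n * (G n i * ∏ j, η j z ^ i j))
    (tendsto_prod_of_fin (fun n i => G n i * ∏ j, η j z ^ i j)
      (fun n i => norm_mul_le_one (hG1 n i) (hprod i))
      (fun n => (hGf n).subset (fun i hi => left_ne_zero_of_mul hi)))
  have e1 : ∀ i : Fin k → ℕ, (∑' n, ϖ ^ n * G n i) * ∏ j, η j z ^ i j =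
      ∑' n, ϖ ^ n * (G n i * ∏ j, η j z ^ i j) := by
    intro i; rw [← tsum_mul_right]; simp only [mul_assoc]
  simp only [e1]
  rw [hsw.tsum_eq]
  congr 1
  ext n
  rw [tsum_mul_left]
  congr 1
  rw [← hq n, aeval_fun_apply, MvPolynomial.aeval_def, MvPolynomial.eval₂_eq']
  symm
  rw [← Finsupp.equivFunOnFinite.tsum_eq, tsum_eq_sum (s := (q n).support)]
  · refine sum_congr rfl (fun d _ => ?_)
    simp [G]
  · intro d hd
    rw [MvPolynomial.notMem_support_iff] at hd
    simp [G, hd]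

lemma ranal_tate {k : ℕ} (hB : Bdd C D) (a : (Fin k → ℕ) → Qp) (ha : IsRestrictedCoeffs p a)
    (ha1 : ∀ i, ‖a i‖ ≤ 1) (ξ : Fin k → Z → Qp) (hξ : ∀ j, ξ j ∈ Tate C D) :
    (fun z => ranalFn p a (fun j => ξ j z)) ∈ Tate C D := by
  have hm : ∀ i : Fin k → ℕ, ∏ j, ξ j ^ i j ∈ Tate C D := fun i =>
    (TateAlg C D hB).prod_mem (fun j _ => (TateAlg C D hB).pow_mem (hξ j) _)
  refine tate_sum hB (fun i : Fin k → ℕ => ∏ j, ξ j ^ i j) hm a ha ha1 _ (fun z hz => ?_)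
  unfold ranalFn
  rw [if_pos (fun j => tate_bdd hB (hξ j) hz)]
  have hn : ∀ i : Fin k → ℕ, ‖(∏ j, ξ j ^ i j) z‖ ≤ 1 := fun i => tate_bdd hB (hm i) hz
  have hsm : Summable (fun i : Fin k → ℕ => a i * (∏ j, ξ j ^ i j) z) := by
    refine summable_of_tendsto_zero ?_
    rw [tendsto_zero_iff_norm_tendsto_zero]
    refine squeeze_zero (fun i => norm_nonneg _) (fun i => ?_) (tendsto_zero_iff_norm_tendsto_zero.1 ha)
    rw [norm_mul]
    exact mul_le_of_le_one_right (norm_nonneg _) (hn i)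
  have := hsm.hasSum
  simpa only [Finset.prod_apply, pow_apply] using this

/-- Finitely generated Tate closure. -/
def TA (C : Set Z) (A : Alg Z) : Set (Z → Qp) :=
  {f | ∃ D ≤ A, D.FG ∧ f ∈ Tate C D}

variable {A : Subalgebra ℤ_[p] (Z → ℚ_[p])}

lemma Bdd.mono {C' : Set Z} (hB : Bdd C A) (hC : C' ⊆ C) (hD : D ≤ A) : Bdd C' D :=
  fun d hd z hz => hB d (hD hd) z (hC hz)

lemma TA_common (n : ℕ) (f : Fin n → Z → Qp) (hf : ∀ i, f i ∈ TA C A) :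
    ∃ D ≤ A, D.FG ∧ ∀ i, f i ∈ Tate C D := by
  choose D hD hFG hT using hf
  refine ⟨univ.sup D, Finset.sup_le (fun i _ => hD i), ?_, fun i => ?_⟩
  · exact Finset.sup_induction Subalgebra.fg_bot (fun _ h _ h' => h.sup h') (fun i _ => hFG i)
  · exact tate_mono (hT i) le_rfl (le_sup (mem_univ i))

lemma TA_of_mem {d : Z → Qp} (hd : d ∈ A) : d ∈ TA C A :=
  ⟨adjoin ℤ_[p] {d}, adjoin_le (by simpa using hd),
    ⟨{d}, by simp⟩, tate_of_mem (subset_adjoin rfl)⟩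

lemma TA_congr {f g : Z → Qp} (hf : f ∈ TA C A) (h : ∀ z ∈ C, g z = f z) :
    g ∈ TA C A := by
  obtain ⟨D, hD, hFG, hT⟩ := hf
  exact ⟨D, hD, hFG, tate_congr hT h⟩

lemma TA_bdd (hB : Bdd C A) {f : Z → Qp} (hf : f ∈ TA C A) {z : Z} (hz : z ∈ C) :
    ‖f z‖ ≤ 1 := by
  obtain ⟨D, hD, hFG, hT⟩ := hf
  exact tate_bdd (hB.mono le_rfl hD) hT hz

lemma TA_add {f g : Z → Qp} (hf : f ∈ TA C A) (hg : g ∈ TA C A) : f + g ∈ TA C A := by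
  obtain ⟨D, hD, hFG, hT⟩ := hf
  obtain ⟨D', hD', hFG', hT'⟩ := hg
  exact ⟨D ⊔ D', sup_le hD hD', hFG.sup hFG', tate_add (tate_mono hT le_rfl le_sup_left)
    (tate_mono hT' le_rfl le_sup_right)⟩

lemma TA_mul (hB : Bdd C A) {f g : Z → Qp} (hf : f ∈ TA C A) (hg : g ∈ TA C A) :
    f * g ∈ TA C A := by
  obtain ⟨D, hD, hFG, hT⟩ := hf
  obtain ⟨D', hD', hFG', hT'⟩ := hg
  exact ⟨D ⊔ D', sup_le hD hD', hFG.sup hFG', tate_mul (hB.mono le_rfl (sup_le hD hD'))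
    (tate_mono hT le_rfl le_sup_left) (tate_mono hT' le_rfl le_sup_right)⟩

/-- `TA` as a subalgebra. -/
def TAlg (C : Set Z) (A : Alg Z) (hB : Bdd C A) :
    Alg Z where
  carrier := TA C A
  add_mem' := TA_add
  mul_mem' := TA_mul hB
  algebraMap_mem' r := TA_of_mem (A.algebraMap_mem r)

lemma TA_subst {C' : Set Z} {A' : Alg Z} (hB' : Bdd C' A')
    (hC : C' ⊆ C) (hA : ∀ d ∈ A, d ∈ TA C' A') {f : Z → Qp} (hf : f ∈ TA C A) :
    f ∈ TA C' A' := by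
  obtain ⟨D, hD, ⟨G, hG⟩, hT⟩ := hf
  obtain ⟨D', hD', hFG', h⟩ := TA_common (C := C') (A := A') G.card (fun i => (G.equivFin.symm i).1)
    (fun i => hA _ (hD (by rw [← hG]; exact subset_adjoin (G.equivFin.symm i).2)))
  refine ⟨D', hD', hFG', tate_trans (hB'.mono le_rfl hD') (fun d hd => ?_) (tate_mono hT hC le_rfl)⟩
  have : D ≤ TateAlg C' D' (hB'.mono le_rfl hD') := by
    rw [← hG]
    refine adjoin_le (fun g hg => ?_)
    have := h (G.equivFin ⟨g, hg⟩)
    simp only [Equiv.symm_apply_apply] at this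
    exact this
  exact this hd

lemma TA_ranal {k : ℕ} (hB : Bdd C A) (a : (Fin k → ℕ) → Qp) (ha : IsRestrictedCoeffs p a)
    (ha1 : ∀ i, ‖a i‖ ≤ 1) (ξ : Fin k → Z → Qp) (hξ : ∀ j, ξ j ∈ TA C A) :
    (fun z => ranalFn p a (fun j => ξ j z)) ∈ TA C A := by
  obtain ⟨D, hD, hFG, h⟩ := TA_common k ξ hξ
  exact ⟨D, hD, hFG, ranal_tate (hB.mono le_rfl hD) a ha ha1 ξ h⟩

lemma TA_const (c : Qp) (hc : ‖c‖ ≤ 1) : (fun _ => c) ∈ TA C A := by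
  refine TA_of_mem ?_
  obtain ⟨c, rfl⟩ : ∃ c' : ℤ_[p], (c' : Qp) = c := ⟨⟨c, hc⟩, rfl⟩
  exact A.algebraMap_mem c

/-- Geometric series. -/
lemma TA_inv (hB : Bdd C A) {f : Z → Qp} (hf : f ∈ TA C A) {N : ℕ} (hN : 0 < N) :
    ∃ g ∈ TA C A, ∀ z ∈ C, (1 + ϖ ^ N * f z)⁻¹ = 1 + p ^ N * g z := by
  obtain ⟨D, hD, hFG, hT⟩ := hf
  have hBD := hB.mono le_rfl hD
  have hx : ∀ z ∈ C, ‖-(ϖ ^ N * f z)‖ < 1 := by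
    intro z hz
    rw [norm_neg, norm_mul, norm_pow]
    have h1 : ‖ϖ‖ ^ N < 1 := pow_lt_one₀ (norm_nonneg _) norm_p_lt_one hN.ne'
    have := tate_bdd hBD hT hz
    have h2 : ‖ϖ‖ ^ N * ‖f z‖ ≤ ‖ϖ‖ ^ N :=
      mul_le_of_le_one_right (by positivity) this
    linarith
  refine ⟨fun z => -f z * (1 + ϖ ^ N * f z)⁻¹, ⟨D, hD, hFG, ?_⟩, fun z hz => ?_⟩
  · have h1 : (fun z => (1 + ϖ ^ N * f z)⁻¹) ∈ Tate C D := by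
      refine tate_sum hBD (fun n : ℕ => f ^ n) (fun n => (TateAlg C D hBD).pow_mem hT n)
        (fun n => (-ϖ ^ N) ^ n) ?_ ?_ _ (fun z hz => ?_)
      · rw [Nat.cofinite_eq_atTop]
        refine tendsto_pow_atTop_nhds_zero_of_norm_lt_one ?_
        rw [norm_neg, norm_pow]
        exact pow_lt_one₀ (norm_nonneg _) norm_p_lt_one hN.ne'
      · intro n
        rw [norm_pow, norm_neg]
        exact pow_le_one₀ (norm_nonneg _) (norm_pow_p_le_one N)
      · have := hasSum_geometric_of_norm_lt_one (hx z hz)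
        rw [sub_neg_eq_add] at this
        refine this.congr_fun (fun n => ?_)
        rw [pow_apply, ← mul_pow]; ring
    exact tate_mul hBD ((TateAlg C D hBD).neg_mem hT) h1
  · have h0 : 1 + ϖ ^ N * f z ≠ 0 := by
      intro h0
      have := hx z hz
      rw [show -(ϖ ^ N * f z) = 1 by linear_combination -h0] at this
      simp at this
    field_simp
    ring

end TateFG

/-! ### Part 4 : rich rings of functions -/

section Ultra

lemma ultra_cover {T : Type*} (G : Set (Set T)) (h : ∀ U : Ultrafilter T, ∃ X ∈ U, X ∈ G) :
    ∃ F : Finset (Set T), (↑F ⊆ G) ∧ ∀ t, ∃ X ∈ F, t ∈ X := by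
  by_contra hcon
  push Not at hcon
  obtain ⟨U, hU⟩ := Ultrafilter.exists_ultrafilter_of_finite_inter_nonempty (compl '' G) (by
    classical
    intro F hF
    obtain ⟨t, ht⟩ := hcon (F.image compl) (by
      intro X hX
      simp only [Finset.coe_image, Set.mem_image, mem_coe] at hX
      obtain ⟨Y, hY, rfl⟩ := hX
      obtain ⟨Z, hZ, rfl⟩ := hF hY
      rwa [compl_compl])
    refine ⟨t, fun X hX => ?_⟩
    have := ht Xᶜ (Finset.mem_image_of_mem _ hX)
    simpa using this)
  obtain ⟨X, hX, hXG⟩ := h U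
  have h1 : Xᶜ ∈ U := hU ⟨X, hXG, rfl⟩
  have := Ultrafilter.compl_notMem_iff.2 hX
  exact this h1

lemma ultra_finset {T ι : Type*} (U : Ultrafilter T) (F : Finset ι) (A : ι → Set T)
    (h : ∀ᶠ t in (U : Filter T), ∃ i ∈ F, t ∈ A i) : ∃ i ∈ F, A i ∈ U := by
  have : (⋃ i ∈ (F : Set ι), A i) ∈ U := by
    filter_upwards [h] with t ht
    simpa using ht
  rw [Ultrafilter.finite_biUnion_mem_iff F.finite_toSet] at this
  simpa using this

end Ultra

section Rich
variable {S : Type*}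

/-- Rings of functions closed under the basic operations. -/
structure PreRich (R : Set (S → Qp)) : Prop where
  const : ∀ c : Qp, (fun _ => c) ∈ R
  add : ∀ {f g}, f ∈ R → g ∈ R → f + g ∈ R
  mul : ∀ {f g}, f ∈ R → g ∈ R → f * g ∈ R
  inv : ∀ {f}, f ∈ R → f⁻¹ ∈ R
  ind : ∀ {f} {k : ℕ}, f ∈ R → 0 < k → indicator {s | f s ∈ Pset p k} 1 ∈ R
  ranal : ∀ {n : ℕ} (a : (Fin n → ℕ) → Qp) (ξ : Fin n → S → Qp), IsRestrictedCoeffs p a →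
    (∀ i, ξ i ∈ R) → (fun s => ranalFn p a (fun i => ξ i s)) ∈ R

/-- Sets definable in `R`. -/
def Def (R : Set (S → Qp)) (X : Set S) : Prop := indicator X (1 : S → Qp) ∈ R

variable {R : Set (S → ℚ_[p])}

namespace PreRich
variable (hR : PreRich R)
include hR

lemma neg {f : S → Qp} (hf : f ∈ R) : -f ∈ R := by
  have := hR.mul (hR.const (-1)) hf
  convert this using 1
  ext s; simp

lemma sub {f g : S → Qp} (hf : f ∈ R) (hg : g ∈ R) : f - g ∈ R := by
  rw [sub_eq_add_neg]; exact hR.add hf (hR.neg hg)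

lemma one : (1 : S → Qp) ∈ R := hR.const 1
lemma zero : (0 : S → Qp) ∈ R := hR.const 0

lemma pow {f : S → Qp} (hf : f ∈ R) (n : ℕ) : f ^ n ∈ R := by
  induction n with
  | zero => rw [pow_zero]; exact hR.one
  | succ n ih => rw [pow_succ]; exact hR.mul ih hf

lemma div {f g : S → Qp} (hf : f ∈ R) (hg : g ∈ R) : f / g ∈ R := by
  rw [div_eq_mul_inv]; exact hR.mul hf (hR.inv hg)

lemma zpow {f : S → Qp} (hf : f ∈ R) (n : ℤ) : f ^ n ∈ R := by
  cases n with
  | ofNat n => rw [Int.ofNat_eq_natCast, zpow_natCast]; exact hR.pow hf n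
  | negSucc n => rw [zpow_negSucc]; exact hR.inv (hR.pow hf _)

lemma sum {ι : Type*} (F : Finset ι) (f : ι → S → Qp) (hf : ∀ i ∈ F, f i ∈ R) :
    ∑ i ∈ F, f i ∈ R := by
  classical
  induction F using Finset.induction_on with
  | empty => simpa using hR.zero
  | insert a F ha ih =>
    rw [sum_insert ha]
    exact hR.add (hf a (by simp)) (ih (fun i hi => hf i (by simp [hi])))

/-- The bounded functions of `R`. -/
def Rc : Alg S where
  carrier := {r | r ∈ R ∧ ∀ s, ‖r s‖ ≤ 1}
  add_mem' := fun ⟨h1, h2⟩ ⟨h3, h4⟩ => ⟨hR.add h1 h3, fun s => norm_add_le_one (h2 s) (h4 s)⟩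
  mul_mem' := fun ⟨h1, h2⟩ ⟨h3, h4⟩ => ⟨hR.mul h1 h3, fun s => norm_mul_le_one (h2 s) (h4 s)⟩
  algebraMap_mem' := fun r => ⟨hR.const _, fun _ => r.2⟩

lemma def_univ : Def R Set.univ := by
  unfold Def; rw [Set.indicator_univ]; exact hR.one

lemma def_compl {X : Set S} (h : Def R X) : Def R Xᶜ := by
  unfold Def; rw [Set.indicator_compl]; exact hR.sub hR.one h

lemma def_inter {X Y : Set S} (h : Def R X) (h' : Def R Y) : Def R (X ∩ Y) := by
  unfold Def; rw [Set.inter_indicator_one]; exact hR.mul h h'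

lemma def_union {X Y : Set S} (h : Def R X) (h' : Def R Y) : Def R (X ∪ Y) := by
  have := hR.def_compl (hR.def_inter (hR.def_compl h) (hR.def_compl h'))
  rwa [← Set.compl_union, compl_compl] at this

lemma def_empty : Def R ∅ := by
  have := hR.def_compl hR.def_univ
  rwa [Set.compl_univ] at this

lemma def_finset {ι : Type*} (F : Finset ι) (A : ι → Set S) (h : ∀ i ∈ F, Def R (A i)) :
    Def R {s | ∀ i ∈ F, s ∈ A i} := by
  classical
  induction F using Finset.induction_on with
  | empty => simpa using hR.def_univ
  | insert a F ha ih =>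
    have := hR.def_inter (h a (by simp)) (ih (fun i hi => h i (by simp [hi])))
    convert this using 1
    ext s; simp

lemma def_ne {r : S → Qp} (hr : r ∈ R) : Def R {s | r s ≠ 0} := by
  unfold Def
  have := hR.mul hr (hR.inv hr)
  convert this using 1
  ext s
  by_cases h : r s = 0
  · rw [indicator_of_notMem (by simpa using h)]; simp [h]
  · rw [indicator_of_mem (by simpa using h)]; simp [h]

lemma def_eq {r r' : S → Qp} (hr : r ∈ R) (hr' : r' ∈ R) : Def R {s | r s = r' s} := by
  have := hR.def_compl (hR.def_ne (hR.sub hr hr'))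
  convert this using 1
  ext s; simp [sub_eq_zero]

lemma def_le_one {r : S → Qp} (hr : r ∈ R) : Def R {s | ‖r s‖ ≤ 1} := by
  unfold Def
  have := hR.ranal (n := 1) (fun i => if i = 0 then 1 else 0) (fun _ => r) (by
    unfold IsRestrictedCoeffs
    refine tendsto_nhds_of_eventually_eq ?_
    rw [eventually_cofinite]
    refine (Set.finite_singleton 0).subset (fun i hi => ?_)
    by_contra h
    exact hi (by simpa using h)) (fun _ => hr)
  convert this using 1
  ext s
  unfold ranalFn
  by_cases h : ‖r s‖ ≤ 1
  · rw [indicator_of_mem (by simpa using h), if_pos (fun _ => h)]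
    rw [tsum_eq_single (0 : Fin 1 → ℕ) (fun i hi => by simp [hi])]
    simp
  · rw [indicator_of_notMem (by simpa using h), if_neg (by simpa using h)]

lemma def_le {r r' : S → Qp} (hr : r ∈ R) (hr' : r' ∈ R) : Def R {s | ‖r s‖ ≤ ‖r' s‖} := by
  have := hR.def_union (hR.def_inter (hR.def_ne hr') (hR.def_le_one (hR.div hr hr')))
    (hR.def_eq hr hR.zero)
  convert this using 1
  ext s
  by_cases h : r' s = 0
  · simp [h]
  · have h1 : 0 < ‖r' s‖ := norm_pos_iff.2 h
    simp only [Set.mem_union, Set.mem_inter_iff, mem_ofPred_eq, Pi.div_apply, norm_div,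
      div_le_one h1, Pi.zero_apply]
    constructor
    · intro h2; exact .inl ⟨h, h2⟩
    · rintro (⟨-, h2⟩ | h2)
      · exact h2
      · simp [h2]

lemma def_lt {r r' : S → Qp} (hr : r ∈ R) (hr' : r' ∈ R) : Def R {s | ‖r s‖ < ‖r' s‖} := by
  have := hR.def_compl (hR.def_le hr' hr)
  convert this using 1
  ext s; simp

lemma def_norm_eq {r r' : S → Qp} (hr : r ∈ R) (hr' : r' ∈ R) : Def R {s | ‖r s‖ = ‖r' s‖} := by
  have := hR.def_inter (hR.def_le hr hr') (hR.def_le hr' hr)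
  convert this using 1
  ext s; simp [le_antisymm_iff]

lemma def_Pset {r : S → Qp} (hr : r ∈ R) {k : ℕ} (hk : 0 < k) : Def R {s | r s ∈ Pset p k} :=
  hR.ind hr hk

lemma def_coset {r : S → Qp} (hr : r ∈ R) (μ : Qp) {k : ℕ} (hk : 0 < k) :
    Def R {s | r s / μ ∈ Pset p k} :=
  hR.def_Pset (hR.div hr (hR.const μ)) hk

lemma restrict {r : S → Qp} (hr : r ∈ R) {X : Set S} (hX : Def R X) : X.indicator r ∈ R := by
  have := hR.mul hX hr
  convert this using 1
  ext s
  by_cases h : s ∈ X <;> simp [h]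

lemma restrict_Rc {r : S → Qp} (hr : r ∈ R) {X : Set S} (hX : Def R X)
    (h : ∀ s ∈ X, ‖r s‖ ≤ 1) : X.indicator r ∈ hR.Rc := by
  refine ⟨hR.restrict hr hX, fun s => ?_⟩
  by_cases hs : s ∈ X
  · simpa [hs] using h s hs
  · simp [hs]

/-- Gluing. -/
lemma glue {f : S → Qp}
    (h : ∀ V : Ultrafilter S, ∃ X ∈ V, Def R X ∧ ∃ r ∈ R, ∀ s ∈ X, f s = r s) : f ∈ R := by
  classical
  obtain ⟨F, hF, hcov⟩ := ultra_cover {X | Def R X ∧ ∃ r ∈ R, ∀ s ∈ X, f s = r s} h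
  have : ∀ F : Finset (Set S), (↑F ⊆ {X | Def R X ∧ ∃ r ∈ R, ∀ s ∈ X, f s = r s}) →
      ∃ r ∈ R, ∀ X ∈ F, ∀ s ∈ X, f s = r s := by
    intro F
    induction F using Finset.induction_on with
    | empty => intro _; exact ⟨0, hR.zero, by simp⟩
    | insert X F _ ih =>
      intro hF
      obtain ⟨r, hr, h1⟩ := ih (fun Y hY => hF (by simp [mem_coe.1 hY]))
      obtain ⟨hX, r', hr', h2⟩ := hF (show X ∈ ↑(insert X F) by simp)
      refine ⟨X.indicator r' + Xᶜ.indicator r, hR.add (hR.restrict hr' hX)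
        (hR.restrict hr (hR.def_compl hX)), ?_⟩
      intro Y hY s hs
      by_cases hsX : s ∈ X
      · simp [hsX, h2 s hsX]
      · rcases mem_insert.1 hY with rfl | hY
        · exact absurd hs hsX
        · simp [hsX, h1 Y hY s hs]
  obtain ⟨r, hr, h1⟩ := this F hF
  have : f = r := by
    ext s
    obtain ⟨X, hX, hs⟩ := hcov s
    exact h1 X hX s hs
  rwa [this]

omit hR in
lemma Rc_bdd {hR : PreRich R} (X : Set S) : Bdd X hR.Rc := fun _ hd z _ => hd.2 z

/-- `TA` functions with coefficients in `R` are in `R`. -/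
lemma of_TA {X : Set S} (hX : Def R X) {f : S → Qp} (hf : f ∈ TA X hR.Rc) :
    ∃ r ∈ hR.Rc, ∀ s ∈ X, f s = r s := by
  have hb := fun s (hs : s ∈ X) => TA_bdd (Rc_bdd X) hf hs
  obtain ⟨D, hD, ⟨G, hG⟩, hT⟩ := hf
  have hrange : Set.range (fun i => (G.equivFin.symm i).1) = (G : Set (S → Qp)) := by
    ext g
    constructor
    · rintro ⟨i, rfl⟩; exact (G.equivFin.symm i).2
    · intro hg; exact ⟨G.equivFin ⟨g, hg⟩, by simp⟩
  have hmem : ∀ i, (G.equivFin.symm i).1 ∈ hR.Rc := fun i =>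
    hD (by rw [← hG]; exact subset_adjoin (G.equivFin.symm i).2)
  obtain ⟨a, ha, h⟩ := tate_repr (C := X) (fun i => (G.equivFin.symm i).1)
    (fun i s _ => (hmem i).2 s) (by rw [hrange, hG]; exact hT)
  refine ⟨_, hR.restrict_Rc (hR.ranal a _ ha (fun i => (hmem i).1)) hX (fun s hs => ?_),
    fun s hs => ?_⟩
  · rw [← h s hs]; exact hb s hs
  · rw [indicator_of_mem hs]; exact h s hs

/-- Fixed points. -/
lemma fixed_point {X : Set S} (hX : Def R X) {c : S → Qp} (hc : ∀ s ∈ X, ‖c s‖ ≤ 1)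
    {B : Alg S} (hB : B ≤ hR.Rc) (hFG : B.FG)
    {D : Alg S} (hD : D = adjoin ℤ_[p] (insert c (B : Set (S → Qp))))
    (h : ∃ η ∈ B, ∃ e ∈ Tate X D, ∀ s ∈ X, c s = η s + p * e s) :
    ∃ r ∈ hR.Rc, ∀ s ∈ X, c s = r s := by
  have hBD : B ≤ D := by
    rw [hD]; intro b hb; exact subset_adjoin (by simp [hb])
  have hbdd : Bdd X D := by
    intro d hd s hs
    rw [hD] at hd
    induction hd using Algebra.adjoin_induction with
    | mem x hx =>
      rcases hx with rfl | hx
      · exact hc s hs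
      · exact (hB hx).2 s
    | algebraMap r => exact r.2
    | add x y _ _ hx hy => exact norm_add_le_one hx hy
    | mul x y _ _ hx hy => exact norm_mul_le_one hx hy
  have hT : c ∈ Tate X B := by
    refine tate_approx hBD hbdd _ hD ?_ (tate_of_mem (by rw [hD]; exact subset_adjoin (by simp)))
    intro g hg
    rcases hg with rfl | hg
    · exact h
    · exact ⟨g, hg, 0, (TateAlg X D hbdd).zero_mem, by simp⟩
  exact hR.of_TA hX ⟨B, hB, hFG, hT⟩

end PreRich
end Rich

/-! ### Part 5 : adjoining roots -/

section LinSec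
variable {Z : Type*}

/-- The module `D + D η + ... + D η^(ℓ-1)`. -/
def Lin (D : Alg Z) (η : Z → Qp) (l : ℕ) : Set (Z → Qp) :=
  {f | ∃ r : ℕ → Z → Qp, (∀ i, r i ∈ D) ∧ f = ∑ i ∈ range l, r i * η ^ i}

variable {D : Subalgebra ℤ_[p] (Z → ℚ_[p])} {η : Z → ℚ_[p]} {l : ℕ}

lemma Lin_add {f g : Z → Qp} (hf : f ∈ Lin D η l) (hg : g ∈ Lin D η l) : f + g ∈ Lin D η l := by
  obtain ⟨r, hr, rfl⟩ := hf
  obtain ⟨q, hq, rfl⟩ := hg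
  refine ⟨fun i => r i + q i, fun i => D.add_mem (hr i) (hq i), ?_⟩
  rw [← Finset.sum_add_distrib]
  exact sum_congr rfl (fun i _ => by ring)

lemma Lin_zero : (0 : Z → Qp) ∈ Lin D η l := ⟨fun _ => 0, fun _ => D.zero_mem, by simp⟩

lemma Lin_smul {f d : Z → Qp} (hd : d ∈ D) (hf : f ∈ Lin D η l) : d * f ∈ Lin D η l := by
  obtain ⟨r, hr, rfl⟩ := hf
  refine ⟨fun i => d * r i, fun i => D.mul_mem hd (hr i), ?_⟩
  rw [mul_sum]
  exact sum_congr rfl (fun i _ => by ring)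

lemma Lin_sum {ι : Type*} (F : Finset ι) (f : ι → Z → Qp) (h : ∀ i ∈ F, f i ∈ Lin D η l) :
    ∑ i ∈ F, f i ∈ Lin D η l := by
  classical
  induction F using Finset.induction_on with
  | empty => simpa using Lin_zero
  | insert a F ha ih =>
    rw [sum_insert ha]
    exact Lin_add (h a (by simp)) (ih (fun i hi => h i (by simp [hi])))

lemma Lin_eta (hb : η ^ l ∈ D) {f : Z → Qp} (hf : f ∈ Lin D η l) : f * η ∈ Lin D η l := by
  obtain ⟨r, hr, rfl⟩ := hf
  cases l with
  | zero => simpa using Lin_zero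
  | succ k =>
    refine ⟨fun i => if i = 0 then r k * η ^ (k + 1) else r (i - 1), fun i => ?_, ?_⟩
    · dsimp only
      split_ifs
      · exact D.mul_mem (hr k) hb
      · exact hr _
    · rw [sum_range_succ, Finset.sum_range_succ', add_mul, Finset.sum_mul]
      congr 1
      · refine sum_congr rfl (fun i _ => ?_)
        simp only [Nat.add_eq_zero_iff, one_ne_zero, and_false, if_false, Nat.add_sub_cancel]
        ring
      · simp only [if_true]
        ring

lemma Lin_mul (hb : η ^ l ∈ D) {f g : Z → Qp} (hf : f ∈ Lin D η l) (hg : g ∈ Lin D η l) :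
    f * g ∈ Lin D η l := by
  have hpow : ∀ i, f * η ^ i ∈ Lin D η l := by
    intro i
    induction i with
    | zero => simpa using hf
    | succ i ih => rw [pow_succ, ← mul_assoc]; exact Lin_eta hb ih
  obtain ⟨r, hr, rfl⟩ := hg
  rw [mul_sum]
  refine Lin_sum _ _ (fun i _ => ?_)
  have : f * (r i * η ^ i) = r i * (f * η ^ i) := by ring
  rw [this]
  exact Lin_smul (hr i) (hpow i)

lemma Lin_of_mem (hl : 0 < l) {d : Z → Qp} (hd : d ∈ D) : d ∈ Lin D η l := by
  refine ⟨fun i => if i = 0 then d else 0, fun i => ?_, ?_⟩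
  · dsimp only
    split_ifs
    · exact hd
    · exact D.zero_mem
  · obtain ⟨k, rfl⟩ : ∃ k, l = k + 1 := ⟨l - 1, by omega⟩
    rw [Finset.sum_range_succ']
    simp

lemma Lin_pow (hl : 0 < l) (hb : η ^ l ∈ D) (i : ℕ) : η ^ i ∈ Lin D η l := by
  induction i with
  | zero => rw [pow_zero]; exact Lin_of_mem hl D.one_mem
  | succ i ih => rw [pow_succ]; exact Lin_eta hb ih

lemma Lin_adjoin (hl : 0 < l) (G : Set (Z → Qp)) {f : Z → Qp}
    (hf : f ∈ adjoin ℤ_[p] (insert η G)) :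
    f ∈ Lin (adjoin ℤ_[p] (insert (η ^ l) G)) η l := by
  have hb : η ^ l ∈ adjoin ℤ_[p] (insert (η ^ l) G) :=
    subset_adjoin (Set.mem_insert _ _)
  induction hf using Algebra.adjoin_induction with
  | mem x hx =>
    rcases hx with rfl | hx
    · simpa using Lin_pow hl hb 1
    · exact Lin_of_mem hl (subset_adjoin (Set.mem_insert_of_mem _ hx))
  | algebraMap r => exact Lin_of_mem hl (Subalgebra.algebraMap_mem _ r)
  | add x y _ _ hx hy => exact Lin_add hx hy
  | mul x y _ _ hx hy => exact Lin_mul hb hx hy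

lemma Lin_tate {X : Set Z} (hl : 0 < l) (G : Set (Z → Qp))
    (hB : Bdd X (adjoin ℤ_[p] (insert (η ^ l) G))) {f : Z → Qp}
    (hf : f ∈ Tate X (adjoin ℤ_[p] (insert η G))) :
    ∃ r : ℕ → Z → Qp, (∀ i, r i ∈ Tate X (adjoin ℤ_[p] (insert (η ^ l) G))) ∧
      ∀ z ∈ X, f z = ∑ i ∈ range l, r i z * η z ^ i := by
  obtain ⟨P, hP, hs⟩ := hf
  choose r hr hPr using fun n => Lin_adjoin hl G (hP n)
  have hsum : ∀ i, ∀ z ∈ X, HasSum (fun n => ϖ ^ n * r n i z)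
      (∑' n, ϖ ^ n * r n i z) := fun i z hz =>
    (summable_pow_mul (fun n => hB _ (hr n i) z hz)).hasSum
  refine ⟨fun i z => ∑' n, ϖ ^ n * r n i z, fun i => ?_, fun z hz => ?_⟩
  · exact ⟨fun n => r n i, fun n => hr n i, hsum i⟩
  · have h1 : HasSum (fun n => ∑ i ∈ range l, (ϖ ^ n * r n i z) * η z ^ i)
        (∑ i ∈ range l, (∑' n, ϖ ^ n * r n i z) * η z ^ i) :=
      hasSum_sum (fun i _ => (hsum i z hz).mul_right _)
    refine (hs z hz).unique (h1.congr_fun (fun n => ?_))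
    rw [hPr n, Finset.sum_apply, mul_sum]
    refine sum_congr rfl (fun i _ => ?_)
    simp only [mul_apply, pow_apply]
    ring

end LinSec

/-! ### Part 6 : adjoining one root -/

section Adjoin
variable {S : Type*} {R : Set (S → ℚ_[p])}

/-- `R` as an algebra. -/
def PreRich.alg (hR : PreRich R) : Alg S where
  carrier := R
  add_mem' := hR.add
  mul_mem' := hR.mul
  algebraMap_mem' := fun _ => hR.const _

/-- local membership -/
def LocIn (R R' : Set (S → Qp)) (V : Ultrafilter S) (f : S → Qp) : Prop :=
  ∃ X ∈ V, Def R X ∧ ∃ r ∈ R', ∀ s ∈ X, f s = r s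

lemma PreRich.coset_loc (hR : PreRich R) (V : Ultrafilter S) {r : S → Qp} (hr : r ∈ R)
    (h0 : {s | r s ≠ 0} ∈ V) {k : ℕ} (hk : 0 < k) :
    ∃ Y ∈ V, Def R Y ∧ ∃ ν : Qp, ν ≠ 0 ∧ ∀ s ∈ Y, r s / ν ∈ Pset p k := by
  obtain ⟨T, hT0, hT⟩ := finite_cosets (p := p) k hk
  obtain ⟨ν, hν, h⟩ := ultra_finset V T (fun ν => {s | r s / ν ∈ Pset p k}) (by
    filter_upwards [h0] with s hs
    exact hT _ hs)
  exact ⟨_, h, hR.def_coset hr ν hk, ν, hT0 ν hν, fun s hs => hs⟩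

variable (hR : PreRich R) {θ b : S → ℚ_[p]} {l : ℕ} (hl : l.Prime) (hb : b ∈ R)
  (hθ : θ ^ l = b) (hM : ∀ s, θ s ≠ 0 → θ s ∈ Pset p (rootM p))
include hR hl hb hθ hM

omit hM in
lemma theta_ne_def : Def R {s | θ s ≠ 0} := by
  have := hR.def_ne hb
  convert this using 1
  ext s
  simp [← hθ, hl.ne_zero]

lemma theta_coset (V : Ultrafilter S) (h0 : {s | θ s ≠ 0} ∈ V) {k : ℕ} (hk : 0 < k) :
    ∃ Y ∈ V, Def R Y ∧ ∃ ν : Qp, ν ≠ 0 ∧ ∀ s ∈ Y, θ s / ν ∈ Pset p k := by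
  have hM0 := rootM_pos (p := p)
  obtain ⟨T, hT0, hT⟩ := finite_cosets (p := p) (k * rootM p) (by positivity)
  obtain ⟨ν, hν, h⟩ := ultra_finset V T (fun ν => {s | θ s / ν ∈ Pset p (k * rootM p)}) (by
    filter_upwards [h0] with s hs
    exact hT _ hs)
  obtain ⟨s0, h1, h2⟩ := V.nonempty_of_mem (inter_mem h h0)
  have hνM : ν⁻¹ ∈ Pset p (rootM p) := by
    have h3 := Pset_dvd (Dvd.intro_left k rfl) h1
    rw [div_eq_mul_inv] at h3
    exact (Pset_mul_iff (hM s0 h2)).1 h3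
  refine ⟨{s | b s / ν ^ l ∈ Pset p (l * (k * rootM p))}, ?_,
    hR.def_coset hb _ (by have := hl.pos; positivity), ν, hT0 ν hν, ?_⟩
  · filter_upwards [h] with s hs
    obtain ⟨z, hz, hz'⟩ := hs
    refine ⟨z, hz, ?_⟩
    rw [mul_comm, pow_mul, hz', div_pow, ← hθ]; rfl
  · rintro s ⟨z, hz, hz'⟩
    have hne : θ s ≠ 0 := by
      intro h3
      have : b s = 0 := by rw [← hθ]; simp [h3, hl.ne_zero]
      rw [this, zero_div] at hz'
      exact hz (pow_eq_zero_iff (by have := hl.pos; positivity) |>.1 hz')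
    have : z ^ (k * rootM p) = θ s / ν := by
      refine root_unique hl.pos ⟨z ^ k, pow_ne_zero _ hz, by rw [pow_mul]⟩ ?_ ?_
      · rw [div_eq_mul_inv]; exact Pset_mul (hM s hne) hνM
      · rw [div_pow, ← pow_mul, mul_comm, hz', ← hθ]; rfl
    rw [← this]
    exact Pset_dvd (Dvd.intro _ rfl) (Pset_pow_self hz)

/-- If a monomial in `θ` is a unit, then `θ` is locally in `R`. -/
lemma unit_root (V : Ultrafilter S) {ρ : S → Qp} (hρ : ρ ∈ R) {i : ℕ} (hi : 0 < i) (hil : i < l)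
    (h : {s | ‖ρ s * θ s ^ i‖ = 1} ∈ V) : LocIn R R V θ := by
  have hl0 := hl.pos
  have hρ0 : {s | ρ s ≠ 0} ∈ V := by
    filter_upwards [h] with s hs h0
    simp [h0] at hs
  obtain ⟨Y1, hY1, hY1d, μ, hμ, hμY⟩ := hR.coset_loc V hρ hρ0 (rootM_pos (p := p))
  set Y := Y1 ∩ {s | ‖(ρ ^ l * b ^ i) s‖ = ‖(1 : S → Qp) s‖} with hYdef
  have hYd : Def R Y := hR.def_inter hY1d
    (hR.def_norm_eq (hR.mul (hR.pow hρ l) (hR.pow hb i)) hR.one)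
  set y : S → Qp := fun s => ρ s * θ s ^ i with hy
  have hyl : ∀ s, (ρ ^ l * b ^ i) s = y s ^ l := by
    intro s; rw [← hθ, hy]; simp only [mul_apply, pow_apply, mul_pow, ← pow_mul]
    rw [mul_comm l i]
  have hYV : Y ∈ V := by
    filter_upwards [hY1, h] with s h1 h2
    refine ⟨h1, ?_⟩
    rw [mem_ofPred_eq, hyl, norm_pow, hy]
    simp only [Pi.one_apply, norm_one]
    rw [h2, one_pow]
  have hy1 : ∀ s ∈ Y, ‖y s‖ = 1 := by
    intro s hs
    have := hs.2
    rw [mem_ofPred_eq, hyl, norm_pow, Pi.one_apply, norm_one] at this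
    exact (pow_eq_one_iff_of_nonneg (norm_nonneg _) hl.ne_zero).1 this
  have hyM : ∀ s ∈ Y, y s / μ ∈ Pset p (rootM p) := by
    intro s hs
    have h1 : θ s ≠ 0 := by
      intro h0
      have := hy1 s hs
      simp [hy, h0, hi.ne'] at this
    have h2 := Pset_mul (hμY s hs.1) (Pset_pow (hM s h1) i)
    have h3 : y s / μ = ρ s / μ * θ s ^ i := by rw [hy]; ring
    rw [h3]; exact h2
  obtain ⟨s0, hs0⟩ := V.nonempty_of_mem hYV
  set u := y s0 with hu
  have hu1 : ‖u‖ = 1 := hy1 s0 hs0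
  have hu0 : u ≠ 0 := by intro h0; simp [h0] at hu1
  set w : S → Qp := fun s => (y s / u - 1) / p ^ 2 with hw
  have hyw : ∀ s, y s = u * (1 + p ^ 2 * w s) := by
    intro s
    have := pK_ne (p := p)
    rw [hw]; field_simp; ring
  have hw1 : ∀ s ∈ Y, ‖w s‖ ≤ 1 := by
    intro s hs
    have h1 : y s / u ∈ Pset p (rootM p) := by
      have := Pset_mul (hyM s hs) (Pset_inv (hyM s0 hs0))
      convert this using 1
      rw [← hu]
      field_simp
    obtain ⟨w', hw', h2⟩ := Pset_near 2 (by rw [norm_div, hy1 s hs, hu1, div_one]) h1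
    have h3 : w s = w' := by
      have := pK_ne (p := p)
      rw [hw]; dsimp only; rw [h2]; field_simp; ring
    rw [h3]; exact hw'
  obtain ⟨c, hc⟩ : ∃ c : ℤ_[p], ϖ = l * c := by
    by_cases hlp : l = p
    · exact ⟨1, by simp [hlp]⟩
    · have h1 : ‖(l : Qp)‖ = 1 := by
        rw [Padic.norm_natCast_eq_one_iff]
        exact (Nat.coprime_primes Fact.out hl).2 (Ne.symm hlp)
      have h2 : (l : Qp) ≠ 0 := by exact_mod_cast hl.ne_zero
      refine ⟨⟨ϖ / l, ?_⟩, ?_⟩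
      · rw [norm_div, h1, div_one]; exact norm_p_lt_one.le
      · push_cast; field_simp
  have hlK : (l : Qp) ≠ 0 := by exact_mod_cast hl.ne_zero
  set e : S → Qp := ∑ j ∈ range (l - 1),
    algebraMap ℤ_[p] (S → Qp) (-((l.choose (j + 2) : ℤ_[p]) * c * p ^ (2 * j))) * w ^ (j + 2) with he
  have hev : ∀ s, (1 + ϖ ^ 2 * w s) ^ l = 1 + l * p ^ 2 * w s - l * p ^ 3 * e s := by
    intro s
    have h1 : e s = ∑ j ∈ range (l - 1),
        (-((l.choose (j + 2) : Qp) * c * p ^ (2 * j))) * w s ^ (j + 2) := by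
      rw [he, Finset.sum_apply]
      refine sum_congr rfl (fun j _ => ?_)
      simp only [mul_apply, pow_apply]
      congr 1
    rw [h1, add_comm, add_pow]
    obtain ⟨k, rfl⟩ : ∃ k, l = k + 2 := ⟨l - 2, by have := hl.two_le; omega⟩
    rw [Finset.sum_range_succ', Finset.sum_range_succ']
    have h2 : (k + 2 - 1) = k + 1 := by omega
    rw [h2, mul_sum, add_assoc, add_comm, sub_eq_add_neg, ← Finset.sum_neg_distrib]
    congr 1
    · simp; ring
    · refine sum_congr rfl (fun j _ => ?_)
      rw [mul_pow]
      simp only [one_pow, mul_one]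
      linear_combination (((k + 2).choose (j + 1 + 1) : Qp) * p ^ (2 * j + 3) * w s ^ (j + 2)) * hc
  set β : S → Qp := fun s => (y s ^ l / u ^ l - 1) / (l * p ^ 2) with hβ
  have hβR : β ∈ R := by
    have : β = ((ρ ^ l * b ^ i) / (fun _ => u ^ l) - 1) / (fun _ => (l * p ^ 2 : Qp)) := by
      ext s
      simp only [hβ, Pi.div_apply, Pi.sub_apply, Pi.one_apply, hyl]
    rw [this]
    exact hR.div (hR.sub (hR.div (hR.mul (hR.pow hρ l) (hR.pow hb i)) (hR.const _)) hR.one) (hR.const _)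
  have hβw : ∀ s, w s = β s + p * e s := by
    intro s
    have h1 := hev s
    have h2 : y s ^ l / u ^ l = (1 + ϖ ^ 2 * w s) ^ l := by
      rw [hyw s, mul_pow]; field_simp
    have := pK_ne (p := p)
    rw [hβ]; dsimp only; rw [h2, h1]; field_simp; ring
  have hbd : ∀ D : Alg S, w ∈ D → e ∈ D := by
    intro D hD
    rw [he]
    exact D.sum_mem (fun j _ => D.mul_mem (D.algebraMap_mem _) (D.pow_mem hD _))
  have he1 : ∀ s ∈ Y, ‖e s‖ ≤ 1 := by
    intro s hs
    exact hbd { carrier := {f | ‖f s‖ ≤ 1}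
                add_mem' := norm_add_le_one
                mul_mem' := norm_mul_le_one
                algebraMap_mem' := fun r => r.2 } (hw1 s hs)
  have hβ1 : ∀ s ∈ Y, ‖β s‖ ≤ 1 := by
    intro s hs
    have : β s = w s + (-p) * e s := by rw [hβw s]; ring
    rw [this]
    refine norm_add_le_one (hw1 s hs) (norm_mul_le_one ?_ (he1 s hs))
    rw [norm_neg]; exact norm_p_lt_one.le
  have hηR := hR.restrict_Rc hβR hYd hβ1
  obtain ⟨r, hr, hrw⟩ := hR.fixed_point hYd hw1
    (B := adjoin ℤ_[p] {Y.indicator β}) (adjoin_le (by simpa using hηR))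
    ⟨{Y.indicator β}, by simp⟩ rfl
    ⟨Y.indicator β, subset_adjoin (by simp), e,
      tate_of_mem (hbd _ (subset_adjoin (by simp))), fun s hs => by
        rw [indicator_of_mem hs]; exact hβw s⟩
  -- Bezout
  set q : S → Qp := (fun _ => u) * (1 + (fun _ => ϖ ^ 2) * r) / ρ with hq
  have hqR : q ∈ R := hR.div (hR.mul (hR.const _) (hR.add hR.one (hR.mul (hR.const _) hr.1))) hρ
  have hcop : Int.gcd i l = 1 := by
    rw [Int.gcd_natCast_natCast]
    exact ((Nat.coprime_primes hl hl).1.mt (by simp)  |> fun _ =>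
      (Nat.coprime_of_lt_prime hi.ne' hil hl).symm)
  have hbez := Int.gcd_eq_gcd_ab i l
  rw [hcop] at hbez
  refine ⟨Y, hYV, hYd, q ^ (Int.gcdA i l) * b ^ (Int.gcdB i l),
    hR.mul (hR.zpow hqR _) (hR.zpow hb _), fun s hs => ?_⟩
  have hρs : ρ s ≠ 0 := by
    intro h0
    have := hy1 s hs
    simp [hy, h0] at this
  have hθs : θ s ≠ 0 := by
    intro h0
    have := hy1 s hs
    simp [hy, h0, hi.ne'] at this
  have hqs : q s = θ s ^ i := by
    have : q s = u * (1 + p ^ 2 * r s) / ρ s := rfl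
    rw [this, ← hrw s hs, ← hyw s, hy]; field_simp
  have hbs : b s = θ s ^ l := by rw [← hθ]; rfl
  show θ s = q s ^ (Int.gcdA i l) * b s ^ (Int.gcdB i l)
  rw [hqs, hbs, ← zpow_natCast, ← zpow_natCast, ← zpow_mul, ← zpow_mul, ← zpow_add₀ hθs, ← hbez]
  simp

end Adjoin

/-! ### Part 7 : the ring generated by a root -/

lemma norm_le_pow_or {x : Qp} (N : ℕ) (h : ‖x‖ ≤ 1) :
    ‖x‖ ≤ ‖ϖ ^ N‖ ∨ ∃ n ∈ range N, ‖x‖ = ‖ϖ ^ n‖ := by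
  by_cases hx : x = 0
  · left; simp [hx]
  · have hp := one_lt_pR (p := p)
    rw [Padic.norm_eq_zpow_neg_valuation hx] at h ⊢
    have hv : 0 ≤ x.valuation := by
      by_contra hv
      have := one_lt_zpow₀ hp (show (0 : ℤ) < -x.valuation by omega)
      linarith
    simp only [Padic.norm_p_pow]
    by_cases hN : (N : ℤ) ≤ x.valuation
    · left
      exact zpow_le_zpow_right₀ hp.le (by omega)
    · right
      refine ⟨x.valuation.toNat, by simp; omega, ?_⟩
      congr 1
      omega

section Adjoin
variable {S : Type*} {R : Set (S → ℚ_[p])}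

variable (hR : PreRich R) {θ b : S → ℚ_[p]} {l : ℕ} (hl : l.Prime) (hb : b ∈ R)
  (hθ : θ ^ l = b) (hM : ∀ s, θ s ≠ 0 → θ s ∈ Pset p (rootM p))
include hR hl hb hθ

lemma theta_def_le {q r : S → Qp} (hq : q ∈ R) (hr : r ∈ R) (e : ℕ) :
    Def R {s | ‖q s * θ s ^ e‖ ≤ ‖r s‖} := by
  have := hR.def_le (hR.mul (hR.pow hq l) (hR.pow hb e)) (hR.pow hr l)
  convert this using 1
  ext s
  have h1 : (q ^ l * b ^ e) s = (q s * θ s ^ e) ^ l := by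
    rw [← hθ]; simp only [mul_apply, pow_apply, mul_pow, ← pow_mul]; rw [mul_comm l e]
  simp only [mem_ofPred_eq]
  rw [h1, norm_pow, pow_apply, norm_pow, pow_le_pow_iff_left₀ (norm_nonneg _) (norm_nonneg _) hl.ne_zero]

include hM
lemma lead {V : Ultrafilter S} (hA : ¬ LocIn R R V θ) {f : S → Qp} (hf : f ∈ Lin hR.alg θ l)
    (N : ℕ) : ∃ X ∈ V, Def R X ∧ ((∀ s ∈ X, f s = 0) ∨
      ∃ i, ∃ ρ ∈ R, (∀ s ∈ X, ρ s ≠ 0 ∧ θ s ≠ 0) ∧ ∃ (g : ℕ → S → Qp) (e : ℕ → ℕ), (∀ j, g j ∈ R) ∧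
        (∀ j, ∀ s ∈ X, ‖g j s * θ s ^ e j‖ ≤ 1) ∧
        ∀ s ∈ X, f s = ρ s * θ s ^ i * (1 + p ^ N * ∑ j ∈ range l, g j s * θ s ^ e j)) := by
  classical
  obtain ⟨r, hr, rfl⟩ := hf
  replace hr : ∀ i, r i ∈ R := hr
  have hθd := theta_ne_def hR hl hb hθ
  have hθV : {s | θ s ≠ 0} ∈ V := by
    by_contra h
    refine hA ⟨_, compl_umem h, hR.def_compl hθd, 0, hR.zero, fun s hs => ?_⟩
    simpa using hs
  obtain ⟨i, hi, hiV⟩ := ultra_finset V (range l)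
    (fun i => {s | ∀ j ∈ range l, ‖r j s * θ s ^ j‖ ≤ ‖r i s * θ s ^ i‖}) (by
      refine Filter.Eventually.of_forall (fun s => ?_)
      exact Finset.exists_max_image (range l) (fun i => ‖r i s * θ s ^ i‖)
        ⟨0, by simp [hl.pos]⟩)
  by_cases h0 : {s | r i s ≠ 0} ∈ V
  swap
  · refine ⟨{s | ∀ j ∈ range l, s ∈ {s | r j s = (0 : S → Qp) s}}, ?_,
      hR.def_finset _ _ (fun j _ => hR.def_eq (hr j) hR.zero), .inl (fun s hs => ?_)⟩
    · filter_upwards [hiV, hθV, compl_umem h0] with s h1 h2 h3 j hj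
      have h3' : r i s = 0 := by simpa using h3
      have := h1 j hj
      rw [h3'] at this
      simp only [zero_mul, norm_zero] at this
      have h4 := norm_le_zero_iff.1 this
      rcases mul_eq_zero.1 h4 with h5 | h5
      · exact h5
      · exact absurd h5 (pow_ne_zero _ h2)
    · rw [Finset.sum_apply]
      refine Finset.sum_eq_zero (fun j hj => ?_)
      have : r j s = 0 := hs j hj
      simp [this]
  · have hil : i < l := by simpa using hi
    -- the quotients
    have key : ∀ j, ∃ q ∈ R, ∃ e : ℕ, (j ≠ i → j < l → 0 < e ∧ e < l) ∧
        (j ≠ i → j < l → ∀ s, r i s ≠ 0 → θ s ≠ 0 → r j s * θ s ^ j = r i s * θ s ^ i * (q s * θ s ^ e)) ∧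
        (¬ (j ≠ i ∧ j < l) → q = 0) := by
      intro j
      by_cases hj : j ≠ i ∧ j < l
      · rcases lt_or_gt_of_ne hj.1 with h1 | h1
        · refine ⟨r j / (r i * b), hR.div (hr j) (hR.mul (hr i) hb), l + j - i, fun _ _ => by omega,
            fun _ _ s h2 h3 => ?_, fun h => absurd hj h⟩
          simp only [Pi.div_apply, mul_apply, ← hθ, pow_apply]
          have : θ s ^ i * θ s ^ (l + j - i) = θ s ^ l * θ s ^ j := by
            rw [← pow_add, ← pow_add]; congr 1; omega
          field_simp
          linear_combination (- r j s) * this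
        · refine ⟨r j / r i, hR.div (hr j) (hr i), j - i, fun _ _ => by omega,
            fun _ _ s h2 h3 => ?_, fun h => absurd hj h⟩
          simp only [Pi.div_apply]
          have : θ s ^ i * θ s ^ (j - i) = θ s ^ j := by
            rw [← pow_add]; congr 1; omega
          field_simp
          linear_combination (- r j s) * this
      · exact ⟨0, hR.zero, 0, fun h1 h2 => absurd ⟨h1, h2⟩ hj, fun h1 h2 => absurd ⟨h1, h2⟩ hj,
          fun _ => rfl⟩
    choose q hq e he hqe hq0 using key
    have hsmall : ∀ j ∈ range l, {s | ‖q j s * θ s ^ e j‖ ≤ ‖(fun _ => ϖ ^ N : S → Qp) s‖} ∈ V := by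
      intro j hj
      have hjl : j < l := by simpa using hj
      by_cases hji : j = i
      · filter_upwards with s
        rw [hq0 j (by simp [hji])]; simp
      by_contra hcon
      obtain ⟨n, hn, hnV⟩ := ultra_finset V (range N)
        (fun n => {s | ‖q j s * θ s ^ e j‖ = ‖ϖ ^ n‖}) (by
          filter_upwards [compl_umem hcon, hiV, h0, hθV] with s h1 h2 h3 h4
          have h5 := h2 j hj
          rw [hqe j hji hjl s h3 h4, norm_mul] at h5
          have h6 : 0 < ‖r i s * θ s ^ i‖ := norm_pos_iff.2 (mul_ne_zero h3 (pow_ne_zero _ h4))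
          have h7 : ‖q j s * θ s ^ e j‖ ≤ 1 := by
            by_contra h8
            push Not at h8
            nlinarith
          rcases norm_le_pow_or N h7 with h8 | h8
          · exact absurd h8 h1
          · exact h8)
      refine hA (unit_root hR hl hb hθ hM V (ρ := (fun _ => (ϖ ^ n)⁻¹) * q j)
        (hR.mul (hR.const _) (hq j)) (he j hji hjl).1 (he j hji hjl).2 ?_)
      filter_upwards [hnV] with s hs
      have hs' : ‖q j s * θ s ^ e j‖ = ‖ϖ ^ n‖ := hs
      show ‖(ϖ ^ n)⁻¹ * q j s * θ s ^ e j‖ = 1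
      rw [mul_assoc, norm_mul, hs', norm_inv, inv_mul_cancel₀]
      exact norm_ne_zero_iff.2 (pow_ne_zero _ pK_ne)
    refine ⟨({s | r i s ≠ 0} ∩ {s | θ s ≠ 0}) ∩ {s | ∀ j ∈ range l, s ∈ {s | ‖q j s * θ s ^ e j‖ ≤ ‖(fun _ => ϖ ^ N : S → Qp) s‖}}, ?_, ?_, .inr ⟨i, r i, hr i, fun s hs => hs.1,
        fun j => (fun _ => (ϖ ^ N)⁻¹) * q j, e, fun j => hR.mul (hR.const _) (hq j), ?_, ?_⟩⟩
    · refine inter_mem (inter_mem h0 hθV) ?_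
      exact (Filter.biInter_finset_mem (range l)).2 hsmall |> fun h => by
        filter_upwards [h] with s hs j hj
        simp only [Set.mem_iInter] at hs
        exact hs j hj
    · exact hR.def_inter (hR.def_inter (hR.def_ne (hr i)) hθd)
        (hR.def_finset _ _ (fun j _ => theta_def_le hR hl hb hθ (hq j) (hR.const _) _))
    · intro j s hs
      show ‖(ϖ ^ N)⁻¹ * q j s * θ s ^ e j‖ ≤ 1
      by_cases hj : j ∈ range l
      · have h1 : ‖q j s * θ s ^ e j‖ ≤ ‖ϖ ^ N‖ := hs.2 j hj
        rw [mul_assoc, norm_mul, norm_inv]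
        have h2 : 0 < ‖ϖ ^ N‖ := norm_pos_iff.2 (pow_ne_zero _ pK_ne)
        rw [inv_mul_le_iff₀ h2, mul_one]
        exact h1
      · rw [hq0 j (by simp at hj; omega)]; simp
    · intro s hs
      rw [Finset.sum_apply, mul_add, mul_one, ← Finset.add_sum_erase _ _ hi]
      congr 1
      rw [← Finset.add_sum_erase _ _ hi]
      have hqi := hq0 i (by simp)
      simp only [hqi, mul_apply, Pi.zero_apply, mul_zero, zero_mul, zero_add, pow_apply]
      rw [mul_sum, mul_sum]
      refine sum_congr rfl (fun j hj => ?_)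
      rw [hqe j (Finset.ne_of_mem_erase hj) (by simpa using Finset.mem_of_mem_erase hj) s hs.1.1 hs.1.2]
      have : ϖ ^ N ≠ 0 := pow_ne_zero _ pK_ne
      field_simp

end Adjoin

/-! ### Part 8 : closure under restricted analytic functions -/

lemma restricted_scale {m : ℕ} {a : (Fin m → ℕ) → Qp} (ha : IsRestrictedCoeffs p a) :
    ∃ n : ℕ, ∀ i, ‖ϖ ^ n * a i‖ ≤ 1 := by
  classical
  have hfin : {i | ¬ ‖a i‖ ≤ 1}.Finite := by
    have h1 : Tendsto (fun i => ‖a i‖) cofinite (nhds 0) := by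
      simpa using ha.norm
    have h2 := h1.eventually (ge_mem_nhds (show (0 : ℝ) < 1 by norm_num))
    exact h2
  set M : ℝ := ∑ i ∈ hfin.toFinset, ‖a i‖ + 1 with hMdef
  have hs : 0 ≤ ∑ i ∈ hfin.toFinset, ‖a i‖ := Finset.sum_nonneg (fun i _ => norm_nonneg _)
  have hM : 0 < M := by linarith
  have hle : ∀ i, ‖a i‖ ≤ M := by
    intro i
    by_cases hi : ‖a i‖ ≤ 1
    · linarith
    · have := Finset.single_le_sum (f := fun i => ‖a i‖) (fun i _ => norm_nonneg _)
        (hfin.mem_toFinset.2 hi)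
      linarith
  obtain ⟨n, hn⟩ := exists_pow_lt_of_lt_one (inv_pos.2 hM) (norm_p_lt_one (p := p))
  refine ⟨n, fun i => ?_⟩
  rw [norm_mul, norm_pow]
  calc ‖ϖ‖ ^ n * ‖a i‖ ≤ M⁻¹ * M := by
        exact mul_le_mul hn.le (hle i) (norm_nonneg _) (inv_pos.2 hM).le
    _ = 1 := inv_mul_cancel₀ hM.ne'

lemma norm_sum_le_one {ι : Type*} (F : Finset ι) (f : ι → Qp) (h : ∀ i ∈ F, ‖f i‖ ≤ 1) :
    ‖∑ i ∈ F, f i‖ ≤ 1 := by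
  classical
  induction F using Finset.induction_on with
  | empty => simp
  | insert a F ha ih =>
    rw [sum_insert ha]
    exact norm_add_le_one (h a (by simp)) (ih (fun i hi => h i (by simp [hi])))

lemma bdd_adjoin {Z : Type*} {X : Set Z} {G : Set (Z → Qp)} (h : ∀ g ∈ G, ∀ z ∈ X, ‖g z‖ ≤ 1) :
    Bdd X (adjoin ℤ_[p] G) := by
  intro d hd z hz
  induction hd using Algebra.adjoin_induction with
  | mem x hx => exact h x hx z hz
  | algebraMap r => exact r.2
  | add x y _ _ hx hy => exact norm_add_le_one hx hy
  | mul x y _ _ hx hy => exact norm_mul_le_one hx hy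

section Adjoin
variable {S : Type*} {R : Set (S → ℚ_[p])}

variable (hR : PreRich R) {θ b : S → ℚ_[p]} {l : ℕ} (hl : l.Prime) (hb : b ∈ R)
  (hθ : θ ^ l = b) (hM : ∀ s, θ s ≠ 0 → θ s ∈ Pset p (rootM p))
include hR hl hb hθ

lemma tate_lin {X : Set S} (hX : Def R X) (G1 : Finset (S → Qp)) :
    ∀ (G2 : Finset (S → Qp)),
    (∀ η ∈ G1, (∃ r ∈ R, ∃ e : ℕ, η = r * θ ^ e) ∧ ∀ s, ‖η s‖ ≤ 1) →
    (∀ η ∈ G2, η ∈ hR.Rc) → ∀ f : S → Qp,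
    f ∈ Tate X (adjoin ℤ_[p] (↑G1 ∪ ↑G2 : Set (S → Qp))) →
    ∃ h ∈ Lin hR.alg θ l, ∀ s ∈ X, f s = h s := by
  classical
  have hbD : θ ^ l ∈ hR.alg := by rw [hθ]; exact hb
  induction G1 using Finset.induction_on with
  | empty =>
    intro G2 _ hG2 f hf
    obtain ⟨r, hr, h⟩ := hR.of_TA hX (f := f) ⟨_, adjoin_le (fun x hx => hG2 x (by simpa using hx)),
      ⟨G2, by simp⟩, hf⟩
    exact ⟨r, Lin_of_mem hl.pos hr.1, h⟩
  | insert η G1 _ ih =>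
    intro G2 hG1 hG2 f hf
    obtain ⟨⟨r, hr, e, hηe⟩, hη1⟩ := hG1 η (by simp)
    have hηl : η ^ l ∈ hR.Rc := by
      refine ⟨?_, fun s => ?_⟩
      · rw [hηe, mul_pow, ← pow_mul, mul_comm e l, pow_mul, hθ]
        exact hR.mul (hR.pow hr l) (hR.pow hb e)
      · rw [pow_apply, norm_pow]; exact pow_le_one₀ (norm_nonneg _) (hη1 s)
    have hηL : η ∈ Lin hR.alg θ l := by
      rw [hηe]; exact Lin_smul hr (Lin_pow hl.pos hbD e)
    rw [Finset.coe_insert, Set.insert_union] at hf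
    obtain ⟨q, hq, hqf⟩ := Lin_tate (l := l) hl.pos _ (bdd_adjoin (by
      intro g hg s _
      rcases hg with rfl | hg | hg
      · exact hηl.2 s
      · exact (hG1 g (by simp [mem_coe.1 hg])).2 s
      · exact (hG2 g hg).2 s)) hf
    have : ∀ i, ∃ h ∈ Lin hR.alg θ l, ∀ s ∈ X, q i s = h s := by
      intro i
      refine ih (insert (η ^ l) G2) (fun g hg => hG1 g (by simp [hg])) ?_ _ ?_
      · intro g hg
        rcases mem_insert.1 hg with rfl | hg
        · exact hηl
        · exact hG2 g hg
      · rw [Finset.coe_insert, Set.union_insert]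
        exact hq i
    choose h hhL hh using this
    have hpow : ∀ i, η ^ i ∈ Lin hR.alg θ l := by
      intro i
      induction i with
      | zero => rw [pow_zero]; exact Lin_of_mem hl.pos hR.one
      | succ i ih => rw [pow_succ]; exact Lin_mul hbD ih hηL
    refine ⟨∑ i ∈ range l, h i * η ^ i, Lin_sum _ _ (fun i _ => Lin_mul hbD (hhL i) (hpow i)),
      fun s hs => ?_⟩
    rw [hqf s hs, Finset.sum_apply]
    exact sum_congr rfl (fun i _ => by simp [hh i s hs])

include hM
lemma lead_bdd {V : Ultrafilter S} (hA : ¬ LocIn R R V θ) {f : S → Qp}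
    (hf : LocIn R (Lin hR.alg θ l) V f) :
    ∃ Y ∈ V, Def R Y ∧ ((∀ s ∈ Y, ¬ ‖f s‖ ≤ 1) ∨
      ∃ G : Finset (S → Qp), (∀ η ∈ G, (∃ r ∈ R, ∃ e : ℕ, η = r * θ ^ e) ∧ ∀ s, ‖η s‖ ≤ 1) ∧
        ∃ h ∈ adjoin ℤ_[p] (↑G : Set (S → Qp)), ∀ s ∈ Y, f s = h s) := by
  classical
  obtain ⟨X0, hX0, hX0d, f', hf', hff⟩ := hf
  obtain ⟨X, hX, hXd, h | ⟨i, ρ, hρ, hρ0, g, e, hg, hg1, hfX⟩⟩ := lead hR hl hb hθ hM hA hf' 1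
  · exact ⟨X0 ∩ X, inter_mem hX0 hX, hR.def_inter hX0d hXd, .inr ⟨∅, by simp, 0,
      Subalgebra.zero_mem _, fun s hs => by rw [hff s hs.1, h s hs.2]; rfl⟩⟩
  set Y0 := {s | ‖ρ s * θ s ^ i‖ ≤ ‖(1 : S → Qp) s‖} with hY0
  have hY0d : Def R Y0 := theta_def_le hR hl hb hθ hρ hR.one i
  have hnorm : ∀ s ∈ X, ‖f' s‖ = ‖ρ s * θ s ^ i‖ := by
    intro s hs
    rw [hfX s hs, norm_mul, norm_one_add_p Nat.one_pos (norm_sum_le_one _ _ (fun j _ => hg1 j s hs)),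
      mul_one]
  by_cases hb : Y0 ∈ V
  swap
  · refine ⟨X0 ∩ X ∩ Y0ᶜ, inter_mem (inter_mem hX0 hX) (compl_umem hb),
      hR.def_inter (hR.def_inter hX0d hXd) (hR.def_compl hY0d), .inl (fun s hs => ?_)⟩
    rw [hff s hs.1.1, hnorm s hs.1.2]
    have := hs.2
    simpa [hY0] using this
  · set Y := X0 ∩ X ∩ Y0 with hY
    have hYd : Def R Y := hR.def_inter (hR.def_inter hX0d hXd) hY0d
    set η0 : S → Qp := Y.indicator ρ * θ ^ i with hη0
    set η : ℕ → S → Qp := fun j => Y.indicator (g j) * θ ^ e j with hη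
    set G : Finset (S → Qp) := insert η0 ((range l).image η) with hG
    have hη0G : η0 ∈ adjoin ℤ_[p] (↑G : Set (S → Qp)) :=
      subset_adjoin (by simp [hG])
    have hηG : ∀ j ∈ range l, η j ∈ adjoin ℤ_[p] (↑G : Set (S → Qp)) := by
      intro j hj
      exact subset_adjoin (mem_coe.2 (mem_insert_of_mem
        (Finset.mem_image_of_mem _ hj)))
    refine ⟨Y, inter_mem (inter_mem hX0 hX) hb, hYd, .inr ⟨G, ?_,
      η0 * (1 + algebraMap ℤ_[p] (S → Qp) (p : ℤ_[p]) * ∑ j ∈ range l, η j), ?_, ?_⟩⟩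
    · intro x hx
      rcases mem_insert.1 hx with rfl | hx
      · refine ⟨⟨_, hR.restrict hρ hYd, i, rfl⟩, fun s => ?_⟩
        by_cases hs : s ∈ Y
        · have := hs.2
          simpa [hη0, hs, hY0] using this
        · simp [hη0, hs]
      · obtain ⟨j, -, rfl⟩ := mem_image.1 hx
        refine ⟨⟨_, hR.restrict (hg j) hYd, e j, rfl⟩, fun s => ?_⟩
        by_cases hs : s ∈ Y
        · have := hg1 j s hs.1.2
          simpa [hη, hs] using this
        · simp [hη, hs]
    · refine Subalgebra.mul_mem _ hη0G (Subalgebra.add_mem _ (Subalgebra.one_mem _)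
        (Subalgebra.mul_mem _ (Subalgebra.algebraMap_mem _ _) (Subalgebra.sum_mem _ hηG)))
    · intro s hs
      rw [hff s hs.1.1, hfX s hs.1.2]
      have h1 : (algebraMap ℤ_[p] (S → Qp) (p : ℤ_[p])) s = p := by
        show ((p : ℤ_[p]) : Qp) = p
        simp
      simp only [mul_apply, Pi.add_apply, Pi.one_apply, h1, Finset.sum_apply, hη0, hη, pow_apply,
        indicator_of_mem hs, pow_one]

end Adjoin

/-! ### Part 9 : the ring obtained by adjoining a root is again closed -/

section Adjoin
variable {S : Type*} {R : Set (S → ℚ_[p])}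

/-- The ring obtained by adjoining `θ`. -/
def adjR (hR : PreRich R) (θ : S → Qp) (l : ℕ) : Set (S → Qp) :=
  {f | ∀ V : Ultrafilter S, LocIn R (Lin hR.alg θ l) V f}

variable (hR : PreRich R) {θ b : S → ℚ_[p]} {l : ℕ} (hl : l.Prime) (hb : b ∈ R)
  (hθ : θ ^ l = b) (hM : ∀ s, θ s ≠ 0 → θ s ∈ Pset p (rootM p))
include hR hl

lemma LocIn_of_R {V : Ultrafilter S} {f : S → Qp} (h : LocIn R R V f) :
    LocIn R (Lin hR.alg θ l) V f := by
  obtain ⟨X, hX, hXd, r, hr, h⟩ := h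
  exact ⟨X, hX, hXd, r, Lin_of_mem hl.pos hr, h⟩

lemma adjR_of_R {f : S → Qp} (h : f ∈ R) : f ∈ adjR hR θ l := fun _ =>
  LocIn_of_R hR hl ⟨Set.univ, univ_mem, hR.def_univ, f, h, fun _ _ => rfl⟩

include hb hθ

lemma adjR_theta : θ ∈ adjR hR θ l := fun _ =>
  ⟨Set.univ, univ_mem, hR.def_univ, θ, by
    have := Lin_pow (D := hR.alg) (η := θ) hl.pos (by rw [hθ]; exact hb) 1
    rwa [pow_one] at this, fun _ _ => rfl⟩

omit hb hθ in
lemma LocIn_A {V : Ultrafilter S} (hA : LocIn R R V θ) {f : S → Qp}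
    (hf : LocIn R (Lin hR.alg θ l) V f) : LocIn R R V f := by
  obtain ⟨X, hX, hXd, r, hr, h⟩ := hA
  obtain ⟨Y, hY, hYd, g, ⟨q, hq, rfl⟩, hg⟩ := hf
  refine ⟨X ∩ Y, inter_mem hX hY, hR.def_inter hXd hYd, ∑ i ∈ range l, q i * r ^ i,
    hR.sum _ _ (fun i _ => hR.mul (hq i) (hR.pow hr i)), fun s hs => ?_⟩
  rw [hg s hs.2, Finset.sum_apply, Finset.sum_apply]
  exact sum_congr rfl (fun i _ => by simp [h s hs.1])

lemma LocIn_add {V : Ultrafilter S} {f g : S → Qp}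
    (hf : LocIn R (Lin hR.alg θ l) V f) (hg : LocIn R (Lin hR.alg θ l) V g) :
    LocIn R (Lin hR.alg θ l) V (f + g) := by
  obtain ⟨X, hX, hXd, r, hr, h⟩ := hf
  obtain ⟨Y, hY, hYd, r', hr', h'⟩ := hg
  exact ⟨X ∩ Y, inter_mem hX hY, hR.def_inter hXd hYd, r + r', Lin_add hr hr', fun s hs => by
    simp [h s hs.1, h' s hs.2]⟩

lemma LocIn_mul {V : Ultrafilter S} {f g : S → Qp}
    (hf : LocIn R (Lin hR.alg θ l) V f) (hg : LocIn R (Lin hR.alg θ l) V g) :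
    LocIn R (Lin hR.alg θ l) V (f * g) := by
  obtain ⟨X, hX, hXd, r, hr, h⟩ := hf
  obtain ⟨Y, hY, hYd, r', hr', h'⟩ := hg
  exact ⟨X ∩ Y, inter_mem hX hY, hR.def_inter hXd hYd, r * r',
    Lin_mul (by rw [hθ]; exact hb) hr hr', fun s hs => by simp [h s hs.1, h' s hs.2]⟩

omit hb hθ in
lemma LocIn_congr {V : Ultrafilter S} {f g : S → Qp} {X : Set S} (hX : X ∈ V) (hXd : Def R X)
    (h : ∀ s ∈ X, g s = f s) (hf : LocIn R (Lin hR.alg θ l) V f) :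
    LocIn R (Lin hR.alg θ l) V g := by
  obtain ⟨Y, hY, hYd, r, hr, h'⟩ := hf
  exact ⟨X ∩ Y, inter_mem hX hY, hR.def_inter hXd hYd, r, hr, fun s hs => by
    rw [h s hs.1, h' s hs.2]⟩

include hM

lemma LocIn_ranal {V : Ultrafilter S} {n : ℕ} (a : (Fin n → ℕ) → Qp) (ξ : Fin n → S → Qp)
    (ha : IsRestrictedCoeffs p a) (hξ : ∀ i, LocIn R (Lin hR.alg θ l) V (ξ i)) :
    LocIn R (Lin hR.alg θ l) V (fun s => ranalFn p a (fun i => ξ i s)) := by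
  classical
  by_cases hA : LocIn R R V θ
  · have := fun i => LocIn_A hR hl hA (hξ i)
    choose X hX hXd r hr h using this
    refine LocIn_of_R hR hl ⟨{s | ∀ i ∈ (univ : Finset (Fin n)), s ∈ X i}, ?_,
      hR.def_finset _ _ (fun i _ => hXd i), _, hR.ranal a r ha hr, fun s hs => ?_⟩
    · filter_upwards [Filter.eventually_all.2 hX] with s hs i _ using hs i
    · dsimp only
      congr 1
      ext i
      exact h i s (hs i (by simp))
  · choose Y hY hYd hYor using fun i => lead_bdd hR hl hb hθ hM hA (hξ i)
    set X := {s | ∀ i ∈ (univ : Finset (Fin n)), s ∈ Y i} with hXdef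
    have hXV : X ∈ V := by
      filter_upwards [Filter.eventually_all.2 hY] with s hs i _ using hs i
    have hXd : Def R X := hR.def_finset _ _ (fun i _ => hYd i)
    by_cases hex : ∃ i, ∀ s ∈ Y i, ¬ ‖ξ i s‖ ≤ 1
    · obtain ⟨i, hi⟩ := hex
      refine ⟨X, hXV, hXd, 0, Lin_zero, fun s hs => ?_⟩
      show ranalFn p a (fun i => ξ i s) = 0
      unfold ranalFn
      rw [if_neg (fun h => hi s (hs i (by simp)) (h i))]
    · push Not at hex
      have : ∀ i, ∃ G : Finset (S → Qp), (∀ η ∈ G, (∃ r ∈ R, ∃ e : ℕ, η = r * θ ^ e) ∧ ∀ s, ‖η s‖ ≤ 1) ∧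
        ∃ h ∈ adjoin ℤ_[p] (↑G : Set (S → Qp)), ∀ s ∈ Y i, ξ i s = h s := by
        intro i
        rcases hYor i with h | h
        · obtain ⟨s, hs, hs'⟩ := hex i
          exact absurd hs' (h s hs)
        · exact h
      choose G hG h hh hξh using this
      set GG := univ.biUnion G with hGG
      obtain ⟨N, hN⟩ := restricted_scale ha
      have hG1 : ∀ η ∈ GG, (∃ r ∈ R, ∃ e : ℕ, η = r * θ ^ e) ∧ ∀ s, ‖η s‖ ≤ 1 := by
        intro η hη
        obtain ⟨i, -, hi⟩ := Finset.mem_biUnion.1 hη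
        exact hG i η hi
      have hT : (fun s => ranalFn p (fun i => ϖ ^ N * a i) (fun i => h i s)) ∈
          Tate X (adjoin ℤ_[p] (↑GG ∪ ↑(∅ : Finset (S → Qp)) : Set (S → Qp))) := by
        refine ranal_tate (bdd_adjoin ?_) _ ?_ hN _ (fun i => tate_of_mem ?_)
        · intro g hg s _
          refine (hG1 g ?_).2 s
          simpa using hg
        · unfold IsRestrictedCoeffs
          have := Filter.Tendsto.const_mul (ϖ ^ N) ha
          simpa using this
        · refine Algebra.adjoin_mono ?_ (hh i)
          intro g hg
          simp only [Finset.coe_empty, Set.union_empty, mem_coe]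
          exact Finset.mem_biUnion.2 ⟨i, by simp, hg⟩
      obtain ⟨H, hH, hHf⟩ := tate_lin hR hl hb hθ hXd GG ∅ hG1 (by simp) _ hT
      refine ⟨X, hXV, hXd, (fun _ => (ϖ ^ N)⁻¹) * H, Lin_smul (hR.const _) hH, fun s hs => ?_⟩
      have h1 : (fun i => ξ i s) = fun i => h i s := by
        ext i; exact hξh i s (hs i (by simp))
      show ranalFn p a (fun i => ξ i s) = _
      rw [mul_apply, ← hHf s hs, h1]
      have h2 : ϖ ^ N ≠ 0 := pow_ne_zero _ pK_ne
      unfold ranalFn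
      split_ifs
      · simp only [mul_assoc]
        rw [tsum_mul_left]
        field_simp
      · simp

lemma LocIn_inv {V : Ultrafilter S} {f : S → Qp} (hf : LocIn R (Lin hR.alg θ l) V f) :
    LocIn R (Lin hR.alg θ l) V f⁻¹ := by
  by_cases hA : LocIn R R V θ
  · obtain ⟨X, hX, hXd, r, hr, h⟩ := LocIn_A hR hl hA hf
    exact LocIn_of_R hR hl ⟨X, hX, hXd, r⁻¹, hR.inv hr, fun s hs => by simp [h s hs]⟩
  obtain ⟨X0, hX0, hX0d, f', hf', hff⟩ := hf
  obtain ⟨X, hX, hXd, h | ⟨i, ρ, hρ, hρ0, g, e, hg, hg1, hfX⟩⟩ := lead hR hl hb hθ hM hA hf' 1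
  · exact ⟨X0 ∩ X, inter_mem hX0 hX, hR.def_inter hX0d hXd, 0, Lin_zero, fun s hs => by
      simp [hff s hs.1, h s hs.2]⟩
  · have hbD : θ ^ l ∈ hR.alg := by rw [hθ]; exact hb
    set G : S → Qp := ∑ j ∈ range l, g j * θ ^ e j with hG
    have hGs : ∀ s, G s = ∑ j ∈ range l, g j s * θ s ^ e j := by
      intro s; rw [hG, Finset.sum_apply]; rfl
    have hGL : G ∈ Lin hR.alg θ l := Lin_sum _ _ (fun j _ => Lin_smul (hg j) (Lin_pow hl.pos hbD _))
    have h1 := LocIn_ranal hR hl hb hθ hM (V := V) (n := 1) (fun i => (-p : Qp) ^ (i 0)) (fun _ => G) (by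
      unfold IsRestrictedCoeffs
      have ht : Tendsto (fun n : ℕ => (-p : Qp) ^ n) cofinite (nhds 0) := by
        rw [Nat.cofinite_eq_atTop]
        exact tendsto_pow_atTop_nhds_zero_of_norm_lt_one (by rw [norm_neg]; exact norm_p_lt_one)
      refine ht.comp (Function.Injective.tendsto_cofinite ?_)
      intro x y hxy
      ext j
      rw [Subsingleton.elim j 0]; exact hxy)
      (fun _ => ⟨Set.univ, univ_mem, hR.def_univ, G, hGL, fun _ _ => rfl⟩)
    have h2 : LocIn R (Lin hR.alg θ l) V (ρ⁻¹ * (b⁻¹) ^ i * θ ^ (l * i - i)) :=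
      ⟨Set.univ, univ_mem, hR.def_univ, _, Lin_smul (hR.mul (hR.inv hρ) (hR.pow (hR.inv hb) i))
        (Lin_pow hl.pos hbD _), fun _ _ => rfl⟩
    refine LocIn_congr hR hl (inter_mem hX0 hX) (hR.def_inter hX0d hXd) (fun s hs => ?_)
      (LocIn_mul hR hl hb hθ h2 h1)
    obtain ⟨hρs, hθs⟩ := hρ0 s hs.2
    have hG1 : ‖G s‖ ≤ 1 := by rw [hGs]; exact norm_sum_le_one _ _ (fun j _ => hg1 j s hs.2)
    have h3 : ranalFn p (fun i : Fin 1 → ℕ => (-p : Qp) ^ (i 0)) (fun _ => G s) = (1 + p * G s)⁻¹ := by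
      unfold ranalFn
      rw [if_pos (fun _ => hG1)]
      have hn : ‖-ϖ * G s‖ < 1 := by
        rw [norm_mul, norm_neg]
        calc ‖ϖ‖ * ‖G s‖ ≤ ‖ϖ‖ * 1 := by gcongr
          _ < 1 := by rw [mul_one]; exact norm_p_lt_one
      have h4 := tsum_geometric_of_norm_lt_one hn
      have h5 : 1 + ϖ * G s = 1 - -ϖ * G s := by ring
      rw [h5, ← h4, ← (Equiv.funUnique (Fin 1) ℕ).symm.tsum_eq]
      refine tsum_congr (fun n => ?_)
      rw [mul_pow]; simp
    rw [Pi.inv_apply, hff s hs.1, hfX s hs.2, ← hGs, mul_apply, h3]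
    simp only [mul_apply, Pi.inv_apply, pow_apply, pow_one]
    rw [mul_inv, mul_inv]
    congr 1
    rw [← hθ, pow_apply, mul_assoc]
    congr 1
    have h6 : θ s ^ (l * i - i) * θ s ^ i = (θ s ^ l) ^ i := by
      rw [← pow_add, ← pow_mul]
      congr 1
      exact Nat.sub_add_cancel (Nat.le_mul_of_pos_left i hl.pos)
    have h7 : (θ s ^ l) ^ i ≠ 0 := pow_ne_zero _ (pow_ne_zero _ hθs)
    rw [inv_pow]
    field_simp
    rw [mul_comm]; exact h6.symm

lemma LocIn_ind {V : Ultrafilter S} {f : S → Qp} (hf : LocIn R (Lin hR.alg θ l) V f)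
    {k : ℕ} (hk : 0 < k) :
    LocIn R (Lin hR.alg θ l) V (indicator {s | f s ∈ Pset p k} 1) := by
  classical
  by_cases hA : LocIn R R V θ
  · obtain ⟨X, hX, hXd, r, hr, h⟩ := LocIn_A hR hl hA hf
    refine LocIn_of_R hR hl ⟨X, hX, hXd, _, hR.ind hr hk, fun s hs => ?_⟩
    simp [Set.indicator_apply, h s hs]
  obtain ⟨N, hN, hNP⟩ := near_one_Pset (p := p) k hk
  obtain ⟨X0, hX0, hX0d, f', hf', hff⟩ := hf
  obtain ⟨X, hX, hXd, h | ⟨i, ρ, hρ, hρ0, g, e, hg, hg1, hfX⟩⟩ := lead hR hl hb hθ hM hA hf' N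
  · refine ⟨X0 ∩ X, inter_mem hX0 hX, hR.def_inter hX0d hXd, 0, Lin_zero, fun s hs => ?_⟩
    rw [indicator_of_notMem]; · rfl
    intro h0
    exact Pset_ne h0 (by rw [hff s hs.1, h s hs.2])
  · obtain ⟨Y1, hY1, hY1d, μ, hμ, hY1P⟩ := hR.coset_loc V hρ
      (by filter_upwards [hX] with s hs using (hρ0 s hs).1) hk
    obtain ⟨Y2, hY2, hY2d, ν, hν, hY2P⟩ := theta_coset hR hl hb hθ hM V
      (by filter_upwards [hX] with s hs using (hρ0 s hs).2) hk
    refine ⟨(X0 ∩ X) ∩ (Y1 ∩ Y2), inter_mem (inter_mem hX0 hX) (inter_mem hY1 hY2),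
      hR.def_inter (hR.def_inter hX0d hXd) (hR.def_inter hY1d hY2d),
      fun _ => if μ * ν ^ i ∈ Pset p k then 1 else 0, Lin_of_mem hl.pos (hR.const _), fun s hs => ?_⟩
    have h1 : f s = (ρ s / μ * (θ s / ν) ^ i * (1 + p ^ N * ∑ j ∈ range l, g j s * θ s ^ e j)) *
        (μ * ν ^ i) := by
      rw [hff s hs.1.1, hfX s hs.1.2, div_pow]; field_simp
    have h2 := Pset_mul (Pset_mul (hY1P s hs.2.1) (Pset_pow (hY2P s hs.2.2) i))
      (hNP _ (norm_sum_le_one (range l) (fun j => g j s * θ s ^ e j) (fun j _ => hg1 j s hs.1.2)))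
    simp only [Set.indicator_apply, mem_ofPred_eq, Pi.one_apply]
    rw [h1, if_congr (Pset_mul_iff h2) rfl rfl]

lemma adjR_prerich : PreRich (adjR hR θ l) where
  const c := adjR_of_R hR hl (hR.const c)
  add hf hg V := LocIn_add hR hl hb hθ (hf V) (hg V)
  mul hf hg V := LocIn_mul hR hl hb hθ (hf V) (hg V)
  inv hf V := LocIn_inv hR hl hb hθ hM (hf V)
  ind hf hk V := LocIn_ind hR hl hb hθ hM (hf V) hk
  ranal a ξ ha hξ V := LocIn_ranal hR hl hb hθ hM a ξ ha (fun i => hξ i V)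

lemma adjR_val {f : S → Qp} (hf : f ∈ adjR hR θ l) (V : Ultrafilter S) :
    ∃ X ∈ V, Def R X ∧ ∃ δ ∈ R, ∀ s ∈ X, ‖f s‖ ^ l = ‖δ s‖ := by
  replace hf := hf V
  by_cases hA : LocIn R R V θ
  · obtain ⟨X, hX, hXd, r, hr, h⟩ := LocIn_A hR hl hA hf
    exact ⟨X, hX, hXd, r ^ l, hR.pow hr l, fun s hs => by rw [h s hs]; simp⟩
  obtain ⟨X0, hX0, hX0d, f', hf', hff⟩ := hf
  obtain ⟨X, hX, hXd, h | ⟨i, ρ, hρ, hρ0, g, e, hg, hg1, hfX⟩⟩ := lead hR hl hb hθ hM hA hf' 1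
  · exact ⟨X0 ∩ X, inter_mem hX0 hX, hR.def_inter hX0d hXd, 0, hR.zero, fun s hs => by
      simp [hff s hs.1, h s hs.2, hl.ne_zero]⟩
  · refine ⟨X0 ∩ X, inter_mem hX0 hX, hR.def_inter hX0d hXd, ρ ^ l * b ^ i,
      hR.mul (hR.pow hρ l) (hR.pow hb i), fun s hs => ?_⟩
    rw [hff s hs.1, hfX s hs.2, norm_mul,
      norm_one_add_p Nat.one_pos (norm_sum_le_one _ _ (fun j _ => hg1 j s hs.2)), mul_one, ← hθ, ← norm_pow]
    simp only [mul_apply, pow_apply, mul_pow, ← pow_mul]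
    rw [mul_comm l i]

end Adjoin

/-! ### Part 10 : closed rings (Zorn) -/

section RichSec
variable {S : Type*}

open Classical in
/-- The distinguished `l`-th root. -/
noncomputable def rootFn (l : ℕ) (b : S → Qp) (s : S) : Qp :=
  if h : ∃ y ∈ Pset p (rootM p), y ^ l = b s then h.choose else 0

lemma rootFn_spec {l : ℕ} {b : S → Qp} {s : S} (h : b s ∈ Pset p (l * rootM p)) :
    rootFn l b s ∈ Pset p (rootM p) ∧ rootFn l b s ^ l = b s := by
  have h' : ∃ y ∈ Pset p (rootM p), y ^ l = b s := by
    obtain ⟨z, hz, h⟩ := h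
    exact ⟨z ^ rootM p, Pset_pow_self hz, by rw [← h, ← pow_mul, mul_comm]⟩
  unfold rootFn
  rw [dif_pos h']
  exact h'.choose_spec

lemma rootFn_zero {l : ℕ} {b : S → Qp} {s : S} (h : b s ∉ Pset p (l * rootM p)) :
    rootFn l b s = 0 := by
  unfold rootFn
  rw [dif_neg]
  rintro ⟨y, ⟨z, hz, rfl⟩, h'⟩
  exact h ⟨z, hz, by rw [← h', ← pow_mul, mul_comm]⟩

/-- Closed under distinguished roots. -/
structure Rich (R : Set (S → Qp)) : Prop where
  pre : PreRich R
  root : ∀ {l : ℕ} {b}, l.Prime → b ∈ R → rootFn l b ∈ R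

/-- Valuations of `R` are controlled by `R₀`. -/
def ValOver (R₀ R : Set (S → Qp)) : Prop :=
  ∀ f ∈ R, ∀ V : Ultrafilter S, ∃ X ∈ V, Def R₀ X ∧ ∃ e : ℕ, 0 < e ∧ ∃ δ ∈ R₀, ∀ s ∈ X, ‖f s‖ ^ e = ‖δ s‖

lemma ValOver.sub {R₀ R : Set (S → Qp)} (h0 : PreRich R₀) (h : ValOver R₀ R) {X : Set S} (hX : Def R X)
    {V : Ultrafilter S} (hXV : X ∈ V) : ∃ Y ∈ V, Def R₀ Y ∧ Y ⊆ X := by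
  classical
  obtain ⟨Y, hY, hYd, e, he, δ, hδ, hf⟩ := h _ hX V
  refine ⟨Y ∩ {s | δ s ≠ 0}, ?_, h0.def_inter hYd (h0.def_ne hδ), ?_⟩
  · filter_upwards [hY, hXV] with s hs hsX
    refine ⟨hs, ?_⟩
    have := hf s hs
    simp only [Set.indicator_apply, hsX, if_true, Pi.one_apply, norm_one, one_pow] at this
    intro h0
    rw [h0, norm_zero] at this
    exact one_ne_zero this
  · rintro s ⟨hs, hs'⟩
    by_contra hsX
    have := hf s hs
    simp only [Set.indicator_apply, hsX, if_false, norm_zero] at this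
    rw [zero_pow he.ne', eq_comm, norm_eq_zero] at this
    exact hs' this

lemma exists_rich (R₀ : Set (S → Qp)) (h0 : PreRich R₀) :
    ∃ R, R₀ ⊆ R ∧ Rich R ∧ ValOver R₀ R := by
  classical
  obtain ⟨R, hR0, hmax⟩ := zorn_subset_nonempty {R | R₀ ⊆ R ∧ PreRich R ∧ ValOver R₀ R} (by
    intro c hc hchain hne
    have hdir : DirectedOn (· ⊆ ·) c := hchain.directedOn
    have hfin : ∀ G : Set (S → Qp), G.Finite → G ⊆ ⋃₀ c → ∃ R ∈ c, G ⊆ R := fun G hG hGs =>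
      hdir.exists_mem_subset_of_finite_of_subset_sUnion hne hG hGs
    refine ⟨⋃₀ c, ⟨?_, ⟨?_, ?_, ?_, ?_, ?_, ?_⟩, ?_⟩, fun s hs => Set.subset_sUnion_of_mem hs⟩
    · obtain ⟨R, hR⟩ := hne
      exact (hc hR).1.trans (Set.subset_sUnion_of_mem hR)
    · intro x
      obtain ⟨R, hR⟩ := hne
      exact ⟨R, hR, (hc hR).2.1.const x⟩
    · intro f g hf hg
      obtain ⟨R, hR, hs⟩ := hfin {f, g} (by simp) (by
        rintro h (rfl | rfl) <;> assumption)
      exact ⟨R, hR, (hc hR).2.1.add (hs (by simp)) (hs (by simp))⟩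
    · intro f g hf hg
      obtain ⟨R, hR, hs⟩ := hfin {f, g} (by simp) (by
        rintro h (rfl | rfl) <;> assumption)
      exact ⟨R, hR, (hc hR).2.1.mul (hs (by simp)) (hs (by simp))⟩
    · rintro f ⟨R, hR, hf⟩
      exact ⟨R, hR, (hc hR).2.1.inv hf⟩
    · rintro f k ⟨R, hR, hf⟩ hk
      exact ⟨R, hR, (hc hR).2.1.ind hf hk⟩
    · intro n a ξ ha hξ
      obtain ⟨R, hR, hs⟩ := hfin (Set.range ξ) (Set.finite_range ξ) (by
        rintro _ ⟨i, rfl⟩; exact hξ i)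
      exact ⟨R, hR, (hc hR).2.1.ranal a ξ ha (fun i => hs ⟨i, rfl⟩)⟩
    · rintro f ⟨R, hR, hf⟩
      exact (hc hR).2.2 f hf) R₀ ⟨subset_rfl, h0, fun f hf V =>
        ⟨Set.univ, univ_mem, h0.def_univ, 1, Nat.one_pos, f, hf, fun s _ => pow_one _⟩⟩
  obtain ⟨⟨-, hR, hV⟩, hmax⟩ := hmax
  refine ⟨R, hR0, ⟨hR, ?_⟩, hV⟩
  intro l b hl hb
  have hk : 0 < l * rootM p := Nat.mul_pos hl.pos rootM_pos
  set b' : S → Qp := indicator {s | b s ∈ Pset p (l * rootM p)} b with hb'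
  have hb'R : b' ∈ R := hR.restrict hb (hR.def_Pset hb hk)
  have hθ : rootFn l b ^ l = b' := by
    ext s
    rw [hb', Set.indicator_apply, pow_apply]
    by_cases h : b s ∈ Pset p (l * rootM p)
    · rw [(rootFn_spec h).2]; simp [h]
    · rw [rootFn_zero h]; simp [h, hl.ne_zero]
  have hM : ∀ s, rootFn l b s ≠ 0 → rootFn l b s ∈ Pset p (rootM p) := by
    intro s hs
    by_cases h : b s ∈ Pset p (l * rootM p)
    · exact (rootFn_spec h).1
    · exact absurd (rootFn_zero h) hs
  have hsub : R ⊆ adjR hR (rootFn l b) l := fun f hf => adjR_of_R hR hl hf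
  refine hmax (y := adjR hR (rootFn l b) l) ⟨hR0.trans hsub, adjR_prerich hR hl hb'R hθ hM, ?_⟩ hsub
    (adjR_theta hR hl hb'R hθ)
  intro f hf V
  obtain ⟨X, hX, hXd, δ, hδ, h⟩ := adjR_val hR hl hb'R hθ hM hf V
  obtain ⟨Y, hY, hYd, hYX⟩ := hV.sub h0 hXd hX
  obtain ⟨Z, hZ, hZd, e, he, δ', hδ', h'⟩ := hV δ hδ V
  exact ⟨Y ∩ Z, inter_mem hY hZ, h0.def_inter hYd hZd, l * e, Nat.mul_pos hl.pos he, δ', hδ', fun s hs => by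
    rw [pow_mul, h s (hYX hs.1), h' s hs.2]⟩

lemma PreRich.glue_ex {R : Set (S → Qp)} (hR : PreRich R) {ι : Type*} (Q : S → (ι → Qp) → Prop)
    (h : ∀ V : Ultrafilter S, ∃ X ∈ V, Def R X ∧ ∃ r : ι → S → Qp, (∀ i, r i ∈ R) ∧
      ∀ s ∈ X, Q s (fun i => r i s)) :
    ∃ r : ι → S → Qp, (∀ i, r i ∈ R) ∧ ∀ s, Q s (fun i => r i s) := by
  classical
  obtain ⟨F, hF, hcov⟩ := ultra_cover {X | Def R X ∧ ∃ r : ι → S → Qp, (∀ i, r i ∈ R) ∧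
      ∀ s ∈ X, Q s (fun i => r i s)} h
  have : ∃ r : ι → S → Qp, (∀ i, r i ∈ R) ∧ ∀ s, (∃ X ∈ F, s ∈ X) → Q s (fun i => r i s) := by
    clear hcov
    induction F using Finset.induction_on with
    | empty => exact ⟨fun _ => 0, fun _ => hR.zero, by simp⟩
    | insert X F _ ih =>
      obtain ⟨r, hr, hrQ⟩ := ih (fun Y hY => hF (mem_coe.2 (mem_insert_of_mem hY)))
      obtain ⟨hXd, r', hr', hrQ'⟩ := hF (mem_coe.2 (mem_insert_self X F))
      refine ⟨fun i => X.indicator (r' i) + Xᶜ.indicator (r i), fun i =>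
        hR.add (hR.restrict (hr' i) hXd) (hR.restrict (hr i) (hR.def_compl hXd)), fun s hs => ?_⟩
      by_cases hsX : s ∈ X
      · simpa [hsX] using hrQ' s hsX
      · obtain ⟨Y, hY, hsY⟩ := hs
        rcases mem_insert.1 hY with rfl | hY
        · exact absurd hsY hsX
        · simpa [hsX] using hrQ s ⟨Y, hY, hsY⟩
  obtain ⟨r, hr, hQ⟩ := this
  exact ⟨r, hr, fun s => hQ s (hcov s)⟩

lemma valuation_div {x y : Qp} (hx : x ≠ 0) (hy : y ≠ 0) :
    (x / y).valuation = x.valuation - y.valuation := by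
  rw [div_eq_mul_inv, valuation_mul hx (inv_ne_zero hy), Padic.valuation_inv]; ring

/-- Floor roots. -/
lemma Rich.floor_root {R : Set (S → Qp)} (hR : Rich R) (e : ℕ) (he : 0 < e) :
    ∀ r ∈ R, ∃ θ ∈ R, ∀ s, r s ≠ 0 → θ s ≠ 0 ∧ (θ s).valuation = (r s).valuation / (e : ℤ) := by
  classical
  induction e using Nat.recOnMul with
  | zero => omega
  | one => exact fun r hr => ⟨r, hr, fun s h => ⟨h, by simp⟩⟩
  | mul a b iha ihb =>
    intro r hr
    obtain ⟨θ1, h1, h1'⟩ := iha (Nat.pos_of_mul_pos_right he) r hr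
    obtain ⟨θ, h2, h2'⟩ := ihb (Nat.pos_of_mul_pos_left he) θ1 h1
    refine ⟨θ, h2, fun s hs => ?_⟩
    obtain ⟨h3, h4⟩ := h1' s hs
    refine ⟨(h2' s h3).1, ?_⟩
    rw [(h2' s h3).2, h4]; push_cast
    rw [Int.ediv_ediv_of_nonneg (by positivity)]
  | prime l hl =>
    intro r hr
    obtain ⟨T, hT, hTc⟩ := finite_cosets (p := p) (l * rootM p) (Nat.mul_pos hl.pos rootM_pos)
    obtain ⟨θ, hθ, h⟩ := hR.pre.glue_ex (ι := Unit) (fun s y => r s ≠ 0 → y () ≠ 0 ∧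
        (y ()).valuation = (r s).valuation / (l : ℤ)) (by
      intro V
      by_cases h0 : {s | r s ≠ 0} ∈ V
      · obtain ⟨μ, hμ, hX⟩ := ultra_finset V T (fun μ => {s | r s / μ ∈ Pset p (l * rootM p)}) (by
          filter_upwards [h0] with s hs using hTc _ hs)
        refine ⟨_, hX, hR.pre.def_coset hr μ (Nat.mul_pos hl.pos rootM_pos),
          fun _ => rootFn l (r / fun _ => μ) * (fun _ => ϖ ^ (μ.valuation / (l : ℤ))), fun _ =>
          hR.pre.mul (hR.root hl (hR.pre.div hr (hR.pre.const μ))) (hR.pre.const _), fun s hs hrs => ?_⟩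
        obtain ⟨h1, h2⟩ := rootFn_spec (b := r / fun _ => μ) (s := s) (l := l) hs
        have h3 := Pset_ne h1
        have h4 : ϖ ^ (μ.valuation / (l : ℤ)) ≠ 0 := zpow_ne_zero _ pK_ne
        refine ⟨mul_ne_zero h3 h4, ?_⟩
        have h5 : (rootFn l (r / fun _ => μ) s).valuation * l = (r s).valuation - μ.valuation := by
          rw [← valuation_div hrs (hT μ hμ)]
          have := congrArg Padic.valuation h2
          rw [valuation_pow] at this
          rw [mul_comm]; exact this
        simp only [mul_apply]
        rw [valuation_mul h3 h4, valuation_zpow, valuation_p, mul_one]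
        have h6 : (r s).valuation = μ.valuation + (rootFn l (r / fun _ => μ) s).valuation * l := by rw [h5]; ring
        rw [h6, Int.add_mul_ediv_right _ _ (by exact_mod_cast hl.ne_zero)]; ring
      · refine ⟨_, compl_umem h0, hR.pre.def_compl (hR.pre.def_ne hr),
          fun _ => 0, fun _ => hR.pre.zero, fun s hs hs' => absurd hs' hs⟩)
    exact ⟨θ (), hθ (), h⟩
end RichSec

/-! ### Part 11 : series with polynomial coefficients -/

section Noeth
open PowerSeries

lemma exists_span_range {Λ : Type*} [CommRing Λ] [IsNoetherianRing Λ] (A : ℕ → Λ) :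
    ∃ D : ℕ, ∀ c ∈ Ideal.span (Set.range A), ∃ b : ℕ → Λ, ∀ D' ≥ D,
      c = ∑ j ∈ range D', b j * A j := by
  classical
  have h1 : (Ideal.span (Set.range A)).FG := IsNoetherian.noetherian _
  obtain ⟨T, hT, hT2⟩ := (Submodule.fg_span_iff_fg_span_finset_subset (Set.range A)).1 h1
  have h2 : ∃ D, ∀ t ∈ T, ∃ j < D, A j = t := by
    choose! f hf using fun t (ht : t ∈ T) => hT ht
    refine ⟨T.sup f + 1, fun t ht => ⟨f t, Nat.lt_succ_of_le (le_sup ht), hf t ht⟩⟩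
  obtain ⟨D, hD⟩ := h2
  refine ⟨D, fun c hc => ?_⟩
  have h3 : c ∈ Submodule.span Λ (A '' ↑(range D)) := by
    have : Ideal.span (Set.range A) ≤ Submodule.span Λ (A '' ↑(range D)) := by
      unfold Ideal.span
      rw [hT2]
      refine Submodule.span_mono (fun t ht => ?_)
      obtain ⟨j, hj, rfl⟩ := hD t ht
      exact ⟨j, by simpa using hj, rfl⟩
    exact this hc
  rw [Submodule.mem_span_image_finset_iff_exists_fun] at h3
  obtain ⟨b, hb⟩ := h3
  refine ⟨fun j => if h : j ∈ range D then b ⟨j, h⟩ else 0, fun D' hD' => ?_⟩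
  have hs := Finset.sum_subset (Finset.range_mono hD')
    (f := fun j => (if h : j ∈ range D then b ⟨j, h⟩ else 0) * A j) (fun x _ hx => by
      show (dite _ _ _) * _ = _
      rw [dif_neg hx, zero_mul])
  rw [← hb]
  refine Eq.trans ?_ hs
  rw [← Finset.sum_coe_sort (range D)]
  refine sum_congr rfl (fun x _ => ?_)
  show _ = (dite _ _ _) * _
  rw [dif_pos x.2]; rfl

lemma noeth_series {Λ : Type*} [CommRing Λ] [IsNoetherianRing Λ] (A : ℕ → Λ⟦X⟧)
    (hA : ∀ k : ℕ, ∃ M : ℕ, ∀ i ≥ M, (X : Λ⟦X⟧) ^ k ∣ A i) (N : ℕ) :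
    ∃ (D : ℕ) (κ : ℕ → ℕ) (b : ℕ → ℕ → Λ⟦X⟧), Tendsto κ atTop atTop ∧
      ∀ i ≥ D, A i = X ^ (N + κ i) * ∑ j ∈ range D, b i j * A j := by
  classical
  obtain ⟨D0, hD0⟩ := exists_span_range A
  obtain ⟨k0, hk0⟩ := Ideal.exists_pow_inf_eq_pow_smul (Ideal.span {(X : Λ⟦X⟧)})
    (Ideal.span (Set.range A) : Submodule Λ⟦X⟧ Λ⟦X⟧)
  have key : ∀ i n, (X : Λ⟦X⟧) ^ (k0 + n) ∣ A i → ∃ c ∈ Ideal.span (Set.range A), A i = X ^ n * c := by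
    intro i n hd
    have h1 : A i ∈ (Ideal.span {(X : Λ⟦X⟧)} ^ (k0 + n) • ⊤ : Submodule Λ⟦X⟧ Λ⟦X⟧) ⊓
        (Ideal.span (Set.range A) : Submodule Λ⟦X⟧ Λ⟦X⟧) := by
      refine ⟨?_, Ideal.subset_span ⟨i, rfl⟩⟩
      rw [Ideal.span_singleton_pow, Ideal.smul_eq_mul, Ideal.mul_top]
      exact Ideal.mem_span_singleton.2 hd
    rw [hk0 _ (Nat.le_add_right _ _), Nat.add_sub_cancel_left, Ideal.span_singleton_pow,
      Submodule.ideal_span_singleton_smul] at h1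
    obtain ⟨c, hc, hc2⟩ := Submodule.mem_smul_pointwise_iff_exists _ _ _ |>.1 h1
    exact ⟨c, hc.2, by rw [← hc2, smul_eq_mul]⟩
  let n : ℕ → ℕ := fun i => if A i = 0 then i + (k0 + N) else (A i).order.toNat
  have hn1 : ∀ i, (X : Λ⟦X⟧) ^ (n i) ∣ A i := by
    intro i
    by_cases h : A i = 0
    · rw [h]; exact dvd_zero _
    · simp only [n, h, if_false]
      exact X_pow_order_dvd
  have hn2 : ∀ k, ∃ M, ∀ i ≥ M, k ≤ n i := by
    intro k
    obtain ⟨M, hM⟩ := hA k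
    refine ⟨max M k, fun i hi => ?_⟩
    by_cases h : A i = 0
    · simp only [n, h, if_true]; have := le_max_right M k; omega
    · simp only [n, h, if_false]
      have h1 := hM i (le_trans (le_max_left _ _) hi)
      have h2 : (k : ℕ∞) ≤ (A i).order := by
        exact le_order _ _ (fun j hj => X_pow_dvd_iff.1 h1 j (by exact_mod_cast hj))
      rw [← ENat.coe_toNat (show (A i).order ≠ ⊤ by simpa using h)] at h2
      exact_mod_cast h2
  obtain ⟨M, hM⟩ := hn2 (k0 + N)
  have h4 : ∀ i, ∃ b : ℕ → Λ⟦X⟧, i ≥ M → ∀ D' ≥ D0, A i = X ^ (N + (n i - (k0 + N))) *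
      ∑ j ∈ range D', b j * A j := by
    intro i
    by_cases hi : i ≥ M
    · obtain ⟨c, hc, hc2⟩ := key i (N + (n i - (k0 + N))) (by
        have := hM i hi
        have h5 : k0 + (N + (n i - (k0 + N))) = n i := by omega
        rw [h5]; exact hn1 i)
      obtain ⟨b, hb⟩ := hD0 c hc
      exact ⟨b, fun _ D' hD' => by rw [← hb D' hD']; exact hc2⟩
    · exact ⟨0, fun h => absurd h hi⟩
  choose b hb using h4
  refine ⟨max D0 M, fun i => n i - (k0 + N), b, ?_, fun i hi => ?_⟩
  · rw [tendsto_atTop_atTop]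
    intro k
    obtain ⟨M', hM'⟩ := hn2 (k + (k0 + N))
    exact ⟨M', fun i hi => by have := hM' i hi; omega⟩
  · exact hb i (le_trans (le_max_right _ _) hi) _ (le_max_left _ _)

end Noeth

/-! ### Part 12 : finite expansion of analytic functions -/

section Series
variable {S : Type*} {R : Set (S → ℚ_[p])}

/-- Pull back of functions along the projection. -/
def pull (p : ℕ) [Fact p.Prime] (S : Type*) :
    (S → ℚ_[p]) →ₐ[ℤ_[p]] (S × ℚ_[p] → ℚ_[p]) where
  toFun f z := f z.1
  map_one' := rfl
  map_mul' _ _ := rfl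
  map_zero' := rfl
  map_add' _ _ := rfl
  commutes' _ := rfl

noncomputable def Dg (B : Alg S) (W : Set (Fn S)) :
    Alg (S × Qp) :=
  B.map (pull p S) ⊔ adjoin ℤ_[p] W

lemma Dg_mono {B B' : Alg S} (h : B ≤ B')
    {W W' : Set (Fn S)} (hW : W ⊆ W') : Dg B W ≤ Dg B' W' :=
  sup_le_sup (Subalgebra.map_mono h) (Algebra.adjoin_mono hW)

lemma Dg_fg {B : Alg S} (h : B.FG)
    {W : Set (Fn S)} (hW : W.Finite) : (Dg B W).FG :=
  (h.map _).sup (Subalgebra.fg_def.2 ⟨W, hW, rfl⟩)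

lemma pull_mem_Dg {B : Alg S} {W : Set (Fn S)}
    {r : S → Qp} (hr : r ∈ B) : (fun z => r z.1) ∈ Dg B W :=
  (le_sup_left : _ ≤ Dg B W) ⟨r, hr, rfl⟩

lemma gen_mem_Dg {B : Alg S} {W : Set (Fn S)}
    {w : Fn S} (hw : w ∈ W) : w ∈ Dg B W :=
  (le_sup_right : _ ≤ Dg B W) (subset_adjoin hw)

/-- Induction principle for `Dg`. -/
lemma Dg_le {B : Alg S} {W : Set (Fn S)}
    {D : Alg (S × Qp)} (h1 : ∀ r ∈ B, (fun z => r z.1) ∈ D)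
    (h2 : ∀ w ∈ W, w ∈ D) : Dg B W ≤ D := by
  refine sup_le ?_ (adjoin_le h2)
  rintro _ ⟨r, hr, rfl⟩
  exact h1 r hr

lemma Dg_bdd {B : Alg S} {W : Set (Fn S)}
    {C : Set (S × Qp)} (h1 : Unif B) (h2 : ∀ w ∈ W, ∀ z ∈ C, ‖w z‖ ≤ 1) :
    Bdd C (Dg B W) := by
  let D : Alg (S × Qp) :=
    { carrier := {f | ∀ z ∈ C, ‖f z‖ ≤ 1}
      add_mem' := fun h h' z hz => norm_add_le_one (h z hz) (h' z hz)
      mul_mem' := fun h h' z hz => norm_mul_le_one (h z hz) (h' z hz)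
      algebraMap_mem' := fun c z _ => c.2 }
  have : Dg B W ≤ D := Dg_le (fun r hr z _ => h1 r hr z.1) h2
  exact fun d hd z hz => this hd z hz

lemma exists_Dg (hR : PreRich R) {W : Set (Fn S)}
    {D : Alg (S × Qp)} (hD : D ≤ Dg hR.Rc W) (hFG : D.FG) :
    ∃ B ≤ hR.Rc, B.FG ∧ D ≤ Dg B W := by
  classical
  let D' : Alg (S × Qp) :=
    { carrier := {f | ∃ B ≤ hR.Rc, B.FG ∧ f ∈ Dg B W}
      add_mem' := by
        rintro a b ⟨B, hB, hf, ha⟩ ⟨B', hB', hf', hb⟩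
        exact ⟨B ⊔ B', sup_le hB hB', hf.sup hf', add_mem (Dg_mono le_sup_left le_rfl ha)
          (Dg_mono le_sup_right le_rfl hb)⟩
      mul_mem' := by
        rintro a b ⟨B, hB, hf, ha⟩ ⟨B', hB', hf', hb⟩
        exact ⟨B ⊔ B', sup_le hB hB', hf.sup hf', mul_mem (Dg_mono le_sup_left le_rfl ha)
          (Dg_mono le_sup_right le_rfl hb)⟩
      algebraMap_mem' := fun c => ⟨⊥, bot_le, Subalgebra.fg_bot, algebraMap_mem _ c⟩ }
  have h1 : Dg hR.Rc W ≤ D' := Dg_le (fun r hr => ⟨adjoin ℤ_[p] {r},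
      adjoin_le (by simpa using hr), ⟨{r}, by simp⟩,
      pull_mem_Dg (subset_adjoin rfl)⟩)
    (fun w hw => ⟨⊥, bot_le, Subalgebra.fg_bot, gen_mem_Dg hw⟩)
  obtain ⟨G, hG⟩ := hFG
  have h2 : ∀ g : G, ∃ B ≤ hR.Rc, B.FG ∧ (g : Fn S) ∈ Dg B W := fun g =>
    h1 (hD (by rw [← hG]; exact subset_adjoin g.2))
  choose B hB hF hm using h2
  refine ⟨univ.sup B, Finset.sup_le (fun i _ => hB i), ?_, ?_⟩
  · exact Finset.sup_induction Subalgebra.fg_bot (fun _ h _ h' => h.sup h') (fun i _ => hF i)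
  · rw [← hG]
    refine adjoin_le (fun g hg => ?_)
    have h3 : B ⟨g, hg⟩ ≤ univ.sup B := le_sup (mem_univ _)
    exact Dg_mono h3 (Set.Subset.refl W) (hm ⟨g, hg⟩)

/-- Evaluation at a point. -/
noncomputable def evB (B : Alg S) (s : S) : B →+* Qp :=
  (Pi.evalRingHom (fun _ : S => Qp) s).comp (B.val : B →+* (S → Qp))

lemma evB_apply (B : Alg S) (s : S) (b : B) : evB B s b = b.1 s := rfl

lemma exists_pev {B : Alg S} {w : Fn S}
    {d : Fn S} (hd : d ∈ Dg B {w}) :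
    ∃ Q : Polynomial B, ∀ z, d z = Q.eval₂ (evB B z.1) (w z) := by
  let D' : Alg (S × Qp) :=
    { carrier := {f | ∃ Q : Polynomial B, ∀ z, f z = Q.eval₂ (evB B z.1) (w z)}
      add_mem' := by
        rintro a b ⟨Q, hQ⟩ ⟨Q', hQ'⟩
        exact ⟨Q + Q', fun z => by rw [eval₂_add, ← hQ, ← hQ']; rfl⟩
      mul_mem' := by
        rintro a b ⟨Q, hQ⟩ ⟨Q', hQ'⟩
        exact ⟨Q * Q', fun z => by rw [eval₂_mul, ← hQ, ← hQ']; rfl⟩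
      algebraMap_mem' := fun c => ⟨Polynomial.C (algebraMap _ _ c), fun z => by
        rw [eval₂_C]; rfl⟩ }
  have h1 : Dg B {w} ≤ D' := Dg_le
    (fun r hr => ⟨Polynomial.C ⟨r, hr⟩, fun z => by rw [eval₂_C]; rfl⟩)
    (fun w' hw' => ⟨Polynomial.X, fun z => by rw [eval₂_X, hw']⟩)
  exact h1 hd

lemma pev_mem {B : Alg S} {w : Fn S} (Q : Polynomial B) :
    (fun z => Q.eval₂ (evB B z.1) (w z)) ∈ Dg B {w} := by
  induction Q using Polynomial.induction_on' with
  | add P Q hP hQ =>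
    convert add_mem hP hQ using 1
    ext z; simp [eval₂_add]
  | monomial n a =>
    convert mul_mem (pull_mem_Dg (W := {w}) a.2) (pow_mem (gen_mem_Dg (B := B) (W := {w}) (w := w) rfl) n) using 1
    ext z; simp [evB_apply]

/-- value of a power series at `p`. -/
noncomputable def pval (B : Alg S) (a : PowerSeries B) (s : S) : Qp :=
  ∑' n, ϖ ^ n * (PowerSeries.coeff n a).1 s

variable {B : Subalgebra ℤ_[p] (S → ℚ_[p])}

lemma pval_hasSum (hB : Unif B) (a : PowerSeries B) (s : S) :
    HasSum (fun n => ϖ ^ n * (PowerSeries.coeff n a).1 s) (pval B a s) :=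
  (summable_pow_mul (fun n => hB _ (PowerSeries.coeff n a).2 s)).hasSum

lemma pval_norm (hB : Unif B) (a : PowerSeries B) (s : S) : ‖pval B a s‖ ≤ 1 :=
  norm_hasSum_le zero_le_one (pval_hasSum hB a s)
    (fun n => norm_mul_le_one (norm_pow_p_le_one n) (hB _ (PowerSeries.coeff n a).2 s))

lemma pval_mul (hB : Unif B) (a b : PowerSeries B) (s : S) :
    pval B (a * b) s = pval B a s * pval B b s := by
  have hs : ∀ a : PowerSeries B, Summable fun n =>
      ‖ϖ ^ n * (PowerSeries.coeff n a).1 s‖ := by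
    intro a
    refine Summable.of_nonneg_of_le (fun _ => norm_nonneg _) (fun n => ?_)
      (summable_geometric_of_lt_one (norm_nonneg ϖ) norm_p_lt_one)
    rw [norm_mul, norm_pow]
    exact mul_le_of_le_one_right (by positivity) (hB _ (PowerSeries.coeff n a).2 s)
  unfold pval
  rw [tsum_mul_tsum_eq_tsum_sum_antidiagonal_of_summable_norm (hs a) (hs b)]
  congr 1
  ext n
  rw [PowerSeries.coeff_mul]
  have : (∑ x ∈ Finset.HasAntidiagonal.antidiagonal n, PowerSeries.coeff x.1 a * PowerSeries.coeff x.2 b).1 s =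
      ∑ x ∈ Finset.HasAntidiagonal.antidiagonal n, (PowerSeries.coeff x.1 a).1 s * (PowerSeries.coeff x.2 b).1 s := by
    rw [← evB_apply, map_sum]; rfl
  rw [this, mul_sum]
  refine sum_congr rfl (fun x hx => ?_)
  rw [← Finset.HasAntidiagonal.mem_antidiagonal.1 hx, pow_add]; ring

lemma pval_add (hB : Unif B) (a b : PowerSeries B) (s : S) :
    pval B (a + b) s = pval B a s + pval B b s := by
  refine HasSum.unique (pval_hasSum hB (a + b) s) (((pval_hasSum hB a s).add
    (pval_hasSum hB b s)).congr_fun (fun n => ?_))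
  rw [map_add, ← mul_add]; rfl

lemma pval_zero (s : S) : pval B 0 s = 0 := by
  unfold pval
  simp

lemma pval_sum (hB : Unif B) (F : Finset ℕ) (a : ℕ → PowerSeries B) (s : S) :
    pval B (∑ j ∈ F, a j) s = ∑ j ∈ F, pval B (a j) s := by
  classical
  induction F using Finset.induction_on with
  | empty => simp [pval_zero]
  | insert x F hx ih => rw [sum_insert hx, sum_insert hx, pval_add hB, ih]

lemma pval_X_pow (k : ℕ) (s : S) : pval B (PowerSeries.X ^ k) s = p ^ k := by
  unfold pval
  rw [tsum_eq_single k]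
  · rw [PowerSeries.coeff_X_pow_self]; simp
  · intro n hn
    rw [PowerSeries.coeff_X_pow, if_neg hn]; simp

lemma pval_mem_tate (hB : Unif B) (a : PowerSeries B) (W : Set (Fn S))
    (C : Set (S × Qp)) : (fun z => pval B a z.1) ∈ Tate C (Dg B W) :=
  ⟨fun n => fun z => (PowerSeries.coeff n a).1 z.1, fun n => pull_mem_Dg (PowerSeries.coeff n a).2,
    fun z _ => pval_hasSum hB a z.1⟩

lemma pval_mem_Rc (hR : PreRich R) (hB : B ≤ hR.Rc) (hFG : B.FG) (a : PowerSeries B) :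
    pval B a ∈ hR.Rc := by
  obtain ⟨r, hr, h⟩ := hR.of_TA hR.def_univ (f := pval B a)
    ⟨B, hB, hFG, fun n => (PowerSeries.coeff n a).1, fun n => (PowerSeries.coeff n a).2,
      fun s _ => pval_hasSum (fun r hr => (hB hr).2) a s⟩
  rw [show pval B a = r from funext fun s => h s trivial]
  exact hr

/-- Expansion as a power series in `w`. -/
lemma pev_expand (hB : Unif B) {w : Fn S} {F : Fn S}
    (P : ℕ → Polynomial B) {z : S × Qp} (hw : ‖w z‖ ≤ 1)
    (h : HasSum (fun n => ϖ ^ n * (P n).eval₂ (evB B z.1) (w z)) (F z)) :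
    HasSum (fun i => pval B (PowerSeries.mk fun n => (P n).coeff i) z.1 * w z ^ i) (F z) := by
  have h1 : Tendsto (fun x : ℕ × ℕ => ϖ ^ x.1 * (((P x.1).coeff x.2).1 z.1 * w z ^ x.2))
      cofinite (nhds 0) := by
    refine tendsto_prod_of_fin (fun n i => ((P n).coeff i).1 z.1 * w z ^ i) (fun n i => ?_)
      (fun n => ?_)
    · exact norm_mul_le_one (hB _ ((P n).coeff i).2 _) (by rw [norm_pow]; exact pow_le_one₀ (norm_nonneg _) hw)
    · refine ((P n).support.finite_toSet).subset (fun i hi => ?_)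
      rw [mem_coe, Polynomial.mem_support_iff]
      rintro h0
      exact hi (by simp [h0])
  have h2 := hasSum_swap (F := fun n i => ϖ ^ n * (((P n).coeff i).1 z.1 * w z ^ i)) h1
  have h3 : ∑' n, ∑' i, ϖ ^ n * (((P n).coeff i).1 z.1 * w z ^ i) = F z := by
    rw [← h.tsum_eq]
    congr 1
    ext n
    rw [tsum_mul_left, Polynomial.eval₂_eq_sum, Polynomial.sum_def, tsum_eq_sum (s := (P n).support)]
    · rfl
    · intro i hi
      rw [Polynomial.notMem_support_iff.1 hi]; simp
  rw [h3] at h2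
  refine h2.congr_fun (fun i => ?_)
  unfold pval
  rw [← tsum_mul_right]
  congr 1
  ext n
  rw [PowerSeries.coeff_mk]; ring

end Series

/-! ### Part 13 : expansions, continued -/

section Series2
variable {S : Type*} {R : Set (S → ℚ_[p])} {C : Set (S × ℚ_[p])} {w : S × ℚ_[p] → ℚ_[p]}

lemma ser_of_TA (hR : PreRich R) {F : Fn S} (hF : F ∈ TA C (Dg hR.Rc {w})) :
    ∃ B ≤ hR.Rc, B.FG ∧ ∃ P : ℕ → Polynomial B, ∀ z ∈ C,
      HasSum (fun n => ϖ ^ n * (P n).eval₂ (evB B z.1) (w z)) (F z) := by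
  obtain ⟨D, hD, hFG, Q, hQ, hs⟩ := hF
  obtain ⟨B, hB, hBF, hDB⟩ := exists_Dg hR hD hFG
  choose P hP using fun n => exists_pev (hDB (hQ n))
  exact ⟨B, hB, hBF, P, fun z hz => (hs z hz).congr_fun (fun n => by rw [hP])⟩

lemma TA_of_ser (hR : PreRich R) {F : Fn S} {B : Alg S}
    (hB : B ≤ hR.Rc) (hF : B.FG) (P : ℕ → Polynomial B) (h : ∀ z ∈ C,
      HasSum (fun n => ϖ ^ n * (P n).eval₂ (evB B z.1) (w z)) (F z)) :
    F ∈ TA C (Dg hR.Rc {w}) :=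
  ⟨Dg B {w}, Dg_mono hB (Set.Subset.refl _), Dg_fg hF (Set.finite_singleton _), fun n z => _,
    fun n => pev_mem (P n), h⟩

lemma lemmaH (hR : PreRich R) (hw : ∀ z ∈ C, ‖w z‖ ≤ 1) {F : Fn S}
    (hF : F ∈ TA C (Dg hR.Rc {w})) (N : ℕ) :
    ∃ (D : ℕ) (g : ℕ → S → Qp) (E : ℕ → Fn S), (∀ j, g j ∈ hR.Rc) ∧
      (∀ j, E j ∈ TA C (Dg hR.Rc {w})) ∧
      ∀ z ∈ C, F z = ∑ j ∈ range D, g j z.1 * w z ^ j +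
        p ^ N * w z ^ D * ∑ j ∈ range D, g j z.1 * E j z := by
  classical
  obtain ⟨B, hB, hBF, P, hP⟩ := ser_of_TA hR hF
  have hB1 : Unif B := fun r hr => (hB hr).2
  haveI : IsNoetherianRing B := by
    haveI : Algebra.FiniteType ℤ_[p] B := B.fg_iff_finiteType.1 hBF
    exact Algebra.FiniteType.isNoetherianRing ℤ_[p] B
  let A : ℕ → PowerSeries B := fun i => PowerSeries.mk fun n => (P n).coeff i
  obtain ⟨D, κ, b, hκ, hb⟩ := noeth_series A (fun k => by
    refine ⟨(range k).sup (fun n => (P n).natDegree) + 1, fun i hi => ?_⟩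
    rw [PowerSeries.X_pow_dvd_iff]
    intro n hn
    rw [PowerSeries.coeff_mk]
    refine Polynomial.coeff_eq_zero_of_natDegree_lt ?_
    have := le_sup (f := fun n => (P n).natDegree) (mem_range.2 hn)
    omega) N
  have hBd : Bdd C (Dg B {w}) := Dg_bdd hB1 (by simpa using hw)
  have hT : Tendsto (fun l => ϖ ^ κ (D + l)) cofinite (nhds 0) := by
    rw [Nat.cofinite_eq_atTop]
    have h1 : Tendsto (fun l => D + l) atTop atTop := tendsto_atTop_mono (fun l => Nat.le_add_left l D) tendsto_id
    exact (tendsto_pow_atTop_nhds_zero_of_norm_lt_one norm_p_lt_one).comp (hκ.comp h1)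
  have hbd : ∀ j l z, z ∈ C → ‖pval B (b (D + l) j) z.1 * w z ^ l‖ ≤ 1 := fun j l z hz =>
    norm_mul_le_one (pval_norm hB1 _ _) (by rw [norm_pow]; exact pow_le_one₀ (norm_nonneg _) (hw z hz))
  have hsum : ∀ j z, z ∈ C → HasSum (fun l => ϖ ^ κ (D + l) *
      (pval B (b (D + l) j) z.1 * w z ^ l))
      (∑' l, ϖ ^ κ (D + l) * (pval B (b (D + l) j) z.1 * w z ^ l)) := by
    intro j z hz
    refine (summable_of_tendsto_zero ?_).hasSum
    rw [tendsto_zero_iff_norm_tendsto_zero] at hT ⊢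
    refine squeeze_zero (fun _ => norm_nonneg _) (fun l => ?_) hT
    rw [norm_mul]
    exact mul_le_of_le_one_right (norm_nonneg _) (hbd j l z hz)
  refine ⟨D, fun j => pval B (A j), fun j z => ∑' l, ϖ ^ κ (D + l) *
      (pval B (b (D + l) j) z.1 * w z ^ l), fun j => pval_mem_Rc hR hB hBF _, fun j => ?_,
      fun z hz => ?_⟩
  · refine ⟨Dg B {w}, Dg_mono hB (Set.Subset.refl _), Dg_fg hBF (Set.finite_singleton _), ?_⟩
    refine tate_sum hBd (fun l z => pval B (b (D + l) j) z.1 * w z ^ l) (fun l => ?_)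
      (fun l => ϖ ^ κ (D + l)) hT (fun l => norm_pow_p_le_one _) _ (hsum j)
    have h5 : w ^ l ∈ Dg B {w} := pow_mem (gen_mem_Dg (Set.mem_singleton w)) l
    exact tate_mul (f := fun z => pval B (b (D + l) j) z.1) (g := w ^ l) hBd
      (pval_mem_tate hB1 _ _ _) (tate_of_mem h5)
  · have h1 := pev_expand hB1 P (hw z hz) (hP z hz)
    have h2 := (hasSum_nat_add_iff' D).2 h1
    have h3 : HasSum (fun l => p ^ N * w z ^ D * ∑ j ∈ range D, pval B (A j) z.1 *
        (ϖ ^ κ (D + l) * (pval B (b (D + l) j) z.1 * w z ^ l)))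
        (p ^ N * w z ^ D * ∑ j ∈ range D, pval B (A j) z.1 *
        ∑' l, ϖ ^ κ (D + l) * (pval B (b (D + l) j) z.1 * w z ^ l)) :=
      (hasSum_sum (fun j _ => (hsum j z hz).mul_left _)).mul_left _
    have h4 := h2.unique (h3.congr_fun (fun l => ?_))
    · rw [← h4]; ring
    · show pval B (A (l + D)) z.1 * w z ^ (l + D) = _
      rw [add_comm l D, hb (D + l) (Nat.le_add_right _ _), pval_mul hB1, pval_X_pow, pval_sum hB1]
      simp_rw [pval_mul hB1]
      rw [mul_sum, mul_sum, Finset.sum_mul]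
      refine sum_congr rfl (fun j _ => ?_)
      rw [pow_add, pow_add]; ring

/-- Splitting with respect to two generators with product in the base. -/
lemma split_two (hR : PreRich R) {w' : Fn S} (hw : ∀ z ∈ C, ‖w z‖ ≤ 1)
    (hw' : ∀ z ∈ C, ‖w' z‖ ≤ 1) {r : S → Qp} (hr : r ∈ hR.Rc)
    (hww : ∀ z ∈ C, w z * w' z = r z.1) {F : Fn S}
    (hF : F ∈ TA C (Dg hR.Rc {w, w'})) :
    ∃ F₁ ∈ TA C (Dg hR.Rc {w}), ∃ F₂ ∈ TA C (Dg hR.Rc {w'}), ∀ z ∈ C, F z = F₁ z + w' z * F₂ z := by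
  obtain ⟨D, hD, hFG, Q, hQ, hs⟩ := hF
  obtain ⟨B, hB, hBF, hDB⟩ := exists_Dg hR hD hFG
  obtain ⟨B', hB', hBF', hDB', hr'⟩ : ∃ B' ≤ hR.Rc, B'.FG ∧ B ≤ B' ∧ r ∈ B' :=
    ⟨B ⊔ adjoin ℤ_[p] {r}, sup_le hB (adjoin_le (by simpa using hr)),
      hBF.sup ⟨{r}, by simp⟩, le_sup_left,
      (le_sup_right : _ ≤ B ⊔ _) (subset_adjoin rfl)⟩
  have hB1 : ∀ r ∈ B', ∀ s, ‖r s‖ ≤ 1 := fun r hr => (hB' hr).2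
  let M : Set (Fn S) := {f | ∃ a ∈ Dg B' {w}, ∃ b ∈ Dg B' {w'}, ∀ z ∈ C, f z = a z + w' z * b z}
  have hMadd : ∀ f g, f ∈ M → g ∈ M → f + g ∈ M := by
    rintro f g ⟨a, ha, b, hb, h⟩ ⟨a', ha', b', hb', h'⟩
    exact ⟨a + a', add_mem ha ha', b + b', add_mem hb hb', fun z hz => by
      simp only [Pi.add_apply, h z hz, h' z hz]; ring⟩
  have hMw : ∀ f ∈ M, (fun z => w z * f z) ∈ M := by
    rintro f ⟨a, ha, b, hb, h⟩
    obtain ⟨Qb, hQb⟩ := exists_pev hb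
    refine ⟨fun z => w z * a z + r z.1 * (Qb.coeff 0).1 z.1,
      add_mem (mul_mem (gen_mem_Dg rfl) ha) (mul_mem (pull_mem_Dg hr') (pull_mem_Dg (Qb.coeff 0).2)),
      fun z => r z.1 * Qb.divX.eval₂ (evB B' z.1) (w' z),
      mul_mem (pull_mem_Dg hr') (pev_mem _), fun z hz => ?_⟩
    dsimp only
    rw [h z hz, hQb z]
    conv_lhs => rw [← Qb.divX_mul_X_add]
    rw [eval₂_add, eval₂_mul, eval₂_X, eval₂_C, evB_apply, ← hww z hz]
    ring
  have hMw' : ∀ f ∈ M, (fun z => w' z * f z) ∈ M := by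
    rintro f ⟨a, ha, b, hb, h⟩
    obtain ⟨Qa, hQa⟩ := exists_pev ha
    refine ⟨fun z => r z.1 * Qa.divX.eval₂ (evB B' z.1) (w z),
      mul_mem (pull_mem_Dg hr') (pev_mem _),
      fun z => (Qa.coeff 0).1 z.1 + w' z * b z,
      add_mem (pull_mem_Dg (Qa.coeff 0).2) (mul_mem (gen_mem_Dg rfl) hb), fun z hz => ?_⟩
    dsimp only
    rw [h z hz, hQa z]
    conv_lhs => rw [← Qa.divX_mul_X_add]
    rw [eval₂_add, eval₂_mul, eval₂_X, eval₂_C, evB_apply, ← hww z hz]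
    ring
  have hMp0 : ∀ w0 : Fn S, (∀ f ∈ M, (fun z => w0 z * f z) ∈ M) →
      ∀ q : Polynomial B', ∀ f ∈ M, (fun z => q.eval₂ (evB B' z.1) (w0 z) * f z) ∈ M := by
    intro w0 h0 q f hf
    induction q using Polynomial.induction_on' with
    | add P Q hP hQ =>
      convert hMadd _ _ hP hQ using 1
      ext z; simp [eval₂_add, add_mul]
    | monomial n c =>
      simp only [eval₂_monomial]
      induction n with
      | zero =>
        obtain ⟨a, ha, b, hb, h⟩ := hf
        exact ⟨_, mul_mem (pull_mem_Dg c.2) ha, _, mul_mem (pull_mem_Dg c.2) hb, fun z hz => by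
          simp only [mul_apply, h z hz, evB_apply]; ring⟩
      | succ n ih =>
        convert h0 _ ih using 2
        ring
  have hMmul : ∀ f g, f ∈ M → g ∈ M → f * g ∈ M := by
    rintro f g ⟨a, ha, b, hb, h⟩ hg
    obtain ⟨q, hq⟩ := exists_pev ha
    obtain ⟨q', hq'⟩ := exists_pev hb
    obtain ⟨a', ha', b', hb', h'⟩ := hMadd _ _ (hMp0 _ hMw q g hg) (hMp0 _ hMw' (Polynomial.X * q') g hg)
    refine ⟨a', ha', b', hb', fun z hz => ?_⟩
    rw [← h' z hz]
    simp only [mul_apply, Pi.add_apply]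
    rw [h z hz, hq, hq', eval₂_mul, eval₂_X]; ring
  let M' : Alg (S × Qp) :=
    { carrier := M
      add_mem' := fun h h' => hMadd _ _ h h'
      mul_mem' := fun h h' => hMmul _ _ h h'
      algebraMap_mem' := fun c => ⟨_, algebraMap_mem _ c, 0, zero_mem _, fun z _ => by simp⟩ }
  have hM : Dg B {w, w'} ≤ M' := by
    refine Dg_le (fun r hr => ⟨_, pull_mem_Dg (hDB' hr), 0, zero_mem _, fun z _ => by simp⟩) ?_
    rintro u (rfl | rfl)
    · exact ⟨_, gen_mem_Dg rfl, 0, zero_mem _, fun z _ => by simp⟩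
    · exact ⟨0, zero_mem _, 1, one_mem _, fun z _ => by simp⟩
  choose a ha b hb hab using fun n => hM (hDB (hQ n))
  have hBd : Bdd C (Dg B' {w}) := Dg_bdd hB1 (by simpa using hw)
  have hBd' : Bdd C (Dg B' {w'}) := Dg_bdd hB1 (by simpa using hw')
  refine ⟨fun z => ∑' n, ϖ ^ n * a n z, ⟨Dg B' {w}, Dg_mono hB' (Set.Subset.refl _),
      Dg_fg hBF' (Set.finite_singleton _), a, ha, fun z hz => ?_⟩,
    fun z => ∑' n, ϖ ^ n * b n z, ⟨Dg B' {w'}, Dg_mono hB' (Set.Subset.refl _),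
      Dg_fg hBF' (Set.finite_singleton _), b, hb, fun z hz => ?_⟩, fun z hz => ?_⟩
  · exact (summable_pow_mul (fun n => hBd _ (ha n) z hz)).hasSum
  · exact (summable_pow_mul (fun n => hBd' _ (hb n) z hz)).hasSum
  · refine (hs z hz).unique (HasSum.congr_fun ((summable_pow_mul (fun n => hBd _ (ha n) z hz)).hasSum.add
      ((summable_pow_mul (fun n => hBd' _ (hb n) z hz)).hasSum.mul_left (w' z))) (fun n => ?_))
    rw [hab n z hz]; ring

end Series2

/-! ### Part 14 : Taylor expansion and solving equations -/

section Taylor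
open Polynomial in
lemma poly_taylor {Λ : Type*} [CommRing Λ] (v : Λ) (P : Λ[X]) (k : ℕ) :
    ∃ Q : Λ[X], P = ∑ j ∈ range k, C ((hasseDeriv j P).eval v) * (X - C v) ^ j +
      (X - C v) ^ k * Q := by
  induction k with
  | zero => exact ⟨P, by simp⟩
  | succ k ih =>
    obtain ⟨Q, hQ⟩ := ih
    have h1 : (hasseDeriv k P).eval v = Q.eval v := by
      have h2 := congrArg (fun P => (taylor v P).coeff k) hQ
      simp only [taylor_coeff, map_add, map_sum, taylor_mul, taylor_pow, taylor_C, taylor_X,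
        coeff_add, finset_sum_coeff, map_sub, add_sub_cancel_right, coeff_C_mul, coeff_X_pow,
        coeff_X_pow_mul'] at h2
      rw [h2, Finset.sum_eq_zero]
      · simp [taylor_coeff_zero]
      · intro i hi
        rw [if_neg (by have := mem_range.1 hi; omega), mul_zero]
    refine ⟨Q /ₘ (X - C v), ?_⟩
    rw [sum_range_succ, h1]
    have h3 := modByMonic_add_div Q (X - C v)
    rw [modByMonic_X_sub_C_eq_C_eval] at h3
    conv_lhs => rw [hQ, ← h3]
    ring

variable {S : Type*} {R : Set (S → ℚ_[p])} {C : Set (S × ℚ_[p])} {w : S × ℚ_[p] → ℚ_[p]}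

open Polynomial in
lemma hasse_map {Λ Λ' : Type*} [CommRing Λ] [CommRing Λ'] (f : Λ →+* Λ') (k : ℕ) (P : Λ[X]) :
    hasseDeriv k (P.map f) = (hasseDeriv k P).map f := by
  ext n
  rw [hasseDeriv_coeff, coeff_map, coeff_map, hasseDeriv_coeff, map_mul, map_natCast]

noncomputable def serv (B : Alg S) (P : ℕ → Polynomial B) (s : S) (y : Qp) :
    Qp := ∑' n, ϖ ^ n * (P n).eval₂ (evB B s) y

variable {B : Subalgebra ℤ_[p] (S → ℚ_[p])}

lemma pev_norm (hB : Unif B) (Q : Polynomial B) (s : S) {y : Qp} (hy : ‖y‖ ≤ 1) :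
    ‖Q.eval₂ (evB B s) y‖ ≤ 1 := by
  rw [Polynomial.eval₂_eq_sum, Polynomial.sum_def]
  exact norm_sum_le_one _ _ (fun i _ => norm_mul_le_one (hB _ (Q.coeff i).2 s)
    (by rw [norm_pow]; exact pow_le_one₀ (norm_nonneg _) hy))

lemma serv_hasSum (hB : Unif B) (P : ℕ → Polynomial B) (s : S) {y : Qp}
    (hy : ‖y‖ ≤ 1) :
    HasSum (fun n => ϖ ^ n * (P n).eval₂ (evB B s) y) (serv B P s y) :=
  (summable_pow_mul (fun n => pev_norm hB (P n) s hy)).hasSum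

lemma serv_norm (hB : Unif B) (P : ℕ → Polynomial B) (s : S) {y : Qp}
    (hy : ‖y‖ ≤ 1) : ‖serv B P s y‖ ≤ 1 :=
  norm_hasSum_le zero_le_one (serv_hasSum hB P s hy)
    (fun n => norm_mul_le_one (norm_pow_p_le_one n) (pev_norm hB (P n) s hy))

lemma serv_mem (hR : PreRich R) (hB : B ≤ hR.Rc) (hFG : B.FG) (P : ℕ → Polynomial B)
    {v : S → Qp} (hv : v ∈ hR.Rc) : (fun s => serv B P s (v s)) ∈ hR.Rc := by
  have hB1 : Unif B := fun r hr => (hB hr).2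
  have hm : ∀ n, (fun s => (P n).eval₂ (evB B s) (v s)) ∈ B ⊔ adjoin ℤ_[p] {v} := by
    intro n
    generalize P n = Q
    induction Q using Polynomial.induction_on' with
    | add P Q hP hQ =>
      convert add_mem hP hQ using 1
      ext z; simp [eval₂_add]
    | monomial n a =>
      convert mul_mem ((le_sup_left : B ≤ B ⊔ adjoin ℤ_[p] {v}) a.2)
        (pow_mem ((le_sup_right : _ ≤ B ⊔ adjoin ℤ_[p] {v})
          (subset_adjoin (Set.mem_singleton v))) n) using 1
      ext z; simp [evB_apply]
  obtain ⟨r, hr, h⟩ := hR.of_TA hR.def_univ (f := fun s => serv B P s (v s))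
    ⟨B ⊔ adjoin ℤ_[p] {v}, sup_le hB (adjoin_le (by simpa using hv)),
      hFG.sup ⟨{v}, by simp⟩, _, hm, fun s _ => serv_hasSum hB1 P s (hv.2 s)⟩
  rw [show (fun s => serv B P s (v s)) = r from funext fun s => h s trivial]
  exact hr

lemma taylor_ser (hR : PreRich R) (hB : B ≤ hR.Rc) (hFG : B.FG) (P : ℕ → Polynomial B)
    (hw : ∀ z ∈ C, ‖w z‖ ≤ 1) {v : S → Qp} (hv : v ∈ hR.Rc) (k : ℕ) :
    ∃ H ∈ TA C (Dg hR.Rc {w}), ∀ z ∈ C, serv B P z.1 (w z) = ∑ j ∈ range k,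
      serv B (fun n => Polynomial.hasseDeriv j (P n)) z.1 (v z.1) * (w z - v z.1) ^ j +
      (w z - v z.1) ^ k * H z := by
  have hB1 : Unif B := fun r hr => (hB hr).2
  obtain ⟨B', hB', hFG', hBB, hvB⟩ : ∃ B' ≤ hR.Rc, B'.FG ∧ B ≤ B' ∧ v ∈ B' :=
    ⟨B ⊔ adjoin ℤ_[p] {v}, sup_le hB (adjoin_le (by simpa using hv)),
      hFG.sup ⟨{v}, by simp⟩, le_sup_left,
      (le_sup_right : _ ≤ B ⊔ _) (subset_adjoin rfl)⟩
  have hB1' : ∀ r ∈ B', ∀ s, ‖r s‖ ≤ 1 := fun r hr => (hB' hr).2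
  let ι : B →+* B' := (Subalgebra.inclusion hBB : B →+* B')
  have hι : ∀ s, (evB B' s).comp ι = evB B s := fun s => rfl
  choose Q hQ using fun n => poly_taylor (⟨v, hvB⟩ : B') ((P n).map ι) k
  have hev : ∀ (q : Polynomial B) s y, q.eval₂ (evB B s) y = (q.map ι).eval₂ (evB B' s) y := by
    intro q s y
    rw [Polynomial.eval₂_map, hι]
  refine ⟨fun z => serv B' Q z.1 (w z), TA_of_ser hR hB' hFG' Q
    (fun z hz => serv_hasSum hB1' Q z.1 (hw z hz)), fun z hz => ?_⟩
  refine (serv_hasSum hB1 P z.1 (hw z hz)).unique (HasSum.congr_fun ((hasSum_sum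
    (fun j _ => (serv_hasSum hB1 (fun n => Polynomial.hasseDeriv j (P n)) z.1 (hv.2 z.1)).mul_right
      ((w z - v z.1) ^ j))).add
    ((serv_hasSum hB1' Q z.1 (hw z hz)).mul_left ((w z - v z.1) ^ k))) (fun n => ?_))
  rw [hev, hQ n, eval₂_add, eval₂_mul, Polynomial.eval₂_pow,
    Polynomial.eval₂_finset_sum, mul_add, mul_sum]
  simp only [eval₂_mul, Polynomial.eval₂_pow, Polynomial.eval₂_sub, eval₂_X,
    eval₂_C]
  have hvv : evB B' z.1 ⟨v, hvB⟩ = v z.1 := rfl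
  rw [hvv]
  congr 1
  · refine sum_congr rfl (fun j _ => ?_)
    rw [hasse_map, ← hvv, ← Polynomial.eval₂_at_apply, ← hev, hvv]
    ring
  · ring

lemma serv_lip (hB : Unif B) (P : ℕ → Polynomial B) (s : S) {x y : Qp}
    (hx : ‖x‖ ≤ 1) (hy : ‖y‖ ≤ 1) : ‖serv B P s x - serv B P s y‖ ≤ ‖x - y‖ := by
  refine norm_hasSum_le (norm_nonneg _) ((serv_hasSum hB P s hx).sub (serv_hasSum hB P s hy))
    (fun n => ?_)
  rw [← mul_sub, norm_mul]
  refine (mul_le_of_le_one_left (norm_nonneg _) (norm_pow_p_le_one n)).trans ?_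
  generalize P n = Q
  induction Q using Polynomial.induction_on' with
  | add P Q hP hQ =>
    rw [eval₂_add, eval₂_add, add_sub_add_comm]
    exact (IsUltrametricDist.norm_add_le_max _ _).trans (max_le hP hQ)
  | monomial n a =>
    rw [eval₂_monomial, eval₂_monomial, ← mul_sub, norm_mul]
    refine (mul_le_of_le_one_left (norm_nonneg _) (hB _ a.2 s)).trans ?_
    rw [← Commute.geom_sum₂_mul (Commute.all x y), norm_mul]
    refine mul_le_of_le_one_left (norm_nonneg _) (norm_sum_le_one _ _ (fun i _ => ?_))
    refine norm_mul_le_one ?_ ?_ <;> rw [norm_pow] <;> exact pow_le_one₀ (norm_nonneg _) ‹_›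

lemma solve_point (hB : Unif B) (P : ℕ → Polynomial B) (s : S) {η : Qp}
    (hη : ‖η‖ ≤ 1) : ∃ y, ‖y‖ ≤ 1 ∧ y = η + p * serv B P s y := by
  let T : ℤ_[p] → ℤ_[p] := fun y => ⟨η + p * serv B P s y, norm_add_le_one hη
    (norm_mul_le_one norm_p_lt_one.le (serv_norm hB P s y.2))⟩
  have hT : ContractingWith ‖ϖ‖₊ T := by
    refine ⟨by rw [← NNReal.coe_lt_coe]; exact norm_p_lt_one, LipschitzWith.of_dist_le_mul (fun x y => ?_)⟩
    rw [dist_eq_norm, dist_eq_norm, PadicInt.norm_def, PadicInt.norm_def]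
    show ‖(η + p * serv B P s x) - (η + p * serv B P s y)‖ ≤ ‖ϖ‖ * ‖((x - y : ℤ_[p]) : Qp)‖
    rw [add_sub_add_left_eq_sub, ← mul_sub, norm_mul, PadicInt.coe_sub]
    exact mul_le_mul_of_nonneg_left (serv_lip hB P s x.2 y.2) (norm_nonneg _)
  refine ⟨(hT.fixedPoint T : ℤ_[p]), (hT.fixedPoint T).2, ?_⟩
  exact congrArg Subtype.val hT.fixedPoint_isFixedPt.symm

lemma solve (hR : PreRich R) (hB : B ≤ hR.Rc) (hFG : B.FG) (P : ℕ → Polynomial B)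
    {η : S → Qp} (hη : η ∈ hR.Rc) :
    ∃ v ∈ hR.Rc, ∀ s, v s = η s + p * serv B P s (v s) := by
  have hB1 : Unif B := fun r hr => (hB hr).2
  choose c hc1 hc2 using fun s => solve_point hB1 P s (hη.2 s)
  have hFG' : (B ⊔ adjoin ℤ_[p] {η}).FG := hFG.sup ⟨{η}, by simp⟩
  have hmem : ∀ n, (fun s => (P n).eval₂ (evB B s) (c s)) ∈ adjoin ℤ_[p]
      (insert c ((B ⊔ adjoin ℤ_[p] {η} : Alg S) : Set (S → Qp))) := by
    intro n
    generalize P n = Q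
    induction Q using Polynomial.induction_on' with
    | add P Q hP hQ =>
      convert add_mem hP hQ using 1
      ext z; simp [eval₂_add]
    | monomial n a =>
      have h1 : a.1 ∈ adjoin ℤ_[p] (insert c ((B ⊔ adjoin ℤ_[p] {η} :
          Alg S) : Set (S → Qp))) :=
        subset_adjoin (.inr ((le_sup_left : B ≤ B ⊔ _) a.2))
      convert mul_mem h1 (pow_mem (subset_adjoin (Set.mem_insert c _)) n) using 1
      ext z; simp [evB_apply]
  obtain ⟨r, hr, h⟩ := hR.fixed_point hR.def_univ (c := c) (fun s _ => hc1 s)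
    (B := B ⊔ adjoin ℤ_[p] {η}) (sup_le hB (adjoin_le (by simpa using hη))) hFG' rfl
    ⟨η, (le_sup_right : _ ≤ B ⊔ _) (subset_adjoin rfl), fun s => serv B P s (c s),
      ⟨fun n s => (P n).eval₂ (evB B s) (c s), hmem, fun s _ => serv_hasSum hB1 P s (hc1 s)⟩,
      fun s _ => hc2 s⟩
  refine ⟨r, hr, fun s => ?_⟩
  rw [← h s trivial]; exact hc2 s

end Taylor

/-! ### Part 15 : cells -/

section Cells
variable {S : Type*} {R : Set (S → ℚ_[p])}

/-- (Generalised) annuli over a definable set. -/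
structure Cell (R : Set (S → Qp)) where
  X : Set S
  c : S → Qp
  a : S → Qp
  b : S → Qp
  hX : Def R X
  hc : c ∈ R
  ha : a ∈ R
  hb : b ∈ R
  hab : (∀ s ∈ X, a s ≠ 0) ∨ (∀ s ∈ X, b s ≠ 0)

namespace Cell
variable (C : Cell R)

noncomputable def x (z : S × Qp) : Qp := z.2 - C.c z.1
def set : Set (S × Qp) := {z | z.1 ∈ C.X ∧ C.x z ≠ 0 ∧ ‖C.a z.1‖ ≤ ‖C.x z‖ ∧ ‖C.b z.1 * C.x z‖ ≤ 1}
noncomputable def w (z : S × Qp) : Qp := C.b z.1 * C.x z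
noncomputable def w' (z : S × Qp) : Qp := C.a z.1 * (C.x z)⁻¹
noncomputable def A (hR : PreRich R) : Alg (S × Qp) := Dg hR.Rc {C.w, C.w'}
def T (hR : PreRich R) : Set (Fn S) := TA C.set (C.A hR)

variable {C}
lemma w_norm {z : S × Qp} (hz : z ∈ C.set) : ‖C.w z‖ ≤ 1 := hz.2.2.2

lemma w'_norm {z : S × Qp} (hz : z ∈ C.set) : ‖C.w' z‖ ≤ 1 := by
  unfold w'
  rw [norm_mul, norm_inv, ← div_eq_mul_inv]
  exact div_le_one_of_le₀ hz.2.2.1 (norm_nonneg _)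

lemma bdd (hR : PreRich R) : Bdd C.set (C.A hR) :=
  Dg_bdd (fun r hr => hr.2) (by
    rintro u (rfl | rfl) z hz
    · exact w_norm hz
    · exact w'_norm hz)

lemma T_w (hR : PreRich R) : C.w ∈ C.T hR := TA_of_mem (gen_mem_Dg (by simp))
lemma T_w' (hR : PreRich R) : C.w' ∈ C.T hR := TA_of_mem (gen_mem_Dg (by simp))
lemma T_Rc (hR : PreRich R) {r : S → Qp} (hr : r ∈ hR.Rc) : (fun z => r z.1) ∈ C.T hR :=
  TA_of_mem (pull_mem_Dg hr)
lemma T_base (hR : PreRich R) {r : S → Qp} (hr : r ∈ R) (h : ∀ s ∈ C.X, ‖r s‖ ≤ 1) :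
    (fun z => r z.1) ∈ C.T hR :=
  TA_congr (T_Rc hR (hR.restrict_Rc hr C.hX h)) (fun z hz => by simp [hz.1])
lemma T_congr {hR : PreRich R} {f g : Fn S} (hf : f ∈ C.T hR) (h : ∀ z ∈ C.set, g z = f z) :
    g ∈ C.T hR := TA_congr hf h
lemma T_add {hR : PreRich R} {f g : Fn S} (hf : f ∈ C.T hR) (hg : g ∈ C.T hR) :
    (fun z => f z + g z) ∈ C.T hR := TA_add hf hg
lemma T_mul {hR : PreRich R} {f g : Fn S} (hf : f ∈ C.T hR) (hg : g ∈ C.T hR) :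
    (fun z => f z * g z) ∈ C.T hR := TA_mul (bdd hR) hf hg
lemma T_pow {hR : PreRich R} {f : Fn S} (hf : f ∈ C.T hR) (n : ℕ) :
    (fun z => f z ^ n) ∈ C.T hR := (TAlg C.set (C.A hR) (bdd hR)).pow_mem hf n
lemma T_const (hR : PreRich R) {c : Qp} (hc : ‖c‖ ≤ 1) : (fun _ => c) ∈ C.T hR := TA_const c hc
lemma T_norm {hR : PreRich R} {f : Fn S} (hf : f ∈ C.T hR) {z} (hz : z ∈ C.set) :
    ‖f z‖ ≤ 1 := TA_bdd (bdd hR) hf hz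

/-- units close to `1` -/
def IsU (C : Cell R) (hR : PreRich R) (N : ℕ) (u : Fn S) : Prop :=
  ∃ E ∈ C.T hR, ∀ z ∈ C.set, u z = 1 + p ^ N * E z

variable {hR : PreRich R} {N : ℕ}

lemma IsU.one : C.IsU hR N (fun _ => 1) := ⟨fun _ => 0, T_const hR (by simp), fun z _ => by simp⟩

lemma IsU.mul {u u' : Fn S} (h : C.IsU hR N u) (h' : C.IsU hR N u') :
    C.IsU hR N (fun z => u z * u' z) := by
  obtain ⟨E, hE, hu⟩ := h
  obtain ⟨E', hE', hu'⟩ := h'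
  refine ⟨_, T_add (T_add hE hE') (T_mul (T_const hR (norm_pow_p_le_one N)) (T_mul hE hE')), fun z hz => ?_⟩
  show u z * u' z = _
  rw [hu z hz, hu' z hz]; ring

lemma IsU.inv (hN : 0 < N) {u : Fn S} (h : C.IsU hR N u) :
    C.IsU hR N (fun z => (u z)⁻¹) := by
  obtain ⟨E, hE, hu⟩ := h
  obtain ⟨g, hg, h⟩ := TA_inv (bdd hR) hE hN
  exact ⟨g, hg, fun z hz => by show (u z)⁻¹ = _; rw [hu z hz, h z hz]⟩

lemma IsU.pow {u : Fn S} (h : C.IsU hR N u) (n : ℕ) :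
    C.IsU hR N (fun z => u z ^ n) := by
  induction n with
  | zero => simpa using IsU.one
  | succ n ih => simp_rw [pow_succ]; exact ih.mul h

lemma IsU.zpow (hN : 0 < N) {u : Fn S} (h : C.IsU hR N u) (n : ℤ) :
    C.IsU hR N (fun z => u z ^ n) := by
  cases n with
  | ofNat n => simpa using h.pow n
  | negSucc n => simp_rw [zpow_negSucc]; exact (h.pow _).inv hN

lemma IsU.norm (hN : 0 < N) {u : Fn S} (h : C.IsU hR N u) {z} (hz : z ∈ C.set) :
    ‖u z‖ = 1 := by
  obtain ⟨E, hE, hu⟩ := h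
  rw [hu z hz]; exact norm_one_add_p hN (T_norm hE hz)

lemma IsU.mem {u : Fn S} (h : C.IsU hR N u) : u ∈ C.T hR := by
  obtain ⟨E, hE, hu⟩ := h
  exact T_congr (T_add (T_const hR (c := 1) (by simp)) (T_mul (T_const hR (norm_pow_p_le_one N)) hE)) hu

/-- prepared functions -/
def Pr (C : Cell R) (hR : PreRich R) (N : ℕ) (f : Fn S) : Prop :=
  ∃ h ∈ R, (∀ s ∈ C.X, h s ≠ 0) ∧ ∃ (ν : ℤ) (u : Fn S), C.IsU hR N u ∧
    ∀ z ∈ C.set, f z = h z.1 * C.x z ^ ν * u z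

def Prep (C : Cell R) (hR : PreRich R) (N : ℕ) (f : Fn S) : Prop :=
  (∀ z ∈ C.set, f z = 0) ∨ C.Pr hR N f

lemma Pr.mul {f g : Fn S} (hf : C.Pr hR N f) (hg : C.Pr hR N g) :
    C.Pr hR N (fun z => f z * g z) := by
  obtain ⟨h, hh, h0, ν, u, hu, e⟩ := hf
  obtain ⟨h', hh', h0', ν', u', hu', e'⟩ := hg
  refine ⟨h * h', hR.mul hh hh', fun s hs => mul_ne_zero (h0 s hs) (h0' s hs), ν + ν', _, hu.mul hu',
    fun z hz => ?_⟩
  show f z * g z = _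
  rw [e z hz, e' z hz, zpow_add₀ hz.2.1, mul_apply]; ring

lemma Pr.zpow (hN : 0 < N) {f : Fn S} (hf : C.Pr hR N f) (k : ℤ) :
    C.Pr hR N (fun z => f z ^ k) := by
  obtain ⟨h, hh, h0, ν, u, hu, e⟩ := hf
  refine ⟨h ^ k, hR.zpow hh k, fun s hs => zpow_ne_zero _ (h0 s hs), ν * k, _, hu.zpow hN k, fun z hz => ?_⟩
  show f z ^ k = _
  rw [e z hz, mul_zpow, mul_zpow, zpow_mul]; rfl

lemma Pr.base {r : S → Qp} (hr : r ∈ R) (h : ∀ s ∈ C.X, r s ≠ 0) : C.Pr hR N (fun z => r z.1) :=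
  ⟨r, hr, h, 0, _, IsU.one, fun z _ => by simp⟩

lemma Pr.congr {f g : Fn S} (hf : C.Pr hR N f) (h : ∀ z ∈ C.set, g z = f z) :
    C.Pr hR N g := by
  obtain ⟨h', hh, h0, ν, u, hu, e⟩ := hf
  exact ⟨h', hh, h0, ν, u, hu, fun z hz => by rw [h z hz, e z hz]⟩

lemma Pr.x : C.Pr hR N C.x :=
  ⟨1, hR.one, fun _ _ => one_ne_zero, 1, _, IsU.one, fun z _ => by simp⟩

lemma Pr.u {u : Fn S} (h : C.IsU hR N u) : C.Pr hR N u :=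
  ⟨1, hR.one, fun _ _ => one_ne_zero, 0, _, h, fun z _ => by simp⟩

lemma Pr.ne (hN : 0 < N) {f : Fn S} (hf : C.Pr hR N f) {z} (hz : z ∈ C.set) : f z ≠ 0 := by
  obtain ⟨h', hh, h0, ν, u, hu, e⟩ := hf
  rw [e z hz]
  refine mul_ne_zero (mul_ne_zero (h0 _ hz.1) (zpow_ne_zero _ hz.2.1)) ?_
  rw [← norm_ne_zero_iff, hu.norm hN hz]; exact one_ne_zero

/-- Restriction to a smaller cell. -/
structure Sub (C C' : Cell R) (hR : PreRich R) : Prop where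
  X : C'.X ⊆ C.X
  set : C'.set ⊆ C.set
  T : ∀ f ∈ C.T hR, f ∈ C'.T hR

structure Shrink (C C' : Cell R) : Prop where
  X : C'.X ⊆ C.X
  c : C'.c = C.c
  a : ∀ s ∈ C'.X, ‖C.a s‖ ≤ ‖C'.a s‖
  b : ∀ s ∈ C'.X, ‖C.b s‖ ≤ ‖C'.b s‖

lemma Sub.of {C C' : Cell R} (hX : C'.X ⊆ C.X) (hs : C'.set ⊆ C.set) (hw : C.w ∈ C'.T hR)
    (hw' : C.w' ∈ C'.T hR) : Sub C C' hR := by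
  refine ⟨hX, hs, fun f hf => TA_subst (bdd hR) hs (fun d hd => ?_) hf⟩
  have : C.A hR ≤ TAlg C'.set (C'.A hR) (bdd hR) := Dg_le (fun r hr => T_Rc hR hr) (by
    rintro u (rfl | rfl)
    · exact hw
    · exact hw')
  exact this hd

lemma Sub.refl (C : Cell R) : Sub C C hR := ⟨subset_rfl, subset_rfl, fun _ h => h⟩

lemma Sub.trans {C C' C'' : Cell R} (h : Sub C C' hR) (h' : Sub C' C'' hR) : Sub C C'' hR :=
  ⟨h'.X.trans h.X, h'.set.trans h.set, fun f hf => h'.T f (h.T f hf)⟩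

lemma Shrink.refl (C : Cell R) : Shrink C C := ⟨subset_rfl, rfl, fun _ _ => le_rfl, fun _ _ => le_rfl⟩

lemma Shrink.trans {C C' C'' : Cell R} (h : Shrink C C') (h' : Shrink C' C'') : Shrink C C'' :=
  ⟨h'.X.trans h.X, h'.c.trans h.c, fun s hs => (h.a s (h'.X hs)).trans (h'.a s hs),
    fun s hs => (h.b s (h'.X hs)).trans (h'.b s hs)⟩

lemma Shrink.x {C C' : Cell R} (h : Shrink C C') : C'.x = C.x := by
  unfold Cell.x; rw [h.c]

lemma norm_ratio {a b : Qp} (h : ‖a‖ ≤ ‖b‖) : ‖a / b‖ ≤ 1 := by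
  rw [norm_div]; exact div_le_one_of_le₀ h (norm_nonneg _)

lemma ratio_mul {a b : Qp} (h : ‖a‖ ≤ ‖b‖) : a / b * b = a := by
  by_cases hb : b = 0
  · have : a = 0 := by simpa [hb] using h
    simp [this]
  · exact div_mul_cancel₀ _ hb

lemma Shrink.sub {C C' : Cell R} (h : Shrink C C') : Sub C C' hR := by
  have hx := h.x
  refine Sub.of h.X ?_ ?_ ?_
  · rintro z ⟨h1, h2, h3, h4⟩
    rw [hx] at h2 h3 h4
    refine ⟨h.X h1, h2, (h.a _ h1).trans h3, le_trans ?_ h4⟩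
    rw [norm_mul, norm_mul]
    exact mul_le_mul_of_nonneg_right (h.b _ h1) (norm_nonneg _)
  · refine T_congr (T_mul (T_base hR (hR.div C.hb C'.hb) (fun s hs => norm_ratio (h.b s hs))) (T_w hR))
      (fun z hz => ?_)
    unfold w
    rw [← mul_assoc, Pi.div_apply, ratio_mul (h.b _ hz.1), hx]
  · refine T_congr (T_mul (T_base hR (hR.div C.ha C'.ha) (fun s hs => norm_ratio (h.a s hs))) (T_w' hR))
      (fun z hz => ?_)
    unfold w'
    rw [← mul_assoc, Pi.div_apply, ratio_mul (h.a _ hz.1), hx]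

lemma Sub.isU {C C' : Cell R} (h : Sub C C' hR) {u : Fn S} (hu : C.IsU hR N u) :
    C'.IsU hR N u := by
  obtain ⟨E, hE, hu⟩ := hu
  exact ⟨E, h.T E hE, fun z hz => hu z (h.set hz)⟩

/-- Extension : smaller cells with `x` prepared. -/
structure Ext (C C' : Cell R) (hR : PreRich R) (N : ℕ) : Prop extends Sub C C' hR where
  pr : C'.Pr hR N C.x

lemma Ext.prep (hN : 0 < N) {C C' : Cell R} (h : Ext C C' hR N) {f : Fn S}
    (hf : C.Pr hR N f) : C'.Pr hR N f := by
  obtain ⟨h', hh, h0, ν, u, hu, e⟩ := hf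
  exact (((Pr.base hh (fun s hs => h0 s (h.X hs))).mul (h.pr.zpow hN ν)).mul (Pr.u (h.isU hu))).congr
    (fun z hz => e z (h.set hz))

lemma Ext.prep' (hN : 0 < N) {C C' : Cell R} (h : Ext C C' hR N) {f : Fn S}
    (hf : C.Prep hR N f) : C'.Prep hR N f :=
  hf.imp (fun h1 z hz => h1 z (h.set hz)) (h.prep hN)

lemma Ext.trans (hN : 0 < N) {C C' C'' : Cell R} (h : Ext C C' hR N) (h' : Ext C' C'' hR N) :
    Ext C C'' hR N := ⟨h.toSub.trans h'.toSub, h'.prep hN h.pr⟩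

lemma Ext.refl (C : Cell R) : Ext C C hR N := ⟨Sub.refl C, Pr.x⟩

lemma Shrink.ext {C C' : Cell R} (h : Shrink C C') : Ext C C' hR N :=
  ⟨h.sub, by rw [← h.x]; exact Pr.x⟩

/-- restriction of the base -/
def res (C : Cell R) (Y : Set S) (hY : Def R Y) (hR : PreRich R) : Cell R :=
  { C with X := C.X ∩ Y, hX := hR.def_inter C.hX hY,
           hab := C.hab.imp (fun h s hs => h s hs.1) (fun h s hs => h s hs.1) }

lemma res_shrink (C : Cell R) (Y : Set S) (hY : Def R Y) : Shrink C (C.res Y hY hR) :=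
  ⟨Set.inter_subset_left, rfl, fun _ _ => le_rfl, fun _ _ => le_rfl⟩

lemma res_set (C : Cell R) (Y : Set S) (hY : Def R Y) : (C.res Y hY hR).set = C.set ∩ {z | z.1 ∈ Y} := by
  ext z
  constructor
  · rintro ⟨h1, h2⟩; exact ⟨⟨h1.1, h2⟩, h1.2⟩
  · rintro ⟨⟨h1, h2⟩, h3⟩; exact ⟨⟨h1, h3⟩, h2⟩

end Cell
end Cells

/-! ### Part 16 : monomials on cells -/

section Mono
variable {S : Type*} {R : Set (S → ℚ_[p])}

lemma norm_le_iff_val {x y : Qp} (hx : x ≠ 0) (hy : y ≠ 0) :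
    ‖x‖ ≤ ‖y‖ ↔ y.valuation ≤ x.valuation := by
  rw [Padic.norm_eq_zpow_neg_valuation hx, Padic.norm_eq_zpow_neg_valuation hy,
    zpow_le_zpow_iff_right₀ one_lt_pR]
  constructor <;> intro h <;> linarith

lemma norm_le_one_iff_val {x : Qp} (hx : x ≠ 0) : ‖x‖ ≤ 1 ↔ 0 ≤ x.valuation := by
  have := norm_le_iff_val hx (one_ne_zero : (1 : Qp) ≠ 0)
  rwa [norm_one, valuation_one] at this

lemma norm_eq_iff_val {x y : Qp} (hx : x ≠ 0) (hy : y ≠ 0) :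
    ‖x‖ = ‖y‖ ↔ x.valuation = y.valuation := by
  rw [le_antisymm_iff, norm_le_iff_val hx hy, norm_le_iff_val hy hx, le_antisymm_iff, and_comm]

lemma floor_norm {r θ x : Qp} {k : ℕ} (hk : 0 < k) (hr : r ≠ 0) (hθ : θ ≠ 0) (hx : x ≠ 0)
    (h : θ.valuation = r.valuation / (k : ℤ)) :
    (‖r * x ^ k‖ ≤ 1 ↔ ‖θ * x‖ ≤ 1) ∧ ‖r / θ ^ k‖ ≤ 1 ∧ (‖r * x ^ k‖ = 1 → ‖θ * x‖ = 1) := by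
  have hk' : (0 : ℤ) < k := by exact_mod_cast hk
  have h1 := Int.emod_add_mul_ediv r.valuation (k : ℤ)
  have h2 := Int.emod_nonneg r.valuation hk'.ne'
  have h3 := Int.emod_lt_of_pos r.valuation hk'
  rw [← h] at h1
  have e1 : (r * x ^ k).valuation = r.valuation + k * x.valuation := by
    rw [valuation_mul hr (pow_ne_zero _ hx), valuation_pow]
  have e2 : (θ * x).valuation = θ.valuation + x.valuation := valuation_mul hθ hx
  refine ⟨?_, ?_, ?_⟩
  · rw [norm_le_one_iff_val (mul_ne_zero hr (pow_ne_zero _ hx)), norm_le_one_iff_val (mul_ne_zero hθ hx),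
      e1, e2]
    constructor
    · intro h5
      by_contra h6
      have : θ.valuation + x.valuation ≤ -1 := by omega
      nlinarith
    · intro h5; nlinarith
  · rw [norm_le_one_iff_val (div_ne_zero hr (pow_ne_zero _ hθ)), valuation_div hr (pow_ne_zero _ hθ),
      valuation_pow]
    linarith
  · intro h5
    have h6 : (r * x ^ k).valuation = (1 : Qp).valuation :=
      (norm_eq_iff_val (mul_ne_zero hr (pow_ne_zero _ hx)) one_ne_zero).1 (by rw [h5, norm_one])
    rw [e1, valuation_one] at h6
    have h7 : (θ * x).valuation = (1 : Qp).valuation := by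
      rw [e2, valuation_one]
      have : (k : ℤ) * (θ.valuation + x.valuation) = - (r.valuation % k) := by linarith
      by_contra h8
      rcases lt_or_gt_of_ne h8 with h9 | h9
      · have : θ.valuation + x.valuation ≤ -1 := by omega
        nlinarith
      · have : 1 ≤ θ.valuation + x.valuation := by omega
        nlinarith
    rw [(norm_eq_iff_val (mul_ne_zero hθ hx) one_ne_zero).2 h7, norm_one]

lemma PreRich.larger (hR : PreRich R) {a b : S → Qp} (ha : a ∈ R) (hb : b ∈ R) :
    ∃ c ∈ R, ∀ s, ‖a s‖ ≤ ‖c s‖ ∧ ‖b s‖ ≤ ‖c s‖ ∧ (c s = a s ∨ c s = b s) := by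
  classical
  have hd := hR.def_le ha hb
  refine ⟨_, hR.add (hR.restrict hb hd) (hR.restrict ha (hR.def_compl hd)), fun s => ?_⟩
  by_cases h : ‖a s‖ ≤ ‖b s‖
  · have h1 : s ∈ {s | ‖a s‖ ≤ ‖b s‖} := h
    have h2 : s ∉ {s | ‖a s‖ ≤ ‖b s‖}ᶜ := fun h' => h' h1
    rw [Pi.add_apply, indicator_of_mem h1, indicator_of_notMem h2, add_zero]
    exact ⟨h, le_rfl, .inr rfl⟩
  · have h1 : s ∉ {s | ‖a s‖ ≤ ‖b s‖} := h
    have h2 : s ∈ {s | ‖a s‖ ≤ ‖b s‖}ᶜ := h1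
    rw [Pi.add_apply, indicator_of_notMem h1, indicator_of_mem h2, zero_add]
    exact ⟨le_rfl, (not_le.1 h).le, .inl rfl⟩

namespace Cell
variable {U : Ultrafilter (S × ℚ_[p])}

/-- Restriction of the base along the ultrafilter. -/
lemma exists_res (hR : PreRich R) (C : Cell R) (hC : C.set ∈ U) {Y : Set S} (hY : Def R Y)
    (h : {z : S × Qp | z.1 ∈ Y} ∈ U) : ∃ C' : Cell R, Shrink C C' ∧ C'.set ∈ U ∧ C'.X ⊆ Y :=
  ⟨C.res Y hY hR, res_shrink C Y hY, by rw [res_set]; exact inter_mem hC h, Set.inter_subset_right⟩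

lemma mono (hR : Rich R) (C : Cell R) (hC : C.set ∈ U) {r : S → Qp} (hr : r ∈ R) (k : ℤ)
    (h : {z | ‖r z.1 * C.x z ^ k‖ ≤ 1} ∈ U) :
    ∃ C' : Cell R, Shrink C C' ∧ C'.set ∈ U ∧ (fun z => r z.1 * C.x z ^ k) ∈ C'.T hR.pre := by
  have hP := hR.pre
  by_cases hr0 : {z : S × Qp | r z.1 = 0} ∈ U
  · obtain ⟨C', h1, h2, h3⟩ := C.exists_res hP hC (hP.def_eq hr hP.zero) hr0
    refine ⟨C', h1, h2, T_congr (T_const hP (c := 0) (by simp)) (fun z hz => ?_)⟩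
    have : r z.1 = 0 := h3 hz.1
    simp [this]
  have hr1 : {z : S × Qp | r z.1 ≠ 0} ∈ U := compl_umem hr0
  obtain ⟨C₁, hs1, hC1, hX1⟩ := C.exists_res hP hC (hP.def_ne hr) hr1
  suffices H : ∃ C' : Cell R, Shrink C₁ C' ∧ C'.set ∈ U ∧ (fun z => r z.1 * C.x z ^ k) ∈ C'.T hR.pre by
    obtain ⟨C', h1, h2⟩ := H
    exact ⟨C', hs1.trans h1, h2⟩
  have hx := hs1.x
  rw [← hx] at h ⊢
  clear hr0 hC
  clear hx hs1 hr1 C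
  obtain ⟨l, hk⟩ := k.eq_nat_or_neg
  rcases l.eq_zero_or_pos with rfl | hl
  · obtain rfl : k = 0 := by simpa using hk
    have h' : {z : S × Qp | z.1 ∈ {s | ‖r s‖ ≤ 1}} ∈ U := by simpa using h
    obtain ⟨C', h1, h2, h3⟩ := C₁.exists_res hP hC1 (hP.def_le_one hr) h'
    exact ⟨C', h1, h2, T_congr (T_base hP hr h3) (fun z hz => by simp)⟩
  obtain ⟨θ, hθ, hθr⟩ := hR.floor_root l hl r hr
  have h1 : (fun s => r s / θ s ^ l) ∈ R := hP.div hr (hP.pow hθ l)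
  have hrθ : ∀ s ∈ C₁.X, ‖r s / θ s ^ l‖ ≤ 1 := fun s hs =>
    (floor_norm hl (hX1 hs) (hθr _ (hX1 hs)).1 one_ne_zero (hθr _ (hX1 hs)).2).2.1
  have hne0 : ∀ {b' : S → Qp}, (∀ s, ‖θ s‖ ≤ ‖b' s‖) → ∀ s ∈ C₁.X, b' s ≠ 0 := fun hb s hs h0 => by
    have := hb s
    rw [h0, norm_zero, norm_le_zero_iff] at this
    exact (hθr s (hX1 hs)).1 this
  obtain rfl | rfl := hk
  · obtain ⟨b', hb', hbb⟩ := hP.larger C₁.hb hθ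
    have hne := hne0 (fun s => (hbb s).2.1)
    let C' : Cell R := ⟨C₁.X, C₁.c, C₁.a, b', C₁.hX, C₁.hc, C₁.ha, hb', .inr hne⟩
    refine ⟨C', ⟨subset_rfl, rfl, fun _ _ => le_rfl, fun s _ => (hbb s).1⟩, ?_, ?_⟩
    · filter_upwards [hC1, h] with z hz hz'
      refine ⟨hz.1, hz.2.1, hz.2.2.1, ?_⟩
      show ‖b' z.1 * C₁.x z‖ ≤ 1
      have h0 := hX1 hz.1
      rcases (hbb z.1).2.2 with h1 | h1
      · rw [h1]; exact hz.2.2.2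
      · rw [h1]
        rw [zpow_natCast] at hz'
        exact (floor_norm hl h0 (hθr _ h0).1 hz.2.1 (hθr _ h0).2).1.1 hz'
    · have h2 : (fun s => θ s / b' s) ∈ R := hP.div hθ hb'
      refine T_congr (T_mul (T_base hP h1 hrθ) (T_pow (T_mul (T_base hP h2 (fun s hs => ?_)) (T_w hP)) l))
        (fun z hz => ?_)
      · exact norm_ratio (hbb s).2.1
      · have hz1 : z.1 ∈ C₁.X := hz.1
        have h3 := (hθr _ (hX1 hz1)).1
        have h4 := hne _ hz1
        show r z.1 * C₁.x z ^ (l : ℤ) = r z.1 / θ z.1 ^ l * (θ z.1 / b' z.1 * (b' z.1 * C₁.x z)) ^ l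
        rw [zpow_natCast, ← mul_assoc, div_mul_cancel₀ _ h4, mul_pow]; field_simp
  · obtain ⟨b', hb', hbb⟩ := hP.larger C₁.ha hθ
    have hne := hne0 (fun s => (hbb s).2.1)
    let C' : Cell R := ⟨C₁.X, C₁.c, b', C₁.b, C₁.hX, C₁.hc, hb', C₁.hb, .inl hne⟩
    refine ⟨C', ⟨subset_rfl, rfl, fun s _ => (hbb s).1, fun _ _ => le_rfl⟩, ?_, ?_⟩
    · filter_upwards [hC1, h] with z hz hz'
      refine ⟨hz.1, hz.2.1, ?_, hz.2.2.2⟩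
      show ‖b' z.1‖ ≤ ‖C₁.x z‖
      have h0 := hX1 hz.1
      rcases (hbb z.1).2.2 with h1 | h1
      · rw [h1]; exact hz.2.2.1
      · rw [h1]
        rw [zpow_neg, zpow_natCast, ← inv_pow] at hz'
        have := (floor_norm hl h0 (hθr _ h0).1 (inv_ne_zero hz.2.1) (hθr _ h0).2).1.1 hz'
        rw [norm_mul, norm_inv, ← div_eq_mul_inv, div_le_one (norm_pos_iff.2 hz.2.1)] at this
        exact this
    · have h2 : (fun s => θ s / b' s) ∈ R := hP.div hθ hb'
      refine T_congr (T_mul (T_base hP h1 hrθ) (T_pow (T_mul (T_base hP h2 (fun s hs => ?_)) (T_w' hP)) l))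
        (fun z hz => ?_)
      · exact norm_ratio (hbb s).2.1
      · have hz1 : z.1 ∈ C₁.X := hz.1
        have h3 := (hθr _ (hX1 hz1)).1
        have h4 := hne _ hz1
        show r z.1 * C₁.x z ^ (-(l : ℤ)) = r z.1 / θ z.1 ^ l * (θ z.1 / b' z.1 * (b' z.1 * (C₁.x z)⁻¹)) ^ l
        rw [zpow_neg, zpow_natCast, ← mul_assoc, div_mul_cancel₀ _ h4, mul_pow, inv_pow]; field_simp

lemma sphere_of (hR : Rich R) (C : Cell R) (hC : C.set ∈ U) {r : S → Qp} (hr : r ∈ R) (k : ℤ) (hk : k ≠ 0)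
    (h : {z | ‖r z.1 * C.x z ^ k‖ = 1} ∈ U) :
    ∃ θ ∈ R, {z | θ z.1 ≠ 0 ∧ ‖C.x z‖ = ‖θ z.1‖} ∈ U := by
  have key : ∀ r ∈ R, ∀ l : ℕ, 0 < l → {z | ‖r z.1 * C.x z ^ l‖ = 1} ∈ U →
      ∃ θ ∈ R, {z | θ z.1 ≠ 0 ∧ ‖C.x z‖ = ‖θ z.1‖} ∈ U := by
    intro r hr l hl h
    obtain ⟨θ, hθ, hθr⟩ := hR.floor_root l hl r hr
    refine ⟨_, hR.pre.inv hθ, ?_⟩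
    filter_upwards [hC, h] with z hz hz'
    have hr0 : r z.1 ≠ 0 := by
      intro h0
      rw [h0, zero_mul, norm_zero] at hz'
      exact zero_ne_one hz'
    have h1 := (hθr _ hr0).1
    have := (floor_norm hl hr0 h1 hz.2.1 (hθr _ hr0).2).2.2 hz'
    refine ⟨inv_ne_zero h1, ?_⟩
    rw [norm_mul] at this
    rw [Pi.inv_apply, norm_inv]
    exact (inv_eq_of_mul_eq_one_right this).symm
  obtain ⟨l, rfl | rfl⟩ := k.eq_nat_or_neg
  · exact key r hr l (by omega) (by simpa using h)
  · refine key _ (hR.pre.inv hr) l (by omega) ?_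
    filter_upwards [h] with z hz
    rw [zpow_neg, zpow_natCast] at hz
    rw [Pi.inv_apply, ← inv_inv (C.x z ^ l), ← mul_inv, norm_inv, hz, inv_one]

lemma IsU.addp {C : Cell R} {hR : PreRich R} {N : ℕ} {u g : Fn S} (hu : C.IsU hR N u)
    (hg : g ∈ C.T hR) : C.IsU hR N (fun z => u z + p ^ N * g z) := by
  obtain ⟨E, hE, hu⟩ := hu
  refine ⟨_, T_add hE hg, fun z hz => ?_⟩
  show u z + _ = _
  rw [hu z hz]; ring

/-- Dominant monomial. -/
lemma dom (hR : Rich R) {N : ℕ} (m : ℤ → S → Qp) (hm : ∀ k, m k ∈ R) (E : Finset ℤ)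
    (C : Cell R) (hC : C.set ∈ U) (u : ℤ → Fn S) (hu : ∀ k ∈ E, C.IsU hR.pre N (u k)) :
    (∃ θ ∈ R, {z | θ z.1 ≠ 0 ∧ ‖C.x z‖ = ‖θ z.1‖} ∈ U) ∨
    ∃ C' : Cell R, Shrink C C' ∧ C'.set ∈ U ∧
      ((∀ z ∈ C'.set, ∑ k ∈ E, m k z.1 * C.x z ^ k * u k z = 0) ∨
        ∃ k ∈ E, (∀ s ∈ C'.X, m k s ≠ 0) ∧ ∃ v, C'.IsU hR.pre N v ∧
          ∀ z ∈ C'.set, ∑ k ∈ E, m k z.1 * C.x z ^ k * u k z = m k z.1 * C.x z ^ k * v z) := by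
  classical
  have hP := hR.pre
  by_cases hsph : ∃ θ ∈ R, {z | θ z.1 ≠ 0 ∧ ‖C.x z‖ = ‖θ z.1‖} ∈ U
  · exact .inl hsph
  right
  have hpN : ϖ ^ N ≠ 0 := pow_ne_zero _ pK_ne
  induction E using Finset.induction_on with
  | empty => exact ⟨C, Shrink.refl C, hC, .inl (fun z _ => by simp)⟩
  | insert l E hl ih =>
    obtain ⟨C₁, hs1, hC1, h1⟩ := ih (fun k hk => hu k (mem_insert_of_mem hk))
    have hul : C₁.IsU hP N (u l) := hs1.sub.isU (hu l (mem_insert_self _ _))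
    by_cases hml : {z : S × Qp | m l z.1 = 0} ∈ U
    · obtain ⟨C₂, hs2, hC2, hX2⟩ := C₁.exists_res hP hC1 (hP.def_eq (hm l) hP.zero) hml
      have hz0 : ∀ z ∈ C₂.set, m l z.1 = 0 := fun z hz => hX2 hz.1
      refine ⟨C₂, hs1.trans hs2, hC2, ?_⟩
      rcases h1 with h1 | ⟨k, hk, hk0, v, hv, h1⟩
      · left
        intro z hz
        rw [sum_insert hl, hz0 z hz, h1 z ((hs2.sub (hR := hP)).set hz)]; ring
      · right
        refine ⟨k, mem_insert_of_mem hk, fun s hs => hk0 s (hs2.X hs), v, hs2.sub.isU hv, fun z hz => ?_⟩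
        rw [sum_insert hl, hz0 z hz, h1 z ((hs2.sub (hR := hP)).set hz)]; ring
    have hml' : {z : S × Qp | m l z.1 ≠ 0} ∈ U := compl_umem hml
    obtain ⟨C₂, hs2, hC2, hX2⟩ := C₁.exists_res hP hC1 (hP.def_ne (hm l)) hml'
    have hsub2 := hs2.sub (hR := hP)
    rcases h1 with h1 | ⟨k, hk, hk0, v, hv, h1⟩
    · refine ⟨C₂, hs1.trans hs2, hC2, .inr ⟨l, mem_insert_self _ _, hX2, u l, hsub2.isU hul, fun z hz => ?_⟩⟩
      rw [sum_insert hl, h1 z (hsub2.set hz), add_zero]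
    have hkl : k ≠ l := fun h => hl (h ▸ hk)
    have hul2 := hsub2.isU hul
    have hv2 := hsub2.isU hv
    have hxx : C₂.x = C.x := (hs1.trans hs2).x
    have comb : ∀ i j : ℤ, (∀ s ∈ C₂.X, m i s ≠ 0) → ∀ vi vj : Fn S, C₂.IsU hP N vi →
        C₂.IsU hP N vj → {z | ‖(ϖ ^ N)⁻¹ * m j z.1 / m i z.1 * C₂.x z ^ (j - i)‖ ≤ 1} ∈ U →
        ∃ C' : Cell R, Shrink C₂ C' ∧ C'.set ∈ U ∧ ∃ v, C'.IsU hP N v ∧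
          ∀ z ∈ C'.set, m i z.1 * C.x z ^ i * vi z + m j z.1 * C.x z ^ j * vj z = m i z.1 * C.x z ^ i * v z := by
      intro i j hi vi vj hvi hvj h
      obtain ⟨C', h1, h2, h3⟩ := C₂.mono hR hC2 (r := fun s => (ϖ ^ N)⁻¹ * m j s / m i s)
        (hP.div (hP.mul (hP.const _) (hm j)) (hm i)) (j - i) h
      have hsub := h1.sub (hR := hP)
      refine ⟨C', h1, h2, _, (hsub.isU hvi).addp (T_mul h3 (hsub.isU hvj).mem), fun z hz => ?_⟩
      have hz2 := hsub.set hz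
      have hx0 := hz2.2.1
      have hi0 := hi _ hz2.1
      rw [← hxx, zpow_sub₀ hx0]
      have := zpow_ne_zero i hx0
      field_simp
    by_cases hc1 : {z | ‖(ϖ ^ N)⁻¹ * m l z.1 / m k z.1 * C₂.x z ^ (l - k)‖ ≤ 1} ∈ U
    · obtain ⟨C', h2, h3, v', hv', h4⟩ := comb k l (fun s hs => hk0 s (hs2.X hs)) v (u l) hv2 hul2 hc1
      refine ⟨C', (hs1.trans hs2).trans h2, h3, .inr ⟨k, mem_insert_of_mem hk,
        fun s hs => hk0 s (hs2.X (h2.X hs)), v', hv', fun z hz => ?_⟩⟩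
      rw [sum_insert hl, h1 z (hsub2.set ((h2.sub (hR := hP)).set hz)), add_comm]
      exact h4 z hz
    by_cases hc2 : {z | ‖(ϖ ^ N)⁻¹ * m k z.1 / m l z.1 * C₂.x z ^ (k - l)‖ ≤ 1} ∈ U
    · obtain ⟨C', h2, h3, v', hv', h4⟩ := comb l k hX2 (u l) v hul2 hv2 hc2
      refine ⟨C', (hs1.trans hs2).trans h2, h3, .inr ⟨l, mem_insert_self _ _,
        fun s hs => hX2 (h2.X hs), v', hv', fun z hz => ?_⟩⟩
      rw [sum_insert hl, h1 z (hsub2.set ((h2.sub (hR := hP)).set hz))]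
      exact h4 z hz
    exfalso
    apply hsph
    have hc1' := compl_umem hc1
    have hc2' := compl_umem hc2
    obtain ⟨j, -, hj⟩ := ultra_finset U (Finset.Icc (-(N : ℤ)) N)
      (fun j => {z | ‖ϖ ^ (-j) * m l z.1 / m k z.1 * C₂.x z ^ (l - k)‖ = 1}) (by
        filter_upwards [hC2, hc1', hc2'] with z hz h1 h2
        have hx0 := hz.2.1
        have hl0 : m l z.1 ≠ 0 := hX2 hz.1
        have hk0' : m k z.1 ≠ 0 := hk0 _ (hs2.X hz.1)
        set y := m l z.1 / m k z.1 * C₂.x z ^ (l - k) with hy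
        have hy0 : y ≠ 0 := mul_ne_zero (div_ne_zero hl0 hk0') (zpow_ne_zero _ hx0)
        have e1 : (ϖ ^ N)⁻¹ * m l z.1 / m k z.1 * C₂.x z ^ (l - k) = y * ϖ ^ (-(N : ℤ)) := by
          rw [hy, zpow_neg, zpow_natCast]; ring
        have e2 : (ϖ ^ N)⁻¹ * m k z.1 / m l z.1 * C₂.x z ^ (k - l) = y⁻¹ * ϖ ^ (-(N : ℤ)) := by
          rw [hy, zpow_neg, zpow_natCast, mul_inv, inv_div, ← zpow_neg, neg_sub]; ring
        have vp : ∀ i : ℤ, (ϖ ^ i).valuation = i := fun i => by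
          rw [valuation_zpow, valuation_p, mul_one]
        have hp0 : ∀ i : ℤ, ϖ ^ i ≠ 0 := fun i => zpow_ne_zero _ pK_ne
        rw [Set.mem_compl_iff, mem_ofPred_eq, e1, norm_le_one_iff_val (mul_ne_zero hy0 (hp0 _)),
          valuation_mul hy0 (hp0 _), vp] at h1
        rw [Set.mem_compl_iff, mem_ofPred_eq, e2, norm_le_one_iff_val (mul_ne_zero (inv_ne_zero hy0) (hp0 _)),
          valuation_mul (inv_ne_zero hy0) (hp0 _), Padic.valuation_inv, vp] at h2
        refine ⟨y.valuation, Finset.mem_Icc.2 ⟨by omega, by omega⟩, ?_⟩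
        have e3 : ϖ ^ (-y.valuation) * m l z.1 / m k z.1 * C₂.x z ^ (l - k) = y * ϖ ^ (-y.valuation) := by
          rw [hy]; ring
        rw [e3, ← norm_one (α := Qp), norm_eq_iff_val (mul_ne_zero hy0 (hp0 _)) one_ne_zero,
          valuation_mul hy0 (hp0 _), vp, valuation_one]
        omega)
    have := C₂.sphere_of hR hC2 (r := fun s => ϖ ^ (-j) * m l s / m k s)
      (hP.div (hP.mul (hP.const _) (hm l)) (hm k)) (l - k) (sub_ne_zero.2 hkl.symm) hj
    rwa [hxx] at this

/-- extension to a cell on which `x` is prepared -/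
lemma toExt (hR : Rich R) {N : ℕ} (C C' : Cell R) (hC : C.set ∈ U) (hC' : C'.set ∈ U)
    (hpr : C'.Pr hR.pre N C.x) (hN : 0 < N) : ∃ C'' : Cell R, Shrink C' C'' ∧ C''.set ∈ U ∧ Ext C C'' hR.pre N := by
  have hP := hR.pre
  obtain ⟨h, hh, h0, ν, u, hu, e⟩ := hpr
  obtain ⟨C₁, s1, m1, X1⟩ := C'.exists_res hP hC' C.hX (by filter_upwards [hC] with z hz using hz.1)
  have s1' := s1.sub (hR := hP)
  have e1 : ∀ z ∈ C₁.set, C.x z = h z.1 * C₁.x z ^ ν * u z := fun z hz => by rw [s1.x]; exact e z (s1'.set hz)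
  have hu1 := s1'.isU hu
  obtain ⟨C₂, s2, m2, t2⟩ := C₁.mono hR m1 (r := fun s => C.b s * h s) (hP.mul C.hb hh) ν (by
    filter_upwards [hC, m1] with z hz hz1
    have := hz.2.2.2
    rw [e1 z hz1] at this
    calc _ = ‖C.b z.1 * h z.1 * C₁.x z ^ ν‖ * ‖u z‖ := by rw [hu1.norm hN hz1, mul_one]
      _ = ‖C.b z.1 * (h z.1 * C₁.x z ^ ν * u z)‖ := by rw [← norm_mul]; congr 1; ring
      _ ≤ 1 := this)
  have s2' := s2.sub (hR := hP)
  obtain ⟨C₃, s3, m3, t3⟩ := C₂.mono hR m2 (r := fun s => C.a s * (h s)⁻¹) (hP.mul C.ha (hP.inv hh)) (-ν) (by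
    filter_upwards [hC, m1] with z hz hz1
    have h2 := w'_norm hz
    unfold w' at h2
    rw [e1 z hz1] at h2
    rw [s2.x]
    calc _ = ‖C.a z.1 * (h z.1)⁻¹ * C₁.x z ^ (-ν)‖ * ‖u z‖⁻¹ := by rw [hu1.norm hN hz1, inv_one, mul_one]
      _ = ‖C.a z.1 * (h z.1 * C₁.x z ^ ν * u z)⁻¹‖ := by
          rw [← norm_inv, ← norm_mul]; congr 1; rw [mul_inv, mul_inv, zpow_neg]; ring
      _ ≤ 1 := h2)
  have s3' := s3.sub (hR := hP)
  have s13 := s2'.trans s3'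
  have hu3 := s13.isU hu1
  have hX : C₃.X ⊆ C.X := fun s hs => X1 (s13.X hs)
  have hw : C.w ∈ C₃.T hP := by
    refine T_congr (T_mul (s3'.T _ t2) hu3.mem) (fun z hz => ?_)
    unfold w; rw [e1 z (s13.set hz)]; ring
  have hw' : C.w' ∈ C₃.T hP := by
    refine T_congr (T_mul t3 (hu3.inv hN).mem) (fun z hz => ?_)
    unfold w'; rw [e1 z (s13.set hz), mul_inv, mul_inv, s2.x, zpow_neg]; ring
  have hset : C₃.set ⊆ C.set := by
    intro z hz
    have hz1 := s13.set hz
    have hx : C.x z ≠ 0 := by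
      rw [e1 z hz1]
      refine mul_ne_zero (mul_ne_zero (h0 _ (s1'.X hz1.1)) (zpow_ne_zero _ hz1.2.1)) ?_
      rw [← norm_ne_zero_iff, hu1.norm hN hz1]; exact one_ne_zero
    refine ⟨hX hz.1, hx, ?_, T_norm hw hz⟩
    have := T_norm hw' hz
    unfold w' at this
    rwa [norm_mul, norm_inv, ← div_eq_mul_inv, div_le_one (norm_pos_iff.2 hx)] at this
  refine ⟨C₃, (s1.trans s2).trans s3, m3, Sub.of hX hset hw hw', ?_⟩
  refine ⟨h, hh, fun s hs => h0 s (s1'.X (s13.X hs)), ν, u, hu3, fun z hz => ?_⟩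
  rw [e1 z (s13.set hz), (s2.trans s3).x]

end Cell
end Mono

/-! ### Part 17 : balls -/

section Balls
variable {S : Type*} {R : Set (S → ℚ_[p])}

/-- Families of closed balls. -/
structure Ball (R : Set (S → Qp)) where
  X : Set S
  γ : S → Qp
  ρ : S → Qp
  hX : Def R X
  hγ : γ ∈ R
  hρ : ρ ∈ R
  hρ0 : ∀ s ∈ X, ρ s ≠ 0

namespace Ball

def set (β : Ball R) : Set (S × Qp) := {z | z.1 ∈ β.X ∧ ‖z.2 - β.γ z.1‖ ≤ ‖β.ρ z.1‖}
noncomputable def w (β : Ball R) (z : S × Qp) : Qp := (z.2 - β.γ z.1) / β.ρ z.1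
def T (β : Ball R) (hR : PreRich R) : Set (Fn S) := TA β.set (Dg hR.Rc {β.w})

variable {β : Ball R} {hR : PreRich R}

lemma w_norm {z : S × Qp} (hz : z ∈ β.set) : ‖β.w z‖ ≤ 1 := Cell.norm_ratio hz.2

lemma w_mul {z : S × Qp} (hz : z ∈ β.set) : z.2 - β.γ z.1 = β.ρ z.1 * β.w z := by
  unfold w; rw [mul_div_cancel₀ _ (β.hρ0 _ hz.1)]

lemma bdd (hR : PreRich R) : Bdd β.set (Dg hR.Rc {β.w}) :=
  Dg_bdd (fun r hr => hr.2) (by rintro u rfl z hz; exact w_norm hz)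

lemma T_w (hR : PreRich R) : β.w ∈ β.T hR := TA_of_mem (gen_mem_Dg (by simp))
lemma T_base (hR : PreRich R) {r : S → Qp} (hr : r ∈ R) (h : ∀ s ∈ β.X, ‖r s‖ ≤ 1) :
    (fun z => r z.1) ∈ β.T hR :=
  TA_congr (TA_of_mem (pull_mem_Dg (hR.restrict_Rc hr β.hX h))) (fun z hz => by simp [hz.1])
lemma T_congr {f g : Fn S} (hf : f ∈ β.T hR) (h : ∀ z ∈ β.set, g z = f z) :
    g ∈ β.T hR := TA_congr hf h
lemma T_add {f g : Fn S} (hf : f ∈ β.T hR) (hg : g ∈ β.T hR) :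
    (fun z => f z + g z) ∈ β.T hR := TA_add hf hg
lemma T_mul {f g : Fn S} (hf : f ∈ β.T hR) (hg : g ∈ β.T hR) :
    (fun z => f z * g z) ∈ β.T hR := TA_mul (bdd hR) hf hg
lemma T_pow {f : Fn S} (hf : f ∈ β.T hR) (n : ℕ) :
    (fun z => f z ^ n) ∈ β.T hR := (TAlg β.set (Dg hR.Rc {β.w}) (bdd hR)).pow_mem hf n
lemma T_const (hR : PreRich R) {c : Qp} (hc : ‖c‖ ≤ 1) : (fun _ => c) ∈ β.T hR := TA_const c hc
lemma T_norm {f : Fn S} (hf : f ∈ β.T hR) {z} (hz : z ∈ β.set) : ‖f z‖ ≤ 1 :=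
  TA_bdd (bdd hR) hf hz
lemma T_sum {ι : Type*} (F : Finset ι) (f : ι → Fn S) (hf : ∀ i ∈ F, f i ∈ β.T hR) :
    (fun z => ∑ i ∈ F, f i z) ∈ β.T hR := by
  have := (TAlg β.set (Dg hR.Rc {β.w}) (bdd hR)).sum_mem hf
  have e : (fun z => ∑ i ∈ F, f i z) = ∑ i ∈ F, f i := by ext z; simp
  rw [e]; exact this

/-- sub-balls -/
noncomputable def sub (β : Ball R) (hR : PreRich R) {Y : Set S} (hY : Def R Y) {v σ : S → Qp} (hv : v ∈ R) (hσ : σ ∈ R)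
    (hσ0 : ∀ s ∈ β.X ∩ Y, σ s ≠ 0) : Ball R where
  X := β.X ∩ Y
  γ := β.γ + β.ρ * v
  ρ := β.ρ * σ
  hX := hR.def_inter β.hX hY
  hγ := hR.add β.hγ (hR.mul β.hρ hv)
  hρ := hR.mul β.hρ hσ
  hρ0 := fun s hs => mul_ne_zero (β.hρ0 s hs.1) (hσ0 s hs)

section Sub
variable {Y : Set S} {hY : Def R Y} {v σ : S → ℚ_[p]} {hv : v ∈ R} {hσ : σ ∈ R} {hσ0 : ∀ s ∈ β.X ∩ Y, σ s ≠ 0}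

lemma sub_w {z : S × Qp} (hz : z ∈ (β.sub hR hY hv hσ hσ0).set) :
    β.w z - v z.1 = σ z.1 * (β.sub hR hY hv hσ hσ0).w z := by
  have h1 := β.hρ0 _ hz.1.1
  have h2 := hσ0 _ hz.1
  show (z.2 - β.γ z.1) / β.ρ z.1 - v z.1 = σ z.1 * ((z.2 - (β.γ z.1 + β.ρ z.1 * v z.1)) / (β.ρ z.1 * σ z.1))
  field_simp; ring

lemma sub_set (hv1 : ∀ s ∈ β.X ∩ Y, ‖v s‖ ≤ 1) (hσ1 : ∀ s ∈ β.X ∩ Y, ‖σ s‖ ≤ 1) :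
    (β.sub hR hY hv hσ hσ0).set ⊆ β.set := by
  intro z hz
  have h1 : β.w z = v z.1 + σ z.1 * (β.sub hR hY hv hσ hσ0).w z := by rw [← sub_w hz]; ring
  have h2 : ‖β.w z‖ ≤ 1 := by
    rw [h1]; exact norm_add_le_one (hv1 _ hz.1) (norm_mul_le_one (hσ1 _ hz.1) (w_norm hz))
  refine ⟨hz.1.1, ?_⟩
  unfold w at h2
  rwa [norm_div, div_le_one (norm_pos_iff.2 (β.hρ0 _ hz.1.1))] at h2

lemma mem_sub {z : S × Qp} (hz : z ∈ β.set) (hzY : z.1 ∈ Y) (h : ‖β.w z - v z.1‖ ≤ ‖σ z.1‖) :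
    z ∈ (β.sub hR hY hv hσ hσ0).set := by
  refine ⟨⟨hz.1, hzY⟩, ?_⟩
  show ‖z.2 - (β.γ z.1 + β.ρ z.1 * v z.1)‖ ≤ ‖β.ρ z.1 * σ z.1‖
  rw [← sub_sub, w_mul hz, ← mul_sub, norm_mul, norm_mul]
  exact mul_le_mul_of_nonneg_left h (norm_nonneg _)

lemma sub_T (hv1 : ∀ s ∈ β.X ∩ Y, ‖v s‖ ≤ 1) (hσ1 : ∀ s ∈ β.X ∩ Y, ‖σ s‖ ≤ 1)
    {f : Fn S} (hf : f ∈ β.T hR) : f ∈ (β.sub hR hY hv hσ hσ0).T hR := by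
  refine TA_subst (bdd hR) (sub_set hv1 hσ1) (fun d hd => ?_) hf
  have : Dg hR.Rc {β.w} ≤ TAlg (β.sub hR hY hv hσ hσ0).set (Dg hR.Rc {(β.sub hR hY hv hσ hσ0).w}) (bdd hR) :=
    Dg_le (fun r hr => TA_of_mem (pull_mem_Dg hr)) (by
      rintro _ rfl
      refine T_congr (T_add (T_base hR hv hv1) (T_mul (T_base hR hσ hσ1) (T_w hR))) (fun z hz => ?_)
      rw [← sub_w hz]; ring)
  exact this hd
end Sub

/-- normal forms on balls -/
structure Form (β : Ball R) (hR : PreRich R) (d M : ℕ) (F : Fn S) (r : S → Qp)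
    (q : ℕ → S → Qp) (H : Fn S) : Prop where
  hr : r ∈ R
  r0 : ∀ s ∈ β.X, r s ≠ 0
  hq : ∀ j, q j ∈ R
  q1 : ∀ s ∈ β.X, q d s = 1
  hH : H ∈ β.T hR
  eq : ∀ z ∈ β.set, F z = r z.1 * (∑ j ∈ range (d + 1), q j z.1 * β.w z ^ j +
    p ^ M * β.w z ^ (d + 1) * H z)

lemma sum_recenter (d : ℕ) (q : ℕ → Qp) (y v : Qp) :
    ∑ j ∈ range (d + 1), q j * y ^ j =
      ∑ i ∈ range (d + 1), (∑ j ∈ range (d + 1), q j * (j.choose i) * v ^ (j - i)) * (y - v) ^ i := by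
  simp_rw [Finset.sum_mul]
  rw [Finset.sum_comm]
  refine sum_congr rfl (fun j hj => ?_)
  have h1 : y ^ j = ∑ i ∈ range (d + 1), (y - v) ^ i * v ^ (j - i) * (j.choose i) := by
    conv_lhs => rw [show y = (y - v) + v by ring, add_pow]
    refine Finset.sum_subset (Finset.range_mono (by have := mem_range.1 hj; omega)) (fun i _ hi => ?_)
    rw [Nat.choose_eq_zero_of_lt (by rw [mem_range] at hi; omega)]; simp
  rw [h1, mul_sum]
  exact sum_congr rfl (fun i _ => by ring)

lemma subForm {d M : ℕ} {F : Fn S} {r : S → Qp} {q : ℕ → S → Qp}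
    {H : Fn S} (hF : β.Form hR d M F r q H) (hM : 0 < M) :
    ∃ B ≤ hR.Rc, B.FG ∧ ∃ P : ℕ → Polynomial B, ∀ (Y : Set S) (hY : Def R Y) (v σ : S → Qp)
      (hv : v ∈ R) (hσ : σ ∈ R) (hσ0 : ∀ s ∈ β.X ∩ Y, σ s ≠ 0) (n : ℕ)
      (_ : ∀ s ∈ β.X ∩ Y, ‖v s‖ ≤ 1) (_ : ∀ s ∈ β.X ∩ Y, ‖σ s‖ ≤ ‖ϖ ^ n‖),
      ∃ r₂ q₂ H₂, (β.sub hR hY hv hσ hσ0).Form hR d (M + n) F r₂ q₂ H₂ ∧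
        ∀ e, e + 1 = d → ∀ s ∈ β.X ∩ Y, ‖q₂ e s * σ s‖ =
          ‖q e s + d * v s + p ^ M * serv B (fun n => Polynomial.hasseDeriv e (P n)) s (v s)‖ := by
  classical
  have hG : (fun z => β.w z ^ (d + 1) * H z) ∈ β.T hR := T_mul (T_pow (T_w hR) _) hF.hH
  obtain ⟨B, hB, hFG, P, hP⟩ := ser_of_TA hR hG
  have hB1 : Unif B := fun r hr => (hB hr).2
  refine ⟨B, hB, hFG, P, fun Y hY v σ hv hσ hσ0 n hv1 hσ1 => ?_⟩
  have hσ1' : ∀ s ∈ β.X ∩ Y, ‖σ s‖ ≤ 1 := fun s hs => (hσ1 s hs).trans (norm_pow_p_le_one n)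
  set β₂ := β.sub hR hY hv hσ hσ0 with hβ₂
  have hsub : β₂.set ⊆ β.set := sub_set hv1 hσ1'
  set v' : S → Qp := (β.X ∩ Y).indicator v with hv'
  have hv'R : v' ∈ hR.Rc := hR.restrict_Rc hv (hR.def_inter β.hX hY) hv1
  have hvv : ∀ s ∈ β.X ∩ Y, v' s = v s := fun s hs => indicator_of_mem hs _
  obtain ⟨K, hK, hKeq⟩ := taylor_ser hR hB hFG P (C := β.set) (fun z hz => w_norm hz) hv'R (d + 1)
  let κ : ℕ → S → Qp := fun j s => serv B (fun n => Polynomial.hasseDeriv j (P n)) s (v' s)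
  have hκ : ∀ j, κ j ∈ hR.Rc := fun j => serv_mem hR hB hFG _ hv'R
  let e : ℕ → S → Qp := fun i s => ∑ j ∈ range (d + 1), q j s * (j.choose i) * v s ^ (j - i) + p ^ M * κ i s
  have he : ∀ i, e i ∈ R := by
    intro i
    have h1 : ∑ j ∈ range (d + 1), q j * (fun _ => ((j.choose i : ℕ) : Qp)) * v ^ (j - i) ∈ R :=
      hR.sum _ _ (fun j _ => hR.mul (hR.mul (hF.hq j) (hR.const _)) (hR.pow hv _))
    have := hR.add h1 (hR.mul (hR.const (ϖ ^ M)) (hκ i).1)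
    convert this using 1
    ext s
    simp [e, Finset.sum_apply]
  have hed : ∀ s ∈ β.X ∩ Y, e d s = 1 + p ^ M * κ d s := by
    intro s hs
    simp only [e]
    rw [Finset.sum_eq_single d]
    · rw [hF.q1 s hs.1]; simp
    · intro j hj hjd
      rw [Nat.choose_eq_zero_of_lt (by have := mem_range.1 hj; omega)]; simp
    · simp
  have hed1 : ∀ s ∈ β.X ∩ Y, ‖e d s‖ = 1 := fun s hs => by
    rw [hed s hs]; exact norm_one_add_p hM ((hκ d).2 s)
  have hed0 : ∀ s ∈ β.X ∩ Y, e d s ≠ 0 := fun s hs h => by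
    have := hed1 s hs; rw [h, norm_zero] at this; exact zero_ne_one this
  have hpn : ϖ ^ n ≠ 0 := pow_ne_zero _ pK_ne
  refine ⟨r * e d * σ ^ d, fun j => e j * σ ^ j / (e d * σ ^ d), fun z => (σ z.1 / ϖ ^ n) * (e d z.1)⁻¹ * K z, ⟨?_, ?_, ?_, ?_, ?_, ?_⟩, ?_⟩
  · exact hR.mul (hR.mul hF.hr (he d)) (hR.pow hσ d)
  · intro s hs
    exact mul_ne_zero (mul_ne_zero (hF.r0 s hs.1) (hed0 s hs)) (pow_ne_zero _ (hσ0 s hs))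
  · intro j
    exact hR.div (hR.mul (he j) (hR.pow hσ j)) (hR.mul (he d) (hR.pow hσ d))
  · intro s hs
    exact div_self (mul_ne_zero (hed0 s hs) (pow_ne_zero _ (hσ0 s hs)))
  · refine T_mul (T_mul (T_base hR (r := fun s => σ s / ϖ ^ n) (hR.div hσ (hR.const _)) ?_)
      (T_base hR (r := fun s => (e d s)⁻¹) (hR.inv (he d)) ?_)) (sub_T hv1 hσ1' hK)
    · intro s hs; exact Cell.norm_ratio (hσ1 s hs)
    · intro s hs; rw [norm_inv, hed1 s hs, inv_one]
  · intro z hz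
    have hzβ := hsub hz
    have h1 := hF.eq z hzβ
    have h2 : β.w z ^ (d + 1) * H z = serv B P z.1 (β.w z) :=
      (hP z hzβ).unique (serv_hasSum hB1 P z.1 (w_norm hzβ))
    have hs := hz.1
    rw [h1, mul_assoc (ϖ ^ M), h2, hKeq z hzβ, sum_recenter d (fun j => q j z.1) (β.w z) (v z.1)]
    rw [hvv z.1 hs, sub_w hz, mul_add (ϖ ^ M), ← add_assoc, mul_sum _ _ (ϖ ^ M), ← Finset.sum_add_distrib]
    have e1 : ∀ i, (∑ j ∈ range (d + 1), q j z.1 * (j.choose i) * v z.1 ^ (j - i)) * (σ z.1 * β₂.w z) ^ i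
        + p ^ M * (serv B (fun n => Polynomial.hasseDeriv i (P n)) z.1 (v z.1) * (σ z.1 * β₂.w z) ^ i) =
        e i z.1 * σ z.1 ^ i * β₂.w z ^ i := by
      intro i; simp only [e, κ]; rw [hvv z.1 hs, mul_pow]; ring
    rw [sum_congr rfl (fun i _ => e1 i)]
    have h3 := hed0 _ hs
    have h4 := pow_ne_zero d (hσ0 _ hs)
    show r z.1 * _ = r z.1 * e d z.1 * σ z.1 ^ d * (∑ j ∈ range (d + 1), e j z.1 * σ z.1 ^ j / (e d z.1 * σ z.1 ^ d) * β₂.w z ^ j + _)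
    rw [mul_assoc (r z.1), mul_assoc (r z.1), mul_add (e d z.1 * σ z.1 ^ d), mul_sum _ _ (e d z.1 * σ z.1 ^ d)]
    congr 1
    congr 1
    · refine sum_congr rfl (fun i _ => ?_)
      field_simp
    · rw [pow_add]
      field_simp
      rw [← hβ₂, mul_pow]
      ring
  · intro i hi s hs
    have h3 := hed0 _ hs
    have h4 := hσ0 _ hs
    have h5 : (e i s * σ s ^ i / (e d s * σ s ^ d)) * σ s = e i s / e d s := by
      rw [← hi, pow_succ]; rw [← hi] at h3; field_simp
    show ‖(e i s * σ s ^ i / (e d s * σ s ^ d)) * σ s‖ = _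
    rw [h5, norm_div, hed1 s hs, div_one]
    simp only [e, κ]
    rw [hvv s hs]
    congr 2
    subst hi
    rw [sum_range_succ, sum_range_succ, Finset.sum_eq_zero, hF.q1 s hs.1]
    · simp
    · intro j hj
      rw [Nat.choose_eq_zero_of_lt (by have := mem_range.1 hj; omega)]; simp

lemma Form.lower {d M : ℕ} {F : Fn S} {r : S → Qp} {q : ℕ → S → Qp}
    {H : Fn S} (hF : β.Form hR (d + 1) M F r q H) (h : ∀ s ∈ β.X, 1 < ‖q d s‖) :
    ∃ r₂ q₂ H₂, β.Form hR d 1 F r₂ q₂ H₂ := by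
  have hq0 : ∀ s ∈ β.X, q d s ≠ 0 := fun s hs => norm_pos_iff.1 (zero_lt_one.trans (h s hs))
  refine ⟨r * q d, fun j => q j / q d, fun z => ((p * q d z.1)⁻¹) * (1 + p ^ M * (β.w z * H z)),
    hR.mul hF.hr (hF.hq d), fun s hs => mul_ne_zero (hF.r0 s hs) (hq0 s hs), fun j => hR.div (hF.hq j) (hF.hq d),
    fun s hs => div_self (hq0 s hs), ?_, fun z hz => ?_⟩
  · refine T_mul (T_base hR (r := fun s => (p * q d s)⁻¹) (hR.inv (hR.mul (hR.const _) (hF.hq d))) (fun s hs => ?_))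
      (T_add (T_const hR (by simp)) (T_mul (T_const hR (norm_pow_p_le_one M)) (T_mul (T_w hR) hF.hH)))
    rw [norm_inv]
    apply inv_le_one_of_one_le₀
    have h1 := (norm_le_one_iff_val (inv_ne_zero (hq0 s hs))).not
    have h2 : ¬ (1 ≤ ‖(q d s)⁻¹‖) := by
      rw [norm_inv, not_le]; exact inv_lt_one_of_one_lt₀ (h s hs)
    have h3 := (norm_le_iff_val (one_ne_zero) (inv_ne_zero (hq0 s hs))).not.1 (by rwa [norm_one])
    rw [valuation_one, Padic.valuation_inv] at h3
    have h4 := (norm_le_iff_val (x := 1) one_ne_zero (mul_ne_zero pK_ne (hq0 s hs))).2 (by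
      rw [valuation_one, valuation_mul pK_ne (hq0 s hs), valuation_p]; omega)
    rwa [norm_one] at h4
  · rw [hF.eq z hz, sum_range_succ _ (d + 1), hF.q1 _ hz.1]
    have := hq0 _ hz.1
    have hp := pK_ne (p := p)
    show _ = r z.1 * q d z.1 * (∑ j ∈ range (d + 1), q j z.1 / q d z.1 * β.w z ^ j + _)
    rw [mul_assoc (r z.1), mul_add (q d z.1), mul_sum, add_assoc]
    congr 1
    congr 1
    · exact sum_congr rfl (fun i _ => by field_simp)
    · field_simp; ring

end Ball
end Balls

/-! ### Part 18 : preparation on balls -/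

section BallPrep
variable {S : Type*} {R : Set (S → ℚ_[p])} {U : Ultrafilter (S × ℚ_[p])}

lemma norm_add_left {a b : Qp} (h : ‖b‖ < ‖a‖) : ‖a + b‖ = ‖a‖ := by
  rw [Padic.add_eq_max_of_ne h.ne', max_eq_left h.le]

lemma norm_nat_le (n : ℕ) : ‖(n : Qp)‖ ≤ 1 := by exact_mod_cast Padic.norm_int_le_one (p := p) n

lemma ultra_res {T : Type*} (U : Ultrafilter T) (g : T → Qp) (h : {z | ‖g z‖ ≤ 1} ∈ U) (n : ℕ) :
    ∃ n0 : ℕ, {z | ‖g z - n0‖ ≤ ‖ϖ ^ n‖} ∈ U := by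
  obtain ⟨i, _, hi⟩ := ultra_finset U (range (p ^ n)) (fun i => {z | ‖g z - i‖ ≤ ‖ϖ ^ n‖}) (by
    filter_upwards [h] with z hz
    obtain ⟨i, hi, y, hy, e⟩ := exists_residue n hz
    refine ⟨i, mem_range.2 hi, ?_⟩
    show ‖g z - i‖ ≤ _
    rw [e, add_sub_cancel_left, norm_mul]
    exact mul_le_of_le_one_right (norm_nonneg _) hy)
  exact ⟨i, hi⟩

lemma exists_small {x : Qp} (hx : x ≠ 0) : ∃ n : ℕ, ‖ϖ ^ n‖ < ‖x‖ := by
  obtain ⟨n, hn⟩ := exists_pow_lt_of_lt_one (norm_pos_iff.2 hx) (norm_p_lt_one (p := p))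
  exact ⟨n, by rwa [norm_pow]⟩

lemma norm_pow_anti {m n : ℕ} (h : m ≤ n) : ‖ϖ ^ n‖ ≤ ‖ϖ ^ m‖ := by
  rw [norm_pow, norm_pow]
  exact pow_le_pow_of_le_one (norm_nonneg _) norm_p_lt_one.le h

/-- cells inside balls -/
structure Ball.In (β : Ball R) (C : Cell R) (hR : PreRich R) : Prop where
  c : C.c = β.γ
  X : C.X ⊆ β.X
  set : C.set ⊆ β.set
  T : ∀ f ∈ β.T hR, f ∈ C.T hR

lemma Ball.In.of {β : Ball R} {C : Cell R} (hR : PreRich R) (hc : C.c = β.γ) (hX : C.X ⊆ β.X)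
    (hb : ∀ s ∈ C.X, ‖(β.ρ s)⁻¹‖ ≤ ‖C.b s‖) : β.In C hR := by
  have hx : ∀ z, z.2 - β.γ z.1 = C.x z := fun z => by unfold Cell.x; rw [hc]
  have hset : C.set ⊆ β.set := by
    intro z hz
    refine ⟨hX hz.1, ?_⟩
    have h1 := hz.2.2.2
    have h2 := norm_pos_iff.2 (β.hρ0 _ (hX hz.1))
    rw [hx, ← div_le_one h2, div_eq_inv_mul, ← norm_inv]
    rw [norm_mul] at h1
    exact (mul_le_mul_of_nonneg_right (hb _ hz.1) (norm_nonneg _)).trans h1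
  refine ⟨hc, hX, hset, fun f hf => TA_subst (Cell.bdd hR) hset (fun d hd => ?_) hf⟩
  have : Dg hR.Rc {β.w} ≤ TAlg C.set (C.A hR) (Cell.bdd hR) := Dg_le (fun r hr => Cell.T_Rc hR hr) (by
    rintro u rfl
    refine Cell.T_congr (Cell.T_mul (Cell.T_base hR (hR.div (hR.inv β.hρ) C.hb)
      (fun s hs => Cell.norm_ratio (hb s hs))) (Cell.T_w hR)) (fun z hz => ?_)
    unfold Ball.w Cell.w
    rw [hx, ← mul_assoc, Pi.div_apply, Pi.inv_apply, Cell.ratio_mul (hb _ hz.1), div_eq_inv_mul])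
  exact this hd

lemma Ball.In.x {β : Ball R} {C : Cell R} {hR : PreRich R} (h : β.In C hR) (z : S × Qp) :
    C.x z = z.2 - β.γ z.1 := by unfold Cell.x; rw [h.c]

variable {N : ℕ}

lemma Ball.cellA (hR : PreRich R) (hgen : Gen R U) (β : Ball R)
    (hβ : β.set ∈ U) {c0 : S → Qp} (hc0 : c0 ∈ R)
    (h : {z : S × Qp | ‖z.2 - β.γ z.1‖ ≤ ‖ϖ ^ N * (β.γ z.1 - c0 z.1)‖} ∈ U) :
    ∃ C : Cell R, C.set ∈ U ∧ β.In C hR ∧ C.Pr hR N (fun z => z.2 - c0 z.1) := by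
  have hpN : ϖ ^ N ≠ 0 := pow_ne_zero _ pK_ne
  have hΔ : (fun s => β.γ s - c0 s) ∈ R := hR.sub β.hγ hc0
  have hpΔ : (fun s => ϖ ^ N * (β.γ s - c0 s)) ∈ R := hR.mul (hR.const _) hΔ
  obtain ⟨b, hb, hb'⟩ := hR.larger (hR.inv β.hρ) (hR.inv hpΔ)
  have hne : ∀ s ∈ β.X ∩ {s | β.γ s - c0 s ≠ 0}, b s ≠ 0 := by
    intro s hs h0
    have := (hb' s).1
    rw [h0, norm_zero, norm_le_zero_iff] at this
    exact inv_ne_zero (β.hρ0 s hs.1) this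
  let C : Cell R := ⟨β.X ∩ {s | β.γ s - c0 s ≠ 0}, β.γ, 0, b, hR.def_inter β.hX (hR.def_ne hΔ), β.hγ, hR.zero, hb,
    .inr hne⟩
  refine ⟨C, ?_, Ball.In.of hR rfl Set.inter_subset_left (fun s _ => (hb' s).1), ?_⟩
  · filter_upwards [hβ, h, hgen _ β.hγ] with z hz hz1 hz2
    have hx : z.2 - β.γ z.1 ≠ 0 := sub_ne_zero.2 hz2
    have hΔ0 : β.γ z.1 - c0 z.1 ≠ 0 := by
      intro h0
      rw [h0, mul_zero, norm_zero, norm_le_zero_iff] at hz1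
      exact hx hz1
    refine ⟨⟨hz.1, hΔ0⟩, hx, by show ‖(0 : Qp)‖ ≤ _; simp, ?_⟩
    show ‖b z.1 * (z.2 - β.γ z.1)‖ ≤ 1
    rcases (hb' z.1).2.2 with h1 | h1
    · rw [h1, Pi.inv_apply, mul_comm, ← div_eq_mul_inv]; exact Cell.norm_ratio hz.2
    · rw [h1, Pi.inv_apply, mul_comm, ← div_eq_mul_inv]; exact Cell.norm_ratio hz1
  · have hu : C.IsU hR N (fun z => 1 + p ^ N * (((ϖ ^ N * (β.γ z.1 - c0 z.1))⁻¹ / b z.1) * C.w z)) :=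
      ⟨_, Cell.T_mul (Cell.T_base hR (hR.div (hR.inv hpΔ) hb) (fun s _ => Cell.norm_ratio (hb' s).2.1))
        (Cell.T_w hR), fun z _ => rfl⟩
    refine ((Cell.Pr.base (C := C) hΔ (fun s hs => hs.2)).mul (Cell.Pr.u hu)).congr (fun z hz => ?_)
    have h1 := hne _ hz.1
    have h2 : β.γ z.1 - c0 z.1 ≠ 0 := hz.1.2
    show z.2 - c0 z.1 = (β.γ z.1 - c0 z.1) * (1 + p ^ N * (((ϖ ^ N * (β.γ z.1 - c0 z.1))⁻¹ / b z.1) * (b z.1 * (z.2 - β.γ z.1))))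
    field_simp
    ring

lemma Ball.cellB (hR : PreRich R) (hgen : Gen R U) (β : Ball R)
    (hβ : β.set ∈ U) {c0 : S → Qp} (hc0 : c0 ∈ R)
    (h : {z : S × Qp | ‖β.γ z.1 - c0 z.1‖ ≤ ‖ϖ ^ N * (z.2 - β.γ z.1)‖} ∈ U) :
    ∃ C : Cell R, C.set ∈ U ∧ β.In C hR ∧ C.Pr hR N (fun z => z.2 - c0 z.1) := by
  have hpN : ϖ ^ N ≠ 0 := pow_ne_zero _ pK_ne
  have hΔ : (fun s => β.γ s - c0 s) ∈ R := hR.sub β.hγ hc0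
  let C : Cell R := ⟨β.X, β.γ, fun s => (β.γ s - c0 s) / ϖ ^ N, β.ρ⁻¹, β.hX, β.hγ,
    hR.div hΔ (hR.const _), hR.inv β.hρ, .inr (fun s hs => inv_ne_zero (β.hρ0 s hs))⟩
  refine ⟨C, ?_, Ball.In.of hR rfl (Set.Subset.refl _) (fun s _ => le_rfl), ?_⟩
  · filter_upwards [hβ, h, hgen _ β.hγ] with z hz hz1 hz2
    have hx : z.2 - β.γ z.1 ≠ 0 := sub_ne_zero.2 hz2
    refine ⟨hz.1, hx, ?_, ?_⟩
    · show ‖(β.γ z.1 - c0 z.1) / ϖ ^ N‖ ≤ ‖z.2 - β.γ z.1‖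
      rw [norm_div, div_le_iff₀ (norm_pos_iff.2 hpN), ← norm_mul, mul_comm]; exact hz1
    · show ‖(β.ρ z.1)⁻¹ * (z.2 - β.γ z.1)‖ ≤ 1
      rw [mul_comm, ← div_eq_mul_inv]; exact Cell.norm_ratio hz.2
  · have hu : C.IsU hR N (fun z => 1 + p ^ N * C.w' z) := ⟨_, Cell.T_w' hR, fun z _ => rfl⟩
    refine (Cell.Pr.x.mul (Cell.Pr.u hu)).congr (fun z hz => ?_)
    have h1 : z.2 - β.γ z.1 ≠ 0 := hz.2.1
    show z.2 - c0 z.1 = (z.2 - β.γ z.1) * (1 + p ^ N * ((β.γ z.1 - c0 z.1) / ϖ ^ N * (z.2 - β.γ z.1)⁻¹))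
    field_simp
    ring

lemma norm_between {x y : Qp} (hx : x ≠ 0) (hy : y ≠ 0) (h1 : ¬ ‖x‖ ≤ ‖ϖ ^ N * y‖)
    (h2 : ¬ ‖y‖ ≤ ‖ϖ ^ N * x‖) : ∃ j ∈ Finset.Icc (-(N : ℤ)) N, ‖x‖ = ‖ϖ ^ j * y‖ := by
  have hp := pK_ne (p := p)
  rw [norm_le_iff_val hx (mul_ne_zero (pow_ne_zero _ hp) hy), valuation_mul (pow_ne_zero _ hp) hy,
    valuation_pow, valuation_p] at h1
  rw [norm_le_iff_val hy (mul_ne_zero (pow_ne_zero _ hp) hx), valuation_mul (pow_ne_zero _ hp) hx,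
    valuation_pow, valuation_p] at h2
  refine ⟨x.valuation - y.valuation, Finset.mem_Icc.2 ⟨by omega, by omega⟩, ?_⟩
  rw [norm_eq_iff_val hx (mul_ne_zero (zpow_ne_zero _ hp) hy), valuation_mul (zpow_ne_zero _ hp) hy,
    valuation_zpow, valuation_p]
  ring

lemma Ball.cellAB (hR : PreRich R) (hgen : Gen R U) (N : ℕ) (β : Ball R)
    (hβ : β.set ∈ U) {c0 : S → Qp} (hc0 : c0 ∈ R) :
    (∃ C : Cell R, C.set ∈ U ∧ β.In C hR ∧ C.Pr hR N (fun z => z.2 - c0 z.1)) ∨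
    ∃ θ ∈ R, {z : S × Qp | θ z.1 ≠ 0 ∧ ‖z.2 - β.γ z.1‖ = ‖θ z.1‖} ∈ U := by
  by_cases hA : {z : S × Qp | ‖z.2 - β.γ z.1‖ ≤ ‖ϖ ^ N * (β.γ z.1 - c0 z.1)‖} ∈ U
  · exact .inl (β.cellA hR hgen hβ hc0 hA)
  by_cases hB : {z : S × Qp | ‖β.γ z.1 - c0 z.1‖ ≤ ‖ϖ ^ N * (z.2 - β.γ z.1)‖} ∈ U
  · exact .inl (β.cellB hR hgen hβ hc0 hB)
  right
  obtain ⟨j, _, hj⟩ := ultra_finset U (Finset.Icc (-(N : ℤ)) N)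
    (fun j => {z : S × Qp | ϖ ^ j * (β.γ z.1 - c0 z.1) ≠ 0 ∧
      ‖z.2 - β.γ z.1‖ = ‖ϖ ^ j * (β.γ z.1 - c0 z.1)‖}) (by
    filter_upwards [compl_umem hA, compl_umem hB, hgen _ β.hγ]
      with z h1 h2 h3
    rw [Set.mem_compl_iff, mem_ofPred_eq] at h1 h2
    have hx : z.2 - β.γ z.1 ≠ 0 := sub_ne_zero.2 h3
    have hy : β.γ z.1 - c0 z.1 ≠ 0 := by
      intro h0; rw [h0, norm_zero] at h2; exact h2 (norm_nonneg _)
    obtain ⟨j, hj, e⟩ := norm_between hx hy h1 h2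
    exact ⟨j, hj, mul_ne_zero (zpow_ne_zero _ pK_ne) hy, e⟩)
  exact ⟨_, hR.mul (hR.const _) (hR.sub β.hγ hc0), hj⟩

/-- both functions prepared on a cell of the ultrafilter -/
def Good (hR : PreRich R) (N : ℕ) (U : Ultrafilter (S × Qp)) (F : Fn S) (c0 : S → Qp) : Prop :=
  ∃ C : Cell R, C.set ∈ U ∧ C.Prep hR N F ∧ C.Pr hR N (fun z => z.2 - c0 z.1)

variable {F : S × ℚ_[p] → ℚ_[p]}

lemma Ball.scale {hR : PreRich R} {β : Ball R} {d M : ℕ} {r : S → Qp} {q : ℕ → S → Qp} {H : Fn S}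
    (hF : β.Form hR d M F r q H) (hM : 0 < M) (hβ : β.set ∈ U) (n : ℕ) :
    ∃ (β' : Ball R) (r' : S → Qp) (q' : ℕ → S → Qp) (H' : Fn S), β'.Form hR d (M + n) F r' q' H' ∧
      β'.set ∈ U ∧ β'.set ⊆ β.set ∧ ∀ s, β'.ρ s = β.ρ s * ϖ ^ n := by
  obtain ⟨n0, hn0⟩ := ultra_res U β.w (Filter.mem_of_superset hβ (fun z hz => Ball.w_norm hz)) n
  obtain ⟨B, hB, hFG, P, h⟩ := Ball.subForm hF hM
  have h1 : ∀ s ∈ β.X ∩ Set.univ, ‖((n0 : ℕ) : Qp)‖ ≤ 1 := fun s _ => norm_nat_le _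
  obtain ⟨r', q', H', h2, _⟩ := h Set.univ hR.def_univ (fun _ => (n0 : Qp)) (fun _ => ϖ ^ n) (hR.const _)
    (hR.const _) (fun s _ => pow_ne_zero _ pK_ne) n h1 (fun s _ => le_rfl)
  refine ⟨_, r', q', H', h2, ?_, Ball.sub_set h1 (fun s _ => norm_pow_p_le_one n), fun s => rfl⟩
  filter_upwards [hβ, hn0] with z hz hz1
  exact Ball.mem_sub hz (Set.mem_univ _) hz1

lemma Ball.finish {hR : PreRich R} {β : Ball R} {C : Cell R} (h : β.In C hR) {d M : ℕ} {r : S → Qp}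
    {q : ℕ → S → Qp} {H : Fn S} (hF : β.Form hR d M F r q H) (hM : N ≤ M) :
    C.IsU hR N (fun z => 1 + p ^ M * (β.w z * H z)) := by
  refine ⟨fun z => p ^ (M - N) * (β.w z * H z), Cell.T_mul (Cell.T_const hR (norm_pow_p_le_one _))
    (h.T _ (Ball.T_mul (Ball.T_w hR) hF.hH)), fun z _ => ?_⟩
  show _ = 1 + ϖ ^ N * (p ^ (M - N) * (β.w z * H z))
  rw [← mul_assoc (ϖ ^ N), ← pow_add, Nat.add_sub_cancel' hM]

lemma Ball.good_zero (hR : PreRich R) (hgen : Gen R U) (β : Ball R)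
    (hβ : β.set ∈ U) {c0 : S → Qp} (hc0 : c0 ∈ R) {M : ℕ} (hM : 0 < M) {r : S → Qp}
    {q : ℕ → S → Qp} {H : Fn S} (hF : β.Form hR 0 M F r q H) : Good hR N U F c0 := by
  have key : ∀ (β : Ball R) (M : ℕ) (r : S → Qp) (q : ℕ → S → Qp) (H : Fn S),
      β.Form hR 0 M F r q H → N ≤ M →
      (∃ C : Cell R, C.set ∈ U ∧ β.In C hR ∧ C.Pr hR N (fun z => z.2 - c0 z.1)) → Good hR N U F c0 := by
    rintro β M r q H hF hM ⟨C, hC, hin, hpr⟩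
    refine ⟨C, hC, .inr ?_, hpr⟩
    refine ((Cell.Pr.base hF.hr (fun s hs => hF.r0 s (hin.X hs))).mul (Cell.Pr.u (Ball.finish hin hF hM))).congr
      (fun z hz => ?_)
    have hz' := hin.set hz
    rw [hF.eq z hz']
    simp only [zero_add, Finset.sum_range_one, pow_zero, pow_one, hF.q1 _ hz'.1]
    ring
  obtain ⟨β, r, q, H, hF, hβ, -, -⟩ := Ball.scale hF hM hβ N
  by_cases hn : {z : S × Qp | ‖c0 z.1 - β.γ z.1‖ ≤ ‖β.ρ z.1‖} ∈ U
  · obtain ⟨B, hB, hFG, P, h⟩ := Ball.subForm hF (by omega)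
    have h1 : ∀ s ∈ β.X ∩ {s | ‖c0 s - β.γ s‖ ≤ ‖β.ρ s‖}, ‖(c0 s - β.γ s) / β.ρ s‖ ≤ 1 :=
      fun s hs => Cell.norm_ratio hs.2
    have hv : (fun s => (c0 s - β.γ s) / β.ρ s) ∈ R := hR.div (hR.sub hc0 β.hγ) β.hρ
    have hY : Def R {s | ‖c0 s - β.γ s‖ ≤ ‖β.ρ s‖} := hR.def_le (hR.sub hc0 β.hγ) β.hρ
    obtain ⟨r', q', H', h2, _⟩ := h _ hY _ (fun _ => 1) hv
      (hR.const _) (fun s _ => one_ne_zero) 0 h1 (fun s _ => by simp)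
    have hset : (β.sub hR hY hv (hR.const 1) (fun s _ => one_ne_zero)).set ∈ U := by
      filter_upwards [hβ, hn] with z hz hz1
      refine Ball.mem_sub hz hz1 ?_
      rw [norm_one]
      show ‖β.w z - (c0 z.1 - β.γ z.1) / β.ρ z.1‖ ≤ 1
      rw [sub_eq_add_neg]
      exact norm_add_le_one (Ball.w_norm hz) (by rw [norm_neg]; exact Cell.norm_ratio hz1)
    refine key _ _ _ _ _ h2 (by omega) (Ball.cellB hR hgen _ hset hc0 ?_)
    filter_upwards [hset] with z hz
    have : (β.sub hR hY hv (hR.const 1) (fun s _ => one_ne_zero)).γ z.1 - c0 z.1 = 0 := by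
      show β.γ z.1 + β.ρ z.1 * ((c0 z.1 - β.γ z.1) / β.ρ z.1) - c0 z.1 = 0
      have := β.hρ0 _ hz.1.1
      field_simp
      ring
    rw [this, norm_zero]; exact norm_nonneg _
  · obtain ⟨β', r', q', H', hF', hβ', hsub, hρ⟩ := Ball.scale hF (by omega) hβ N
    refine key _ _ _ _ _ hF' (by omega) (Ball.cellA hR hgen _ hβ' hc0 ?_)
    filter_upwards [hβ', compl_umem hn] with z hz hz1
    rw [Set.mem_compl_iff, mem_ofPred_eq, not_le] at hz1
    have h2 := (hsub hz).2
    have h3 := hz.2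
    have e1 : ‖z.2 - c0 z.1‖ = ‖c0 z.1 - β.γ z.1‖ := by
      have : ‖-(c0 z.1 - β.γ z.1) + (z.2 - β.γ z.1)‖ = ‖-(c0 z.1 - β.γ z.1)‖ :=
        norm_add_left (by rw [norm_neg]; exact h2.trans_lt hz1)
      rw [norm_neg] at this
      rw [← this]; congr 1; ring
    have h4 : ‖z.2 - β'.γ z.1‖ ≤ ‖β.ρ z.1‖ * ‖ϖ ^ N‖ := by rwa [hρ, norm_mul] at h3
    have h5 : ‖β.ρ z.1‖ * ‖ϖ ^ N‖ ≤ ‖β.ρ z.1‖ := mul_le_of_le_one_right (norm_nonneg _) (norm_pow_p_le_one _)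
    have e2 : ‖β'.γ z.1 - c0 z.1‖ = ‖z.2 - c0 z.1‖ := by
      have : ‖(z.2 - c0 z.1) + -(z.2 - β'.γ z.1)‖ = ‖z.2 - c0 z.1‖ :=
        norm_add_left (by rw [norm_neg, e1]; exact (h4.trans h5).trans_lt hz1)
      rw [← this]; congr 1; ring
    rw [norm_mul, e2, e1, mul_comm]
    exact h4.trans (mul_le_mul_of_nonneg_right hz1.le (norm_nonneg _))

end BallPrep

/-! ### Part 19 : the induction -/

section BallInd
variable {S : Type*} {R : Set (S → ℚ_[p])} {U : Ultrafilter (S × ℚ_[p])} {N : ℕ} {F : S × ℚ_[p] → ℚ_[p]}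

lemma serv_smul {B : Alg S} (P : ℕ → Polynomial B) (c : ℤ_[p]) (s : S) (y : Qp) :
    serv B (fun n => (algebraMap ℤ_[p] B c) • P n) s y = c * serv B P s y := by
  unfold serv
  rw [← tsum_mul_left]
  refine tsum_congr (fun n => ?_)
  rw [Polynomial.eval₂_smul, evB_apply]
  have : ((algebraMap ℤ_[p] B c : B) : S → Qp) s = c := rfl
  rw [this]; ring

lemma Ball.good_succ (hR : Rich R) (hN : 0 < N) (hgen : Gen R U)
    {c0 : S → Qp} (hc0 : c0 ∈ R) (e : ℕ)
    (ih : ∀ (β : Ball R) (M : ℕ) (r : S → Qp) (q : ℕ → S → Qp) (H : Fn S), β.set ∈ U → 0 < M →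
      β.Form hR.pre e M F r q H → Good hR.pre N U F c0)
    (β : Ball R) (M : ℕ) (r : S → Qp) (q : ℕ → S → Qp) (H : Fn S) (hβ : β.set ∈ U) (hM : 0 < M)
    (hF : β.Form hR.pre (e + 1) M F r q H) : Good hR.pre N U F c0 := by
  have hP := hR.pre
  set D : Qp := ((e + 1 : ℕ) : Qp) with hD
  have hD0 : D ≠ 0 := by rw [hD]; exact_mod_cast Nat.succ_ne_zero e
  obtain ⟨n, hn⟩ := exists_small hD0
  have hn0 : 0 < n := by
    rcases Nat.eq_zero_or_pos n with h | h
    · rw [h, pow_zero, norm_one] at hn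
      exact absurd (norm_nat_le (p := p) (e + 1)) (not_le.2 hn)
    · exact h
  obtain ⟨β, r, q, H, hF, hβ, -, -⟩ := Ball.scale hF hM hβ (n + 1 + N)
  generalize hM' : M + (n + 1 + N) = M' at hF
  have hMD : ‖ϖ ^ M'‖ < ‖D‖ := (norm_pow_anti (by omega)).trans_lt hn
  have hpn : ϖ ^ n ≠ 0 := pow_ne_zero _ pK_ne
  obtain ⟨B, hB, hFG, P, h⟩ := Ball.subForm hF (by omega)
  have hB1 : Unif B := fun r hr => (hB hr).2
  by_cases hq : {z : S × Qp | ‖D‖ < ‖q e z.1‖} ∈ U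
  · obtain ⟨n0, hn0⟩ := ultra_res U β.w (Filter.mem_of_superset hβ (fun z hz => Ball.w_norm hz)) n
    have hY : Def R {s | ‖D‖ < ‖q e s‖} := hP.def_lt (hP.const D) (hF.hq e)
    obtain ⟨r', q', H', h2, h3⟩ := h _ hY (fun _ => (n0 : Qp)) (fun _ => ϖ ^ n) (hP.const _)
      (hP.const _) (fun s _ => hpn) n (fun s _ => norm_nat_le _) (fun s _ => le_rfl)
    obtain ⟨r₂, q₂, H₂, h4⟩ := Ball.Form.lower h2 (by
      intro s hs
      have h5 := h3 e rfl s hs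
      have hs2 : ‖D‖ < ‖q e s‖ := hs.2
      rw [add_assoc, norm_add_left, norm_mul] at h5
      · rw [← h5] at hs2
        have h6 := hn.trans hs2
        by_contra h7
        exact absurd h6 (not_lt.2 (mul_le_of_le_one_left (norm_nonneg _) (not_lt.1 h7)))
      · refine (IsUltrametricDist.norm_add_le_max _ _).trans_lt (max_lt (lt_of_le_of_lt ?_ hs2)
          (lt_of_le_of_lt ?_ (hMD.trans hs2)))
        · rw [norm_mul]; exact mul_le_of_le_one_right (norm_nonneg _) (norm_nat_le _)
        · rw [norm_mul]; exact mul_le_of_le_one_right (norm_nonneg _) (serv_norm hB1 _ _ (norm_nat_le _)))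
    refine ih _ 1 _ _ _ ?_ one_pos h4
    filter_upwards [hβ, hn0, hq] with z hz hz1 hz2
    exact Ball.mem_sub hz hz2 hz1
  -- the critical point
  have hq' : {z : S × Qp | ‖q e z.1‖ ≤ ‖D‖} ∈ U := by
    filter_upwards [compl_umem hq] with z hz
    rw [Set.mem_compl_iff, mem_ofPred_eq, not_lt] at hz
    exact hz
  have hY : Def R {s | ‖q e s‖ ≤ ‖D‖} := hP.def_le (hF.hq e) (hP.const D)
  set Y : Set S := {s | ‖q e s‖ ≤ ‖D‖} with hYdef
  obtain ⟨c, hc⟩ : ∃ c : ℤ_[p], (c : Qp) = -ϖ ^ (M' - 1) / D :=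
    ⟨⟨-ϖ ^ (M' - 1) / D, by
      rw [norm_div, norm_neg, ← norm_div]
      exact Cell.norm_ratio ((norm_pow_anti (by omega)).trans hn.le)⟩, rfl⟩
  have hη : (β.X ∩ Y).indicator (fun s => - q e s / D) ∈ hP.Rc :=
    hP.restrict_Rc (hP.div (hP.neg (hF.hq e)) (hP.const D)) (hP.def_inter β.hX hY) (fun s hs => by
      show ‖- q e s / D‖ ≤ 1
      rw [norm_div, norm_neg, ← norm_div]; exact Cell.norm_ratio hs.2)
  obtain ⟨v0, hv0, hv0e⟩ := solve hP hB hFG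
    (fun n => (algebraMap ℤ_[p] B c) • Polynomial.hasseDeriv e (P n)) hη
  set κ : S → Qp → Qp := serv B (fun n => Polynomial.hasseDeriv e (P n)) with hκ
  have hφ : ∀ s ∈ β.X ∩ Y, q e s + D * v0 s + p ^ M' * κ s (v0 s) = 0 := by
    intro s hs
    have h1 := hv0e s
    rw [serv_smul, hc, indicator_of_mem hs] at h1
    generalize hk : κ s (v0 s) = k
    have h1' : v0 s = -q e s / D + p * (-p ^ (M' - 1) / D * k) := by rw [← hk]; exact h1
    have h2 : D * v0 s = - q e s - p * p ^ (M' - 1) * k := by rw [h1']; field_simp; ring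
    have : ϖ ^ M' = p * p ^ (M' - 1) := by rw [← pow_succ', Nat.sub_add_cancel (by omega)]
    rw [this, h2]; ring
  -- from a sphere to a lower degree
  have hsphere : (∃ θ ∈ R, {z : S × Qp | θ z.1 ≠ 0 ∧ ‖z.2 - (β.γ z.1 + β.ρ z.1 * v0 z.1)‖ = ‖θ z.1‖} ∈ U) →
      Good hP N U F c0 := by
    rintro ⟨θ, hθ, hθU⟩
    obtain ⟨n1, hn1⟩ := ultra_res U (fun z => (z.2 - (β.γ z.1 + β.ρ z.1 * v0 z.1)) / θ z.1)
      (Filter.mem_of_superset hθU (fun z hz => Cell.norm_ratio hz.2.le)) n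
    have hn11 : ‖(n1 : Qp)‖ = 1 := by
      obtain ⟨z, hz1, hz2⟩ := U.nonempty_of_mem (Filter.inter_mem hθU hn1)
      rw [mem_ofPred_eq] at hz1 hz2
      have h1 : ‖(z.2 - (β.γ z.1 + β.ρ z.1 * v0 z.1)) / θ z.1‖ = 1 := by
        rw [norm_div, hz1.2, div_self (norm_ne_zero_iff.2 hz1.1)]
      have h2 := norm_add_left (a := (z.2 - (β.γ z.1 + β.ρ z.1 * v0 z.1)) / θ z.1)
        (b := -((z.2 - (β.γ z.1 + β.ρ z.1 * v0 z.1)) / θ z.1 - n1)) (by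
        rw [norm_neg, h1]
        refine hz2.trans_lt ?_
        rw [norm_pow]
        exact pow_lt_one₀ (norm_nonneg _) norm_p_lt_one hn0.ne')
      rw [h1] at h2
      rw [← h2]; congr 1; ring
    set Y' : Set S := Y ∩ {s | θ s ≠ 0} ∩ {s | ‖θ s‖ ≤ ‖β.ρ s‖} with hY'
    have hY'd : Def R Y' := hP.def_inter (hP.def_inter hY (hP.def_ne hθ)) (hP.def_le hθ β.hρ)
    have hσR : (fun s => θ s / β.ρ s) ∈ R := hP.div hθ β.hρ
    have hvR : (fun s => v0 s + θ s / β.ρ s * n1) ∈ R := hP.add hv0.1 (hP.mul hσR (hP.const _))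
    have hσ2R : (fun s => θ s / β.ρ s * ϖ ^ n) ∈ R := hP.mul hσR (hP.const _)
    have hσ1 : ∀ s ∈ β.X ∩ Y', ‖θ s / β.ρ s‖ ≤ 1 := fun s hs => Cell.norm_ratio hs.2.2
    have hσ0 : ∀ s ∈ β.X ∩ Y', θ s / β.ρ s ≠ 0 := fun s hs => div_ne_zero hs.2.1.2 (β.hρ0 s hs.1)
    have hv1 : ∀ s ∈ β.X ∩ Y', ‖v0 s + θ s / β.ρ s * n1‖ ≤ 1 := fun s hs =>
      norm_add_le_one (hv0.2 s) (norm_mul_le_one (hσ1 s hs) (norm_nat_le _))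
    have hσ20 : ∀ s ∈ β.X ∩ Y', θ s / β.ρ s * ϖ ^ n ≠ 0 := fun s hs => mul_ne_zero (hσ0 s hs) hpn
    obtain ⟨r', q', H', h2, h3⟩ := h Y' hY'd _ _ hvR hσ2R hσ20 n hv1
      (fun s hs => by rw [norm_mul]; exact mul_le_of_le_one_left (norm_nonneg _) (hσ1 s hs))
    obtain ⟨r₂, q₂, H₂, h4⟩ := Ball.Form.lower h2 (by
      intro s hs
      have h5 := h3 e rfl s hs
      have h6 := hφ s ⟨hs.1, hs.2.1.1⟩
      have h7 : q e s + D * (v0 s + θ s / β.ρ s * n1) + p ^ M' * κ s (v0 s + θ s / β.ρ s * n1) =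
          D * (θ s / β.ρ s * n1) + p ^ M' * (κ s (v0 s + θ s / β.ρ s * n1) - κ s (v0 s)) := by
        linear_combination h6
      rw [h7, norm_add_left, norm_mul, norm_mul D, norm_mul, norm_mul, hn11, mul_one] at h5
      · have h8 := norm_pos_iff.2 (hσ0 s hs)
        by_contra h9
        have h10 : ‖q' e s‖ * (‖θ s / β.ρ s‖ * ‖ϖ ^ n‖) < ‖D‖ * ‖θ s / β.ρ s‖ :=
          lt_of_le_of_lt (mul_le_of_le_one_left (by positivity) (not_lt.1 h9)) (by
            rw [mul_comm]; exact mul_lt_mul_of_pos_right hn h8)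
        exact h10.ne h5
      · have h8 := serv_lip hB1 (fun n => Polynomial.hasseDeriv e (P n)) s (hv1 s hs) (hv0.2 s)
        rw [add_sub_cancel_left] at h8
        rw [norm_mul, norm_mul D]
        refine lt_of_le_of_lt (mul_le_mul_of_nonneg_left h8 (norm_nonneg _)) (mul_lt_mul_of_pos_right hMD ?_)
        rw [norm_mul, hn11, mul_one]; exact norm_pos_iff.2 (hσ0 s hs))
    refine ih _ 1 _ _ _ ?_ one_pos h4
    filter_upwards [hβ, hq', hθU, hn1] with z hz hz1 hz2 hz3
    have hρ := β.hρ0 _ hz.1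
    have hx : z.2 - (β.γ z.1 + β.ρ z.1 * v0 z.1) = β.ρ z.1 * (β.w z - v0 z.1) := by
      rw [mul_sub, ← Ball.w_mul hz]; ring
    have hθρ : ‖θ z.1‖ ≤ ‖β.ρ z.1‖ := by
      rw [← hz2.2, hx, norm_mul]
      refine mul_le_of_le_one_right (norm_nonneg _) ?_
      rw [sub_eq_add_neg]
      exact norm_add_le_one (Ball.w_norm hz) (by rw [norm_neg]; exact hv0.2 _)
    refine Ball.mem_sub hz ⟨⟨hz1, hz2.1⟩, hθρ⟩ ?_
    have e1 : β.w z - (v0 z.1 + θ z.1 / β.ρ z.1 * n1) =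
        θ z.1 / β.ρ z.1 * ((z.2 - (β.γ z.1 + β.ρ z.1 * v0 z.1)) / θ z.1 - n1) := by
      rw [hx]; have := hz2.1; field_simp; ring
    show ‖β.w z - (v0 z.1 + θ z.1 / β.ρ z.1 * n1)‖ ≤ ‖θ z.1 / β.ρ z.1 * ϖ ^ n‖
    rw [e1, norm_mul, norm_mul]
    exact mul_le_mul_of_nonneg_left hz3 (norm_nonneg _)
  obtain ⟨r', q', H', h2, -⟩ := h Y hY v0 (fun _ => 1) hv0.1 (hP.const _) (fun s _ => one_ne_zero) 0
    (fun s _ => hv0.2 s) (fun s _ => by simp)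
  have hset : (β.sub hP hY hv0.1 (hP.const 1) (fun s _ => one_ne_zero)).set ∈ U := by
    filter_upwards [hβ, hq'] with z hz hz1
    refine Ball.mem_sub hz hz1 ?_
    rw [norm_one, sub_eq_add_neg]
    exact norm_add_le_one (Ball.w_norm hz) (by rw [norm_neg]; exact hv0.2 _)
  set β' := β.sub hP hY hv0.1 (hP.const 1) (fun s _ => one_ne_zero) with hβ'
  rcases Ball.cellAB hP hgen N β' hset hc0 with ⟨C, hC, hin, hpr⟩ | hs
  swap
  · exact hsphere hs
  let m : ℤ → S → Qp := fun k => r' * q' k.toNat * β'.ρ ^ (-k)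
  let u : ℤ → Fn S := fun k => if k = ((e + 1 : ℕ) : ℤ) then fun z => 1 + p ^ (M' + 0) * (β'.w z * H' z) else fun _ => 1
  have hsum : ∀ z ∈ C.set, F z = ∑ k ∈ (range (e + 2)).map Nat.castEmbedding, m k z.1 * C.x z ^ k * u k z := by
    intro z hz
    have hz' := hin.set hz
    have hρ := β'.hρ0 _ hz'.1
    rw [h2.eq z hz', Finset.sum_map, hin.x z]
    have hw := Ball.w_mul hz'
    have hterm : ∀ j : ℕ, r' z.1 * q' j z.1 * β'.w z ^ j = m (j : ℤ) z.1 * (z.2 - β'.γ z.1) ^ (j : ℤ) := by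
      intro j
      show _ = r' z.1 * q' (j : ℤ).toNat z.1 * β'.ρ z.1 ^ (-(j : ℤ)) * _
      rw [hw, Int.toNat_natCast, zpow_neg, zpow_natCast, zpow_natCast, mul_pow]
      field_simp
    rw [sum_range_succ, sum_range_succ _ (e + 1), mul_add, mul_add, mul_sum, add_assoc]
    congr 1
    · refine sum_congr rfl (fun j hj => ?_)
      have hj' : ((j : ℕ) : ℤ) ≠ ((e + 1 : ℕ) : ℤ) := by
        have := mem_range.1 hj; exact_mod_cast this.ne
      simp only [Nat.castEmbedding_apply, u, if_neg hj', mul_one]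
      rw [← hterm j]; ring
    · simp only [Nat.castEmbedding_apply, u, if_true]
      rw [← hterm (e + 1), h2.q1 _ hz'.1]; ring
  rcases Cell.dom hR (N := N) m (fun k => hP.mul (hP.mul h2.hr (h2.hq _)) (hP.zpow β'.hρ _))
    ((range (e + 2)).map Nat.castEmbedding) C hC u (by
      intro k _
      by_cases hk : k = ((e + 1 : ℕ) : ℤ)
      · simp only [u, if_pos hk]; exact Ball.finish hin h2 (by omega)
      · simp only [u, if_neg hk]; exact Cell.IsU.one) with ⟨θ, hθ, hθ'⟩ | ⟨C', hs, hC', h⟩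
  · refine hsphere ⟨θ, hθ, ?_⟩
    filter_upwards [hθ'] with z hz
    rw [hin.x z] at hz
    exact hz
  · refine ⟨C', hC', ?_, hs.ext.prep hN hpr⟩
    have hsub := (hs.sub (hR := hP)).set
    rcases h with h | ⟨k, _, hk, v, hv, h⟩
    · exact .inl (fun z hz => by rw [hsum z (hsub hz), h z hz])
    · refine .inr ⟨m k, hP.mul (hP.mul h2.hr (h2.hq _)) (hP.zpow β'.hρ _), hk, k, v, hv, fun z hz => ?_⟩
      rw [hsum z (hsub hz), h z hz, hs.x]

theorem Ball.good (hR : Rich R) (hN : 0 < N) (hgen : Gen R U)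
    {c0 : S → Qp} (hc0 : c0 ∈ R) (d : ℕ) :
    ∀ (β : Ball R) (M : ℕ) (r : S → Qp) (q : ℕ → S → Qp) (H : Fn S), β.set ∈ U → 0 < M →
      β.Form hR.pre d M F r q H → Good hR.pre N U F c0 := by
  induction d with
  | zero => intro β M r q H hβ hM hF; exact Ball.good_zero hR.pre hgen β hβ hc0 hM hF
  | succ e ih => exact Ball.good_succ hR hN hgen hc0 e ih

end BallInd

/-! ### Part 20 : preparation of elements of `T` -/

section MainPrep
variable {S : Type*} {R : Set (S → ℚ_[p])} {U : Ultrafilter (S × ℚ_[p])} {N : ℕ}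

def Ball.res (β : Ball R) (hR : PreRich R) {Y : Set S} (hY : Def R Y) : Ball R :=
  { β with X := β.X ∩ Y, hX := hR.def_inter β.hX hY, hρ0 := fun s hs => β.hρ0 s hs.1 }

lemma Ball.res_T {β : Ball R} {hR : PreRich R} {Y : Set S} (hY : Def R Y) {f : Fn S}
    (hf : f ∈ β.T hR) : f ∈ (β.res hR hY).T hR :=
  TA_subst (Ball.bdd hR) (C := β.set) (C' := (β.res hR hY).set)
    (fun z (hz : z ∈ (β.res hR hY).set) => (⟨hz.1.1, hz.2⟩ : z ∈ β.set)) (fun _ hd => TA_of_mem hd) hf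

lemma Ball.good_T (hR : Rich R) (hN : 0 < N) (hgen : Gen R U)
    {c0 : S → Qp} (hc0 : c0 ∈ R) (β : Ball R) (hβ : β.set ∈ U) {G : Fn S}
    (hG : G ∈ β.T hR.pre) : Good hR.pre N U G c0 := by
  classical
  have hP := hR.pre
  obtain ⟨D, g, E, hg, hE, e⟩ := lemmaH (C := β.set) hR.pre (fun z hz => Ball.w_norm hz) hG 1
  by_cases h0 : {z : S × Qp | ∀ j ∈ range D, z.1 ∈ {s | g j s = 0}} ∈ U
  · have hY : Def R {s | ∀ j ∈ range D, s ∈ {s | g j s = 0}} :=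
      hP.def_finset _ _ (fun j _ => hP.def_eq (hg j).1 hP.zero)
    have hβ' : (β.res hP hY).set ∈ U := by
      filter_upwards [hβ, h0] with z hz hz0
      exact ⟨⟨hz.1, hz0⟩, hz.2⟩
    have hF : (β.res hP hY).Form hP 0 1 ((β.res hP hY).set.indicator 1) 1 (fun _ => 1) (fun _ => 0) :=
      ⟨hP.one, fun _ _ => one_ne_zero, fun _ => hP.one, fun _ _ => rfl, Ball.T_const hP (by simp),
        fun z hz => by rw [indicator_of_mem hz]; simp⟩
    obtain ⟨C, hC, h1, h2⟩ := Ball.good hR hN hgen hc0 0 _ _ _ _ _ hβ' one_pos hF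
    refine ⟨C, hC, .inl (fun z hz => ?_), h2⟩
    have h3 : C.Pr hP N ((β.res hP hY).set.indicator 1) := by
      rcases h1 with h1 | h1
      · obtain ⟨z, hz, hz'⟩ := U.nonempty_of_mem (Filter.inter_mem hC hβ')
        have := h1 z hz
        rw [indicator_of_mem hz'] at this
        exact absurd this one_ne_zero
      · exact h1
    have h4 : z ∈ (β.res hP hY).set := by
      by_contra hn
      exact h3.ne hN hz (indicator_of_notMem hn _)
    have h5 : ∀ j ∈ range D, g j z.1 = 0 := h4.1.2
    rw [e z ⟨h4.1.1, h4.2⟩, Finset.sum_eq_zero (fun j hj => by rw [h5 j hj, zero_mul]),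
      Finset.sum_eq_zero (fun j hj => by rw [h5 j hj, zero_mul]), mul_zero, add_zero]
  · let B : ℕ → ℕ → Set S := fun d j => if j ≤ d then {s | ‖g j s‖ ≤ ‖g d s‖} else {s | ‖g j s‖ < ‖g d s‖}
    let Y : ℕ → Set S := fun d => {s | g d s ≠ 0} ∩ {s | ∀ j ∈ range D, s ∈ B d j}
    obtain ⟨d, hd, hdU⟩ := ultra_finset U (range D) (fun d => {z : S × Qp | z.1 ∈ Y d}) (by
      filter_upwards [compl_umem h0] with z hz
      rw [Set.mem_compl_iff, mem_ofPred_eq] at hz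
      push Not at hz
      obtain ⟨j, hj, hj0⟩ := hz
      obtain ⟨d, hd, hmax⟩ := Finset.exists_max_image (range D) (fun j => toLex (‖g j z.1‖, j)) ⟨j, hj⟩
      have hle : ∀ j ∈ range D, ‖g j z.1‖ < ‖g d z.1‖ ∨ ‖g j z.1‖ = ‖g d z.1‖ ∧ j ≤ d := by
        intro j hj
        have := hmax j hj
        rwa [Prod.Lex.toLex_le_toLex] at this
      refine ⟨d, hd, ?_, fun i hi => ?_⟩
      · intro hd0
        apply hj0
        rcases hle j hj with h | h
        · rw [hd0, norm_zero] at h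
          exact absurd h (not_lt.2 (norm_nonneg _))
        · rw [hd0, norm_zero] at h
          exact norm_eq_zero.1 h.1
      · show z.1 ∈ (if i ≤ d then {s | ‖g i s‖ ≤ ‖g d s‖} else {s | ‖g i s‖ < ‖g d s‖})
        split_ifs with hid
        · exact (hle i hi).elim le_of_lt (fun h => h.1.le)
        · exact (hle i hi).elim id (fun h => absurd h.2 hid))
    rw [mem_range] at hd
    have hY : Def R (Y d) := by
      refine hP.def_inter (hP.def_ne (hg d).1) (hP.def_finset _ _ (fun j _ => ?_))
      show Def R (if j ≤ d then _ else _)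
      split_ifs
      · exact hP.def_le (hg j).1 (hg d).1
      · exact hP.def_lt (hg j).1 (hg d).1
    have hβ' : (β.res hP hY).set ∈ U := by
      filter_upwards [hβ, hdU] with z hz hz0
      exact ⟨⟨hz.1, hz0⟩, hz.2⟩
    obtain ⟨k, rfl⟩ : ∃ k, D = d + 1 + k := ⟨D - (d + 1), by omega⟩
    have hle : ∀ j < d + 1 + k, ∀ s ∈ Y d, ‖g j s / g d s‖ ≤ 1 := by
      intro j hj s hs
      apply Cell.norm_ratio
      have : s ∈ (if j ≤ d then {s | ‖g j s‖ ≤ ‖g d s‖} else {s | ‖g j s‖ < ‖g d s‖}) := hs.2 j (mem_range.2 hj)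
      split_ifs at this
      · exact this
      · exact le_of_lt this
    have hlt : ∀ j < k, ∀ s ∈ Y d, ‖g (d + 1 + j) s / g d s / p‖ ≤ 1 := by
      intro j hj s hs
      have : s ∈ (if (d + 1 + j) ≤ d then {s | ‖g (d + 1 + j) s‖ ≤ ‖g d s‖} else {s | ‖g (d + 1 + j) s‖ < ‖g d s‖}) :=
        hs.2 _ (mem_range.2 (by omega))
      rw [if_neg (by omega)] at this
      have h1 : ‖g (d + 1 + j) s / g d s‖ < 1 := by
        rw [norm_div, div_lt_one (norm_pos_iff.2 hs.1)]; exact this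
      apply Cell.norm_ratio
      rw [Padic.norm_p]
      have := (Padic.norm_le_pow_iff_norm_lt_pow_add_one (g (d + 1 + j) s / g d s) (-1)).2 (by simpa using h1)
      simpa using this
    let q : ℕ → S → Qp := fun j s => g j s / g d s
    have hq : ∀ j, q j ∈ R := fun j => hP.div (hg j).1 (hg d).1
    have hF : (β.res hP hY).Form hP d 1 G (g d) q (fun z =>
        ∑ j ∈ range k, q (d + 1 + j) z.1 / p * (β.res hP hY).w z ^ j +
        (β.res hP hY).w z ^ k * ∑ j ∈ range (d + 1 + k), q j z.1 * E j z) := by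
      refine ⟨(hg d).1, fun s hs => hs.2.1, hq, fun s hs => div_self hs.2.1, ?_, ?_⟩
      · refine Ball.T_add (Ball.T_sum _ _ (fun j hj => ?_)) (Ball.T_mul (Ball.T_pow (Ball.T_w hP) _)
          (Ball.T_sum _ _ (fun j hj => ?_)))
        · exact Ball.T_mul (Ball.T_base hP (hP.div (hq _) (hP.const p))
            (fun s hs => hlt j (mem_range.1 hj) s hs.2)) (Ball.T_pow (Ball.T_w hP) j)
        · exact Ball.T_mul (Ball.T_base hP (hq _) (fun s hs => hle j (mem_range.1 hj) s hs.2))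
            (Ball.res_T hY (hE j))
      · intro z hz
        have hw : (β.res hP hY).w z = β.w z := rfl
        have hd0 : g d z.1 ≠ 0 := hz.1.2.1
        have hgq : ∀ j, g j z.1 = g d z.1 * q j z.1 := fun j => (mul_div_cancel₀ _ hd0).symm
        rw [e z ⟨hz.1.1, hz.2⟩, hw, Finset.sum_range_add]
        have e1 : ∑ j ∈ range (d + 1), g j z.1 * β.w z ^ j =
            g d z.1 * ∑ j ∈ range (d + 1), q j z.1 * β.w z ^ j := by
          rw [mul_sum]; exact sum_congr rfl (fun j _ => by rw [hgq j]; ring)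
        have e2 : ∑ j ∈ range k, g (d + 1 + j) z.1 * β.w z ^ (d + 1 + j) =
            g d z.1 * (p * β.w z ^ (d + 1) * ∑ j ∈ range k, q (d + 1 + j) z.1 / p * β.w z ^ j) := by
          rw [mul_sum, mul_sum]
          refine sum_congr rfl (fun j _ => ?_)
          rw [hgq (d + 1 + j), pow_add _ (d + 1) j]
          have := pK_ne (p := p)
          field_simp
        have e3 : ∑ j ∈ range (d + 1 + k), g j z.1 * E j z =
            g d z.1 * ∑ j ∈ range (d + 1 + k), q j z.1 * E j z := by
          rw [mul_sum]; exact sum_congr rfl (fun j _ => by rw [hgq j]; ring)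
        rw [e1, e2, e3]
        ring
    exact Ball.good hR hN hgen hc0 d _ _ _ _ _ hβ' one_pos hF

end MainPrep

/-! ### Part 21 : preparation on cells -/

section MainPrep
variable {S : Type*} {R : Set (S → ℚ_[p])} {U : Ultrafilter (S × ℚ_[p])} {N : ℕ}

lemma Cell.good_sphere (hR : Rich R) (hN : 0 < N) (hgen : Gen R U)
    (C : Cell R) (hC : C.set ∈ U) {θ : S → Qp} (hθ : θ ∈ R)
    (h : {z : S × Qp | θ z.1 ≠ 0 ∧ ‖C.x z‖ = ‖θ z.1‖} ∈ U) {G : Fn S}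
    (hG : G ∈ C.T hR.pre) : Good hR.pre N U G C.c := by
  have hP := hR.pre
  obtain ⟨n0, hn0⟩ := ultra_res U (fun z => C.x z / θ z.1) (by
    filter_upwards [h] with z hz
    exact Cell.norm_ratio hz.2.le) 1
  simp only [pow_one] at hn0
  have hp1 : ‖ϖ‖ < 1 := norm_p_lt_one
  have hn1 : ‖(n0 : Qp)‖ = 1 := by
    obtain ⟨z, hz, hz'⟩ := U.nonempty_of_mem (Filter.inter_mem h hn0)
    have h1 : ‖C.x z / θ z.1‖ = 1 := by rw [norm_div, hz.2, div_self (norm_ne_zero_iff.2 hz.1)]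
    have h2 : ‖C.x z / θ z.1 + -(C.x z / θ z.1 - n0)‖ = ‖C.x z / θ z.1‖ :=
      norm_add_left (by rw [norm_neg, h1]; exact lt_of_le_of_lt hz' hp1)
    rw [h1] at h2
    rw [← h2]; congr 1; ring
  have hn00 : (n0 : Qp) ≠ 0 := by rw [← norm_ne_zero_iff, hn1]; exact one_ne_zero
  let β : Ball R := ⟨C.X ∩ ({s | θ s ≠ 0} ∩ ({s | ‖C.a s‖ ≤ ‖θ s‖} ∩ {s | ‖C.b s * θ s‖ ≤ 1})),
    fun s => C.c s + θ s * n0, fun s => θ s * p,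
    hP.def_inter C.hX (hP.def_inter (hP.def_ne hθ) (hP.def_inter (hP.def_le C.ha hθ)
      (hP.def_le_one (hP.mul C.hb hθ)))), hP.add C.hc (hP.mul hθ (hP.const _)), hP.mul hθ (hP.const _),
    fun s hs => mul_ne_zero hs.2.1 pK_ne⟩
  have hx : ∀ z ∈ β.set, C.x z = θ z.1 * (n0 * (1 + p ^ 1 * ((n0 : Qp)⁻¹ * β.w z))) := by
    intro z hz
    have := Ball.w_mul hz
    have e : C.x z = (z.2 - β.γ z.1) + θ z.1 * n0 := by
      show z.2 - C.c z.1 = z.2 - (C.c z.1 + θ z.1 * n0) + θ z.1 * n0; ring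
    rw [e, this]
    show θ z.1 * p * β.w z + _ = _
    field_simp
    ring
  have hV : (fun z => (n0 : Qp)⁻¹ * β.w z) ∈ β.T hP :=
    Ball.T_mul (Ball.T_const hP (by rw [norm_inv, hn1, inv_one])) (Ball.T_w hP)
  obtain ⟨V, hV', hVe⟩ := TA_inv (Ball.bdd hP) hV one_pos
  have hxn : ∀ z ∈ β.set, ‖C.x z‖ = ‖θ z.1‖ := by
    intro z hz
    rw [hx z hz, norm_mul, norm_mul, hn1, norm_one_add_p one_pos (Ball.T_norm hV hz)]; ring
  have hsub : β.set ⊆ C.set := by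
    intro z hz
    have h1 := hxn z hz
    refine ⟨hz.1.1, ?_, ?_, ?_⟩
    · rw [← norm_ne_zero_iff, h1, norm_ne_zero_iff]; exact hz.1.2.1
    · rw [h1]; exact hz.1.2.2.1
    · rw [norm_mul, h1, ← norm_mul]; exact hz.1.2.2.2
  refine Ball.good_T hR hN hgen C.hc β ?_ ?_
  · filter_upwards [hC, h, hn0] with z hz hz1 hz2
    refine ⟨⟨hz.1, hz1.1, hz.2.2.1.trans hz1.2.le, ?_⟩, ?_⟩
    · have := hz.2.2.2
      rw [norm_mul, hz1.2, ← norm_mul] at this; exact this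
    · show ‖z.2 - (C.c z.1 + θ z.1 * n0)‖ ≤ ‖θ z.1 * p‖
      have e : z.2 - (C.c z.1 + θ z.1 * n0) = θ z.1 * (C.x z / θ z.1 - n0) := by
        have := hz1.1
        show _ = θ z.1 * ((z.2 - C.c z.1) / θ z.1 - n0)
        field_simp; ring
      rw [e, norm_mul, norm_mul]
      exact mul_le_mul_of_nonneg_left hz2 (norm_nonneg _)
  · refine TA_subst (Ball.bdd hP) hsub (fun d hd => ?_) hG
    have : C.A hP ≤ TAlg β.set (Dg hP.Rc {β.w}) (Ball.bdd hP) := Dg_le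
      (fun r hr => TA_of_mem (pull_mem_Dg hr)) (by
      rintro u (rfl | rfl)
      · refine Ball.T_congr (Ball.T_mul (Ball.T_base hP (hP.mul C.hb hθ) (fun s hs => hs.2.2.2))
          (Ball.T_mul (Ball.T_const hP hn1.le) (Ball.T_add (Ball.T_const hP (c := 1) (by simp))
          (Ball.T_mul (Ball.T_const hP (norm_pow_p_le_one 1)) hV)))) (fun z hz => ?_)
        show C.b z.1 * C.x z = C.b z.1 * θ z.1 * _
        rw [hx z hz]; ring
      · refine Ball.T_congr (Ball.T_mul (Ball.T_base hP (hP.div C.ha hθ) (fun s hs => Cell.norm_ratio hs.2.2.1))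
          (Ball.T_mul (Ball.T_const hP (c := (n0 : Qp)⁻¹) (by rw [norm_inv, hn1, inv_one]))
          (Ball.T_add (Ball.T_const hP (c := 1) (by simp))
          (Ball.T_mul (Ball.T_const hP (norm_pow_p_le_one 1)) hV')))) (fun z hz => ?_)
        show C.a z.1 * (C.x z)⁻¹ = C.a z.1 / θ z.1 * _
        rw [hx z hz, ← hVe z hz, mul_inv, mul_inv]; ring)
    exact this hd

lemma Cell.T_sub_gen {C : Cell R} {hP : PreRich R} {w : Fn S}
    (hw : w ∈ ({C.w, C.w'} : Set (Fn S)))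
    {F : Fn S} (hF : F ∈ TA C.set (Dg hP.Rc {w})) : F ∈ C.T hP :=
  TA_subst (Cell.bdd hP) subset_rfl
    (fun _ hd => TA_of_mem (Dg_mono le_rfl (Set.singleton_subset_iff.2 hw) hd)) hF

theorem Cell.mainT (hR : Rich R) (hN : 0 < N) (hgen : Gen R U)
    (C : Cell R) (hC : C.set ∈ U) {G : Fn S} (hG : G ∈ C.T hR.pre) :
    ∃ C' : Cell R, C'.set ∈ U ∧ C.Ext C' hR.pre N ∧ C'.Prep hR.pre N G := by
  classical
  have hP := hR.pre
  have hrY : Def R {s | ‖(C.b * C.a) s‖ ≤ 1} := hP.def_le_one (hP.mul C.hb C.ha)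
  obtain ⟨F₁, hF₁, F₂, hF₂, hsplit⟩ := split_two (C := C.set) hP (fun z hz => Cell.w_norm hz) (fun z hz => Cell.w'_norm hz)
    (hP.restrict_Rc (hP.mul C.hb C.ha) hrY (fun s hs => hs)) (fun z hz => by
      have e : C.w z * C.w' z = (C.b * C.a) z.1 := by
        have := hz.2.1
        show C.b z.1 * C.x z * (C.a z.1 * (C.x z)⁻¹) = C.b z.1 * C.a z.1
        field_simp
      rw [e, indicator_of_mem]
      show ‖(C.b * C.a) z.1‖ ≤ 1
      rw [← e]; exact norm_mul_le_one (Cell.w_norm hz) (Cell.w'_norm hz)) hG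
  obtain ⟨D, g, E, hg, hE, e₁⟩ := lemmaH (C := C.set) hP (fun z hz => Cell.w_norm hz) hF₁ N
  obtain ⟨D', g', E', hg', hE', e₂⟩ := lemmaH (C := C.set) hP (fun z hz => Cell.w'_norm hz) hF₂ N
  let m : ℤ → S → Qp := fun k => match k with
    | Int.ofNat j => fun s => g j s * C.b s ^ j
    | Int.negSucc j => fun s => g' j s * C.a s ^ (j + 1)
  let u : ℤ → Fn S := fun k => match k with
    | Int.ofNat j => fun z => 1 + p ^ N * (C.w z ^ (D - j) * E j z)
    | Int.negSucc j => fun z => 1 + p ^ N * (C.w' z ^ (D' - j) * E' j z)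
  let i₁ : ℕ ↪ ℤ := ⟨Int.ofNat, fun a b h => Int.ofNat.inj h⟩
  let i₂ : ℕ ↪ ℤ := ⟨Int.negSucc, fun a b h => Int.negSucc.inj h⟩
  let EE : Finset ℤ := (range D).map i₁ ∪ (range D').map i₂
  have hm : ∀ k, m k ∈ R := by
    rintro (j | j)
    · exact hP.mul (hg j).1 (hP.pow C.hb j)
    · exact hP.mul (hg' j).1 (hP.pow C.ha (j + 1))
  have hu : ∀ k ∈ EE, C.IsU hP N (u k) := by
    rintro (j | j) -
    · exact ⟨_, Cell.T_mul (Cell.T_pow (Cell.T_w hP) (D - j)) (Cell.T_sub_gen (by simp) (hE j)), fun z _ => rfl⟩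
    · exact ⟨_, Cell.T_mul (Cell.T_pow (Cell.T_w' hP) (D' - j)) (Cell.T_sub_gen (by simp) (hE' j)), fun z _ => rfl⟩
  have key : ∀ z ∈ C.set, G z = ∑ k ∈ EE, m k z.1 * C.x z ^ k * u k z := by
    intro z hz
    have hx := hz.2.1
    rw [Finset.sum_union, Finset.sum_map, Finset.sum_map, hsplit z hz, e₁ z hz, e₂ z hz]
    · congr 1
      · rw [mul_sum, ← Finset.sum_add_distrib]
        refine sum_congr rfl (fun j hj => ?_)
        show _ = g j z.1 * C.b z.1 ^ j * C.x z ^ (j : ℤ) * (1 + p ^ N * (C.w z ^ (D - j) * E j z))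
        have e1 : C.w z ^ D = C.w z ^ j * C.w z ^ (D - j) := by
          rw [← pow_add]; congr 1; have := mem_range.1 hj; omega
        have e2 : C.b z.1 ^ j * C.x z ^ (j : ℤ) = C.w z ^ j := by
          rw [zpow_natCast, ← mul_pow]; rfl
        rw [e1, mul_assoc (g j z.1), e2]; ring
      · rw [mul_sum, ← Finset.sum_add_distrib, mul_sum]
        refine sum_congr rfl (fun j hj => ?_)
        show _ = g' j z.1 * C.a z.1 ^ (j + 1) * C.x z ^ (Int.negSucc j) * (1 + p ^ N * (C.w' z ^ (D' - j) * E' j z))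
        have e1 : C.w' z ^ D' = C.w' z ^ j * C.w' z ^ (D' - j) := by
          rw [← pow_add]; congr 1; have := mem_range.1 hj; omega
        have e2 : C.a z.1 ^ (j + 1) * C.x z ^ (Int.negSucc j) = C.w' z ^ (j + 1) := by
          rw [zpow_negSucc, ← inv_pow, ← mul_pow]; rfl
        rw [e1, mul_assoc (g' j z.1), e2]; ring
    · rw [Finset.disjoint_left]
      intro k hk hk'
      rw [Finset.mem_map] at hk hk'
      obtain ⟨a, _, ha⟩ := hk
      obtain ⟨b, _, hb⟩ := hk'
      have : Int.ofNat a = Int.negSucc b := ha.trans hb.symm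
      cases this
  rcases Cell.dom hR m hm EE C hC u hu with ⟨θ, hθ, h⟩ | ⟨C', hs, hC', h⟩
  · obtain ⟨C₁, hC₁, h1, h2⟩ := C.good_sphere hR hN hgen hC hθ h hG
    obtain ⟨C₂, hs, hC₂, he⟩ := Cell.toExt hR C C₁ hC hC₁ h2 hN
    exact ⟨C₂, hC₂, he, (hs.ext (hR := hP)).prep' hN h1⟩
  · refine ⟨C', hC', hs.ext, ?_⟩
    have hsub := (hs.sub (hR := hP)).set
    rcases h with h | ⟨k, hk, h0, v, hv, h⟩
    · exact .inl (fun z hz => (key z (hsub hz)).trans (h z hz))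
    · exact .inr ⟨m k, hm k, h0, k, v, hv, fun z hz => by rw [key z (hsub hz), h z hz, hs.x]⟩

/-- The functions for which the preparation applies. -/
def Cell.InA (C : Cell R) (hR : PreRich R) (f : Fn S) : Prop :=
  ∃ r ∈ R, ∃ k : ℤ, ∃ G ∈ C.T hR, ∀ z ∈ C.set, f z = r z.1 * C.x z ^ k * G z

theorem Cell.mainA (hR : Rich R) (hN : 0 < N) (hgen : Gen R U)
    (C : Cell R) (hC : C.set ∈ U) {f : Fn S} (hf : C.InA hR.pre f) :
    ∃ C' : Cell R, C'.set ∈ U ∧ C.Ext C' hR.pre N ∧ C'.Prep hR.pre N f := by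
  have hP := hR.pre
  obtain ⟨r, hr, k, G, hG, e⟩ := hf
  by_cases h0 : {z : S × Qp | z.1 ∈ {s | r s ≠ 0}} ∈ U
  · obtain ⟨C₁, hs, hC₁, h1⟩ := Cell.exists_res hP C hC (hP.def_ne hr) h0
    obtain ⟨C₂, hC₂, h2, h3⟩ := C₁.mainT hR hN hgen hC₁ ((hs.sub (hR := hP)).T G hG)
    refine ⟨C₂, hC₂, hs.ext.trans hN h2, ?_⟩
    have hx : C₂.Pr hP N C.x := by rw [← hs.x]; exact h2.pr
    have hsub : ∀ z ∈ C₂.set, z ∈ C.set := fun z hz => (hs.sub (hR := hP)).set (h2.set hz)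
    rcases h3 with h3 | h3
    · exact .inl (fun z hz => by rw [e z (hsub z hz), h3 z hz, mul_zero])
    · exact .inr ((((Cell.Pr.base hr (fun s hs => h1 (h2.X hs))).mul (hx.zpow hN k)).mul h3).congr
        (fun z hz => e z (hsub z hz)))
  · obtain ⟨C₁, hs, hC₁, h1⟩ := Cell.exists_res hP C hC (hP.def_eq hr hP.zero) (by
      filter_upwards [compl_umem h0] with z hz
      by_contra hn; exact hz hn)
    refine ⟨C₁, hC₁, hs.ext, .inl (fun z hz => ?_)⟩
    have : r z.1 = 0 := h1 hz.1
    rw [e z ((hs.sub (hR := hP)).set hz), this, zero_mul, zero_mul]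

end MainPrep

/-! ### Part 22 : simultaneous preparation -/

section PA
variable {S : Type*} {R : Set (S → ℚ_[p])} {U : Ultrafilter (S × ℚ_[p])} {N : ℕ}

lemma Cell.Prep.congr {C : Cell R} {hR : PreRich R} {f g : Fn S} (hf : C.Prep hR N f)
    (h : ∀ z ∈ C.set, g z = f z) : C.Prep hR N g :=
  hf.imp (fun h1 z hz => (h z hz).trans (h1 z hz)) (fun h1 => h1.congr h)

lemma Cell.add_prep (hR : Rich R) (hN : 0 < N) (hgen : Gen R U)
    (C : Cell R) (hC : C.set ∈ U) {f g : Fn S} (hf : C.Prep hR.pre N f) (hg : C.Prep hR.pre N g) :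
    ∃ C' : Cell R, C'.set ∈ U ∧ C.Ext C' hR.pre N ∧ C'.Prep hR.pre N (fun z => f z + g z) := by
  have hP := hR.pre
  have key : ∀ f g : Fn S, C.Pr hP N f → C.Pr hP N g → {z | ‖f z‖ ≤ ‖g z‖} ∈ U →
      ∃ C' : Cell R, C'.set ∈ U ∧ C.Ext C' hR.pre N ∧ C'.Prep hR.pre N (fun z => f z + g z) := by
    rintro f g ⟨h, hh, h0, ν, u, hu, e⟩ ⟨h', hh', h0', ν', u', hu', e'⟩ hle
    obtain ⟨C₁, hs, hC₁, h1⟩ := C.mono hR hC (r := h / h') (hP.div hh hh') (ν - ν') (by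
      filter_upwards [hC, hle] with z hz hz1
      rw [e z hz, e' z hz, norm_mul, norm_mul _ (u' z), hu.norm hN hz, hu'.norm hN hz, mul_one, mul_one] at hz1
      have := Cell.norm_ratio hz1
      rw [Pi.div_apply, zpow_sub₀ hz.2.1]
      convert this using 2
      have := h0' _ hz.1
      field_simp)
    have hsb := hs.sub (hR := hP)
    obtain ⟨C₂, hC₂, h2, h3⟩ := C₁.mainA hR hN hgen hC₁ (f := fun z => f z + g z)
      ⟨h', hh', ν', _, Cell.T_add (hsb.isU hu').mem (Cell.T_mul h1 (hsb.isU hu).mem), fun z hz => by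
        have hz' := hsb.set hz
        show f z + g z = h' z.1 * C₁.x z ^ ν' * (u' z + (h z.1 / h' z.1) * C.x z ^ (ν - ν') * u z)
        rw [e z hz', e' z hz', hs.x, zpow_sub₀ hz'.2.1]
        have := h0' _ hz'.1
        have := zpow_ne_zero ν' hz'.2.1
        field_simp
        ring⟩
    exact ⟨C₂, hC₂, hs.ext.trans hN h2, h3⟩
  rcases hf with hf | hf
  · exact ⟨C, hC, Cell.Ext.refl C, hg.congr (fun z hz => by show f z + g z = g z; rw [hf z hz, zero_add])⟩
  rcases hg with hg | hg
  · exact ⟨C, hC, Cell.Ext.refl C, .inr (hf.congr (fun z hz => by show f z + g z = f z; rw [hg z hz, add_zero]))⟩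
  by_cases h : {z | ‖f z‖ ≤ ‖g z‖} ∈ U
  · exact key f g hf hg h
  · obtain ⟨C', h1, h2, h3⟩ := key g f hg hf (by
      filter_upwards [compl_umem h] with z hz
      rw [Set.mem_compl_iff, mem_ofPred_eq, not_le] at hz
      exact hz.le)
    exact ⟨C', h1, h2, h3.congr (fun z _ => add_comm _ _)⟩

/-- functions that can be prepared -/
def PA (hR : PreRich R) (N : ℕ) (U : Ultrafilter (S × Qp)) (f : Fn S) : Prop :=
  ∀ C : Cell R, C.set ∈ U → ∃ C' : Cell R, C'.set ∈ U ∧ C.Ext C' hR N ∧ C'.Prep hR N f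

lemma PA.finset {hR : PreRich R} (hN : 0 < N) {ι : Type*} (F : Finset ι) {f : ι → Fn S}
    (hf : ∀ i ∈ F, PA hR N U (f i)) (C : Cell R) (hC : C.set ∈ U) :
    ∃ C' : Cell R, C'.set ∈ U ∧ C.Ext C' hR N ∧ ∀ i ∈ F, C'.Prep hR N (f i) := by
  classical
  induction F using Finset.induction_on with
  | empty => exact ⟨C, hC, Cell.Ext.refl C, by simp⟩
  | insert i F hi ih =>
    obtain ⟨C₁, h1, h2, h3⟩ := ih (fun j hj => hf j (mem_insert_of_mem hj))
    obtain ⟨C₂, h4, h5, h6⟩ := hf i (mem_insert_self _ _) C₁ h1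
    refine ⟨C₂, h4, h2.trans hN h5, fun j hj => ?_⟩
    rcases mem_insert.1 hj with rfl | hj
    · exact h6
    · exact h5.prep' hN (h3 j hj)

lemma PA.add (hR : Rich R) (hN : 0 < N) (hgen : Gen R U)
    {f g : Fn S} (hf : PA hR.pre N U f) (hg : PA hR.pre N U g) :
    PA hR.pre N U (fun z => f z + g z) := by
  intro C hC
  obtain ⟨C₁, h1, h2, h3⟩ := hf C hC
  obtain ⟨C₂, h4, h5, h6⟩ := hg C₁ h1
  obtain ⟨C₃, h7, h8, h9⟩ := C₂.add_prep hR hN hgen h4 (h5.prep' hN h3) h6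
  exact ⟨C₃, h7, (h2.trans hN h5).trans hN h8, h9⟩

lemma PA.mul {hR : PreRich R} (hN : 0 < N) {f g : Fn S} (hf : PA hR N U f) (hg : PA hR N U g) :
    PA hR N U (fun z => f z * g z) := by
  intro C hC
  obtain ⟨C₁, h1, h2, h3⟩ := hf C hC
  obtain ⟨C₂, h4, h5, h6⟩ := hg C₁ h1
  refine ⟨C₂, h4, h2.trans hN h5, ?_⟩
  rcases h5.prep' hN h3 with h | h
  · exact .inl (fun z hz => by show f z * g z = 0; rw [h z hz, zero_mul])
  rcases h6 with h' | h'
  · exact .inl (fun z hz => by show f z * g z = 0; rw [h' z hz, mul_zero])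
  exact .inr (h.mul h')

lemma PA.inv {hR : PreRich R} (hN : 0 < N) {f : Fn S} (hf : PA hR N U f) :
    PA hR N U (fun z => (f z)⁻¹) := by
  intro C hC
  obtain ⟨C₁, h1, h2, h3⟩ := hf C hC
  refine ⟨C₁, h1, h2, h3.imp (fun h z hz => by show (f z)⁻¹ = 0; rw [h z hz, inv_zero]) (fun h => ?_)⟩
  exact (h.zpow hN (-1)).congr (fun z _ => by rw [zpow_neg_one])

lemma PA.base {hR : PreRich R} {r : S → Qp} (hr : r ∈ R) : PA hR N U (fun z => r z.1) := by
  intro C hC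
  by_cases h0 : {z : S × Qp | z.1 ∈ {s | r s ≠ 0}} ∈ U
  · obtain ⟨C₁, hs, hC₁, h1⟩ := Cell.exists_res hR C hC (hR.def_ne hr) h0
    exact ⟨C₁, hC₁, hs.ext, .inr (Cell.Pr.base hr (fun s hs => h1 hs))⟩
  · obtain ⟨C₁, hs, hC₁, h1⟩ := Cell.exists_res hR C hC (hR.def_eq hr hR.zero) (by
      filter_upwards [compl_umem h0] with z hz
      by_contra hn; exact hz hn)
    exact ⟨C₁, hC₁, hs.ext, .inl (fun z hz => h1 hz.1)⟩

lemma PA.snd (hR : Rich R) (hN : 0 < N) (hgen : Gen R U) :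
    PA hR.pre N U (fun z => z.2) := by
  intro C hC
  obtain ⟨C₁, h1, h2, h3⟩ := PA.base (hR := hR.pre) C.hc C hC (N := N)
  obtain ⟨C₃, h7, h8, h9⟩ := C₁.add_prep hR hN hgen h1 h3 (.inr h2.pr)
  exact ⟨C₃, h7, h2.trans hN h8, h9.congr (fun z _ => by unfold Cell.x; ring)⟩

lemma Cell.bdd_T (hR : Rich R) (hN : 0 < N) (C : Cell R) (hC : C.set ∈ U) {ι : Type*} (F : Finset ι)
    {f : ι → Fn S} (hf : ∀ i ∈ F, C.Prep hR.pre N (f i)) (h : ∀ i ∈ F, {z | ‖f i z‖ ≤ 1} ∈ U) :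
    ∃ C' : Cell R, C'.set ∈ U ∧ C.Shrink C' ∧ ∀ i ∈ F, f i ∈ C'.T hR.pre := by
  classical
  have hP := hR.pre
  induction F using Finset.induction_on with
  | empty => exact ⟨C, hC, Cell.Shrink.refl C, by simp⟩
  | insert i F hi ih =>
    obtain ⟨C₁, h1, h2, h3⟩ := ih (fun j hj => hf j (mem_insert_of_mem hj))
      (fun j hj => h j (mem_insert_of_mem hj))
    suffices ∃ C' : Cell R, C'.set ∈ U ∧ C₁.Shrink C' ∧ f i ∈ C'.T hP by
      obtain ⟨C₂, h4, h5, h6⟩ := this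
      refine ⟨C₂, h4, h2.trans h5, fun j hj => ?_⟩
      rcases mem_insert.1 hj with rfl | hj
      · exact h6
      · exact h5.sub.T _ (h3 j hj)
    rcases (h2.ext (hR := hP)).prep' hN (hf i (mem_insert_self _ _)) with h4 | ⟨r, hr, h0, ν, u, hu, e⟩
    · exact ⟨C₁, h1, Cell.Shrink.refl _, Cell.T_congr (Cell.T_const hP (c := 0) (by simp)) h4⟩
    · obtain ⟨C₂, h5, h6, h7⟩ := C₁.mono hR h1 hr ν (by
        filter_upwards [h1, h i (mem_insert_self _ _)] with z hz hz1
        rwa [e z hz, norm_mul, hu.norm hN hz, mul_one] at hz1)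
      have hsb := h5.sub (hR := hP)
      exact ⟨C₂, h6, h5, Cell.T_congr (Cell.T_mul h7 (hsb.isU hu).mem) (fun z hz => e z (hsb.set hz))⟩

lemma PA.ranal (hR : Rich R) (hN : 0 < N) (hgen : Gen R U)
    {n : ℕ} {a : (Fin n → ℕ) → Qp} (ha : IsRestrictedCoeffs p a) {f : Fin n → Fn S}
    (hf : ∀ i, PA hR.pre N U (f i)) : PA hR.pre N U (fun z => ranalFn p a (fun i => f i z)) := by
  have hP := hR.pre
  intro C hC
  obtain ⟨C₁, h1, h2, h3⟩ := PA.finset hN univ (fun i _ => hf i) C hC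
  by_cases hb : ∀ i, {z | ‖f i z‖ ≤ 1} ∈ U
  · obtain ⟨C₂, h4, h5, h6⟩ := C₁.bdd_T hR hN h1 univ h3 (fun i _ => hb i)
    obtain ⟨k, hk⟩ := restricted_scale ha
    have hk' : IsRestrictedCoeffs p (fun i => ϖ ^ k * a i) := by
      have := Filter.Tendsto.const_mul (ϖ ^ k) ha
      rwa [mul_zero] at this
    have h7 := TA_ranal (Cell.bdd (C := C₂) hP) _ hk' hk f (fun j => h6 j (mem_univ _))
    obtain ⟨C₃, h8, h9, h10⟩ := C₂.mainA hR hN hgen h4 (f := fun z => ranalFn p a (fun i => f i z))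
      ⟨fun _ => (ϖ ^ k)⁻¹, hP.const _, 0, _, h7, fun z _ => by
        have hpk : ϖ ^ k ≠ 0 := pow_ne_zero _ pK_ne
        show ranalFn p a (fun i => f i z) = _
        unfold ranalFn
        split_ifs
        · simp_rw [mul_assoc]
          rw [tsum_mul_left, zpow_zero, one_mul, inv_mul_cancel_left₀ hpk]
        · simp⟩
    exact ⟨C₃, h8, h2.trans hN (h5.ext.trans hN h9), h10⟩
  · push Not at hb
    obtain ⟨i, hi⟩ := hb
    have hi' := compl_umem hi
    rcases h3 i (mem_univ _) with h4 | h4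
    · obtain ⟨z, hz, hz'⟩ := U.nonempty_of_mem (Filter.inter_mem h1 hi')
      rw [Set.mem_compl_iff, mem_ofPred_eq, h4 z hz] at hz'
      simp at hz'
    have h5 : C₁.Pr hP N (fun z => ϖ⁻¹ * f i z ^ (-1 : ℤ)) :=
      (Cell.Pr.base (hP.const ϖ⁻¹) (fun _ _ => inv_ne_zero pK_ne)).mul (h4.zpow hN (-1))
    obtain ⟨C₂, h6, h7, h8⟩ := C₁.bdd_T hR hN h1 {()} (f := fun _ z => ϖ⁻¹ * f i z ^ (-1 : ℤ))
      (fun _ _ => .inr h5) (fun _ _ => by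
        filter_upwards [hi'] with z hz
        rw [Set.mem_compl_iff, mem_ofPred_eq, not_le] at hz
        have hz0 : f i z ≠ 0 := by rintro h; rw [h, norm_zero] at hz; linarith
        rw [zpow_neg_one, ← mul_inv, norm_inv, norm_mul, Padic.norm_p]
        apply inv_le_one_of_one_le₀
        have h9 : (p : ℝ) ≤ ‖f i z‖ := by
          by_contra hn
          rw [not_le] at hn
          have := (Padic.norm_le_pow_iff_norm_lt_pow_add_one (f i z) 0).2 (by simpa using hn)
          rw [zpow_zero] at this
          linarith
        have hp0 : (0 : ℝ) < p := by have := one_lt_pR (p := p); linarith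
        rw [inv_mul_eq_div, le_div_iff₀ hp0, one_mul]; exact h9)
    refine ⟨C₂, h6, h2.trans hN h7.ext, .inl (fun z hz => ?_)⟩
    have h9 := Cell.T_norm (h8 () (by simp)) hz
    have h10 : f i z ≠ 0 := h4.ne hN ((h7.sub (hR := hP)).set hz)
    have h11 : 1 < ‖f i z‖ := by
      rw [norm_mul, zpow_neg_one, norm_inv, norm_inv, Padic.norm_p, inv_inv, ← div_eq_mul_inv,
        div_le_one (norm_pos_iff.2 h10)] at h9
      exact one_lt_pR.trans_le h9
    show ranalFn p a (fun i => f i z) = _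
    unfold ranalFn
    rw [if_neg]
    push Not
    exact ⟨i, h11⟩

lemma PA.dfun (hR : Rich R) (hN : 0 < N) (hgen : Gen R U)
    {n : ℕ} {f : Aff n → Qp} (hf : IsDFunction p f) :
    ∀ (g : Fin n → Fn S), (∀ i, PA hR.pre N U (g i)) → PA hR.pre N U (fun z => f (fun i => g i z)) := by
  induction hf with
  | ranal a ha => intro g hg; exact PA.ranal hR hN hgen ha hg
  | poly q =>
    intro g hg
    induction q using MvPolynomial.induction_on with
    | C a => simpa using PA.base (hR := hR.pre) (hR.pre.const a)
    | add q q' h h' => simpa using PA.add hR hN hgen h h'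
    | mul_X q i h => simpa using PA.mul hN h (hg i)
  | inv => intro g hg; exact PA.inv hN (hg 0)
  | comp f g _ _ ihf ihg =>
    intro h hh
    exact ihf _ (fun i => ihg i h hh)

/-- there are cells in generic ultrafilters -/
lemma exists_cell (hR : PreRich R) (hgen : Gen R U) :
    ∃ C : Cell R, C.set ∈ U := by
  by_cases h : {z : S × Qp | ‖z.2‖ ≤ 1} ∈ U
  · refine ⟨⟨Set.univ, 0, 0, 1, hR.def_univ, hR.zero, hR.zero, hR.one, .inr (fun _ _ => one_ne_zero)⟩, ?_⟩
    filter_upwards [h, hgen 0 hR.zero] with z h1 h2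
    refine ⟨trivial, by simpa [Cell.x] using h2, by simp, by simpa [Cell.x] using h1⟩
  · refine ⟨⟨Set.univ, 0, 1, 0, hR.def_univ, hR.zero, hR.one, hR.zero, .inl (fun _ _ => one_ne_zero)⟩, ?_⟩
    filter_upwards [compl_umem h, hgen 0 hR.zero] with z h1 h2
    rw [Set.mem_compl_iff, mem_ofPred_eq, not_le] at h1
    refine ⟨trivial, by simpa [Cell.x] using h2, by simpa [Cell.x] using h1.le, by simp⟩

theorem prep_finset (hR : Rich R) (hN : 0 < N) (hgen : Gen R U)
    {ι : Type*} (F : Finset ι) (f : ι → Fn S) (hf : ∀ i ∈ F, PA hR.pre N U (f i)) :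
    ∃ C : Cell R, C.set ∈ U ∧ ∀ i ∈ F, C.Prep hR.pre N (f i) := by
  obtain ⟨C, hC⟩ := exists_cell hR.pre hgen
  obtain ⟨C', h1, _, h2⟩ := PA.finset hN F hf C hC
  exact ⟨C', h1, h2⟩

end PA

/-! ### Subanalytic sets through ultrafilters -/

namespace IsDFunction
variable {m : ℕ} {f g : (Fin m → ℚ_[p]) → ℚ_[p]}

lemma const (c : Qp) : IsDFunction p (fun _ : Fin m → Qp => c) := by
  simpa using IsDFunction.poly (p := p) (m := m) (MvPolynomial.C c)

lemma coord (i : Fin m) : IsDFunction p (fun x : Fin m → Qp => x i) := by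
  simpa using IsDFunction.poly (p := p) (m := m) (MvPolynomial.X i)

lemma add (hf : IsDFunction p f) (hg : IsDFunction p g) : IsDFunction p (fun x => f x + g x) := by
  have h : ∀ i, IsDFunction p (![f, g] i) := fun i => by fin_cases i <;> simpa
  have := IsDFunction.comp _ _ (IsDFunction.poly (MvPolynomial.X 0 + MvPolynomial.X 1)) h
  simp only [map_add, MvPolynomial.eval_X] at this
  exact this

lemma mul (hf : IsDFunction p f) (hg : IsDFunction p g) : IsDFunction p (fun x => f x * g x) := by
  have h : ∀ i, IsDFunction p (![f, g] i) := fun i => by fin_cases i <;> simpa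
  have := IsDFunction.comp _ _ (IsDFunction.poly (MvPolynomial.X 0 * MvPolynomial.X 1)) h
  simp only [map_mul, MvPolynomial.eval_X] at this
  exact this

lemma inv' (hf : IsDFunction p f) : IsDFunction p (fun x => (f x)⁻¹) := by
  simpa using IsDFunction.comp _ ![f] IsDFunction.inv (by intro i; fin_cases i; simpa)

lemma div_const (hf : IsDFunction p f) (μ : Qp) : IsDFunction p (fun x => f x / μ) := by
  simpa only [div_eq_mul_inv] using hf.mul (IsDFunction.const μ⁻¹)

lemma sub (hf : IsDFunction p f) (hg : IsDFunction p g) : IsDFunction p (fun x => f x - g x) := by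
  have := hf.add ((IsDFunction.const (-1)).mul hg)
  simpa [sub_eq_add_neg] using this

lemma pow (hf : IsDFunction p f) (n : ℕ) : IsDFunction p (fun x => f x ^ n) := by
  induction n with
  | zero => simpa using IsDFunction.const 1
  | succ n ih => simpa only [pow_succ] using ih.mul hf

lemma inits {f : Aff m → Qp} (hf : IsDFunction p f) :
    IsDFunction p (fun z : Fin (m + 1) → Qp => f (fun i => z i.castSucc)) :=
  IsDFunction.comp f (fun i z => z i.castSucc) hf (fun i => IsDFunction.coord _)

end IsDFunction

/-- Basic subanalytic sets. -/
def Bas {m : ℕ} (B : Set Aff m) : Prop :=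
  (∃ f, IsDFunction p f ∧ B = {x | f x = 0}) ∨ (∃ f n, IsDFunction p f ∧ 0 < n ∧ B = {x | f x ∈ Pset p n})

/-- The filter generated by the basic subanalytic sets of an ultrafilter. -/
def BF {m : ℕ} (V : Ultrafilter Aff m) : Filter Aff m :=
  Filter.generate {B | B ∈ V ∧ Bas B}

section
variable {m : ℕ} {V : Ultrafilter (Fin m → ℚ_[p])} {f : (Fin m → ℚ_[p]) → ℚ_[p]}

lemma le_BF : (V : Filter _) ≤ BF V := by
  rw [BF, Filter.le_generate_iff]
  exact fun B hB => hB.1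

lemma BF_eq (hf : IsDFunction p f) (h : {x | f x = 0} ∈ V) : {x | f x = 0} ∈ BF V :=
  Filter.mem_generate_of_mem ⟨h, .inl ⟨f, hf, rfl⟩⟩

lemma BF_P (hf : IsDFunction p f) {k : ℕ} (hk : 0 < k) (h : {x | f x ∈ Pset p k} ∈ V) :
    {x | f x ∈ Pset p k} ∈ BF V :=
  Filter.mem_generate_of_mem ⟨h, .inr ⟨f, k, hf, hk, rfl⟩⟩

lemma BF_coset (hf : IsDFunction p f) (h : {x | f x = 0} ∉ V) {k : ℕ} (hk : 0 < k) :
    ∃ μ : Qp, μ ≠ 0 ∧ {x | f x / μ ∈ Pset p k} ∈ BF V := by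
  obtain ⟨T, hT, hT'⟩ := finite_cosets (p := p) k hk
  obtain ⟨μ, hμ, h'⟩ := ultra_finset V T (fun μ => {x | f x / μ ∈ Pset p k}) (by
    filter_upwards [compl_umem h] with x hx
    exact hT' _ hx)
  exact ⟨μ, hT μ hμ, BF_P (hf.div_const μ) hk h'⟩

lemma BF_ne (hf : IsDFunction p f) (h : {x | f x = 0} ∉ V) : {x | f x ≠ 0} ∈ BF V := by
  obtain ⟨μ, hμ, h'⟩ := BF_coset hf h one_pos
  filter_upwards [h'] with x hx h0
  rw [h0, zero_div] at hx
  exact Pset_ne hx rfl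

lemma BF_notP (hf : IsDFunction p f) {k : ℕ} (hk : 0 < k) (h : {x | f x ∈ Pset p k} ∉ V) :
    {x | f x ∉ Pset p k} ∈ BF V := by
  by_cases h0 : {x | f x = 0} ∈ V
  · filter_upwards [BF_eq hf h0] with x hx h'
    exact Pset_ne h' hx
  obtain ⟨μ, hμ, h'⟩ := BF_coset hf h0 hk
  filter_upwards [h'] with x hx hx'
  apply h
  refine mem_of_superset (le_BF h') fun y hy => ?_
  have h1 : f y = (f y / μ) * (f x * (f x / μ)⁻¹) := by
    have := Pset_ne hx'
    field_simp
  show f y ∈ Pset p k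
  rw [h1]
  exact Pset_mul hy (Pset_mul hx' (Pset_inv hx))

lemma Bas.compl {B : Set Aff m} (hB : Bas B) (h : B ∉ V) : Bᶜ ∈ BF V := by
  rcases hB with ⟨f, hf, rfl⟩ | ⟨f, n, hf, hn, rfl⟩
  · exact BF_ne hf h
  · exact BF_notP hf hn h

lemma IsSubanalytic.mem_BF {X : Set Aff m} (hX : IsSubanalytic p X) (h : X ∈ V) : X ∈ BF V := by
  obtain ⟨r, s, F, hF, rfl⟩ := hX
  obtain ⟨i, -, hi⟩ := ultra_finset V univ (fun i => ⋂ j, F i j) (by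
    filter_upwards [h] with x hx
    simpa using hx)
  have : (⋂ j, F i j) ∈ BF V := by
    refine Filter.iInter_mem.2 fun j => Filter.mem_generate_of_mem ⟨mem_of_superset hi (Set.iInter_subset _ j), hF i j⟩
  exact mem_of_superset this (Set.subset_iUnion (fun i => ⋂ j, F i j) i)

lemma IsSubanalytic.compl_BF {X : Set Aff m} (hX : IsSubanalytic p X) (h : X ∉ V) : Xᶜ ∈ BF V := by
  obtain ⟨r, s, F, hF, rfl⟩ := hX
  rw [Set.compl_iUnion]
  refine Filter.iInter_mem.2 fun i => ?_
  have : ∃ j, F i j ∉ V := by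
    by_contra! hc
    exact h (mem_of_superset (Filter.iInter_mem.2 hc) (Set.subset_iUnion (fun i => ⋂ j, F i j) i))
  obtain ⟨j, hj⟩ := this
  exact mem_of_superset (Bas.compl (hF i j) hj) (Set.compl_subset_compl.2 (Set.iInter_subset _ j))

/-- Uniform finite representation of members of `BF`. -/
lemma mem_BF {A : Set Aff m} (h : A ∈ BF V) :
    ∃ t : Set (Set Aff m), t.Finite ∧ (∀ B ∈ t, B ∈ V ∧ Bas B) ∧ ⋂₀ t ⊆ A := by
  obtain ⟨t, ht, hf, hA⟩ := Filter.mem_generate_iff.1 h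
  exact ⟨t, hf, fun B hB => ht hB, hA⟩

lemma subanalytic_of_BF {X : Set Aff m}
    (h : ∀ V : Ultrafilter Aff m, X ∈ V → X ∈ BF V) : IsSubanalytic p X := by
  classical
  obtain ⟨F, hF, hc⟩ := ultra_cover {A : Set Aff m | A = Xᶜ ∨
      (∃ t : Set (Set Aff m), t.Finite ∧ (∀ B ∈ t, Bas B) ∧ ⋂₀ t = A) ∧ A ⊆ X} (fun V => by
    by_cases hX : X ∈ V
    · obtain ⟨t, ht, htB, htX⟩ := mem_BF (h V hX)
      exact ⟨⋂₀ t, (Filter.sInter_mem ht).2 fun B hB => (htB B hB).1,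
        .inr ⟨⟨t, ht, fun B hB => (htB B hB).2, rfl⟩, htX⟩⟩
    · exact ⟨Xᶜ, compl_umem hX, .inl rfl⟩)
  have h1 : ∀ A : {A // A ∈ F ∧ A ⊆ X}, ∃ t : Finset (Set Aff m), (∀ B ∈ t, Bas B) ∧ ⋂₀ ↑t = A.1 := by
    rintro ⟨A, hA, hAX⟩
    rcases hF hA with h | ⟨⟨t, ht, htB, htA⟩, -⟩
    · refine ⟨{{x | (1 : Qp) = 0}}, fun B hB => .inl ⟨_, IsDFunction.const 1, Finset.mem_singleton.1 hB⟩, ?_⟩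
      have : A = ∅ := by
        rw [h] at hAX ⊢
        rw [Set.compl_empty_iff, ← Set.compl_subset_iff_union.1 hAX] ; simp
      simp [this]
    · exact ⟨ht.toFinset, by simpa using htB, by simpa using htA⟩
  choose t ht ht' using h1
  let G := {A // A ∈ F ∧ A ⊆ X}
  have : Finite G := Finite.of_injective (β := F) (fun A => ⟨A.1, A.2.1⟩) (fun A B h => Subtype.ext (congrArg (fun a : F => a.1) h))
  have := Fintype.ofFinite G
  obtain ⟨r, ⟨e⟩⟩ := Finite.exists_equiv_fin G
  let Q : Finset (Set Aff m) := univ.biUnion t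
  obtain ⟨s, ⟨e'⟩⟩ := Finite.exists_equiv_fin Q
  refine ⟨r, s, fun i j => if (e'.symm j).1 ∈ t (e.symm i) then (e'.symm j).1 else {x | (0 : Qp) = 0},
    fun i j => ?_, ?_⟩
  · dsimp only
    split_ifs with h
    · exact ht _ _ h
    · exact .inl ⟨_, IsDFunction.const 0, rfl⟩
  · ext x
    rw [Set.mem_iUnion]
    constructor
    · intro hx
      obtain ⟨A, hA, hxA⟩ := hc x
      have hAX : A ⊆ X := by
        rcases hF hA with h | ⟨-, h⟩
        · exact absurd hx (by rw [h] at hxA; exact hxA)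
        · exact h
      refine ⟨e ⟨A, hA, hAX⟩, Set.mem_iInter.2 fun j => ?_⟩
      dsimp only
      rw [e.symm_apply_apply]
      split_ifs with h
      · have : x ∈ ⋂₀ (↑(t ⟨A, hA, hAX⟩) : Set (Set _)) := by rw [ht']; exact hxA
        exact this _ h
      · exact rfl
    · rintro ⟨i, hi⟩
      rw [Set.mem_iInter] at hi
      refine (e.symm i).2.2 ?_
      rw [← ht']
      intro B hB
      have := hi (e' ⟨B, Finset.mem_biUnion.2 ⟨_, mem_univ _, hB⟩⟩)
      dsimp only at this
      rw [e'.symm_apply_apply, if_pos (mem_coe.1 hB)] at this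
      exact this

/-- Locally `D`-functions. -/
def R0 (p : ℕ) [Fact p.Prime] (m : ℕ) : Set ((Fin m → ℚ_[p]) → ℚ_[p]) :=
  {f | ∀ V : Ultrafilter (Fin m → ℚ_[p]), ∃ δ, IsDFunction p δ ∧ ∀ᶠ s in BF V, f s = δ s}

lemma preRich_R0 : PreRich (R0 p m) where
  const c V := ⟨_, IsDFunction.const c, Eventually.of_forall fun _ => rfl⟩
  add hf hg V := by
    obtain ⟨δ, h, h'⟩ := hf V
    obtain ⟨ε, k, k'⟩ := hg V
    exact ⟨_, h.add k, by filter_upwards [h', k'] with s h1 h2; simp [h1, h2]⟩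
  mul hf hg V := by
    obtain ⟨δ, h, h'⟩ := hf V
    obtain ⟨ε, k, k'⟩ := hg V
    exact ⟨_, h.mul k, by filter_upwards [h', k'] with s h1 h2; simp [h1, h2]⟩
  inv hf V := by
    obtain ⟨δ, h, h'⟩ := hf V
    exact ⟨_, h.inv', by filter_upwards [h'] with s h1; simp [h1]⟩
  ind {f k} hf hk V := by
    obtain ⟨δ, h, h'⟩ := hf V
    by_cases hP : {s | δ s ∈ Pset p k} ∈ V
    · exact ⟨_, IsDFunction.const 1, by filter_upwards [h', BF_P h hk hP] with s h1 h2; simp_all⟩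
    · exact ⟨_, IsDFunction.const 0, by filter_upwards [h', BF_notP h hk hP] with s h1 h2; simp_all⟩
  ranal {n} a ξ ha hξ V := by
    choose δ h h' using fun i => hξ i V
    refine ⟨_, IsDFunction.comp _ δ (IsDFunction.ranal a ha) h, ?_⟩
    filter_upwards [Filter.eventually_all.2 h'] with s hs
    simp only [hs]

lemma R0_of_D (hf : IsDFunction p f) : f ∈ R0 p m := fun _ => ⟨f, hf, Eventually.of_forall fun _ => rfl⟩

lemma Def_R0_BF {X : Set Aff m} (hX : Def (R0 p m) X) (h : X ∈ V) : X ∈ BF V := by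
  classical
  obtain ⟨δ, hδ, h'⟩ := hX V
  have : {x | δ x = 0} ∉ V := fun hc => by
    obtain ⟨x, ⟨h1, h2⟩, h3⟩ := V.nonempty_of_mem (inter_mem (inter_mem h hc) (le_BF h'))
    simp_all
  filter_upwards [h', BF_ne hδ this] with x h1 h2
  by_contra hx
  rw [indicator_of_notMem hx] at h1
  exact h2 h1.symm

lemma IsSubanalytic.Def {X : Set Aff m} (hX : IsSubanalytic p X) : Def (R0 p m) X := by
  classical
  intro V
  by_cases h : X ∈ V
  · exact ⟨_, IsDFunction.const 1, by filter_upwards [hX.mem_BF h] with s h1; simp_all⟩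
  · exact ⟨_, IsDFunction.const 0, by filter_upwards [hX.compl_BF h] with s h1; simp_all⟩

end

/-- The smallest rich ring. -/
def RR (p : ℕ) [Fact p.Prime] (m : ℕ) : Set ((Fin m → ℚ_[p]) → ℚ_[p]) := ⋂₀ {R | R0 p m ⊆ R ∧ Rich R}

section
variable {m : ℕ} {V : Ultrafilter (Fin m → ℚ_[p])}

lemma R0_sub : R0 p m ⊆ RR p m := Set.subset_sInter fun _ h => h.1
lemma richRR : Rich (RR p m) where
  pre :=
    { const := fun c _ h => h.2.pre.const c
      add := fun hf hg R h => h.2.pre.add (hf R h) (hg R h)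
      mul := fun hf hg R h => h.2.pre.mul (hf R h) (hg R h)
      inv := fun hf R h => h.2.pre.inv (hf R h)
      ind := fun hf hk R h => h.2.pre.ind (hf R h) hk
      ranal := fun a ξ ha hξ R h => h.2.pre.ranal a ξ ha fun i => hξ i R h }
  root := fun hl hb R h => h.2.root hl (hb R h)
lemma valRR : ValOver (R0 p m) (RR p m) := fun f hf => by
  obtain ⟨R, h1, h2, h3⟩ := exists_rich (R0 p m) preRich_R0
  exact h3 f (hf R ⟨h1, h2⟩)
lemma preRR : PreRich (RR p m) := richRR.pre

lemma Def_BF {X : Set Aff m} (hX : Def (RR p m) X) (h : X ∈ V) : X ∈ BF V := by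
  obtain ⟨Y, hY, hYd, hYX⟩ := valRR.sub preRich_R0 hX h
  exact mem_of_superset (Def_R0_BF hYd hY) hYX

lemma RR_D {f : Aff m → Qp} (hf : IsDFunction p f) : f ∈ RR p m := R0_sub (R0_of_D hf)

lemma RR_comp_D {m' : ℕ} {f : Aff m' → Qp} (hf : IsDFunction p f) :
    ∀ {σ : Fin m' → Aff m → Qp}, (∀ i, σ i ∈ RR p m) → (fun s => f (fun i => σ i s)) ∈ RR p m := by
  induction hf with
  | ranal a ha => exact fun hσ => preRR.ranal a _ ha hσ
  | poly q =>
    intro σ hσ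
    induction q using MvPolynomial.induction_on with
    | C a => simpa using preRR.const a
    | add f g hf hg => simp only [map_add]; exact preRR.add hf hg
    | mul_X f i hf => simp only [map_mul, MvPolynomial.eval_X]; exact preRR.mul hf (hσ i)
  | inv => exact fun hσ => preRR.inv (hσ 0)
  | comp f g hf hg ihf ihg => exact fun hσ => ihf (fun i => ihg i hσ)

lemma Bas.preimage {m' : ℕ} {B : Set Aff m'} (hB : Bas B)
    {σ : Fin m' → Aff m → Qp} (hσ : ∀ i, σ i ∈ RR p m) :
    Def (RR p m) {s | (fun i => σ i s) ∈ B} := by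
  rcases hB with ⟨f, hf, rfl⟩ | ⟨f, n, hf, hn, rfl⟩
  · simpa using preRR.def_eq (RR_comp_D hf hσ) (preRR.const 0)
  · exact preRR.def_Pset (RR_comp_D hf hσ) hn

lemma tendsto_BF {m' : ℕ} {σ : Fin m' → Aff m → Qp} (hσ : ∀ i, σ i ∈ RR p m) :
    Tendsto (fun s i => σ i s) (BF V) (BF (V.map (fun s i => σ i s))) := by
  rw [BF.eq_1 (Ultrafilter.map _ _), Tendsto, Filter.le_generate_iff]
  rintro B ⟨hB, hB'⟩
  exact Def_BF (hB'.preimage hσ) hB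

end

/-! ### Constructible functions and the rich ring -/

lemma absQ {x : Qp} (hx : x ≠ 0) : padicNormE x = (p : ℚ) ^ (-x.valuation) := by
  have h := Padic.norm_eq_zpow_neg_valuation hx
  have h2 : ‖x‖ = ((padicNormE x : ℚ) : ℝ) := rfl
  rw [h2] at h
  exact Rat.cast_injective (α := ℝ) (by push_cast; exact h)

section
variable {m : ℕ} {V : Ultrafilter (Fin m → ℚ_[p])}

lemma mem_BF' {A : Set Aff m} (h : A ∈ BF V) : ∃ X ∈ V, Def (RR p m) X ∧ X ⊆ A := by
  obtain ⟨t, ht, hB, hA⟩ := mem_BF h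
  refine ⟨⋂₀ t, (Filter.sInter_mem ht).2 fun B hB' => (hB B hB').1, ?_, hA⟩
  have := preRR.def_finset (R := RR p m) ht.toFinset id (fun B h' =>
    (hB B (ht.mem_toFinset.1 h')).2.preimage (σ := fun i s => s i) fun i => RR_D (IsDFunction.coord i))
  convert this using 1
  ext s; simp

lemma RR_comp {m' : ℕ} {f : Aff m' → Qp} (hf : f ∈ RR p m')
    {σ : Fin m' → Aff m → Qp} (hσ : ∀ i, σ i ∈ RR p m) : (fun s => f (fun i => σ i s)) ∈ RR p m := by
  refine hf {f | (fun s => f (fun i => σ i s)) ∈ RR p m} ⟨fun f hf => preRR.glue fun V => ?_, ⟨⟨preRR.const, preRR.add, preRR.mul, preRR.inv,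
    preRR.ind, fun a ξ => preRR.ranal a fun i s => ξ i fun i => σ i s⟩, richRR.root⟩⟩
  obtain ⟨δ, hδ, h⟩ := hf (V.map fun s i => σ i s)
  obtain ⟨X, hX, hXd, h'⟩ := mem_BF' ((tendsto_BF hσ).eventually h)
  exact ⟨X, hX, hXd, _, RR_comp_D hδ hσ, fun s hs => h' hs⟩

lemma Def.sub {X : Set Aff m} (hX : Def (RR p m) X) : IsSubanalytic p X :=
  subanalytic_of_BF fun _ h => Def_BF hX h

lemma tendsto_init {U : Ultrafilter Aff (m + 1)} :
    Tendsto (fun z (i : Fin m) => z i.castSucc) (BF U) (BF (U.map (fun z (i : Fin m) => z i.castSucc))) :=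
  tendsto_BF fun i => RR_D (IsDFunction.coord i.castSucc)

lemma sub_of_R0 {h : Aff m → Qp} (hh : h ∈ R0 p m) : IsSubanalyticFn p h := by
  refine subanalytic_of_BF fun U hU => ?_
  obtain ⟨δ, hδ, h1⟩ := hh (U.map (fun z (i : Fin m) => z i.castSucc))
  have h2 := tendsto_init.eventually h1
  have h3 := BF_eq (V := U) (hδ.inits.sub (IsDFunction.coord (Fin.last m))) (by
    filter_upwards [le_BF h2, hU] with z hz hz'
    have hz1 : h _ = δ _ := hz
    rw [← hz1, hz'.2, sub_self])
  filter_upwards [h2, h3] with z hz hz'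
  exact ⟨trivial, hz.trans (sub_eq_zero.1 hz')⟩

open Classical in
/-- A total version of the root function. -/
noncomputable def rootT (e : ℕ) (δ : Aff m → Qp) (s : Fin m → Qp) : Qp :=
  if δ s ∈ Pset p (e * rootM p) then rootFn e δ s else 1

lemma sub_rootT {e : ℕ} (he : 0 < e) {δ : Aff m → Qp} (hδ : IsDFunction p δ) :
    IsSubanalyticFn p (rootT e δ) := by
  refine subanalytic_of_BF fun U hU => ?_
  have hpos : 0 < e * rootM p := Nat.mul_pos he rootM_pos
  have hl := IsDFunction.coord (p := p) (Fin.last m)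
  by_cases hP : {z : Fin (m + 1) → Qp | δ (fun i => z i.castSucc) ∈ Pset p (e * rootM p)} ∈ U
  · have h1 := BF_P (V := U) hl rootM_pos (by
      filter_upwards [hU, hP] with z hz hz'
      rw [← hz.2, rootT, if_pos hz']
      exact (rootFn_spec hz').1)
    have h2 := BF_eq (V := U) ((hl.pow e).sub hδ.inits) (by
      filter_upwards [hU, hP] with z hz hz'
      rw [← hz.2, rootT, if_pos hz', sub_eq_zero]
      exact (rootFn_spec hz').2)
    filter_upwards [BF_P hδ.inits hpos hP, h1, h2] with z h0 h1 h2
    refine ⟨trivial, ?_⟩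
    rw [rootT, if_pos h0]
    exact root_unique he (rootFn_spec h0).1 h1 ((rootFn_spec h0).2.trans (sub_eq_zero.1 h2).symm)
  · have h1 := BF_notP hδ.inits hpos hP
    have h2 := BF_eq (V := U) (hl.sub (IsDFunction.const 1)) (by
      filter_upwards [hU, le_BF h1] with z hz hz'
      rw [← hz.2, rootT, if_neg hz', sub_self])
    filter_upwards [h1, h2] with z hz hz'
    refine ⟨trivial, ?_⟩
    rw [rootT, if_neg hz, sub_eq_zero.1 hz']

lemma rootT_ne {e : ℕ} {δ : Aff m → Qp} (s) : rootT e δ s ≠ 0 := by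
  unfold rootT
  split_ifs with h
  · exact Pset_ne (rootFn_spec h).1
  · exact one_ne_zero

lemma ind_CA {X : Set Aff m} (hX : Def (RR p m) X) : indicator X 1 ∈ CA m := by
  classical
  refine subset_adjoin (.inr ⟨indicator X 1, sub_of_R0 hX.sub.Def, ?_⟩)
  ext s
  by_cases hs : s ∈ X <;> simp [hs]

lemma CA_glue_ex {P : Aff m → ℚ → Prop}
    (h : ∀ V : Ultrafilter Aff m, ∃ g ∈ CA m, ∀ᶠ s in BF V, P s (g s)) :
    ∃ g ∈ CA m, ∀ s, P s (g s) := by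
  classical
  obtain ⟨G, hG, hc⟩ := ultra_cover {X | Def (RR p m) X ∧ ∃ g ∈ CA m, ∀ s ∈ X, P s (g s)} (fun V => by
    obtain ⟨g, hg, h1⟩ := h V
    obtain ⟨X, hX, hXd, hX'⟩ := mem_BF' h1
    exact ⟨X, hX, hXd, g, hg, fun s hs => hX' hs⟩)
  have key : ∀ G' : Finset (Set Aff m), G' ⊆ G → ∃ g ∈ CA m, ∀ X ∈ G', ∀ s ∈ X, P s (g s) := by
    intro G'
    induction G' using Finset.induction_on with
    | empty => exact fun _ => ⟨0, zero_mem _, by simp⟩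
    | insert X G' hX ih =>
      intro hs
      obtain ⟨g, hg, h1⟩ := ih ((Finset.subset_insert _ _).trans hs)
      obtain ⟨hXd, g', hg', h2⟩ := hG (hs (mem_insert_self _ _))
      refine ⟨_, add_mem (mul_mem (ind_CA hXd) hg') (mul_mem (sub_mem (one_mem _) (ind_CA hXd)) hg), ?_⟩
      intro Y hY s hsY
      by_cases hsX : s ∈ X
      · simpa [hsX] using h2 s hsX
      · rcases mem_insert.1 hY with rfl | hY
        · exact absurd hsY hsX
        · simpa [hsX] using h1 Y hY s hsY
  obtain ⟨g, hg, h1⟩ := key G subset_rfl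
  exact ⟨g, hg, fun s => by obtain ⟨X, hX, hs⟩ := hc s; exact h1 X hX s hs⟩

lemma CA_glue {F : Aff m → ℚ}
    (h : ∀ V : Ultrafilter Aff m, ∃ g ∈ CA m, ∀ᶠ s in BF V, F s = g s) :
    F ∈ CA m := by
  obtain ⟨g, hg, h⟩ := CA_glue_ex (P := fun s y => F s = y) h
  exact (funext h : F = g) ▸ hg

/-- Functions whose norm is controlled by `D`-functions. -/
def VD (θ : Aff m → Qp) : Prop :=
  ∀ V : Ultrafilter Aff m, ∃ e : ℕ, 0 < e ∧ ∃ δ, IsDFunction p δ ∧ ∀ᶠ s in BF V, ‖θ s‖ ^ e = ‖δ s‖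

lemma VD_RR {θ : Aff m → Qp} (hθ : θ ∈ RR p m) : VD θ := by
  intro V
  obtain ⟨X, hX, hXd, e, he, δ, hδ, h⟩ := valRR θ hθ V
  obtain ⟨ε, hε, h'⟩ := hδ V
  refine ⟨e, he, ε, hε, ?_⟩
  filter_upwards [Def_R0_BF hXd hX, h'] with s h1 h2
  rw [h s h1, h2]

lemma VD.local {θ : Aff m → Qp} (hθ : VD θ) (V : Ultrafilter Aff m) :
    (∀ᶠ s in BF V, θ s = 0) ∨ ∃ h, IsSubanalyticFn p h ∧ (∀ s, h s ≠ 0) ∧ ∃ w : ℤ,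
      ∀ᶠ s in BF V, θ s ≠ 0 ∧ (θ s).valuation = (h s).valuation + w := by
  obtain ⟨e, he, δ, hδ, h⟩ := hθ V
  by_cases h0 : {x | δ x = 0} ∈ V
  · left
    filter_upwards [h, BF_eq hδ h0] with s h1 h2
    rw [show δ s = 0 from h2, norm_zero] at h1
    exact norm_eq_zero.1 (pow_eq_zero_iff he.ne' |>.1 h1)
  right
  obtain ⟨μ, hμ, h1⟩ := BF_coset hδ h0 (Nat.mul_pos he (rootM_pos (p := p)))
  have key : ∀ s, ‖θ s‖ ^ e = ‖δ s‖ → δ s / μ ∈ Pset p (e * rootM p) →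
      θ s ≠ 0 ∧ e * (θ s).valuation = e * (rootT e (fun x => δ x / μ) s).valuation + μ.valuation := by
    intro s hs hs'
    have h2 : rootT e (fun x => δ x / μ) s ^ e * μ = δ s := by
      rw [rootT, if_pos hs', (rootFn_spec (b := fun x => δ x / μ) hs').2, div_mul_cancel₀ _ hμ]
    have h3 := rootT_ne (e := e) (δ := fun x => δ x / μ) s
    have h4 : θ s ≠ 0 := by
      intro h4
      rw [h4, norm_zero, zero_pow he.ne', ← h2, eq_comm, norm_eq_zero] at hs
      exact mul_ne_zero (pow_ne_zero _ h3) hμ hs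
    refine ⟨h4, ?_⟩
    rw [← norm_pow, ← h2, norm_eq_iff_val (pow_ne_zero _ h4) (mul_ne_zero (pow_ne_zero _ h3) hμ),
      valuation_mul (pow_ne_zero _ h3) hμ, valuation_pow, valuation_pow] at hs
    exact hs
  obtain ⟨s0, hs0, hs0'⟩ := V.nonempty_of_mem (inter_mem (le_BF h) (le_BF h1))
  refine ⟨_, sub_rootT he (hδ.div_const μ), rootT_ne,
    (θ s0).valuation - (rootT e (fun x => δ x / μ) s0).valuation, ?_⟩
  filter_upwards [h, h1] with s hs hs'
  have k1 := key s hs hs'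
  have k2 := key s0 hs0 hs0'
  refine ⟨k1.1, ?_⟩
  have he' : (e : ℤ) ≠ 0 := by exact_mod_cast he.ne'
  apply mul_left_cancel₀ he'
  linear_combination k1.2 - k2.2

lemma VD.val {θ : Aff m → Qp} (hθ : VD θ) :
    (fun s => ((θ s).valuation : ℚ)) ∈ CA m := by
  refine CA_glue fun V => ?_
  rcases hθ.local V with h | ⟨h, h1, h2, w, h3⟩
  · exact ⟨0, zero_mem _, by filter_upwards [h] with s hs; simp [hs]⟩
  · refine ⟨_, add_mem (subset_adjoin (.inl ⟨h, h1, h2, rfl⟩)) (algebraMap_mem _ (w : ℚ)), ?_⟩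
    filter_upwards [h3] with s hs
    simp [hs.2]

lemma VD.abs {θ : Aff m → Qp} (hθ : VD θ) :
    (fun s => padicNormE (θ s)) ∈ CA m := by
  refine CA_glue fun V => ?_
  rcases hθ.local V with h | ⟨h, h1, h2, w, h3⟩
  · exact ⟨0, zero_mem _, by filter_upwards [h] with s hs; simp [hs]⟩
  · refine ⟨_, mul_mem (subset_adjoin (.inr ⟨h, h1, rfl⟩)) (algebraMap_mem _ ((p : ℚ) ^ (-w))), ?_⟩
    filter_upwards [h3] with s hs
    have hp : (p : ℚ) ≠ 0 := by exact_mod_cast (Fact.out : p.Prime).ne_zero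
    simp [absQ hs.1, absQ (h2 s), hs.2, zpow_add₀ hp, mul_comm]

end

/-! ### Subanalytic functions lie in the rich ring; preparation of constructible functions -/

lemma Pset_zpow {k : ℕ} {x : Qp} (h : x ∈ Pset p k) (ν : ℤ) : x ^ ν ∈ Pset p k := by
  obtain ⟨y, hy, rfl⟩ := h
  exact ⟨y ^ ν, zpow_ne_zero _ hy, by rw [← zpow_natCast, ← zpow_natCast, zpow_comm]⟩

lemma near_one_ge (k : ℕ) (hk : 0 < k) : ∃ N0 : ℕ, 0 < N0 ∧ ∀ N ≥ N0, ∀ y : Qp, ‖y‖ ≤ 1 → 1 + p ^ N * y ∈ Pset p k := by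
  obtain ⟨N0, h0, h⟩ := near_one_Pset (p := p) k hk
  refine ⟨N0, h0, fun N hN y hy => ?_⟩
  have := h (p ^ (N - N0) * y) (norm_mul_le_one (norm_pow_p_le_one _) hy)
  rwa [← mul_assoc, ← pow_add, Nat.add_sub_cancel' hN] at this

section
variable {m : ℕ}

/-- The identification of `S × K` with the next affine space. -/
def sn (z : Aff m × Qp) : Fin (m + 1) → Qp := Fin.snoc (α := fun _ => Qp) z.1 z.2

lemma sn_castSucc (z : Aff m × Qp) (i : Fin m) : sn z i.castSucc = z.1 i := by simp [sn]
lemma sn_last (z : Aff m × Qp) : sn z (Fin.last m) = z.2 := by simp [sn]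
lemma sn_RR {c : Aff m → Qp} (hc : c ∈ RR p m) (i : Fin (m + 1)) :
    (fun s => sn (s, c s) i) ∈ RR p m := by
  induction i using Fin.lastCases with
  | last => simpa only [sn_last] using hc
  | cast i => simpa only [sn_castSucc] using RR_D (IsDFunction.coord i)

/-- The domain of a prepared formula. -/
def Om (C : Cell (RR p m)) (μ : Qp) (n : ℕ) (Y : Set Aff m) : Set (Aff m × Qp) :=
  {z | z ∈ C.set ∧ z.1 ∈ Y ∧ C.x z / μ ∈ Pset p n}

variable (U : Ultrafilter ((Fin m → ℚ_[p]) × ℚ_[p]))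

/-- `Q` holds for all sufficiently fine cells. -/
def FG (Q : Cell (RR p m) → Qp → ℕ → Prop) : Prop :=
  ∃ D : Set (Aff (m + 1) → Qp), D.Finite ∧ (∀ f ∈ D, IsDFunction p f) ∧ ∃ n0 : ℕ, 0 < n0 ∧ ∃ N0 : ℕ,
    ∀ N ≥ N0, 0 < N → ∀ C : Cell (RR p m), C.set ∈ U → (∀ f ∈ D, C.Prep preRR N (fun z => f (sn z))) →
    ∀ μ ≠ 0, ∀ n, n0 ∣ n → {z | C.x z / μ ∈ Pset p n} ∈ U → Q C μ n

variable {U} {Q Q' : Cell (RR p m) → ℚ_[p] → ℕ → Prop}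

lemma FG.and (h : FG U Q) (h' : FG U Q') : FG U (fun C μ n => Q C μ n ∧ Q' C μ n) := by
  obtain ⟨D, hf, hD, n0, hn0, N0, H⟩ := h
  obtain ⟨D', hf', hD', n0', hn0', N0', H'⟩ := h'
  refine ⟨D ∪ D', hf.union hf', fun f hf => hf.elim (hD f) (hD' f), n0 * n0', Nat.mul_pos hn0 hn0', max N0 N0', ?_⟩
  intro N hN hN0 C hC hP μ hμ n hn hn'
  exact ⟨H N ((le_max_left _ _).trans hN) hN0 C hC (fun f hf => hP f (.inl hf)) μ hμ n ((Dvd.intro _ rfl).trans hn) hn',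
    H' N ((le_max_right _ _).trans hN) hN0 C hC (fun f hf => hP f (.inr hf)) μ hμ n ((Dvd.intro_left _ rfl).trans hn) hn'⟩

lemma FG.mono (h : FG U Q) (h' : ∀ C μ n, Q C μ n → Q' C μ n) : FG U Q' := by
  obtain ⟨D, hf, hD, n0, hn0, N0, H⟩ := h
  exact ⟨D, hf, hD, n0, hn0, N0, fun N a b C c d μ e n f g => h' _ _ _ (H N a b C c d μ e n f g)⟩

lemma FG.elim (h : FG U Q) (hgen : Gen (RR p m) U) :
    ∃ C μ n, ∃ N : ℕ, 0 < N ∧ 0 < n ∧ μ ≠ 0 ∧ C.set ∈ U ∧ {z | C.x z / μ ∈ Pset p n} ∈ U ∧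
      1 + ϖ ^ N ∈ Pset p n ∧ Q C μ n := by
  obtain ⟨D, hf, hD, n0, hn0, N0, H⟩ := h
  obtain ⟨N1, hN1, h1⟩ := near_one_ge (p := p) n0 hn0
  have hN : 0 < max N0 N1 := lt_max_of_lt_right hN1
  obtain ⟨C, hC, hP⟩ := prep_finset (N := max N0 N1) richRR hN hgen hf.toFinset
    (fun f z => f (sn z)) (fun f h => PA.dfun richRR hN hgen (hD f (hf.mem_toFinset.1 h)) (fun i z => sn z i) (fun i => by
      induction i using Fin.lastCases with
      | last => simpa only [sn_last] using PA.snd richRR hN hgen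
      | cast i => simpa only [sn_castSucc] using PA.base (RR_D (IsDFunction.coord i))))
  obtain ⟨T, hT, hT'⟩ := finite_cosets (p := p) n0 hn0
  obtain ⟨μ, hμ, h'⟩ := ultra_finset U T (fun μ => {z | C.x z / μ ∈ Pset p n0}) (by
    filter_upwards [hC] with z hz
    exact hT' _ hz.2.1)
  exact ⟨C, μ, n0, max N0 N1, hN, hn0, hT μ hμ, hC, h', by simpa using h1 _ (le_max_right _ _) 1 (by simp),
    H _ (le_max_left _ _) hN C hC (fun f h => hP f (hf.mem_toFinset.2 h)) μ (hT μ hμ) n0 dvd_rfl h'⟩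

lemma FG_Bas {B : Set Aff (m + 1)} (hB : Bas B) (h : B ∈ U.map sn) :
    FG U (fun C μ n => ∃ Y, Def (RR p m) Y ∧ {z | z.1 ∈ Y} ∈ U ∧ ∀ z ∈ Om C μ n Y, sn z ∈ B) := by
  have h' : {z | sn z ∈ B} ∈ U := h
  rcases hB with ⟨f, hf, rfl⟩ | ⟨f, k, hf, hk, rfl⟩
  · refine ⟨{f}, Set.finite_singleton f, by simpa using hf, 1, one_pos, 1, fun N hN hN0 C hC hP μ hμ n hn hn' => ?_⟩
    rcases hP f rfl with h1 | h1
    · exact ⟨_, preRR.def_univ, univ_mem, fun z hz => h1 z hz.1⟩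
    · obtain ⟨z, hz, hz'⟩ := U.nonempty_of_mem (inter_mem h' hC)
      exact absurd hz (h1.ne hN0 hz')
  · obtain ⟨N0, hN0, hN⟩ := near_one_ge (p := p) k hk
    refine ⟨{f}, Set.finite_singleton f, by simpa using hf, k, hk, N0, fun N hN1 hN0 C hC hP μ hμ n hn hn' => ?_⟩
    rcases hP f rfl with h1 | ⟨g, hg, -, ν, u, ⟨E, hE, hu⟩, e⟩
    · obtain ⟨z, hz, hz'⟩ := U.nonempty_of_mem (inter_mem h' hC)
      exact absurd (h1 z hz') (Pset_ne hz)
    have key : ∀ z ∈ C.set, C.x z / μ ∈ Pset p n → (f (sn z) ∈ Pset p k ↔ g z.1 * μ ^ ν ∈ Pset p k) := by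
      intro z hz hz'
      have h2 : (C.x z / μ) ^ ν * u z ∈ Pset p k :=
        Pset_mul (Pset_zpow (Pset_dvd hn hz') ν) (hu z hz ▸ hN N hN1 _ (Cell.T_norm hE hz))
      rw [show f (sn z) = ((C.x z / μ) ^ ν * u z) * (g z.1 * μ ^ ν) by
        rw [show f (sn z) = _ from e z hz, div_zpow]; have := zpow_ne_zero ν hμ; field_simp]
      exact Pset_mul_iff h2
    refine ⟨{s | g s * μ ^ ν ∈ Pset p k}, preRR.def_Pset (preRR.mul hg (preRR.const _)) hk, ?_, fun z hz => ?_⟩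
    · filter_upwards [h', hC, hn'] with z h1 h2 h3
      exact (key z h2 h3).1 h1
    · exact (key z hz.1 hz.2.2).2 hz.2.1

lemma FG_BF {A : Set Aff (m + 1)} (h : A ∈ BF (U.map sn)) :
    FG U (fun C μ n => ∃ Y, Def (RR p m) Y ∧ {z | z.1 ∈ Y} ∈ U ∧ ∀ z ∈ Om C μ n Y, sn z ∈ A) := by
  induction h with
  | basic h => exact FG_Bas h.2 h.1
  | univ => exact ⟨∅, Set.finite_empty, by simp, 1, one_pos, 1, fun _ _ _ _ _ _ _ _ _ _ _ =>
      ⟨_, preRR.def_univ, univ_mem, fun _ _ => trivial⟩⟩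
  | superset _ hs ih => exact ih.mono fun C μ n ⟨Y, h1, h2, h3⟩ => ⟨Y, h1, h2, fun z hz => hs (h3 z hz)⟩
  | inter _ _ ih1 ih2 =>
    exact (ih1.and ih2).mono fun C μ n ⟨⟨Y, h1, h2, h3⟩, ⟨Y', h1', h2', h3'⟩⟩ =>
      ⟨Y ∩ Y', preRR.def_inter h1 h1', inter_mem h2 h2',
        fun z hz => ⟨h3 z ⟨hz.1, hz.2.1.1, hz.2.2⟩, h3' z ⟨hz.1, hz.2.1.2, hz.2.2⟩⟩⟩

/-- Subanalytic functions lie in the rich ring. -/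
theorem sub_RR {h : Aff m → Qp} (hh : IsSubanalyticFn p h) : h ∈ RR p m := by
  have hg : ∀ z, sn z ∈ graphFun p Set.univ h ↔ h z.1 = z.2 := by
    intro z
    simp only [graphFun, mem_ofPred_eq, sn_castSucc, sn_last, Set.mem_univ, true_and]
  refine preRR.glue fun V => ?_
  by_cases hc : ∃ c ∈ RR p m, {s | h s = c s} ∈ V
  · obtain ⟨c, hc, h1⟩ := hc
    have h2 := (tendsto_BF (V := V) (sn_RR hc)).eventually (IsSubanalytic.mem_BF hh (by
      show {s | sn (s, c s) ∈ graphFun p Set.univ h} ∈ V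
      filter_upwards [h1] with s hs
      exact (hg _).2 hs))
    obtain ⟨X, hX, hXd, h3⟩ := mem_BF' h2
    exact ⟨X, hX, hXd, c, hc, fun s hs => (hg (s, c s)).1 (h3 hs)⟩
  exfalso
  push Not at hc
  let U : Ultrafilter (Aff m × Qp) := V.map (fun s => (s, h s))
  have h1 := FG_BF (U := U) (IsSubanalytic.mem_BF hh (by
    show {s | sn (s, h s) ∈ graphFun p Set.univ h} ∈ V
    exact mem_of_superset univ_mem fun s _ => (hg _).2 rfl))
  obtain ⟨C, μ, n, N, hN0, hn, hμ, hC, hP, hN, Y, hY, hY', h2⟩ := h1.elim (fun c hc' =>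
    compl_umem (hc c hc'))
  obtain ⟨z, ⟨hz1, hz2⟩, hz3⟩ := U.nonempty_of_mem (inter_mem (inter_mem hC hP) hY')
  let z' : Aff m × Qp := (z.1, C.c z.1 + C.x z * (1 + p ^ N))
  have hx : C.x z' = C.x z * (1 + p ^ N) := by simp [Cell.x, z']
  have hnN : ‖(1 : Qp) + p ^ N‖ = 1 := by
    simpa using norm_one_add_p (p := p) hN0 (y := 1) (by simp)
  have h3 := (hg _).1 (h2 z ⟨hz1, hz3, hz2⟩)
  have h4 := (hg _).1 (h2 z' ⟨⟨hz1.1, by rw [hx]; exact mul_ne_zero hz1.2.1 (Pset_ne hN), by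
    rw [hx, norm_mul, hnN, mul_one]; exact hz1.2.2.1, by
    rw [hx, norm_mul, norm_mul, hnN, mul_one, ← norm_mul]; exact hz1.2.2.2⟩, hz3, by
    show C.x z' / μ ∈ _
    rw [hx, mul_div_right_comm]; exact Pset_mul hz2 hN⟩)
  have h5 : z.2 = C.c z.1 + C.x z * (1 + p ^ N) := h3.symm.trans h4
  have h6 : C.x z * p ^ N = 0 := by
    have : C.x z = z.2 - C.c z.1 := rfl
    linear_combination -h5 - this
  exact mul_ne_zero hz1.2.1 (pow_ne_zero _ pK_ne) h6

end

section
variable {m : ℕ}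

lemma VD_sub {h : Aff m → Qp} (hh : IsSubanalyticFn p h) : VD h := VD_RR (sub_RR hh)

/-- Composition of constructible functions with functions of the rich ring. -/
lemma comp_CA {m' : ℕ} {F : Aff m' → ℚ} (hF : F ∈ CA m')
    {σ : Fin m' → Aff m → Qp} (hσ : ∀ i, σ i ∈ RR p m) :
    (fun s => F (fun i => σ i s)) ∈ CA m := by
  induction hF using Algebra.adjoin_induction with
  | mem F hF =>
    rcases hF with ⟨h, h1, h2, rfl⟩ | ⟨h, h1, rfl⟩
    · exact (VD_RR (RR_comp (sub_RR h1) hσ)).val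
    · exact (VD_RR (RR_comp (sub_RR h1) hσ)).abs
  | algebraMap r => exact algebraMap_mem _ r
  | add f g _ _ hf hg => exact add_mem hf hg
  | mul f g _ _ hf hg => exact mul_mem hf hg

/-- Functions on `S × ℤ` that are polynomial in `k` and `p ^ k`. -/
noncomputable def TT (p : ℕ) [Fact p.Prime] (m : ℕ) : Subalgebra ℚ ((Fin m → ℚ_[p]) × ℤ → ℚ) :=
  adjoin ℚ ({Φ | ∃ c ∈ ConstructibleAlg p m, Φ = fun w => c w.1} ∪
    {Φ | Φ = (fun w => (w.2 : ℚ)) ∨ ∃ ν : ℤ, Φ = fun w => (p : ℚ) ^ (ν * w.2)})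

lemma TT_c {c : Aff m → ℚ} (hc : c ∈ CA m) : (fun w => c w.1) ∈ TT p m :=
  subset_adjoin (.inl ⟨c, hc, rfl⟩)
lemma TT_k : (fun w => (w.2 : ℚ)) ∈ TT p m := subset_adjoin (.inr (.inl rfl))
lemma TT_p (ν : ℤ) : (fun w => (p : ℚ) ^ (ν * w.2)) ∈ TT p m := subset_adjoin (.inr (.inr ⟨ν, rfl⟩))

noncomputable def kap (C : Cell (RR p m)) (μ : Qp) (n : ℕ) (z : Aff m × Qp) : ℤ :=
  ((C.x z).valuation - μ.valuation) / n

lemma Pset_val {k : ℕ} {x μ : Qp} (hx : x ≠ 0) (hμ : μ ≠ 0) (h : x / μ ∈ Pset p k) (hk : 0 < k) :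
    x.valuation = μ.valuation + k * ((x.valuation - μ.valuation) / k) := by
  obtain ⟨y, hy, e⟩ := h
  have h1 := congrArg Padic.valuation e
  rw [valuation_pow, valuation_div hx hμ] at h1
  rw [← h1, Int.mul_ediv_cancel_left _ (by exact_mod_cast hk.ne')]
  omega

variable {U : Ultrafilter ((Fin m → ℚ_[p]) × ℚ_[p])}

lemma FG_gen {h : Aff (m + 1) → Qp} (hh : IsSubanalyticFn p h) :
    FG U (fun C μ n => 0 < n → ∃ Y, Def (RR p m) Y ∧ {z | z.1 ∈ Y} ∈ U ∧ ((∀ z ∈ Om C μ n Y, h (sn z) = 0) ∨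
      ∃ θ ∈ RR p m, ∃ ν : ℤ, ∀ z ∈ Om C μ n Y, h (sn z) ≠ 0 ∧ θ z.1 ≠ 0 ∧
        (h (sn z)).valuation = (θ z.1).valuation + ν * kap C μ n z)) := by
  obtain ⟨e, he, δ, hδ, hA⟩ := VD_sub hh (U.map sn)
  have h2 : FG U (fun C μ n => μ ≠ 0 ∧ e ∣ n ∧ ∃ N, 0 < N ∧ C.Prep preRR N (fun z => δ (sn z))) :=
    ⟨{δ}, Set.finite_singleton δ, by simpa using hδ, e, he, 1, fun N hN hN0 C hC hP μ hμ n hn hn' =>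
      ⟨hμ, hn, N, hN0, hP δ rfl⟩⟩
  refine ((FG_BF hA).and h2).mono ?_
  rintro C μ n ⟨⟨Y, hY, hY', hA⟩, hμ, ⟨n', rfl⟩, N, hN, hP⟩ hn0
  refine ⟨Y, hY, hY', ?_⟩
  rcases hP with h1 | ⟨g, hg, hg0, ν, u, hu, hf⟩
  · left
    intro z hz
    have h3 : ‖h (sn z)‖ ^ e = ‖δ (sn z)‖ := hA z hz
    rw [show δ (sn z) = 0 from h1 z hz.1, norm_zero] at h3
    exact norm_eq_zero.1 (pow_eq_zero_iff he.ne' |>.1 h3)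
  · right
    obtain ⟨θ, hθ, hθ'⟩ := richRR.floor_root e he (fun s => g s * μ ^ ν) (preRR.mul hg (preRR.const _))
    refine ⟨θ, hθ, ν * n', fun z hz => ?_⟩
    have hgz := hg0 z.1 hz.1.1
    have hx := hz.1.2.1
    have hxν := zpow_ne_zero ν hx
    have h3 : ‖h (sn z)‖ ^ e = ‖δ (sn z)‖ := hA z hz
    rw [show δ (sn z) = _ from hf z hz.1, norm_mul, hu.norm hN hz.1, mul_one, ← norm_pow] at h3
    have h4 : h (sn z) ≠ 0 := by
      intro h4
      rw [h4, zero_pow he.ne', norm_zero, eq_comm, norm_eq_zero] at h3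
      exact mul_ne_zero hgz hxν h3
    rw [norm_eq_iff_val (pow_ne_zero _ h4) (mul_ne_zero hgz hxν), valuation_mul hgz hxν,
      valuation_pow, valuation_zpow, Pset_val hx hμ hz.2.2 hn0] at h3
    have h5 := hθ' z.1 (mul_ne_zero hgz (zpow_ne_zero _ hμ))
    refine ⟨h4, h5.1, ?_⟩
    have he' : (e : ℤ) ≠ 0 := by exact_mod_cast he.ne'
    rw [h5.2, valuation_mul hgz (zpow_ne_zero _ hμ), valuation_zpow]
    unfold kap
    rw [show (g z.1).valuation + ν * μ.valuation = e * ((h (sn z)).valuation -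
      ν * n' * (((C.x z).valuation - μ.valuation) / (e * n' : ℕ))) by push_cast at h3 ⊢; linear_combination -h3,
      Int.mul_ediv_cancel_left _ he']
    ring

/-- Preparation of constructible functions. -/
theorem FG_CA {F : Aff (m + 1) → ℚ} (hF : F ∈ CA (m + 1)) :
    FG U (fun C μ n => 0 < n → ∃ Y, Def (RR p m) Y ∧ {z | z.1 ∈ Y} ∈ U ∧ ∃ Φ ∈ TT p m,
      ∀ z ∈ Om C μ n Y, F (sn z) = Φ (z.1, kap C μ n z)) := by
  have hp : (p : ℚ) ≠ 0 := by exact_mod_cast (Fact.out : p.Prime).ne_zero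
  induction hF using Algebra.adjoin_induction with
  | mem F hF =>
    rcases hF with ⟨h, h1, h2, rfl⟩ | ⟨h, h1, rfl⟩
    · refine (FG_gen h1).mono fun C μ n H hn => ?_
      obtain ⟨Y, hY, hY', h3 | ⟨θ, hθ, ν, h3⟩⟩ := H hn
      · exact ⟨Y, hY, hY', 0, zero_mem _, fun z hz => by simp [h3 z hz]⟩
      · refine ⟨Y, hY, hY', _, add_mem (TT_c (VD_RR hθ).val) (mul_mem (algebraMap_mem _ (ν : ℚ)) TT_k), fun z hz => ?_⟩
        simp [(h3 z hz).2.2]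
    · refine (FG_gen h1).mono fun C μ n H hn => ?_
      obtain ⟨Y, hY, hY', h3 | ⟨θ, hθ, ν, h3⟩⟩ := H hn
      · exact ⟨Y, hY, hY', 0, zero_mem _, fun z hz => by simp [h3 z hz]⟩
      · refine ⟨Y, hY, hY', _, mul_mem (TT_c (VD_RR hθ).abs) (TT_p (-ν)), fun z hz => ?_⟩
        obtain ⟨h4, h5, h6⟩ := h3 z hz
        simp only [mul_apply, absQ h4, absQ h5, h6]
        rw [← zpow_add₀ hp]; ring_nf
  | algebraMap r => exact ⟨∅, Set.finite_empty, by simp, 1, one_pos, 1, fun _ _ _ _ _ _ _ _ _ _ _ _ =>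
      ⟨_, preRR.def_univ, univ_mem, _, algebraMap_mem _ r, fun _ _ => rfl⟩⟩
  | add f g _ _ hf hg =>
    refine (hf.and hg).mono fun C μ n ⟨H, H'⟩ hn => ?_
    obtain ⟨Y, h1, h2, Φ, hΦ, h3⟩ := H hn
    obtain ⟨Y', h1', h2', Φ', hΦ', h3'⟩ := H' hn
    refine ⟨Y ∩ Y', preRR.def_inter h1 h1', inter_mem h2 h2', _, add_mem hΦ hΦ', fun z hz => ?_⟩
    simp [h3 z ⟨hz.1, hz.2.1.1, hz.2.2⟩, h3' z ⟨hz.1, hz.2.1.2, hz.2.2⟩]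
  | mul f g _ _ hf hg =>
    refine (hf.and hg).mono fun C μ n ⟨H, H'⟩ hn => ?_
    obtain ⟨Y, h1, h2, Φ, hΦ, h3⟩ := H hn
    obtain ⟨Y', h1', h2', Φ', hΦ', h3'⟩ := H' hn
    refine ⟨Y ∩ Y', preRR.def_inter h1 h1', inter_mem h2 h2', _, mul_mem hΦ hΦ', fun z hz => ?_⟩
    simp [h3 z ⟨hz.1, hz.2.1.1, hz.2.2⟩, h3' z ⟨hz.1, hz.2.1.2, hz.2.2⟩]

end

/-! ### Exponential polynomials -/

/-- Monomials. -/
noncomputable def mon (p : ℕ) (i : ℤ × ℕ) (k : ℤ) : ℚ := (p : ℚ) ^ (i.1 * k) * (k : ℚ) ^ i.2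

section
variable {m : ℕ}

lemma pQ_ne : (p : ℚ) ≠ 0 := by exact_mod_cast (Fact.out : p.Prime).ne_zero

lemma TT_subst {Φ : Aff m × ℤ → ℚ} (hΦ : Φ ∈ TT p m) {θ : Aff m → Qp} (hθ : θ ∈ RR p m)
    (n : ℤ) : (fun w => Φ (w.1, (θ w.1).valuation + n * w.2)) ∈ TT p m := by
  induction hΦ using Algebra.adjoin_induction with
  | mem F hF =>
    rcases hF with ⟨c, hc, rfl⟩ | rfl | ⟨ν, rfl⟩
    · exact TT_c hc
    · convert add_mem (TT_c (VD_RR hθ).val) (mul_mem (algebraMap_mem _ (n : ℚ)) TT_k) using 1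
      ext w; simp
    · have h : (fun s => (p : ℚ) ^ (ν * (θ s).valuation)) ∈ CA m := by
        have h1 := (VD_RR (preRR.zpow (preRR.add hθ (preRR.def_eq hθ preRR.zero)) (-ν))).abs
        convert h1 using 1
        ext s
        by_cases h0 : θ s = 0
        · simp [h0]
        · simp [h0, absQ h0, zpow_mul']
      convert mul_mem (TT_c h) (TT_p (ν * n)) using 1
      ext w
      simp only [mul_apply, ← zpow_add₀ (pQ_ne (p := p))]
      ring_nf
  | algebraMap r => exact algebraMap_mem _ r
  | add f g _ _ hf hg => exact add_mem hf hg
  | mul f g _ _ hf hg => exact mul_mem hf hg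

lemma TT_at {Φ : Aff m × ℤ → ℚ} (hΦ : Φ ∈ TT p m) {θ : Aff m → Qp} (hθ : θ ∈ RR p m)
    (n : ℤ) : (fun s => Φ (s, (θ s).valuation + n)) ∈ CA m := by
  induction hΦ using Algebra.adjoin_induction with
  | mem F hF =>
    rcases hF with ⟨c, hc, rfl⟩ | rfl | ⟨ν, rfl⟩
    · exact hc
    · convert add_mem (VD_RR hθ).val (algebraMap_mem _ (n : ℚ)) using 1
      ext w; simp
    · have h1 := (VD_RR (preRR.zpow (preRR.add hθ (preRR.def_eq hθ preRR.zero)) (-ν))).abs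
      convert mul_mem h1 (algebraMap_mem _ ((p : ℚ) ^ (ν * n))) using 1
      ext s
      by_cases h0 : θ s = 0
      · simp [h0]
      · simp [h0, absQ h0, zpow_mul', mul_add, zpow_add₀ (pQ_ne (p := p))]
  | algebraMap r => exact algebraMap_mem _ r
  | add f g _ _ hf hg => exact add_mem hf hg
  | mul f g _ _ hf hg => exact mul_mem hf hg

lemma mon_TT (i : ℤ × ℕ) : (fun w => mon p i w.2) ∈ TT p m := mul_mem (TT_p i.1) (pow_mem TT_k i.2)

lemma TT_span {Φ : Aff m × ℤ → ℚ} (hΦ : Φ ∈ TT p m) : Φ ∈ Submodule.span ℚ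
    {Φ : Aff m × ℤ → ℚ | ∃ c ∈ CA m, ∃ i, Φ = fun w => c w.1 * mon p i w.2} := by
  induction hΦ using Algebra.adjoin_induction with
  | mem F hF =>
    rcases hF with ⟨c, hc, rfl⟩ | rfl | ⟨ν, rfl⟩
    · exact Submodule.subset_span ⟨c, hc, (0, 0), by simp [mon]⟩
    · exact Submodule.subset_span ⟨1, one_mem _, (0, 1), by simp [mon]⟩
    · exact Submodule.subset_span ⟨1, one_mem _, (ν, 0), by simp [mon]⟩
  | algebraMap r =>
    exact Submodule.subset_span ⟨_, algebraMap_mem _ r, (0, 0), by ext; simp [mon]⟩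
  | add f g _ _ hf hg => exact add_mem hf hg
  | mul f g _ _ hf hg =>
    have h := Submodule.mul_mem_mul hf hg
    rw [Submodule.span_mul_span] at h
    refine Submodule.span_mono ?_ h
    rintro _ ⟨_, ⟨c, hc, i, rfl⟩, _, ⟨c', hc', i', rfl⟩, rfl⟩
    refine ⟨_, mul_mem hc hc', i + i', ?_⟩
    ext w
    simp only [mon, mul_apply, Prod.fst_add, Prod.snd_add, add_mul, zpow_add₀ (pQ_ne (p := p)), pow_add]
    ring

lemma TT_rep {Φ : Aff m × ℤ → ℚ} (hΦ : Φ ∈ TT p m) : ∃ e : (ℤ × ℕ) →₀ (Aff m → ℚ),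
    (∀ i, e i ∈ CA m) ∧ ∀ w, Φ w = e.sum fun i c => c w.1 * mon p i w.2 := by
  classical
  have hs := TT_span hΦ
  clear hΦ
  induction hs using Submodule.span_induction with
  | mem Φ h =>
    obtain ⟨c, hc, i, rfl⟩ := h
    refine ⟨Finsupp.single i c, fun j => ?_, fun w => by simp⟩
    rw [Finsupp.single_apply]; split_ifs; exacts [hc, zero_mem _]
  | zero => exact ⟨0, fun _ => zero_mem _, fun w => by simp⟩
  | add f g _ _ hf hg =>
    obtain ⟨e, h1, h2⟩ := hf
    obtain ⟨e', h1', h2'⟩ := hg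
    refine ⟨e + e', fun i => add_mem (h1 i) (h1' i), fun w => ?_⟩
    rw [Finsupp.sum_add_index' (by simp) (by simp [add_mul]), Pi.add_apply, h2, h2']
  | smul r f _ hf =>
    obtain ⟨e, h1, h2⟩ := hf
    refine ⟨r • e, fun i => Subalgebra.smul_mem _ (h1 i) r, fun w => ?_⟩
    rw [Finsupp.sum_smul_index' (by simp), Pi.smul_apply, h2, Finsupp.smul_sum]
    simp [mul_assoc]

lemma TT_anti {Ψ : Aff m × ℤ → ℚ} (hΨ : Ψ ∈ TT p m) :
    ∃ T ∈ TT p m, ∀ s k, T (s, k + 1) - T (s, k) = Ψ (s, k) := by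
  have key : ∀ (α : ℤ) (d : ℕ), ∃ t : ℤ → ℚ, (fun w => t w.2) ∈ TT p m ∧ ∀ k, t (k + 1) - t k = mon p (α, d) k := by
    intro α d
    induction d using Nat.strong_induction_on with
    | _ d ih =>
    choose! t ht ht' using ih
    by_cases hα : α = 0
    · subst hα
      refine ⟨fun k => ((k : ℚ) ^ (d + 1) - ∑ i ∈ range d, (Nat.choose (d + 1) i : ℚ) * t i k) / (d + 1), ?_, fun k => ?_⟩
      · convert mul_mem (algebraMap_mem (TT p m) ((d + 1 : ℚ)⁻¹)) (sub_mem (pow_mem TT_k (d + 1)) (sum_mem fun i (hi : i ∈ range d) =>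
          mul_mem (algebraMap_mem (TT p m) (Nat.choose (d + 1) i : ℚ)) (ht i (mem_range.1 hi)))) using 1
        ext w; simp [div_eq_inv_mul]
      · rw [← sub_div, sub_sub_sub_comm, ← Finset.sum_sub_distrib]
        have h1 : ∑ i ∈ range d, ((Nat.choose (d + 1) i : ℚ) * t i (k + 1) - (Nat.choose (d + 1) i : ℚ) * t i k)
            = ∑ i ∈ range d, (k : ℚ) ^ i * (Nat.choose (d + 1) i : ℚ) :=
          sum_congr rfl fun i hi => by
            rw [← mul_sub, ht' i (mem_range.1 hi)]; simp [mon, mul_comm]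
        have h2 : ((k : ℚ) + 1) ^ (d + 1) = _ := add_pow _ _ _
        rw [sum_range_succ, sum_range_succ] at h2
        simp only [one_pow, mul_one, Nat.choose_self, Nat.choose_succ_self_right] at h2
        rw [h1]; push_cast at h2 ⊢; rw [h2]
        have : (d : ℚ) + 1 ≠ 0 := by positivity
        simp only [mon, zero_mul, zpow_zero, one_mul]
        field_simp; ring
    · have hq : (p : ℚ) ^ α - 1 ≠ 0 := by
        rw [sub_ne_zero]
        intro h
        have h1 : (1 : ℚ) < p := by exact_mod_cast (Fact.out : p.Prime).one_lt
        exact hα ((zpow_eq_one_iff_right₀ (by linarith) h1.ne').1 h)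
      refine ⟨fun k => (mon p (α, d) k - (p : ℚ) ^ α * ∑ i ∈ range d, (Nat.choose d i : ℚ) * t i k) / ((p : ℚ) ^ α - 1), ?_, fun k => ?_⟩
      · convert mul_mem (algebraMap_mem (TT p m) (((p : ℚ) ^ α - 1)⁻¹)) (sub_mem (mon_TT (α, d))
          (mul_mem (algebraMap_mem (TT p m) ((p : ℚ) ^ α)) (sum_mem fun i (hi : i ∈ range d) =>
          mul_mem (algebraMap_mem (TT p m) (Nat.choose d i : ℚ)) (ht i (mem_range.1 hi))))) using 1
        ext w; simp [div_eq_inv_mul]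
      · rw [← sub_div, sub_sub_sub_comm, ← mul_sub, ← Finset.sum_sub_distrib]
        have h1 : ∑ i ∈ range d, ((Nat.choose d i : ℚ) * t i (k + 1) - (Nat.choose d i : ℚ) * t i k)
            = (p : ℚ) ^ (α * k) * ∑ i ∈ range d, (k : ℚ) ^ i * (Nat.choose d i : ℚ) := by
          rw [mul_sum]
          exact sum_congr rfl fun i hi => by
            rw [← mul_sub, ht' i (mem_range.1 hi)]; simp only [mon]; ring
        have h2 : ((k : ℚ) + 1) ^ d = _ := add_pow _ _ _
        rw [sum_range_succ] at h2
        simp only [one_pow, mul_one, Nat.choose_self] at h2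
        rw [h1, div_eq_iff hq]
        simp only [mon, mul_add, zpow_add₀ (pQ_ne (p := p))]
        push_cast
        rw [h2, mul_one]; push_cast; ring
  have hs := TT_span hΨ
  clear hΨ
  induction hs using Submodule.span_induction with
  | mem Φ h =>
    obtain ⟨c, hc, i, rfl⟩ := h
    obtain ⟨t, ht, h⟩ := key i.1 i.2
    exact ⟨_, mul_mem (TT_c hc) ht, fun s k => by simp [← mul_sub, h]⟩
  | zero => exact ⟨0, zero_mem _, by simp⟩
  | add f g _ _ hf hg =>
    obtain ⟨e, h1, h2⟩ := hf
    obtain ⟨e', h1', h2'⟩ := hg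
    exact ⟨_, add_mem h1 h1', fun s k => by simp only [Pi.add_apply, ← h2, ← h2']; ring⟩
  | smul r f _ hf =>
    obtain ⟨e, h1, h2⟩ := hf
    exact ⟨_, Subalgebra.smul_mem _ h1 r, fun s k => by simp only [Pi.smul_apply, smul_eq_mul, ← h2]; ring⟩

open Asymptotics in
lemma mon_littleO {i j : ℤ × ℕ} (h : i.1 < j.1 ∨ i.1 = j.1 ∧ i.2 < j.2) :
    (fun l : ℕ => ((mon p i l : ℚ) : ℝ)) =o[atTop] (fun l : ℕ => ((mon p j l : ℚ) : ℝ)) := by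
  have hp1 := one_lt_pR (p := p)
  have hp0 : (p : ℝ) ≠ 0 := by positivity
  have e : ∀ i, (fun l : ℕ => ((mon p i l : ℚ) : ℝ)) = fun l : ℕ => ((p : ℝ) ^ i.1) ^ l * (l : ℝ) ^ i.2 := by
    intro i; ext l; simp [mon, zpow_mul]
  rw [e i, e j]
  rcases h with h | ⟨h, h'⟩
  · have h1 : (fun l : ℕ => (l : ℝ) ^ i.2) =o[atTop] (fun l : ℕ => ((p : ℝ) ^ (j.1 - i.1)) ^ l) :=
      isLittleO_pow_const_const_pow_of_one_lt _ (one_lt_zpow₀ hp1 (by omega))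
    have h2 := (isBigO_refl (fun l : ℕ => ((p : ℝ) ^ i.1) ^ l) atTop).mul_isLittleO h1
    refine h2.trans_isBigO ?_
    simp only [← mul_pow, ← zpow_add₀ hp0, add_sub_cancel]
    refine IsBigO.of_bound 1 ?_
    filter_upwards [eventually_ge_atTop 1] with l hl
    rw [one_mul, norm_mul]
    refine le_mul_of_one_le_right (norm_nonneg _) ?_
    rw [norm_pow, Real.norm_natCast]
    exact one_le_pow₀ (by exact_mod_cast hl)
  · rw [h]
    exact (isBigO_refl _ _).mul_isLittleO ((isLittleO_pow_pow_atTop_of_lt h').comp_tendsto tendsto_natCast_atTop_atTop)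

open Asymptotics in
lemma mon_limit (e : (ℤ × ℕ) →₀ ℝ) {L : ℝ}
    (h : Tendsto (fun l : ℕ => e.sum fun i c => c * ((mon p i l : ℚ) : ℝ)) atTop (nhds L)) : L = e (0, 0) := by
  classical
  have h00 : (fun l : ℕ => ((mon p (0, 0) l : ℚ) : ℝ)) = fun _ => 1 := by ext; simp [mon]
  rcases e.support.eq_empty_or_nonempty with h0 | h0
  · rw [Finsupp.support_eq_empty] at h0
    subst h0
    simpa using tendsto_nhds_unique h (by simp)
  obtain ⟨j, hj, hmax⟩ := e.support.exists_max_image toLex h0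
  have hne : e j ≠ 0 := Finsupp.mem_support_iff.1 hj
  have hlt : ∀ i, toLex i < toLex j → i.1 < j.1 ∨ i.1 = j.1 ∧ i.2 < j.2 := fun i hi => Prod.Lex.lt_iff.1 hi
  have h1 : (fun l : ℕ => (e.sum fun i c => c * ((mon p i l : ℚ) : ℝ)) - e j * ((mon p j l : ℚ) : ℝ)) =o[atTop]
      (fun l : ℕ => ((mon p j l : ℚ) : ℝ)) := by
    have : (fun l : ℕ => (e.sum fun i c => c * ((mon p i l : ℚ) : ℝ)) - e j * ((mon p j l : ℚ) : ℝ)) =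
        fun l : ℕ => ∑ i ∈ e.support.erase j, e i * ((mon p i l : ℚ) : ℝ) := by
      ext l; rw [Finsupp.sum, ← Finset.add_sum_erase _ _ hj]; ring
    rw [this]
    refine IsLittleO.fun_sum fun i hi => (mon_littleO (hlt i ?_)).const_mul_left _
    rw [Finset.mem_erase] at hi
    exact lt_of_le_of_ne (hmax i hi.2) (fun hc => hi.1 (toLex.injective hc))
  rcases lt_trichotomy (toLex j) (toLex (0, 0)) with hlt0 | heq | hgt
  · have h2 : e (0, 0) = 0 := by
      by_contra hc
      exact absurd (hmax _ (Finsupp.mem_support_iff.2 hc)) (not_le.2 hlt0)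
    have h3 := mon_littleO (p := p) (j := (0, 0)) (Prod.Lex.lt_iff.1 hlt0)
    have h4 := ((h1.trans h3).add (h3.const_mul_left (e j))).congr_left (fun l => sub_add_cancel _ _)
    rw [h00, isLittleO_one_iff] at h4
    rw [h2]; exact tendsto_nhds_unique h h4
  · obtain rfl := toLex.injective heq
    rw [h00, isLittleO_one_iff] at h1
    have h2 := h1.add_const (e (0, 0))
    refine tendsto_nhds_unique h ?_
    have h00' : ∀ l : ℕ, ((mon p (0, 0) l : ℚ) : ℝ) = 1 := fun l => congrFun h00 l
    rw [zero_add] at h2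
    exact h2.congr fun l => by rw [h00' l]; ring
  · exfalso
    have h3 := mon_littleO (p := p) (i := (0, 0)) (Prod.Lex.lt_iff.1 hgt)
    have h4 : (fun l : ℕ => e.sum fun i c => c * ((mon p i l : ℚ) : ℝ)) =o[atTop] (fun l : ℕ => ((mon p j l : ℚ) : ℝ)) := by
      refine IsBigO.trans_isLittleO ?_ h3
      rw [h00]; exact h.isBigO_one ℝ
    have h5 := (h4.sub h1).congr_left (fun l => sub_sub_cancel _ _)
    have h6 := (isLittleO_const_mul_left_iff hne).1 h5
    have h7 : ∀ᶠ l : ℕ in atTop, ((mon p j l : ℚ) : ℝ) ≠ 0 := by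
      filter_upwards [eventually_ge_atTop 1] with l hl
      have : (l : ℚ) ≠ 0 := by exact_mod_cast (by omega : l ≠ 0)
      simp only [mon, ne_eq, Rat.cast_eq_zero, mul_eq_zero, not_or]
      exact ⟨zpow_ne_zero _ pQ_ne, pow_ne_zero _ (by exact_mod_cast this)⟩
    exact isLittleO_irrefl h7.frequently h6

end

/-! ### Summation over the value group -/

section
variable {m : ℕ}

/-- Pieces of `S × ℤ`. -/
def Pc (X : Set Aff m) (n : ℕ) (j : ℤ) (b b' : Aff m → Qp) : Set (Aff m × ℤ) :=
  {w | w.1 ∈ X ∧ (n : ℤ) ∣ w.2 - j ∧ ‖b w.1 * p ^ w.2‖ ≤ 1 ∧ ‖b' w.1 * p ^ (-w.2)‖ ≤ 1}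

/-- Definable pieces whose lower bound satisfies `Q`. -/
def IsPc (Q : (Aff m → Qp) → Prop) (n : ℕ) (j : ℤ) (A : Set (Aff m × ℤ)) : Prop :=
  0 < n ∧ ∃ X b d, Def (RR p m) X ∧ b ∈ RR p m ∧ d ∈ RR p m ∧ Q b ∧ A = Pc X n j b d

/-- `Φ` is exponential-polynomial on `A`. -/
def TOn (Φ : Aff m × ℤ → ℚ) (n : ℕ) (j : ℤ) (A : Set (Aff m × ℤ)) : Prop :=
  ∃ Φ' ∈ TT p m, ∀ w ∈ A, Φ w = Φ' (w.1, (w.2 - j) / n)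

/-- Piecewise exponential-polynomial functions. -/
def Tame (Φ : Aff m × ℤ → ℚ) : Prop :=
  ∀ 𝓦 : Ultrafilter (Aff m × ℤ), ∃ A ∈ 𝓦, ∃ n j, IsPc (fun _ => True) n j A ∧ TOn Φ n j A

/-- The sums of `Φ` over the fibres of `Z` are constructible. -/
def SumOK (Φ : Aff m × ℤ → ℚ) (Z : Set (Aff m × ℤ)) : Prop :=
  ∃ g ∈ CA m, ∀ s, Summable (fun k => (Φ (s, k) : ℝ)) →
    (g s : ℝ) = ∑' k, Z.indicator (fun w => (Φ w : ℝ)) (s, k)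

lemma pow_le_one_iff {x : Qp} (hx : x ≠ 0) (k : ℤ) : ‖x * p ^ k‖ ≤ 1 ↔ 0 ≤ x.valuation + k := by
  rw [norm_le_one_iff_val (mul_ne_zero hx (zpow_ne_zero _ pK_ne)), valuation_mul hx (zpow_ne_zero _ pK_ne),
    valuation_zpow, valuation_p, mul_one]

lemma IsPc.inter {A A' : Set (Aff m × ℤ)} {n n' : ℕ} {j j' : ℤ} (h : IsPc (fun b => ∀ s, b s ≠ 0) n j A)
    (h' : IsPc (fun _ => True) n' j' A') : ∃ n'' j'', IsPc (fun b => ∀ s, b s ≠ 0) n'' j'' (A ∩ A') ∧ n' ∣ n'' ∧ (n' : ℤ) ∣ j'' - j' := by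
  obtain ⟨hn, X, b, d, hX, hb, hd, hb0, rfl⟩ := h
  obtain ⟨hn', X', b', d', hX', hb', hd', -, rfl⟩ := h'
  obtain ⟨b2, hb2, hb2'⟩ := preRR.larger hb hb'
  obtain ⟨d2, hd2, hd2'⟩ := preRR.larger hd hd'
  have hmax : ∀ {x y z w : Qp}, ‖x‖ ≤ ‖z‖ ∧ ‖y‖ ≤ ‖z‖ ∧ (z = x ∨ z = y) → (‖z * w‖ ≤ 1 ↔ ‖x * w‖ ≤ 1 ∧ ‖y * w‖ ≤ 1) := by
    rintro x y z w ⟨h1, h2, h3⟩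
    simp only [norm_mul]
    refine ⟨fun h => ⟨le_trans (by gcongr) h, le_trans (by gcongr) h⟩, fun h => ?_⟩
    rcases h3 with rfl | rfl
    exacts [h.1, h.2]
  have hne : ∀ s, b2 s ≠ 0 := fun s h => hb0 s (norm_le_zero_iff.1 (by simpa [h] using (hb2' s).1))
  by_cases hk : ∃ k0 : ℤ, (n : ℤ) ∣ k0 - j ∧ (n' : ℤ) ∣ k0 - j'
  · obtain ⟨k0, h1, h2⟩ := hk
    refine ⟨n.lcm n', k0, ⟨Nat.lcm_pos hn hn', _, _, _, preRR.def_inter hX hX', hb2, hd2, hne, ?_⟩, Nat.dvd_lcm_right _ _, h2⟩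
    have hl : ∀ k : ℤ, ((n.lcm n' : ℕ) : ℤ) ∣ k - k0 ↔ (n : ℤ) ∣ k - j ∧ (n' : ℤ) ∣ k - j' := by
      intro k
      rw [← sub_add_sub_cancel k k0 j, ← sub_add_sub_cancel k k0 j', dvd_add_left h1, dvd_add_left h2]
      exact Int.coe_lcm_dvd_iff (a := n) (b := n')
    ext w
    simp only [Pc, Set.mem_inter_iff, mem_ofPred_eq, hl, hmax (hb2' w.1), hmax (hd2' w.1)]
    tauto
  · refine ⟨n', j', ⟨hn', _, _, _, preRR.def_empty, hb2, hd2, hne, ?_⟩, dvd_rfl, by simp⟩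
    ext w
    refine ⟨fun hw => (hk ⟨w.2, hw.1.2.1, hw.2.2.1⟩).elim, fun hw => hw.1.elim⟩

lemma TOn.refine {Φ : Aff m × ℤ → ℚ} {A B : Set (Aff m × ℤ)} {n n' : ℕ} {j j' : ℤ} (h : TOn Φ n j A)
    (hB : IsPc (fun b => ∀ s, b s ≠ 0) n' j' B) (hn0 : 0 < n) (hn : n ∣ n') (hj : (n : ℤ) ∣ j' - j) (hs : B ⊆ A) : TOn Φ n' j' B := by
  obtain ⟨Φ', hΦ', h⟩ := h
  obtain ⟨hn', X, b, b', -, -, -, -, rfl⟩ := hB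
  obtain ⟨e, rfl⟩ := hn
  obtain ⟨i, hi⟩ := hj
  refine ⟨_, TT_subst hΦ' (preRR.const (ϖ ^ i)) e, fun w hw => ?_⟩
  rw [h w (hs hw)]
  obtain ⟨q, hq⟩ := hw.2.1
  have h1 : w.2 - j = n * (i + e * q) := by push_cast at hq; linear_combination hq + hi
  have h0 : (n : ℤ) ≠ 0 := by exact_mod_cast hn0.ne'
  rw [h1, hq, Int.mul_ediv_cancel_left _ h0, Int.mul_ediv_cancel_left _ (by exact_mod_cast hn'.ne')]
  simp

/-- Sums over one piece. -/
lemma sum_piece {Φ : Aff m × ℤ → ℚ} {A : Set (Aff m × ℤ)} {n : ℕ} {j : ℤ}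
    (hA : IsPc (fun b => ∀ s, b s ≠ 0) n j A) (h : TOn Φ n j A) : SumOK Φ A := by
  classical
  obtain ⟨hn, X, b, d, hX, hb, hd, hb0, rfl⟩ := hA
  obtain ⟨Φ', hΦ', h⟩ := h
  have hn0 : (0 : ℤ) < n := by exact_mod_cast hn
  obtain ⟨θ, hθ, hθ'⟩ := richRR.floor_root n hn _ (preRR.mul hb (preRR.const (ϖ ^ j)))
  obtain ⟨η, hη, hη'⟩ := richRR.floor_root n hn _ (preRR.mul hd (preRR.const (ϖ ^ (-j))))
  obtain ⟨T, hT, hT'⟩ := TT_anti hΦ'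
  have hpj : ∀ i : ℤ, ϖ ^ i ≠ 0 := fun i => zpow_ne_zero _ pK_ne
  replace hθ' : ∀ s, θ s ≠ 0 ∧ (θ s).valuation = ((b s).valuation + j) / n := fun s => by
    simpa [valuation_mul (hb0 s) (hpj j), valuation_zpow] using hθ' s (mul_ne_zero (hb0 s) (hpj j))
  replace hη' : ∀ s, d s ≠ 0 → η s ≠ 0 ∧ (η s).valuation = ((d s).valuation - j) / n := fun s hs => by
    have := hη' s (mul_ne_zero hs (hpj (-j)))
    rwa [mul_apply, valuation_mul hs (hpj (-j)), valuation_zpow, valuation_p, mul_one, ← sub_eq_add_neg] at this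
  have hT1 := TT_subst hT (preRR.inv hθ) 1
  have hT0 := TT_at hT (preRR.inv hθ) 0
  obtain ⟨e, he, hee⟩ := TT_rep hT1
  simp only [Pi.inv_apply, Padic.valuation_inv, one_mul] at hee hT0
  -- the fibre sums as sums over `ℕ`
  have hsum : ∀ s, Summable (fun k => (Φ (s, k) : ℝ)) → s ∈ X →
      HasSum (fun l : ℕ => if d s = 0 ∨ (l : ℤ) ≤ (η s).valuation + (θ s).valuation then (Φ' (s, -(θ s).valuation + l) : ℝ) else 0)
      (∑' k, (Pc X n j b d).indicator (fun w => (Φ w : ℝ)) (s, k)) := by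
    intro s hs hsX
    have hs' : Summable fun k => (Pc X n j b d).indicator (fun w => (Φ w : ℝ)) (s, k) := by
      exact hs.indicator {k | (s, k) ∈ Pc X n j b d}
    have hinj : Function.Injective (fun l : ℕ => j + n * (-(θ s).valuation + l)) := by
      intro l l' hl
      have := mul_left_cancel₀ hn0.ne' (add_left_cancel hl)
      omega
    have hmem : ∀ q : ℤ, (s, j + n * q) ∈ Pc X n j b d ↔ -(θ s).valuation ≤ q ∧ (d s = 0 ∨ q ≤ (η s).valuation) := by
      intro q
      have h1 : 0 ≤ (b s).valuation + (j + n * q) ↔ -(θ s).valuation ≤ q := by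
        rw [(hθ' s).2, neg_le, Int.le_ediv_iff_mul_le hn0]
        constructor <;> intro h <;> linarith
      have h2 : ‖d s * p ^ (-(j + n * q))‖ ≤ 1 ↔ (d s = 0 ∨ q ≤ (η s).valuation) := by
        by_cases h0 : d s = 0
        · simp [h0]
        · rw [pow_le_one_iff h0, (hη' s h0).2, Int.le_ediv_iff_mul_le hn0]
          simp only [h0, false_or]
          constructor <;> intro h <;> linarith
      simp only [Pc, mem_ofPred_eq, hsX, true_and, add_sub_cancel_left, dvd_mul_right, pow_le_one_iff (hb0 s), h1, h2]
    have h3 := hs'.hasSum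
    rw [← hinj.hasSum_iff] at h3
    · convert h3 using 1
      ext l
      simp only [Function.comp]
      by_cases h4 : (s, j + n * (-(θ s).valuation + l)) ∈ Pc X n j b d
      · rw [indicator_of_mem h4, h _ h4, if_pos]
        · simp [hn.ne']
        · exact ((hmem _).1 h4).2.imp_right fun h => by omega
      · rw [indicator_of_notMem h4, if_neg]
        rw [hmem] at h4
        exact fun h5 => h4 ⟨by omega, h5.imp_right fun h => by omega⟩
    · intro k hk
      refine indicator_of_notMem (fun h4 => hk ?_) _
      obtain ⟨q, hq⟩ := h4.2.1
      obtain rfl : k = j + n * q := by simp only at hq; omega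
      have h5 := ((hmem q).1 h4).1
      exact ⟨(q + (θ s).valuation).toNat, by simp only; rw [Int.toNat_of_nonneg (by omega)]; ring_nf⟩
  have htel : ∀ s (L : ℕ), ∑ l ∈ range L, (Φ' (s, -(θ s).valuation + l) : ℝ) = T (s, -(θ s).valuation + L) - T (s, -(θ s).valuation) := by
    intro s L
    have := Finset.sum_range_sub (fun l : ℕ => (T (s, -(θ s).valuation + l) : ℝ)) L
    simp only [Nat.cast_zero, add_zero] at this
    rw [← this]
    refine sum_congr rfl fun l _ => ?_
    rw [← hT']; push_cast; rw [add_assoc]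
  refine CA_glue_ex (P := fun s y => Summable (fun k => (Φ (s, k) : ℝ)) → (y : ℝ) = _) fun V => ?_
  have hcase : ∀ {Y : Set Aff m}, Def (RR p m) Y → (Y ∈ BF V) ∨ Yᶜ ∈ BF V := fun {Y} hY =>
    (V.em (· ∈ Y)).imp (Def_BF hY) (Def_BF (preRR.def_compl hY))
  rcases hcase hX with hX' | hX'
  swap
  · refine ⟨0, zero_mem _, ?_⟩
    filter_upwards [hX'] with s hs _
    rw [tsum_congr (fun k => indicator_of_notMem (fun h => hs h.1) _)]; simp
  rcases hcase (preRR.def_eq hd preRR.zero) with h0 | h0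
  · refine ⟨_, sub_mem (he (0, 0)) hT0, ?_⟩
    filter_upwards [hX', h0] with s hs h0 hS
    have h1 := (hsum s hS hs).tendsto_sum_nat
    simp only [show d s = 0 from h0, true_or, if_true, htel] at h1
    have h2 := h1.add_const (T (s, -(θ s).valuation) : ℝ)
    simp only [sub_add_cancel] at h2
    have h3 := mon_limit (p := p) (e.mapRange (fun c => ((c s : ℚ) : ℝ)) (by simp)) (h2.congr fun l => by
      rw [hee (s, l), Finsupp.sum_mapRange_index (by simp), Finsupp.sum, Finsupp.sum]
      push_cast; rfl)
    simp only [Finsupp.mapRange_apply] at h3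
    rw [← sub_eq_of_eq_add h3.symm]
    simp
  rcases hcase (preRR.def_le_one (preRR.mul (preRR.mul hη hθ) (preRR.const (ϖ ^ (1 : ℤ))))) with h1 | h1
  · refine ⟨_, sub_mem (TT_at hT hη 1) hT0, ?_⟩
    filter_upwards [hX', h0, h1] with s hs h0 h1 hS
    replace h0 : d s ≠ 0 := h0
    have hη0 := (hη' s h0).1
    replace h1 := (pow_le_one_iff (mul_ne_zero hη0 (hθ' s).1) 1).1 h1
    rw [valuation_mul hη0 (hθ' s).1] at h1
    have h2 := hsum s hS hs
    have h3 : ∀ l : ℕ, (d s = 0 ∨ (l : ℤ) ≤ (η s).valuation + (θ s).valuation) ↔ l ∈ range ((η s).valuation + (θ s).valuation + 1).toNat := by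
      intro l
      rw [mem_range, or_iff_right h0]; omega
    simp only [h3] at h2
    rw [h2.unique (hasSum_sum_of_ne_finset_zero (s := range ((η s).valuation + (θ s).valuation + 1).toNat)
      fun l hl => if_neg hl), sum_congr rfl (fun l hl => if_pos hl), htel, Int.toNat_of_nonneg h1]
    simp only [Pi.sub_apply, add_zero]; push_cast; ring_nf
  · refine ⟨0, zero_mem _, ?_⟩
    filter_upwards [hX', h0, h1] with s hs h0 h1 hS
    replace h0 : d s ≠ 0 := h0
    have hη0 := (hη' s h0).1
    have h1' : ¬ _ := fun h => h1 ((pow_le_one_iff (mul_ne_zero hη0 (hθ' s).1) 1).2 h)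
    rw [valuation_mul hη0 (hθ' s).1] at h1'
    have h2 := hsum s hS hs
    have h3 : ∀ l : ℕ, ¬ (d s = 0 ∨ (l : ℤ) ≤ (η s).valuation + (θ s).valuation) := by
      intro l
      rw [or_iff_right h0]; omega
    simp only [h3, if_false] at h2
    rw [h2.unique hasSum_zero]; simp

lemma sum_half {Φ : Aff m × ℤ → ℚ} (hΦ : Tame Φ) (h : ℤ) : SumOK Φ {w | h ≤ w.2} := by
  classical
  obtain ⟨F, hF, hcov⟩ := ultra_cover {A | ∃ n j, IsPc (fun _ => True) n j A ∧ TOn Φ n j A} fun 𝓦 => by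
    obtain ⟨A, hA, h⟩ := hΦ 𝓦
    exact ⟨A, hA, h⟩
  have key : ∀ F' : Finset (Set (Aff m × ℤ)), F' ⊆ F → ∀ W n j, IsPc (fun b => ∀ s, b s ≠ 0) n j W →
      SumOK Φ (W ∩ {w | ∃ A ∈ F', w ∈ A}) := by
    intro F'
    induction F' using Finset.induction_on with
    | empty => exact fun _ W n j _ => ⟨0, zero_mem _, fun s _ => by simp⟩
    | insert A F' _ ih =>
      intro hF' W n j hW
      rw [Finset.insert_subset_iff] at hF'
      obtain ⟨n1, j1, hA, hT⟩ := hF hF'.1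
      obtain ⟨n2, j2, h2, hn, hj⟩ := hW.inter hA
      obtain ⟨g1, hg1, e1⟩ := sum_piece h2 (hT.refine h2 hA.1 hn hj Set.inter_subset_right)
      obtain ⟨g2, hg2, e2⟩ := ih hF'.2 W n j hW
      obtain ⟨g3, hg3, e3⟩ := ih hF'.2 _ _ _ h2
      refine ⟨_, sub_mem (add_mem hg1 hg2) hg3, fun s hs => ?_⟩
      have hs' : ∀ Z : Set (Aff m × ℤ), Summable fun k => Z.indicator (fun w => (Φ w : ℝ)) (s, k) := fun Z =>
        hs.indicator {k | (s, k) ∈ Z}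
      simp only [Pi.sub_apply, Pi.add_apply, Rat.cast_sub, Rat.cast_add]
      rw [e1 s hs, e2 s hs, e3 s hs, ← (hs' _).tsum_add (hs' _), ← ((hs' _).add (hs' _)).tsum_sub (hs' _)]
      refine tsum_congr fun k => ?_
      by_cases h1 : (s, k) ∈ W <;> by_cases h2 : (s, k) ∈ A <;> by_cases h3 : ∃ A ∈ F', (s, k) ∈ A <;>
        simp [indicator, h1, h2, h3]
  have hW : IsPc (p := p) (m := m) (fun b => ∀ s, b s ≠ 0) 1 0 {w | h ≤ w.2} := by
    refine ⟨one_pos, Set.univ, _, 0, preRR.def_univ, preRR.const (ϖ ^ (-h)), preRR.zero, fun _ => zpow_ne_zero _ pK_ne, ?_⟩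
    ext w
    simp only [Pc, pow_le_one_iff (zpow_ne_zero (-h) (pK_ne (p := p))), valuation_zpow, valuation_p]
    simp
  have h1 : ({w | h ≤ w.2} : Set (Aff m × ℤ)) = {w | h ≤ w.2} ∩ {w | ∃ A ∈ F, w ∈ A} := by
    ext w
    simp [hcov w]
  rw [h1]
  exact key F subset_rfl _ _ _ hW

lemma Tame.neg {Φ : Aff m × ℤ → ℚ} (hΦ : Tame Φ) : Tame fun w => Φ (w.1, -w.2) := by
  intro 𝓦
  obtain ⟨A, hA, n, j, ⟨hn, X, b, b', hX, hb, hb', -, rfl⟩, Φ', hΦ', h⟩ := hΦ (𝓦.map fun w => (w.1, -w.2))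
  have e : ∀ w : Aff m × ℤ, w ∈ Pc X n (-j) b' b ↔ (w.1, -w.2) ∈ Pc X n j b b' := fun w => by
    simp only [Pc, mem_ofPred_eq, neg_neg, ← dvd_neg (b := -w.2 - j), neg_sub, sub_neg_eq_add, add_comm]
    tauto
  refine ⟨Pc X n (-j) b' b, mem_of_superset hA fun w hw => (e w).2 hw, n, -j, ⟨hn, X, b', b, hX, hb', hb, trivial, rfl⟩,
    _, TT_subst hΦ' (preRR.const 1) (-1), fun w hw => ?_⟩
  have hw' := (e w).1 hw
  obtain ⟨q, hq⟩ := hw'.2.1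
  show Φ (w.1, -w.2) = _
  rw [h _ hw']
  have hn0 : (n : ℤ) ≠ 0 := by exact_mod_cast hn.ne'
  simp only at hq ⊢
  rw [hq, show w.2 - -j = n * -q by linarith, Int.mul_ediv_cancel_left _ hn0, Int.mul_ediv_cancel_left _ hn0]
  simp

lemma Tame.sum {Φ : Aff m × ℤ → ℚ} (hΦ : Tame Φ) : ∃ g ∈ CA m, ∀ s,
    Summable (fun k => (Φ (s, k) : ℝ)) → (g s : ℝ) = ∑' k, (Φ (s, k) : ℝ) := by
  obtain ⟨g1, hg1, e1⟩ := sum_half hΦ 0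
  obtain ⟨g2, hg2, e2⟩ := sum_half hΦ.neg 1
  refine ⟨_, add_mem hg1 hg2, fun s hs => ?_⟩
  have hs2 : Summable fun k => (Φ (s, -k) : ℝ) := (Equiv.neg ℤ).summable_iff.2 hs
  simp only [Pi.add_apply, Rat.cast_add]
  have h1 : Summable fun k => ({w | 0 ≤ w.2} : Set (Aff m × ℤ)).indicator (fun w => (Φ w : ℝ)) (s, k) :=
    hs.indicator {k | 0 ≤ k}
  have h2 : Summable fun k => ({w | 1 ≤ w.2} : Set (Aff m × ℤ)).indicator (fun w => (Φ (w.1, -w.2) : ℝ)) (s, k) :=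
    hs2.indicator {k | 1 ≤ k}
  rw [e1 s hs, e2 s hs2, ← (Equiv.neg ℤ).tsum_eq]
  refine (((Equiv.neg ℤ).summable_iff.2 h1).tsum_add h2).symm.trans ?_
  refine (tsum_congr fun k => ?_).trans ((Equiv.neg ℤ).tsum_eq fun k => (Φ (s, k) : ℝ))
  simp only [Function.comp, indicator, mem_ofPred_eq, Equiv.neg_apply]
  by_cases h : 0 ≤ -k
  · rw [if_pos h, if_neg (by omega), add_zero]
  · rw [if_neg h, if_pos (by omega), zero_add]

end

/-! ### Restricting constructible functions to powers of `p` -/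

section
variable {m : ℕ}

lemma near_pow (M : ℕ) {x : Qp} (hx : x ∈ Pset p (p ^ M).totient) :
    ∃ w, ‖w‖ ≤ 1 ∧ x = p ^ x.valuation * (1 + p ^ M * w) := by
  obtain ⟨z, hz, rfl⟩ := hx
  obtain ⟨u, hu, hzu⟩ := exists_unit z hz
  obtain ⟨w, hw, h⟩ := Pset_near (p := p) M (x := u ^ (p ^ M).totient) (by rw [norm_pow, hu, one_pow])
    ⟨u, norm_ne_zero_iff.1 (by rw [hu]; exact one_ne_zero), rfl⟩
  refine ⟨w, hw, ?_⟩
  rw [← h, valuation_pow, mul_comm (_ : ℤ) z.valuation, zpow_mul, zpow_natCast, ← mul_pow, ← hzu]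

lemma tri (𝓦 : Ultrafilter (Aff m × ℤ)) {Δ : Aff m → Qp} (hΔ : Δ ∈ RR p m) (M : ℕ) :
    {w | Δ w.1 ≠ 0 ∧ ‖(Δ w.1)⁻¹ * p ^ (-M : ℤ) * p ^ w.2‖ ≤ 1} ∈ 𝓦 ∨ {w | ‖Δ w.1 * p ^ (-M : ℤ) * p ^ (-w.2)‖ ≤ 1} ∈ 𝓦 ∨
    ∃ ξ : Qp, ∃ A ∈ 𝓦, IsPc (fun _ => True) 1 0 A ∧ ∀ w ∈ A, ‖ξ * Δ w.1 - p ^ w.2‖ ≤ ‖ϖ ^ M * p ^ w.2‖ := by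
  by_cases h1 : {w | Δ w.1 ≠ 0 ∧ ‖(Δ w.1)⁻¹ * p ^ (-M : ℤ) * p ^ w.2‖ ≤ 1} ∈ 𝓦
  · exact .inl h1
  by_cases h2 : {w | ‖Δ w.1 * p ^ (-M : ℤ) * p ^ (-w.2)‖ ≤ 1} ∈ 𝓦
  · exact .inr (.inl h2)
  right; right
  have hN : 0 < (p ^ M).totient := Nat.totient_pos.2 (pow_pos (Fact.out : p.Prime).pos _)
  obtain ⟨T, hT, hT'⟩ := finite_cosets (p := p) _ hN
  have hp : ∀ i : ℤ, ϖ ^ i ≠ 0 := fun i => zpow_ne_zero _ pK_ne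
  have e1 : ∀ (s : Fin m → Qp) (d k : ℤ), Δ s ≠ 0 → (‖(Δ s)⁻¹ * p ^ (-d) * p ^ k‖ ≤ 1 ↔ (Δ s).valuation + d ≤ k) := fun s d k hs => by
    rw [pow_le_one_iff (mul_ne_zero (inv_ne_zero hs) (hp _)), valuation_mul (inv_ne_zero hs) (hp _),
      Padic.valuation_inv, valuation_zpow, valuation_p]
    constructor <;> intro <;> linarith
  have e2 : ∀ (s : Fin m → Qp) (d k : ℤ), Δ s ≠ 0 → (‖Δ s * p ^ d * p ^ (-k)‖ ≤ 1 ↔ k ≤ (Δ s).valuation + d) := fun s d k hs => by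
    rw [pow_le_one_iff (mul_ne_zero hs (hp _)), valuation_mul hs (hp _), valuation_zpow, valuation_p]
    constructor <;> intro <;> linarith
  obtain ⟨⟨d, μ⟩, hdμ, hA⟩ := ultra_finset 𝓦 (Finset.Icc (-M : ℤ) M ×ˢ T) (fun i => Pc ({s | Δ s ≠ 0} ∩ {s | Δ s / i.2 ∈ Pset p (p ^ M).totient}) 1 0
    (Δ⁻¹ * fun _ => ϖ ^ (-i.1)) (Δ * fun _ => ϖ ^ i.1)) (by
      filter_upwards [compl_umem h1, compl_umem h2] with w hw1 hw2
      rw [Set.mem_compl_iff, mem_ofPred_eq] at hw1 hw2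
      have hw0 : Δ w.1 ≠ 0 := fun h => hw2 (by simp [h])
      rw [e2 _ _ _ hw0] at hw2
      rw [e1 _ _ _ hw0, not_and] at hw1
      replace hw1 := hw1 hw0
      obtain ⟨μ, hμ, hμ'⟩ := hT' _ hw0
      refine ⟨(w.2 - (Δ w.1).valuation, μ), Finset.mem_product.2 ⟨Finset.mem_Icc.2 ⟨by simp only; omega, by simp only; omega⟩, hμ⟩,
        ⟨hw0, hμ'⟩, by simp, ?_, ?_⟩
      · exact (e1 _ _ _ hw0).2 (by simp)
      · exact (e2 _ _ _ hw0).2 (by simp))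
  have hμ := hT μ (Finset.mem_product.1 hdμ).2
  refine ⟨p ^ (d + μ.valuation) / μ, _, hA, ⟨one_pos, _, _, _, preRR.def_inter (preRR.def_ne hΔ) (preRR.def_coset hΔ μ hN),
    preRR.mul (preRR.inv hΔ) (preRR.const _), preRR.mul hΔ (preRR.const _), trivial, rfl⟩, ?_⟩
  rintro ⟨s, k⟩ ⟨⟨h0, h3⟩, -, h4, h5⟩
  have hk : k = (Δ s).valuation + d := le_antisymm ((e2 _ _ _ h0).1 h5) ((e1 _ _ _ h0).1 h4)
  obtain ⟨y, hy, h6⟩ := near_pow M h3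
  rw [valuation_div h0 hμ] at h6
  have h7 : p ^ (d + μ.valuation) / μ * Δ s = p ^ k + p ^ M * p ^ k * y := by
    rw [div_mul_eq_mul_div, mul_div_assoc, h6, hk, ← mul_assoc, ← zpow_add₀ pK_ne]; ring_nf
  simp only
  rw [h7, add_sub_cancel_left, norm_mul]
  exact mul_le_of_le_one_right (norm_nonneg _) hy

lemma Om_near {C : Cell (RR p m)} {μ : Qp} {n M : ℕ} {Y : Set Aff m} (hM : 0 < M)
    (hn : ∀ y : Qp, ‖y‖ ≤ 1 → 1 + p ^ M * y ∈ Pset p n) {s : Fin m → Qp} {t t' y : Qp} (hy : ‖y‖ ≤ 1)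
    (h : C.x (s, t') = C.x (s, t) * (1 + p ^ M * y)) : ((s, t') ∈ Om C μ n Y ↔ (s, t) ∈ Om C μ n Y) ∧ kap C μ n (s, t') = kap C μ n (s, t) := by
  have h1 := norm_one_add_p hM hy
  have h0 : (1 : Qp) + p ^ M * y ≠ 0 := norm_ne_zero_iff.1 (by rw [h1]; exact one_ne_zero)
  have h2 : ‖C.x (s, t')‖ = ‖C.x (s, t)‖ := by rw [h, norm_mul, h1, mul_one]
  have h3 : C.x (s, t') = 0 ↔ C.x (s, t) = 0 := by rw [h, mul_eq_zero, or_iff_left h0]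
  refine ⟨?_, ?_⟩
  · simp only [Om, Cell.set, mem_ofPred_eq, norm_mul, h2, ne_eq, h3]
    rw [h, mul_comm (C.x _) (1 + _), mul_div_assoc, Pset_mul_iff (hn y hy)]
  · by_cases hx : C.x (s, t) = 0
    · rw [kap, kap, h3.2 hx, hx]
    · rw [kap, kap, (norm_eq_iff_val (fun h => hx (h3.1 h)) hx).1 h2]

lemma tame_pow {F : Aff (m + 1) → ℚ} (hF : F ∈ CA (m + 1)) (M : ℕ)
    (hLC : ∀ s t t', t ≠ 0 → ‖t' - t‖ ≤ ‖ϖ ^ M * t‖ → F (sn (s, t')) = F (sn (s, t))) :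
    Tame fun w : Aff m × ℤ => F (sn (w.1, p ^ w.2)) := by
  intro 𝓦
  have hp : ∀ i : ℤ, ϖ ^ i ≠ 0 := fun i => zpow_ne_zero _ pK_ne
  have fin3 : ∀ {Δ : Aff m → Qp}, Δ ∈ RR p m → ∀ {M'}, M ≤ M' → (∃ ξ : Qp, ∃ A ∈ 𝓦, IsPc (fun _ => True) 1 0 A ∧
      ∀ w ∈ A, ‖ξ * Δ w.1 - p ^ w.2‖ ≤ ‖ϖ ^ M' * p ^ w.2‖) →
      ∃ A ∈ 𝓦, ∃ n j, IsPc (fun _ => True) n j A ∧ TOn (fun w : Aff m × ℤ => F (sn (w.1, p ^ w.2))) n j A := by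
    rintro Δ hΔ M' hM ⟨ξ, A, hA, hA', h⟩
    refine ⟨A, hA, 1, 0, hA', _, TT_c (comp_CA hF (sn_RR (preRR.mul (preRR.const ξ) hΔ))), fun w hw => ?_⟩
    refine (hLC _ _ _ (hp _) ((h w hw).trans ?_)).symm
    rw [norm_mul, norm_mul]
    gcongr ?_ * _
    exact norm_pow_anti hM
  have hlarge : ∀ x : Qp, x ≠ 0 → ¬ ‖x⁻¹ * p ^ (-(M + 1 : ℕ) : ℤ) * x‖ ≤ 1 := fun x hx => by
    rw [mul_right_comm, inv_mul_cancel₀ hx, pow_le_one_iff one_ne_zero, valuation_one]; push_cast; omega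
  by_cases hgen : ∀ c ∈ RR p m, {z | z.2 ≠ c z.1} ∈ 𝓦.map fun w : Aff m × ℤ => (w.1, ϖ ^ w.2)
  swap
  · push Not at hgen
    obtain ⟨c, hc, hc'⟩ := hgen
    replace hc' : {w : Aff m × ℤ | ϖ ^ w.2 = c w.1} ∈ 𝓦 := by
      have := compl_umem hc'
      filter_upwards [this] with w hw
      simpa using hw
    rcases tri 𝓦 hc (M + 1) with h | h | h
    · obtain ⟨w, h1, -, h2⟩ := 𝓦.nonempty_of_mem (inter_mem hc' h)
      rw [show c w.1 = _ from (Eq.symm h1)] at h2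
      exact (hlarge _ (hp _) h2).elim
    · obtain ⟨w, h1, h2⟩ := 𝓦.nonempty_of_mem (inter_mem hc' h)
      rw [mem_ofPred_eq, show c w.1 = _ from (Eq.symm h1), zpow_neg _ w.2] at h2
      exact (hlarge _ (inv_ne_zero (hp w.2)) (by rwa [inv_inv])).elim
    · exact fin3 hc (by omega) h
  obtain ⟨C, μ, n, -, -, hn, hμ, hC, hP, -, hQ⟩ := (FG_CA hF).elim hgen
  obtain ⟨Y, hY, hY', Φ, hΦ, hFΦ⟩ := hQ hn
  obtain ⟨N0, hN0, hN⟩ := near_one_ge (p := p) n hn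
  have hM' : 0 < max M N0 := lt_max_of_lt_right hN0
  have hN' := hN (max M N0) (le_max_right _ _)
  have hOm : {w : Aff m × ℤ | (w.1, ϖ ^ w.2) ∈ Om C μ n Y} ∈ 𝓦 := by
    filter_upwards [hC, hP, hY'] with w h1 h2 h3 using ⟨h1, h3, h2⟩
  have hmul : ∀ {M : ℕ} {a b : Qp}, a ≠ 0 → ‖a⁻¹ * p ^ (-M : ℤ) * b‖ ≤ 1 → ∃ y, ‖y‖ ≤ 1 ∧ b = a * p ^ M * y := fun {M a b} ha h =>
    ⟨_, h, by have := pow_ne_zero M (pK_ne (p := p)); rw [zpow_neg, zpow_natCast]; field_simp⟩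
  rcases tri 𝓦 C.hc (max M N0) with h | h | h
  · have hnear : ∀ w : Aff m × ℤ, (C.c w.1 ≠ 0 ∧ ‖(C.c w.1)⁻¹ * p ^ (-(max M N0 : ℕ) : ℤ) * p ^ w.2‖ ≤ 1) →
        ((w.1, ϖ ^ w.2) ∈ Om C μ n Y ↔ (w.1, (0 : Qp)) ∈ Om C μ n Y) ∧ kap C μ n (w.1, ϖ ^ w.2) = kap C μ n (w.1, 0) := by
      rintro w ⟨h0, h1⟩
      obtain ⟨y, hy, h2⟩ := hmul h0 h1
      exact Om_near hM' hN' (y := -y) (by rwa [norm_neg]) (by simp only [Cell.x]; rw [h2]; ring)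
    have hD : Def (RR p m) ({s | C.c s ≠ 0} ∩ {s | (s, (0 : Qp)) ∈ Om C μ n Y}) := by
      have hc := preRR.neg C.hc
      have := preRR.def_inter (preRR.def_ne C.hc) (preRR.def_inter (preRR.def_inter C.hX (preRR.def_inter (preRR.def_ne hc) (preRR.def_inter (preRR.def_le C.ha hc)
        (preRR.def_le_one (preRR.mul C.hb hc))))) (preRR.def_inter hY (preRR.def_coset hc μ hn)))
      convert this using 1
      ext s
      simp [Om, Cell.set, Cell.x]
    obtain ⟨θ, hθ, hθ'⟩ := richRR.floor_root n hn _ (preRR.mul (preRR.neg C.hc) (preRR.const μ⁻¹))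
    refine ⟨Pc _ 1 0 (C.c⁻¹ * fun _ => ϖ ^ (-(max M N0 : ℕ) : ℤ)) 0, ?_, 1, 0, ⟨one_pos, _, _, _, hD, preRR.mul (preRR.inv C.hc) (preRR.const _), preRR.zero, trivial, rfl⟩,
      _, TT_c (TT_at hΦ hθ 0), ?_⟩
    · filter_upwards [h, hOm] with w hw hw'
      exact ⟨⟨hw.1, (hnear w hw).1.1 hw'⟩, by simp, hw.2, by simp⟩
    · rintro w ⟨⟨h1, h2⟩, -, h3, -⟩
      have h4 := hnear w ⟨h1, h3⟩
      have h5 : -C.c w.1 ≠ 0 := neg_ne_zero.2 h1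
      have h6 := (hθ' w.1 (mul_ne_zero h5 (inv_ne_zero hμ))).2
      simp only [mul_apply, Pi.neg_apply, ← div_eq_mul_inv, valuation_div h5 hμ] at h6
      simp only [hFΦ _ (h4.1.2 h2), h4.2, h6, add_zero]
      simp [kap, Cell.x]
  · have hnear : ∀ w : Aff m × ℤ, ‖C.c w.1 * p ^ (-(max M N0 : ℕ) : ℤ) * p ^ (-w.2)‖ ≤ 1 →
        ((w.1, ϖ ^ w.2) ∈ Om C μ n Y ↔ (w.1, C.c w.1 + ϖ ^ w.2) ∈ Om C μ n Y) ∧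
        kap C μ n (w.1, ϖ ^ w.2) = kap C μ n (w.1, C.c w.1 + ϖ ^ w.2) := by
      intro w h1
      obtain ⟨y, hy, h2⟩ := hmul (hp w.2) (b := C.c w.1) (by rw [← zpow_neg]; convert h1 using 2; ring)
      exact Om_near hM' hN' (y := -y) (by rwa [norm_neg]) (by
        simp only [Cell.x, add_sub_cancel_left]; nth_rewrite 1 [h2]; ring)
    have hx : ∀ s (k : ℤ), C.x (s, C.c s + ϖ ^ k) = p ^ k := fun s k => add_sub_cancel_left _ _
    obtain ⟨b', hb', hb2⟩ := preRR.larger C.ha (preRR.mul C.hc (preRR.const (ϖ ^ (-(max M N0 : ℕ) : ℤ))))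
    obtain ⟨w1, hw1, hw1'⟩ := 𝓦.nonempty_of_mem (inter_mem h hOm)
    have h1 := ((hnear w1 hw1).1.1 hw1').2.2
    rw [hx] at h1
    have hdvd : ∀ k : ℤ, ϖ ^ k / μ ∈ Pset p n ↔ (n : ℤ) ∣ k - μ.valuation := by
      have h2 : ∀ k : ℤ, ϖ ^ k / μ ∈ Pset p n → (n : ℤ) ∣ k - μ.valuation := fun k hk => by
        have := Pset_val (hp k) hμ hk hn
        rw [valuation_zpow, valuation_p, mul_one] at this
        exact ⟨_, sub_eq_of_eq_add' this⟩
      refine fun k => ⟨h2 k, fun hk => ?_⟩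
      obtain ⟨q, hq⟩ := dvd_sub hk (h2 _ h1)
      have h3 : ϖ ^ k / μ = (ϖ ^ q) ^ n * (p ^ w1.2 / μ) := by
        rw [← zpow_natCast, ← zpow_mul, mul_comm q, ← hq, ← mul_div_assoc, ← zpow_add₀ pK_ne]; ring_nf
      rw [h3, Pset_mul_iff ⟨_, hp q, rfl⟩]
      exact h1
    have hle : ∀ {x : Qp} {k : ℤ}, ‖x * p ^ (-k)‖ ≤ 1 ↔ ‖x‖ ≤ ‖ϖ ^ k‖ := fun {x k} => by
      rw [zpow_neg, ← div_eq_mul_inv, norm_div, div_le_one (norm_pos_iff.2 (hp k))]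
    refine ⟨Pc (C.X ∩ Y) n μ.valuation C.b b', ?_, n, μ.valuation, ⟨hn, _, _, _, preRR.def_inter C.hX hY, C.hb, hb', trivial, rfl⟩, Φ, hΦ, ?_⟩
    · filter_upwards [h, hOm] with w hw hw'
      obtain ⟨⟨g1, -, g2, g3⟩, g4, g5⟩ := (hnear w hw).1.1 hw'
      rw [hx] at g2 g3 g5
      refine ⟨⟨g1, g4⟩, (hdvd _).1 g5, g3, ?_⟩
      rcases (hb2 w.1).2.2 with e | e <;> rw [e]
      exacts [hle.2 g2, hw]
    · rintro w ⟨⟨g1, g2⟩, g3, g4, g5⟩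
      have h2 := hnear w (hle.2 ((hb2 w.1).2.1.trans (hle.1 g5)))
      rw [show (fun w : Aff m × ℤ => F (sn (w.1, p ^ w.2))) w = _ from hFΦ _ (h2.1.2 ?_), h2.2, kap, hx, valuation_zpow, valuation_p, mul_one]
      refine ⟨⟨g1, ?_, ?_, ?_⟩, g2, ?_⟩ <;> rw [hx]
      exacts [hp _, (hb2 w.1).1.trans (hle.1 g5), g4, (hdvd _).2 g3]
  · exact fin3 C.hc (le_max_left _ _) h

end

/-! ### Integration in one variable -/

section Ball

lemma nat_unique {N : ℕ} {i i' : ℕ} (h : i < p ^ N) (h' : i' < p ^ N) (e : ‖(i : Qp) - i'‖ ≤ ‖ϖ ^ N‖) : i = i' := by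
  have h1 : ((i : Qp) - i') = ((i - i' : ℤ) : Qp) := by push_cast; rfl
  rw [h1, norm_pow, Padic.norm_p, inv_pow, ← zpow_natCast, ← zpow_neg, Padic.norm_int_le_pow_iff_dvd] at e
  have := Int.eq_zero_of_abs_lt_dvd e (by push_cast; rw [abs_lt]; constructor <;> zify at h h' <;> omega)
  omega

variable {μ : Measure ℚ_[p]} [μ.IsAddHaarMeasure]

lemma ball_real (h1 : μ (closedBall 0 1) = 1) (a : Qp) (k : ℤ) :
    μ.real (closedBall a ‖ϖ ^ k‖) = (p : ℝ) ^ (-k) := by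
  have hc : ∀ a r, μ.real (closedBall a r) = μ.real (closedBall 0 r) := fun a r => by
    rw [Measure.real, Measure.real, Measure.addHaar_closedBall_center]
  have hpp : ϖ ≠ 0 := pK_ne
  have hp : (p : ℝ) ≠ 0 := by exact_mod_cast (Fact.out : p.Prime).ne_zero
  rw [hc]
  have key : ∀ j : ℤ, μ.real (closedBall 0 ‖ϖ ^ j‖) = p * μ.real (closedBall 0 ‖ϖ ^ (j + 1)‖) := by
    intro j
    have hj : ϖ ^ j ≠ 0 := zpow_ne_zero _ hpp
    have hU : closedBall 0 ‖ϖ ^ j‖ = ⋃ i ∈ range p, closedBall (ϖ ^ j * i) ‖ϖ ^ (j + 1)‖ := by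
      ext x
      simp only [Metric.mem_closedBall, Set.mem_iUnion, mem_range, dist_eq_norm, sub_zero, exists_prop]
      constructor
      · intro h
        obtain ⟨y, hy, rfl⟩ := exists_mul_of_norm_le hj h
        obtain ⟨i, hi, z, hz, rfl⟩ := exists_residue 1 hy
        refine ⟨i, by simpa using hi, ?_⟩
        rw [pow_one, mul_add, add_sub_cancel_left, ← mul_assoc, zpow_add_one₀ hpp, norm_mul]
        exact mul_le_of_le_one_right (norm_nonneg _) hz
      · rintro ⟨i, hi, h⟩
        rw [← sub_add_cancel x (ϖ ^ j * i)]
        refine (Padic.nonarchimedean _ _).trans (max_le (h.trans ?_) ?_)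
        · rw [zpow_add_one₀ hpp, norm_mul]
          exact mul_le_of_le_one_right (norm_nonneg _) norm_p_lt_one.le
        · rw [norm_mul]; exact mul_le_of_le_one_right (norm_nonneg _) (norm_nat_le i)
    rw [hU, measureReal_biUnion_finset (h := fun _ _ => (isCompact_closedBall _ _).measure_lt_top.ne)]
    · simp [hc]
    · intro i hi i' hi' hne
      rw [Function.onFun, Set.disjoint_left]
      intro x h h'
      simp only [Metric.mem_closedBall, dist_eq_norm] at h h'
      refine hne (nat_unique (p := p) (N := 1) (by simpa using hi) (by simpa using hi') ?_)
      have h3 : ‖ϖ ^ j * ((i : Qp) - i')‖ ≤ ‖ϖ ^ (j + 1)‖ := by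
        rw [show ϖ ^ j * ((i : Qp) - i') = (x - p ^ j * i') + -(x - p ^ j * i) by ring]
        exact (Padic.nonarchimedean _ _).trans (max_le h' (by rwa [norm_neg]))
      rw [zpow_add_one₀ hpp, norm_mul, norm_mul] at h3
      rw [pow_one]
      exact le_of_mul_le_mul_left h3 (norm_pos_iff.2 hj)
    · exact fun _ _ => Metric.isClosed_closedBall.measurableSet
  induction k using Int.induction_on with
  | zero => simp [Measure.real, h1]
  | succ i ih =>
    rw [key] at ih
    rw [neg_add, zpow_add₀ hp, ← ih]; field_simp
  | pred i ih =>
    rw [key, sub_add_cancel, ih, neg_sub, sub_neg_eq_add, neg_neg, zpow_add₀ hp, zpow_one]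

end Ball

section Int
variable {m : ℕ}

/-- The fibre integrals of `F` are constructible. -/
def IntOK (μ : Measure Qp) (F : Aff (m + 1) → ℚ) : Prop :=
  ∃ g ∈ CA m, ∀ s, Integrable (fun t => (F (sn (s, t)) : ℝ)) μ → (g s : ℝ) = ∫ t, (F (sn (s, t)) : ℝ) ∂μ

lemma norm_p_pow_lt {M : ℕ} (hM : 0 < M) : ‖ϖ ^ M‖ < 1 := by
  rw [norm_pow]; exact pow_lt_one₀ (norm_nonneg _) norm_p_lt_one hM.ne'

lemma near_norm {M : ℕ} (hM : 0 < M) {t t' : Qp} (h0 : t ≠ 0) (h : ‖t' - t‖ ≤ ‖ϖ ^ M * t‖) : ‖t'‖ = ‖t‖ := by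
  have h1 : ‖t' - t‖ < ‖t‖ := h.trans_lt (by
    rw [norm_mul]; exact mul_lt_of_lt_one_left (norm_pos_iff.2 h0) (norm_p_pow_lt hM))
  have := norm_add_left h1
  rwa [add_sub_cancel] at this

lemma IntOK_zero {μ : Measure Qp} [μ.IsAddHaarMeasure] (h1 : μ (closedBall 0 1) = 1)
    {F : Aff (m + 1) → ℚ} (hF : F ∈ CA (m + 1)) {M : ℕ} (hM : 0 < M)
    (hLC : ∀ s t t', t ≠ 0 → ‖t' - t‖ ≤ ‖ϖ ^ M * t‖ → F (sn (s, t')) = F (sn (s, t))) : IntOK μ F := by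
  classical
  have hpp : ϖ ≠ 0 := pK_ne
  have hpz : ∀ k : ℤ, ϖ ^ k ≠ 0 := fun k => zpow_ne_zero _ hpp
  have hp : (p : ℝ) ≠ 0 := by exact_mod_cast (Fact.out : p.Prime).ne_zero
  let U := {u : Fin (p ^ M) // ‖((u : ℕ) : Qp)‖ = 1}
  let w : U → Qp := fun u => ((u.1 : ℕ) : Qp)
  have hw : ∀ u, ‖w u‖ = 1 := fun u => u.2
  have hw0 : ∀ u, w u ≠ 0 := fun u => norm_ne_zero_iff.1 (by rw [hw]; exact one_ne_zero)
  have hg : ∀ u : U, ∃ g ∈ CA m, ∀ s, Summable (fun k : ℤ => (p : ℝ) ^ (-k) * F (sn (s, p ^ k * w u))) →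
      (g s : ℝ) = ∑' k : ℤ, (p : ℝ) ^ (-k) * F (sn (s, p ^ k * w u)) := by
    intro u
    have h2 : (fun z : Fin (m + 1) → Qp => padicNormE (z (Fin.last m)) * F (sn (fun i => z i.castSucc, z (Fin.last m) * w u))) ∈ CA (m + 1) := by
      refine mul_mem (VD_RR (RR_D (IsDFunction.coord _))).abs (comp_CA hF fun i => ?_)
      induction i using Fin.lastCases with
      | last => simp only [sn_last]; exact preRR.mul (RR_D (IsDFunction.coord _)) (preRR.const _)
      | cast i => simpa only [sn_castSucc] using RR_D (IsDFunction.coord i.castSucc)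
    obtain ⟨g, hg, h3⟩ := (tame_pow h2 M (fun s t t' h0 h => by
      simp only [sn_castSucc, sn_last]
      congr 1
      · have := near_norm hM h0 h
        exact_mod_cast (show ((padicNormE t' : ℚ) : ℝ) = (padicNormE t : ℚ) from this)
      · refine hLC _ _ _ (mul_ne_zero h0 (hw0 u)) ?_
        rwa [← sub_mul, ← mul_assoc, norm_mul, hw, mul_one, norm_mul (_ * _), hw, mul_one])).sum
    refine ⟨g, hg, fun s hs => ?_⟩
    have h4 : ∀ k : ℤ, ((padicNormE (ϖ ^ k) : ℚ) : ℝ) = (p : ℝ) ^ (-k) := fun k => by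
      rw [absQ (hpz k), valuation_zpow, valuation_p]; simp
    have := h3 s
    simp only [sn_castSucc, sn_last, Rat.cast_mul, h4] at this
    exact this hs
  choose g hg hg' using hg
  refine ⟨fun s => (p : ℚ) ^ (-M : ℤ) * ∑ u, g u s, mul_mem (algebraMap_mem (CA m) ((p : ℚ) ^ (-M : ℤ))) ?_, fun s hs => ?_⟩
  · convert sum_mem fun u (_ : u ∈ univ) => hg u
    simp
  let E : U × ℤ → Set Qp := fun q => closedBall (p ^ q.2 * w q.1) ‖ϖ ^ (q.2 + M)‖
  have hE : ∀ q x, x ∈ E q ↔ ‖x - p ^ q.2 * w q.1‖ ≤ ‖ϖ ^ M * (p ^ q.2 * w q.1)‖ := fun q x => by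
    simp only [E, Metric.mem_closedBall, dist_eq_norm]
    rw [norm_mul _ (_ * _), norm_mul _ (w _), hw, mul_one, ← norm_mul, zpow_add₀ hpp, zpow_natCast, mul_comm (p ^ M : Qp)]
  have hn0 : ∀ q : U × ℤ, ϖ ^ q.2 * w q.1 ≠ 0 := fun q => mul_ne_zero (hpz _) (hw0 _)
  have hEn : ∀ q, ∀ x ∈ E q, ‖x‖ = ‖ϖ ^ q.2‖ := fun q x hx => by
    rw [near_norm hM (hn0 q) ((hE q x).1 hx), norm_mul, hw, mul_one]
  have hU : ⋃ q, E q = {0}ᶜ := by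
    ext x
    simp only [Set.mem_iUnion, Set.mem_compl_iff, Set.mem_singleton_iff]
    constructor
    · rintro ⟨q, hq⟩ rfl
      have := hEn q _ hq
      rw [norm_zero, eq_comm, norm_eq_zero] at this
      exact hpz _ this
    · intro hx
      obtain ⟨v, hv, hxv⟩ := exists_unit x hx
      obtain ⟨i, hi, y, hy, rfl⟩ := exists_residue M hv.le
      have h3 : ‖ϖ ^ M * y‖ < 1 := by
        rw [norm_mul]; exact (mul_le_of_le_one_right (norm_nonneg _) hy).trans_lt (norm_p_pow_lt hM)
      have h4 : ‖(i : Qp)‖ = 1 := by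
        rw [← hv] at h3 ⊢
        have h5 := norm_add_left (a := (i : Qp) + ϖ ^ M * y) (b := -(ϖ ^ M * y)) (by rwa [norm_neg])
        rwa [add_neg_cancel_right] at h5
      refine ⟨(⟨⟨i, hi⟩, h4⟩, x.valuation), (hE _ _).2 ?_⟩
      simp only [w]
      rw [← mul_assoc, norm_mul _ (i : Qp), h4, mul_one]
      have h5 : x - ϖ ^ x.valuation * i = p ^ M * p ^ x.valuation * y := by linear_combination hxv
      rw [h5, norm_mul]
      exact mul_le_of_le_one_right (norm_nonneg _) hy
  have hd : Pairwise (Function.onFun Disjoint E) := by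
    rintro ⟨u, k⟩ ⟨u', k'⟩ hne
    rw [Function.onFun, Set.disjoint_left]
    intro x h h'
    have h2 := (hEn _ _ h).symm.trans (hEn _ _ h')
    simp only [norm_eq_iff_val (hpz _) (hpz _), valuation_zpow, valuation_p, mul_one] at h2
    subst h2
    refine hne (Prod.ext (Subtype.ext (Fin.ext (nat_unique u.1.2 u'.1.2 ?_))) rfl)
    simp only [E, Metric.mem_closedBall, dist_eq_norm] at h h'
    have h3 : ‖ϖ ^ k * (w u - w u')‖ ≤ ‖ϖ ^ (k + M)‖ := by
      rw [show ϖ ^ k * (w u - w u') = (x - p ^ k * w u') + -(x - p ^ k * w u) by ring]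
      exact (Padic.nonarchimedean _ _).trans (max_le h' (by rwa [norm_neg]))
    rw [zpow_add₀ hpp, norm_mul, norm_mul, zpow_natCast] at h3
    exact le_of_mul_le_mul_left h3 (norm_pos_iff.2 (hpz _))
  have hae : μ.restrict {0}ᶜ = μ := Measure.restrict_eq_self_of_ae_mem (mem_ae_iff.2 (by simp))
  have hm : ∀ q, MeasurableSet (E q) := fun q => Metric.isClosed_closedBall.measurableSet
  have hsum := hasSum_integral_iUnion hm hd (hs.integrableOn (s := ⋃ q, E q))
  have hInt : ∀ q : U × ℤ, ∫ t in E q, (F (sn (s, t)) : ℝ) ∂μ = (p : ℝ) ^ (-M : ℤ) * ((p : ℝ) ^ (-q.2) * F (sn (s, p ^ q.2 * w q.1))) := fun q => by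
    rw [setIntegral_congr_fun (hm q) (g := fun _ => (F (sn (s, p ^ q.2 * w q.1)) : ℝ)) fun t ht => by
      rw [hLC s _ t (hn0 q) ((hE q t).1 ht)], setIntegral_const, ball_real h1, neg_add, zpow_add₀ hp, smul_eq_mul]
    ring
  simp only [hInt] at hsum
  rw [hU, hae] at hsum
  have hS : ∀ u : U, Summable (fun k : ℤ => (p : ℝ) ^ (-M : ℤ) * ((p : ℝ) ^ (-k) * F (sn (s, p ^ k * w u)))) := fun u => hsum.summable.prod_factor u
  rw [(hsum.prod_fiberwise fun u => (hS u).hasSum).unique (hasSum_fintype _)]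
  push_cast
  rw [mul_sum]
  refine sum_congr rfl fun u _ => ?_
  rw [tsum_mul_left, hg' u s ((summable_mul_left_iff (zpow_ne_zero _ hp)).1 (hS u))]

end Int

section Int
variable {m : ℕ} {μ : Measure ℚ_[p]} [μ.IsAddHaarMeasure]

/-- `F` is locally constant relative to the centres `𝒸`. -/
def LCF (𝒸 : Finset (Aff m → Qp)) (M : ℕ) (F : Aff (m + 1) → ℚ) : Prop :=
  ∀ s t t', (∀ c ∈ 𝒸, t ≠ c s ∧ ‖t' - t‖ ≤ ‖ϖ ^ M * (t - c s)‖) → F (sn (s, t')) = F (sn (s, t))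

lemma RR_init {c : Aff m → Qp} (hc : c ∈ RR p m) : (fun z : Fin (m + 1) → Qp => c fun i => z i.castSucc) ∈ RR p (m + 1) :=
  RR_comp hc fun i => RR_D (IsDFunction.coord i.castSucc)

lemma IntOK_c (h1 : μ (closedBall 0 1) = 1) {F : Aff (m + 1) → ℚ} (hF : F ∈ CA (m + 1))
    {M : ℕ} (hM : 0 < M) {c : Aff m → Qp} (hc : c ∈ RR p m) (hLC : LCF {c} M F) : IntOK μ F := by
  have h2 : (fun z : Fin (m + 1) → Qp => F (sn (fun i => z i.castSucc, c (fun i => z i.castSucc) + z (Fin.last m)))) ∈ CA (m + 1) := by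
    refine comp_CA hF fun i => ?_
    induction i using Fin.lastCases with
    | last => simp only [sn_last]; exact preRR.add (RR_init hc) (RR_D (IsDFunction.coord _))
    | cast i => simpa only [sn_castSucc] using RR_D (IsDFunction.coord i.castSucc)
  obtain ⟨g, hg, h3⟩ := IntOK_zero h1 h2 hM (fun s t t' h0 h => by
    simp only [sn_castSucc, sn_last]
    refine hLC _ _ _ fun c' hc' => ?_
    rw [Finset.mem_singleton.1 hc']
    rw [add_sub_add_left_eq_sub, add_sub_cancel_left]
    exact ⟨by simpa using h0, h⟩)
  refine ⟨g, hg, fun s hs => ?_⟩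
  have := h3 s
  simp only [sn_castSucc, sn_last] at this
  rw [this (hs.comp_add_left (c s)), integral_add_left_eq_self (fun t => (F (sn (s, t)) : ℝ))]

lemma IntOK.split {F : Aff (m + 1) → ℚ} {N : Set Aff (m + 1)} (hN : ∀ s, MeasurableSet {t | sn (s, t) ∈ N})
    (h : IntOK μ (N.indicator F)) (h' : IntOK μ (Nᶜ.indicator F)) : IntOK μ F := by
  obtain ⟨g, hg, h1⟩ := h
  obtain ⟨g', hg', h1'⟩ := h'
  refine ⟨g + g', add_mem hg hg', fun s hs => ?_⟩
  have e : (fun t => ((N.indicator F (sn (s, t)) : ℚ) : ℝ)) = indicator {t | sn (s, t) ∈ N} fun t => (F (sn (s, t)) : ℝ) := by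
    ext t; by_cases ht : sn (s, t) ∈ N <;> simp [ht]
  have e' : (fun t => ((Nᶜ.indicator F (sn (s, t)) : ℚ) : ℝ)) = indicator {t | sn (s, t) ∈ N}ᶜ fun t => (F (sn (s, t)) : ℝ) := by
    ext t; by_cases ht : sn (s, t) ∈ N <;> simp [ht]
  have h2 := h1 s (by rw [e]; exact hs.indicator (hN s))
  have h3 := h1' s (by rw [e']; exact hs.indicator (hN s).compl)
  rw [e, integral_indicator (hN s)] at h2
  rw [e', integral_indicator (hN s).compl] at h3
  rw [Pi.add_apply, Rat.cast_add, h2, h3, integral_add_compl (hN s) hs]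

lemma IntOK_LCF (h1 : μ (closedBall 0 1) = 1) {M : ℕ} (hM : 0 < M) (𝒸 : Finset (Aff m → Qp)) (h𝒸 : 𝒸.Nonempty) :
    ∀ {F : Aff (m + 1) → ℚ}, F ∈ CA (m + 1) → (∀ c ∈ 𝒸, c ∈ RR p m) → LCF 𝒸 M F → IntOK μ F := by
  classical
  have hle : ∀ x : Qp, ‖ϖ ^ M * x‖ ≤ ‖x‖ := fun x => by
    rw [norm_mul]; exact mul_le_of_le_one_left (norm_nonneg _) (norm_p_pow_lt hM).le
  have hmono : ∀ {x y : Qp}, ‖x‖ ≤ ‖y‖ → ‖ϖ ^ M * x‖ ≤ ‖ϖ ^ M * y‖ := fun h => by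
    rw [norm_mul, norm_mul]; exact mul_le_mul_of_nonneg_left h (norm_nonneg _)
  have hnn : ∀ {t t' c : Qp}, t ≠ c → ‖t' - t‖ ≤ ‖ϖ ^ M * (t - c)‖ → ‖t' - c‖ = ‖t - c‖ := fun h h' =>
    near_norm hM (sub_ne_zero.2 h) (by simpa using h')
  have htr : ∀ t t' c : Qp, ‖t' - c‖ ≤ max ‖t' - t‖ ‖t - c‖ := fun t t' c => by
    have := Padic.nonarchimedean (t' - t) (t - c)
    rwa [sub_add_sub_cancel] at this
  induction h𝒸 using Finset.Nonempty.cons_induction with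
  | singleton c => exact fun hF hc hL => IntOK_c h1 hF hM (hc c (by simp)) hL
  | cons c 𝒸 hc' _ ih =>
    intro F hF hc hL
    have hcR : c ∈ RR p m := hc c (by simp)
    have hcR' : ∀ c ∈ 𝒸, c ∈ RR p m := fun c' h => hc c' (by simp [h])
    set N : Set Aff (m + 1) := {z | ∀ c' ∈ 𝒸, ‖z (Fin.last m) - c fun i => z i.castSucc‖ ≤ ‖z (Fin.last m) - c' fun i => z i.castSucc‖} with hNdef
    have hmem : ∀ s t, sn (s, t) ∈ N ↔ ∀ c' ∈ 𝒸, ‖t - c s‖ ≤ ‖t - c' s‖ := fun s t => by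
      simp only [hNdef, mem_ofPred_eq, sn_last, sn_castSucc]
    have hND : Def (RR p (m + 1)) N := by
      have := preRR.def_finset (R := RR p (m + 1)) 𝒸 (fun c' => {z | ‖z (Fin.last m) - c fun i => z i.castSucc‖ ≤ ‖z (Fin.last m) - c' fun i => z i.castSucc‖})
        fun c' h => preRR.def_le (preRR.sub (RR_D (IsDFunction.coord _)) (RR_init hcR)) (preRR.sub (RR_D (IsDFunction.coord _)) (RR_init (hcR' c' h)))
      convert this using 1
      ext z; simp [hNdef]
    have hNm : ∀ s, MeasurableSet {t | sn (s, t) ∈ N} := fun s => by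
      have : {t | sn (s, t) ∈ N} = ⋂ c' ∈ 𝒸, {t | ‖t - c s‖ ≤ ‖t - c' s‖} := by ext t; simp [hmem]
      rw [this]
      exact Finset.measurableSet_biInter _ fun c' _ => (isClosed_le (by fun_prop) (by fun_prop)).measurableSet
    have hI : ∀ {X : Set Aff (m + 1)}, Def (RR p (m + 1)) X → X.indicator F ∈ CA (m + 1) := fun {X} hX => by
      convert mul_mem (ind_CA hX) hF using 1
      ext z; by_cases hz : z ∈ X <;> simp [hz]
    refine IntOK.split hNm (IntOK_c h1 (hI hND) hM hcR fun s t t' h => ?_) (ih (hI (preRR.def_compl hND)) hcR' fun s t t' h => ?_)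
    · obtain ⟨h0, h2⟩ := h c (by simp)
      have h3 := hnn h0 h2
      by_cases ht : sn (s, t) ∈ N
      · have h4 : ∀ c' ∈ 𝒸, t ≠ c' s ∧ ‖t' - t‖ ≤ ‖ϖ ^ M * (t - c' s)‖ := fun c' h' => by
          have h5 := (hmem s t).1 ht c' h'
          exact ⟨fun e => h0 (sub_eq_zero.1 (norm_le_zero_iff.1 (by simpa [e] using h5))), h2.trans (hmono h5)⟩
        have ht' : sn (s, t') ∈ N := (hmem s t').2 fun c' h' => by
          rw [h3, hnn (h4 c' h').1 (h4 c' h').2]; exact (hmem s t).1 ht c' h'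
        rw [indicator_of_mem ht, indicator_of_mem ht']
        refine hL _ _ _ fun c' h' => ?_
        rcases Finset.mem_cons.1 h' with rfl | h'
        exacts [⟨h0, h2⟩, h4 c' h']
      · have ht' : sn (s, t') ∉ N := fun hN' => ht ((hmem s t).2 fun c' h' => by
          by_contra hlt
          have h5 := (hmem s t').1 hN' c' h'
          rw [h3] at h5
          rcases le_max_iff.1 (h5.trans (htr t t' (c' s))) with h6 | h6
          · have h7 : ‖ϖ ^ M * (t - c s)‖ < ‖t - c s‖ := by
              rw [norm_mul]; exact mul_lt_of_lt_one_left (norm_pos_iff.2 (sub_ne_zero.2 h0)) (norm_p_pow_lt hM)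
            exact absurd (h6.trans h2) (not_le.2 h7)
          · exact hlt h6)
        rw [indicator_of_notMem ht, indicator_of_notMem ht']
    · by_cases ht : sn (s, t) ∈ N
      · have ht' : sn (s, t') ∈ N := (hmem s t').2 fun c' h' => by
          rw [hnn (h c' h').1 (h c' h').2]
          exact (htr t t' (c s)).trans (max_le ((h c' h').2.trans (hle _)) ((hmem s t).1 ht c' h'))
        rw [indicator_of_notMem (not_not_intro ht'), indicator_of_notMem (not_not_intro ht)]
      · have h5 := ht
        rw [hmem] at h5
        push Not at h5
        obtain ⟨c', h', h6⟩ := h5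
        have h7 : t ≠ c s := fun e => by
          rw [e, sub_self, norm_zero] at h6; exact absurd h6 (not_lt.2 (norm_nonneg _))
        have h8 : ‖t' - t‖ ≤ ‖ϖ ^ M * (t - c s)‖ := (h c' h').2.trans (hmono h6.le)
        have ht' : sn (s, t') ∉ N := fun hN' => by
          have h9 := (hmem s t').1 hN' c' h'
          rw [hnn h7 h8, hnn (h c' h').1 (h c' h').2] at h9
          exact absurd h6 (not_lt.2 h9)
        rw [indicator_of_mem (show _ ∈ Nᶜ from ht), indicator_of_mem (show _ ∈ Nᶜ from ht')]
        refine hL _ _ _ fun c' h' => ?_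
        rcases Finset.mem_cons.1 h' with rfl | h'
        exacts [⟨h7, h8⟩, h c' h']

theorem IntOK_CA (h1 : μ (closedBall 0 1) = 1) {F : Aff (m + 1) → ℚ} (hF : F ∈ CA (m + 1)) : IntOK μ F := by
  classical
  obtain ⟨G, hG, hcov⟩ := ultra_cover {Z : Set (Aff m × Qp) | ∃ c ∈ RR p m, ∃ M : ℕ, ∀ z ∈ Z, ∀ t', z.2 ≠ c z.1 →
      ‖t' - z.2‖ ≤ ‖ϖ ^ M * (z.2 - c z.1)‖ → F (sn (z.1, t')) = F (sn z)} (fun U => by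
    by_cases hgen : Gen (RR p m) U
    swap
    · unfold Gen at hgen
      push Not at hgen
      obtain ⟨c, hc, h⟩ := hgen
      exact ⟨_, compl_umem h, c, hc, 0, fun z hz t' h0 => absurd h0 hz⟩
    obtain ⟨C, μ, n, -, -, hn, hμ, hC, hP, -, hQ⟩ := (FG_CA hF).elim hgen
    obtain ⟨Y, hY, hY', Φ, hΦ, hFΦ⟩ := hQ hn
    obtain ⟨N0, hN0, hN⟩ := near_one_ge (p := p) n hn
    refine ⟨Om C μ n Y, ?_, C.c, C.hc, N0, fun z hz t' h0 h => ?_⟩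
    · filter_upwards [hC, hP, hY'] with z h1 h2 h3 using ⟨h1, h3, h2⟩
    · obtain ⟨s, t⟩ := z
      have h0' : (t - C.c s) ≠ 0 := sub_ne_zero.2 h0
      obtain ⟨y, hy, h2⟩ := exists_mul_of_norm_le (mul_ne_zero (pow_ne_zero N0 pK_ne) h0') h
      have h3 := Om_near (C := C) (μ := μ) (n := n) (Y := Y) (s := s) (t := t) (t' := t') hN0 (hN N0 le_rfl) hy
        (by simp only [Cell.x] at h2 ⊢; linear_combination h2)
      rw [hFΦ _ (h3.1.2 hz), hFΦ _ hz, h3.2])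
  choose! c hc M hM using fun X (hX : X ∈ G) => hG hX
  refine IntOK_LCF h1 (M := G.sup M + 1) (Nat.succ_pos _) (insert 0 (G.image c)) (by simp) hF ?_ fun s t t' h => ?_
  · intro c' h'
    rcases mem_insert.1 h' with rfl | h'
    · exact preRR.zero
    · obtain ⟨X, hX, rfl⟩ := mem_image.1 h'
      exact hc X hX
  · obtain ⟨X, hX, hs⟩ := hcov (s, t)
    obtain ⟨h2, h3⟩ := h (c X) (mem_insert_of_mem (Finset.mem_image_of_mem c hX))
    refine hM X hX _ hs t' h2 (h3.trans ?_)
    rw [norm_mul, norm_mul]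
    exact mul_le_mul_of_nonneg_right (norm_pow_anti ((le_sup hX).trans (Nat.le_succ _))) (norm_nonneg _)

end Int

lemma pi_int {μ : Measure Qp} [μ.IsAddHaarMeasure] (h1 : μ (closedBall 0 1) = 1) (m n : ℕ) :
    ∀ f ∈ CA (m + n), ∃ g ∈ CA m, ∀ lam : Fin m → Qp,
      Integrable (fun x : Fin n → Qp => (f (Fin.append lam x) : ℝ)) (Measure.pi fun _ => μ) →
      (g lam : ℝ) = ∫ x : Fin n → Qp, (f (Fin.append lam x) : ℝ) ∂(Measure.pi fun _ => μ) := by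
  induction n with
  | zero =>
    intro f hf
    refine ⟨f, hf, fun lam _ => ?_⟩
    rw [Measure.pi_of_empty _ Fin.elim0, integral_dirac]
    congr 2
    ext i
    exact (Fin.append_left lam Fin.elim0 i).symm
  | succ n ih =>
    intro f hf
    obtain ⟨f1, hf1, h2⟩ := IntOK_CA h1 (m := m + n) (F := f) hf
    obtain ⟨g, hg, h3⟩ := ih f1 hf1
    refine ⟨g, hg, fun lam hi => ?_⟩
    have hmp := (measurePreserving_piFinSuccAbove (fun _ : Fin (n + 1) => μ) (Fin.last n)).symm
    have he : ∀ z : Qp × Aff n,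
        Fin.append lam ((MeasurableEquiv.piFinSuccAbove (fun _ => Qp) (Fin.last n)).symm z) =
          sn (Fin.append lam z.2, z.1) := by
      intro z
      rw [sn, ← Fin.append_snoc, ← Fin.insertNth_last']
      rfl
    have hi' : Integrable (fun z : Qp × Aff n => (f (sn (Fin.append lam z.2, z.1)) : ℝ))
        (μ.prod (Measure.pi fun _ => μ)) := by
      have := (hmp.integrable_comp_emb (MeasurableEquiv.measurableEmbedding _)).2 hi
      refine this.congr (Eventually.of_forall fun z => ?_)
      simp only [Function.comp, he]
    have hae : ∀ᵐ y ∂(Measure.pi fun _ : Fin n => μ),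
        ∫ x, (f (sn (Fin.append lam y, x)) : ℝ) ∂μ = (f1 (Fin.append lam y) : ℝ) := by
      filter_upwards [hi'.prod_left_ae] with y hy
      exact (h2 _ hy).symm
    rw [h3 lam (hi'.integral_prod_right.congr hae), ← integral_congr_ae hae]
    rw [← integral_prod_symm _ hi', ← hmp.integral_comp']
    simp only [he]

lemma pi_haar {n : ℕ} (ν : Measure Aff n) [ν.IsAddHaarMeasure] (hν1 : ν (ZpSet p n) = 1) :
    ∃ μ : Measure Qp, μ.IsAddHaarMeasure ∧ μ (closedBall 0 1) = 1 ∧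
      ν = Measure.pi fun _ => μ := by
  let K : TopologicalSpace.PositiveCompacts Qp :=
    ⟨⟨closedBall 0 1, isCompact_closedBall 0 1⟩,
      ⟨0, mem_interior.2 ⟨_, Metric.ball_subset_closedBall, Metric.isOpen_ball, by simp⟩⟩⟩
  have hZ : ZpSet p n = closedBall 0 1 := by
    ext x
    rw [mem_closedBall_zero_iff, pi_norm_le_iff_of_nonneg zero_le_one]
    rfl
  have h1 : Measure.addHaarMeasure K (closedBall 0 1) = 1 := Measure.addHaarMeasure_self
  let L : TopologicalSpace.PositiveCompacts Aff n :=
    ⟨⟨ZpSet p n, hZ ▸ isCompact_closedBall 0 1⟩,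
      ⟨0, mem_interior.2 ⟨_, hZ ▸ Metric.ball_subset_closedBall, Metric.isOpen_ball, by simp⟩⟩⟩
  refine ⟨Measure.addHaarMeasure K, inferInstance, h1, ?_⟩
  have hL : (L : Set Aff n) = ZpSet p n := rfl
  rw [Measure.addHaarMeasure_unique ν L,
    Measure.addHaarMeasure_unique (Measure.pi fun _ => Measure.addHaarMeasure K) L, hL, hν1, hZ,
    Measure.pi_closedBall _ _ zero_le_one]
  simp [h1]

end PadicSub

open PadicSub MeasureTheory in
open scoped Classical in
/-- **Basic theorem on `p`-adic analytic integrals** (Theorem 4.3 of the paper).  For any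
subanalytic constructible function `f ∈ C(ℚ_p^{m+n})`, the function `I_m(f)`, defined as
`λ ↦ ∫_{ℚ_p^n} f(λ,x) |dx|` if `x ↦ f(λ,x)` is absolutely integrable for every `λ` and as
the zero function otherwise, belongs to `C(ℚ_p^m)`. -/
theorem basic_theorem_on_padic_analytic_integrals
    (p : ℕ) [Fact p.Prime] (m n : ℕ)
    (ν : Measure (Fin n → ℚ_[p])) (hν : ν.IsAddHaarMeasure) (hν1 : ν (ZpSet p n) = 1)
    (f : (Fin (m + n) → ℚ_[p]) → ℚ) (hf : f ∈ ConstructibleAlg p (m + n)) :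
    ∃ g ∈ ConstructibleAlg p m, ∀ lam : Fin m → ℚ_[p],
      (g lam : ℝ) =
        if ∀ lam' : Fin m → ℚ_[p],
            Integrable (fun x : Fin n → ℚ_[p] => (f (Fin.append lam' x) : ℝ)) ν
        then ∫ x : Fin n → ℚ_[p], (f (Fin.append lam x) : ℝ) ∂ν
        else 0 := by
  obtain ⟨μ, hμ, h1, rfl⟩ := pi_haar ν hν1
  split_ifs with h
  · obtain ⟨g, hg, h2⟩ := pi_int h1 m n f hf
    exact ⟨g, hg, fun lam => h2 lam (h lam)⟩
  · exact ⟨0, zero_mem _, fun lam => by simp⟩
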